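/- Let λ be a partition with n parts (zeros allowed) and largest part L, and let μ ∈ S_n(λ). Then the interpolation ASEP polynomial equals the weight generating function of signed multiline queues of type μ: f*_μ = F*_μ := Σ_Q wt(Q), the sum over all signed multiline queues Q of type μ. Moreover, the interpolation Macdonald polynomial equals the combinatorial partition function: P*_λ = Z*_λ := Σ_{μ ∈ S_n(λ)} F*_μ. -/

import Mathlib

open MvPolynomial

noncomputable section
open scoped Classical

/-- The field `K = ℚ(q,t)`. -/
abbrev K : Type := FractionRing (MvPolynomial (Fin 2) ℚ)

/-- The indeterminate `q` as an element of `K`. -/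
def qq : K := algebraMap (MvPolynomial (Fin 2) ℚ) K (X 0)

/-- The indeterminate `t` as an element of `K`. -/
def tt : K := algebraMap (MvPolynomial (Fin 2) ℚ) K (X 1)

/-- The size `|ν|` of a composition. -/
def csize {n : ℕ} (ν : Fin n → ℕ) : ℕ := ∑ i, ν i

/-- `k_i(ν) = #{j < i : ν_j > ν_i} + #{j > i : ν_j ≥ ν_i}`. -/
def kstat {n : ℕ} (ν : Fin n → ℕ) (i : Fin n) : ℕ :=
  Set.ncard {j : Fin n | j < i ∧ ν i < ν j} + Set.ncard {j : Fin n | i < j ∧ ν i ≤ ν j}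

/-- The evaluation point `ν̃ = (q^{ν_i} t^{-k_i(ν)})_i`. -/
def evalPt {n : ℕ} (ν : Fin n → ℕ) : Fin n → K :=
  fun i => qq ^ ν i * tt ^ (-(kstat ν i : ℤ))

/-- Weakly decreasing composition. -/
def IsPartition {n : ℕ} (l : Fin n → ℕ) : Prop := ∀ i j : Fin n, i ≤ j → l j ≤ l i

/-- The action `σ·μ := μ ∘ σ⁻¹`. -/
def permAct {n : ℕ} (σ : Equiv.Perm (Fin n)) (μ : Fin n → ℕ) : Fin n → ℕ := μ ∘ ⇑σ.symm

/-- `S_n(λ)`: the rearrangements of `λ`. -/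
def Sn {n : ℕ} (l : Fin n → ℕ) : Set (Fin n → ℕ) :=
  {μ | ∃ σ : Equiv.Perm (Fin n), permAct σ l = μ}

/-- The rearrangements of `λ` as a `Finset`. -/
def SnFinset {n : ℕ} (l : Fin n → ℕ) : Finset (Fin n → ℕ) :=
  Finset.image (fun σ : Equiv.Perm (Fin n) => permAct σ l) Finset.univ

/-- The exponent `Finsupp` of the monomial `x^μ`. -/
def expOf {n : ℕ} (μ : Fin n → ℕ) : Fin n →₀ ℕ := Finsupp.equivFunOnFinite.symm μ

/-- Characterization of the interpolation nonsymmetric Macdonald polynomial `E*_μ`. -/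
def IsEstar {n : ℕ} (μ : Fin n → ℕ) (f : MvPolynomial (Fin n) K) : Prop :=
  f.totalDegree ≤ csize μ ∧ coeff (expOf μ) f = 1 ∧
    ∀ ν : Fin n → ℕ, csize ν ≤ csize μ → ν ≠ μ → eval (evalPt ν) f = 0

/-- The interpolation nonsymmetric Macdonald polynomial `E*_μ` (unique by Knop–Sahi). -/
def Estar {n : ℕ} (μ : Fin n → ℕ) : MvPolynomial (Fin n) K :=
  if h : ∃ f, IsEstar μ f then h.choose else 0

/-- Characterization of the interpolation (symmetric) Macdonald polynomial `P*_λ`. -/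
def IsPstar {n : ℕ} (l : Fin n → ℕ) (f : MvPolynomial (Fin n) K) : Prop :=
  f.IsSymmetric ∧ f.totalDegree ≤ csize l ∧ coeff (expOf l) f = 1 ∧
    ∀ ν : Fin n → ℕ, IsPartition ν → csize ν ≤ csize l → ν ≠ l → eval (evalPt ν) f = 0

/-- The interpolation Macdonald polynomial `P*_λ`. -/
def Pstar {n : ℕ} (l : Fin n → ℕ) : MvPolynomial (Fin n) K :=
  if h : ∃ f, IsPstar l f then h.choose else 0

/-- The space `V*_λ`. -/
def Vstar {n : ℕ} (l : Fin n → ℕ) : Submodule K (MvPolynomial (Fin n) K) :=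
  (restrictTotalDegree (Fin n) K (csize l)) ⊓
    ⨅ (ν : Fin n → ℕ) (_ : csize ν ≤ csize l ∧ ν ∉ Sn l),
      LinearMap.ker (aeval (R := K) (evalPt ν)).toLinearMap

/-- Exchange of the variables `x_i` and `x_j` in a polynomial. -/
def swapVars {n : ℕ} (i j : Fin n) (f : MvPolynomial (Fin n) K) : MvPolynomial (Fin n) K :=
  rename (Equiv.swap i j) f

/-- Exact division of polynomials: the unique `g` with `a = b * g` when it exists. -/
def exactDiv {n : ℕ} (a b : MvPolynomial (Fin n) K) : MvPolynomial (Fin n) K :=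
  if h : ∃ g, a = b * g then h.choose else 0

/-- The Hecke operator
`T f = t f − ((t x_i − x_j)/(x_i − x_j))·(f − s_i f)` (where `j = i+1`). -/
def hecke {n : ℕ} (i j : Fin n) (f : MvPolynomial (Fin n) K) : MvPolynomial (Fin n) K :=
  C tt * f - (C tt * X i - X j) * exactDiv (f - swapVars i j f) (X i - X j)

/-- The Coxeter length of a permutation (number of inversions). -/
def permLength {n : ℕ} (σ : Equiv.Perm (Fin n)) : ℕ :=
  Set.ncard {p : Fin n × Fin n | p.1 < p.2 ∧ σ p.2 < σ p.1}

/-- The adjacent transposition `s_i = (i, i+1)` (0-indexed). -/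
def adjSwap {n : ℕ} (i : {i : ℕ // i + 1 < n}) : Equiv.Perm (Fin n) :=
  Equiv.swap ⟨i.1, Nat.lt_of_succ_lt i.2⟩ ⟨i.1 + 1, i.2⟩

/-- The Hecke operator `T_i` for an adjacent transposition index. -/
def heckeAt {n : ℕ} (i : {i : ℕ // i + 1 < n}) :
    MvPolynomial (Fin n) K → MvPolynomial (Fin n) K :=
  hecke ⟨i.1, Nat.lt_of_succ_lt i.2⟩ ⟨i.1 + 1, i.2⟩

/-- `T_{i_1} ⋯ T_{i_ℓ} f` for a word `w = [i_1, …, i_ℓ]`. -/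
def Tword {n : ℕ} (w : List {i : ℕ // i + 1 < n}) (f : MvPolynomial (Fin n) K) :
    MvPolynomial (Fin n) K :=
  w.foldr heckeAt f

/-- `w` is a reduced word for `σ`. -/
def IsReducedWordOf {n : ℕ} (w : List {i : ℕ // i + 1 < n}) (σ : Equiv.Perm (Fin n)) : Prop :=
  (w.map adjSwap).prod = σ ∧ w.length = permLength σ

/-- `T_σ`, computed from a reduced word of `σ` (independent of the choice, by the
Hecke algebra relations). -/
def Tsigma {n : ℕ} (σ : Equiv.Perm (Fin n)) :
    MvPolynomial (Fin n) K → MvPolynomial (Fin n) K :=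
  if h : ∃ w, IsReducedWordOf w σ then Tword h.choose else id

/-- `σ_μ`: the (unique) shortest permutation with `σ·l = μ`. -/
def sigmaMin {n : ℕ} (l μ : Fin n → ℕ) : Equiv.Perm (Fin n) :=
  if h : ∃ σ, permAct σ l = μ ∧ ∀ τ, permAct τ l = μ → permLength σ ≤ permLength τ then
    h.choose else 1

/-- The weakly decreasing rearrangement of a composition. -/
def sortDesc {n : ℕ} (μ : Fin n → ℕ) : Fin n → ℕ :=
  if h : ∃ l, IsPartition l ∧ μ ∈ Sn l then h.choose else μ

/-- The interpolation ASEP polynomial `f*_μ = T_{σ_μ} E*_λ`, where `λ` is the weakly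
decreasing rearrangement of `μ`. -/
def fstar {n : ℕ} (μ : Fin n → ℕ) : MvPolynomial (Fin n) K :=
  Tsigma (sigmaMin (sortDesc μ) μ) (Estar (sortDesc μ))

/-- The composition with entries `i` and `j` exchanged. -/
def swapEntries {n : ℕ} (i j : Fin n) (μ : Fin n → ℕ) : Fin n → ℕ := μ ∘ ⇑(Equiv.swap i j)
/-- `λ^{(r)}`: the parts of `λ` of size `≥ r`, padded by zeros. -/
def lamTrunc {n : ℕ} (l : Fin n → ℕ) (r : ℕ) : Fin n → ℕ := fun i => if r ≤ l i then l i else 0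

/-- The row below a classic row (index shift for classic layers). -/
def rowBelow {L : ℕ} (r : Fin L) : Fin L :=
  ⟨r.1 - 1, Nat.lt_of_le_of_lt (Nat.sub_le r.1 1) r.2⟩

/-- A signed multiline queue on the cylinder with `n` columns and `2L` rows
(rows `1, 1', 2, 2', …, L, L'` from bottom to top), of shape `λ = l`.
`reg r` is the classic row `r+1` (1-based), with `0` denoting an empty position and a
positive value the label of a regular ball; `sgn r` is the signed row `(r+1)'`, with `0`
denoting an empty position and a nonzero integer the (signed) label of a signed ball.
`cpair r` is the pairing (classic layer) from row `r+1` down to row `r'` (for `r ≥ 1`,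
0-based `r.1 ≥ 1`), and `spair r` is the pairing (signed layer) from row `(r+1)'` down to
row `r+1`; both are normalized to be the identity on empty positions. -/
structure SMLQ (n L : ℕ) (l : Fin n → ℕ) where
  reg : Fin L → Fin n → ℕ
  sgn : Fin L → Fin n → ℤ
  cpair : Fin L → Fin n → Fin n
  spair : Fin L → Fin n → Fin n
  /-- row `r+1` is a rearrangement of `λ^{(r+1)}` -/
  reg_content : ∀ r : Fin L, ∃ σ : Equiv.Perm (Fin n),
    ∀ i, reg r i = lamTrunc l (r.1 + 1) (σ i)
  /-- row `(r+1)'` is, in absolute value, a rearrangement of `λ^{(r+1)}` -/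
  sgn_content : ∀ r : Fin L, ∃ σ : Equiv.Perm (Fin n),
    ∀ i, (sgn r i).natAbs = lamTrunc l (r.1 + 1) (σ i)
  /-- no classic pairing out of the bottom row -/
  cpair_bot : ∀ r : Fin L, r.1 = 0 → cpair r = id
  cpair_triv : ∀ (r : Fin L) (j : Fin n), reg r j = 0 → cpair r j = j
  /-- classic pairings preserve the absolute value of the label -/
  cpair_label : ∀ (r : Fin L), 0 < r.1 → ∀ j : Fin n, reg r j ≠ 0 →
    (sgn (rowBelow r) (cpair r j)).natAbs = reg r j
  cpair_inj : ∀ (r : Fin L) (j j' : Fin n), reg r j ≠ 0 → reg r j' ≠ 0 →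
    cpair r j = cpair r j' → j = j'
  /-- the local rule in classic layers: a ball of label `a` has an empty position or a
  ball of absolute label `a' ≥ a` beneath it, and `a' = a` forces a trivial pairing -/
  cpair_below : ∀ (r : Fin L), 0 < r.1 → ∀ j : Fin n, reg r j ≠ 0 →
    (sgn (rowBelow r) j ≠ 0 → reg r j ≤ (sgn (rowBelow r) j).natAbs) ∧
    ((sgn (rowBelow r) j).natAbs = reg r j → cpair r j = j)
  spair_triv : ∀ (r : Fin L) (j : Fin n), sgn r j = 0 → spair r j = j
  /-- signed pairings preserve the absolute value of the label -/
  spair_label : ∀ (r : Fin L) (j : Fin n), sgn r j ≠ 0 →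
    reg r (spair r j) = (sgn r j).natAbs
  spair_inj : ∀ (r : Fin L) (j j' : Fin n), sgn r j ≠ 0 → sgn r j' ≠ 0 →
    spair r j = spair r j' → j = j'
  /-- signed pairings travel straight down or to the right, without wrapping -/
  spair_nowrap : ∀ (r : Fin L) (j : Fin n), sgn r j ≠ 0 → j ≤ spair r j
  /-- a positive ball of label `a` has a ball of label `a' ≥ a` beneath it,
  and `a' = a` forces a trivial pairing -/
  spair_pos : ∀ (r : Fin L) (j : Fin n), 0 < sgn r j →
    reg r j ≠ 0 ∧ (sgn r j).natAbs ≤ reg r j ∧ ((reg r j : ℤ) = sgn r j → spair r j = j)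
  /-- a negative ball of label `−a` has an empty position or a ball of label `a' ≤ a`
  beneath it -/
  spair_neg : ∀ (r : Fin L) (j : Fin n), sgn r j < 0 →
    reg r j = 0 ∨ reg r j ≤ (sgn r j).natAbs

/-- The type of a signed multiline queue: its bottom row (row `1`). -/
def SMLQ.typeOf {n L : ℕ} {l : Fin n → ℕ} (Q : SMLQ n L l) : Fin n → ℕ :=
  fun i => if h : 0 < L then Q.reg ⟨0, h⟩ i else 0

/-- In the pairing order on the balls of the upper row (decreasing absolute label,
and right to left within a fixed absolute label), the ball at `j'` is treated strictly
before position `j`. -/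
def earlier {n : ℕ} (u : Fin n → ℕ) (j' j : Fin n) : Prop :=
  u j' ≠ 0 ∧ (u j < u j' ∨ (u j' = u j ∧ j < j'))

/-- The free balls of the lower row (labels `d`) right before the ball of the upper row
(absolute labels `u`) at position `j` is paired, in a classic layer: balls not yet matched,
where trivially paired balls with the same label as the current ball are not considered
free. -/
def freeClassic {n : ℕ} (u d : Fin n → ℕ) (p : Fin n → Fin n) (j : Fin n) : Set (Fin n) :=
  {k | d k ≠ 0 ∧ (∀ j', earlier u j' j → p j' ≠ k) ∧ ¬(d k = u j ∧ u k ≠ 0 ∧ p k = k)}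

/-- The free balls of the lower row right before the ball at position `j` is paired,
in a signed layer. -/
def freeSigned {n : ℕ} (u : Fin n → ℤ) (d : Fin n → ℕ) (p : Fin n → Fin n) (j : Fin n) :
    Set (Fin n) :=
  {k | d k ≠ 0 ∧ ∀ j', earlier (fun m => (u m).natAbs) j' j → p j' ≠ k}

/-- `i` lies strictly between `j` and `k`, cyclically, going to the right from `j`. -/
def strictlyBetweenCyc {n : ℕ} (j k i : Fin n) : Prop :=
  (j < k ∧ j < i ∧ i < k) ∨ (k < j ∧ (j < i ∨ i < k))

/-- The weight of the classic pairing out of position `j` of the upper row: `1` if the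
position is empty or the pairing is trivial, and otherwise
`(1−t)·t^{skipped}/(1 − q^{a−r+1} t^{free})`, times `q^{a−r+1}` if the pairing wraps
around. Here the upper row is row `R = r` (classic), `u` gives its labels, `d` the
absolute labels of the lower row `(r−1)'`, and `p` the pairing. -/
def cweight {n : ℕ} (u d : Fin n → ℕ) (p : Fin n → Fin n) (R : ℕ) (j : Fin n) : K :=
  if u j = 0 ∨ p j = j then 1
  else
    (1 - tt) * tt ^ ({k | k ∈ freeClassic u d p j ∧ strictlyBetweenCyc j (p j) k}.ncard)
      / (1 - qq ^ (u j - R + 1) * tt ^ (freeClassic u d p j).ncard)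
      * (if p j < j then qq ^ (u j - R + 1) else 1)

/-- The weight of the signed pairing out of position `j` of the upper (signed) row:
`1` if the position is empty or the pairing is trivial, and otherwise
`±(1−t)·t^{skipped + empty}`, with sign according to the sign of the signed ball. -/
def sweight {n : ℕ} (u : Fin n → ℤ) (d : Fin n → ℕ) (p : Fin n → Fin n) (j : Fin n) : K :=
  if u j = 0 ∨ p j = j then 1
  else
    (if 0 < u j then 1 else -1) * (1 - tt) *
      tt ^ ({k | k ∈ freeSigned u d p j ∧ j < k ∧ k < p j}.ncard +
            {k : Fin n | d k = 0 ∧ j < k ∧ k < p j}.ncard)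

/-- The shifted ball-weight of a signed multiline queue: every signed ball in row `(r+1)'`
(0-based `r`) and column `i` contributes `x_i` if positive and `−q^r/t^{n−1}` if
negative. -/
def SMLQ.ballWeight {n L : ℕ} {l : Fin n → ℕ} (Q : SMLQ n L l) : MvPolynomial (Fin n) K :=
  ∏ r : Fin L, ∏ i : Fin n,
    (if 0 < Q.sgn r i then X i
     else if Q.sgn r i < 0 then C (-(qq ^ r.1) / tt ^ (n - 1)) else 1)

/-- The pairing-weight of a signed multiline queue: the product of the weights of all
(nontrivial) pairings in all classic and signed layers. -/
def SMLQ.pairWeight {n L : ℕ} {l : Fin n → ℕ} (Q : SMLQ n L l) : K :=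
  (∏ r : Fin L, ∏ j : Fin n,
    (if 0 < r.1 then
      cweight (Q.reg r) (fun m => (Q.sgn (rowBelow r) m).natAbs) (Q.cpair r) (r.1 + 1) j
     else 1)) *
  ∏ r : Fin L, ∏ j : Fin n, sweight (Q.sgn r) (Q.reg r) (Q.spair r) j

/-- The weight of a signed multiline queue. -/
def SMLQ.wt {n L : ℕ} {l : Fin n → ℕ} (Q : SMLQ n L l) : MvPolynomial (Fin n) K :=
  C Q.pairWeight * Q.ballWeight

/-- `F*_μ`: the weight generating function of signed multiline queues of type `μ`. -/
def Fstar (n L : ℕ) (l μ : Fin n → ℕ) : MvPolynomial (Fin n) K :=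
  ∑ᶠ Q : {Q : SMLQ n L l // Q.typeOf = μ}, (Q : SMLQ n L l).wt

/-! ### Field facts -/

theorem qt_nat_inj (a b c d : ℕ) (h : qq ^ a * tt ^ b = qq ^ c * tt ^ d) : a = c ∧ b = d := by
  unfold qq tt at h
  rw [← map_pow, ← map_pow, ← map_pow, ← map_pow, ← map_mul, ← map_mul] at h
  have h2 := IsFractionRing.injective (MvPolynomial (Fin 2) ℚ) K h
  have h3 : ∀ a b : ℕ, (X 0 ^ a * X 1 ^ b : MvPolynomial (Fin 2) ℚ)
      = monomial (Finsupp.single 0 a + Finsupp.single 1 b) 1 := by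
    intro a b
    rw [X_pow_eq_monomial, X_pow_eq_monomial, monomial_mul, one_mul]
  rw [h3, h3] at h2
  have h4 := (monomial_left_injective (R := ℚ) one_ne_zero) h2
  have e0 := DFunLike.congr_fun h4 0
  have e1 := DFunLike.congr_fun h4 1
  simp at e0 e1
  exact ⟨e0, e1⟩

theorem qq_ne : qq ≠ 0 := by
  intro h
  have := qt_nat_inj 1 0 2 0 (by simp [h])
  omega

theorem tt_ne : tt ≠ 0 := by
  intro h
  have := qt_nat_inj 0 1 0 2 (by simp [h])
  omega

theorem qt_int_inj (a b c d : ℤ) (h : qq ^ a * tt ^ b = qq ^ c * tt ^ d) : a = c ∧ b = d := by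
  have hq := qq_ne
  have ht := tt_ne
  have key : ∀ a b : ℤ, qq ^ a * tt ^ b = 1 → a = 0 ∧ b = 0 := by
    intro a b h
    have h1 : qq ^ a.toNat * tt ^ b.toNat = qq ^ (-a).toNat * tt ^ (-b).toNat := by
      have ea : qq ^ a = qq ^ a.toNat / qq ^ (-a).toNat := by
        rw [← zpow_natCast, ← zpow_natCast, ← zpow_sub₀ hq]; congr 1; omega
      have eb : tt ^ b = tt ^ b.toNat / tt ^ (-b).toNat := by
        rw [← zpow_natCast, ← zpow_natCast, ← zpow_sub₀ ht]; congr 1; omega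
      rw [ea, eb, div_mul_div_comm, div_eq_one_iff_eq (by positivity)] at h
      exact h
    have := qt_nat_inj _ _ _ _ h1
    omega
  have := key (a - c) (b - d) (by
    rw [zpow_sub₀ hq, zpow_sub₀ ht, div_mul_div_comm, h, div_self]
    exact mul_ne_zero (zpow_ne_zero _ hq) (zpow_ne_zero _ ht))
  omega

theorem tt_ne_one : tt ≠ 1 := by
  intro h
  have := qt_nat_inj 0 1 0 0 (by simp [h])
  omega

theorem one_sub_qt_ne (a b : ℕ) (ha : a ≠ 0) : 1 - qq ^ a * tt ^ b ≠ 0 := by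
  intro h
  have := qt_nat_inj a b 0 0 (by rw [sub_eq_zero] at h; simp [← h])
  omega

/-- `c = t^{-(n-1)}` with `n = N+1`. -/
def cc (N : ℕ) : K := tt ^ (-(N : ℤ))

theorem cc_ne (N : ℕ) : cc N ≠ 0 := zpow_ne_zero _ tt_ne

/-! ### Interpolation points -/

theorem kstat_eq {n : ℕ} (ν : Fin n → ℕ) (i : Fin n) :
    kstat ν i = (Finset.univ.filter (fun j => j < i ∧ ν i < ν j)).card
      + (Finset.univ.filter (fun j => i < j ∧ ν i ≤ ν j)).card := by
  unfold kstat
  rw [Set.ncard_eq_toFinset_card', Set.ncard_eq_toFinset_card']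
  simp

/-- the index set counted by kstat, as one set -/
def kset {n : ℕ} (ν : Fin n → ℕ) (i : Fin n) : Finset (Fin n) :=
  Finset.univ.filter (fun j => ν i < ν j ∨ (ν i = ν j ∧ i < j))

theorem kstat_kset {n : ℕ} (ν : Fin n → ℕ) (i : Fin n) : kstat ν i = (kset ν i).card := by
  rw [kstat_eq, ← Finset.card_union_of_disjoint]
  · congr 1
    ext j
    simp only [kset, Finset.mem_union, Finset.mem_filter, Finset.mem_univ, true_and]
    rcases lt_trichotomy i j with h | h | h
    · have := h.not_gt
      simp [h, this]; omega
    · subst h; simp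
    · have := h.not_gt
      simp [h, this]
  · rw [Finset.disjoint_left]
    intro j
    simp only [Finset.mem_filter, Finset.mem_univ, true_and]
    rintro ⟨h, _⟩ ⟨h', _⟩
    exact absurd h h'.not_gt

theorem kset_ssub {n : ℕ} (ν : Fin n → ℕ) (i j : Fin n) (h : j ∈ kset ν i) :
    kset ν j ⊂ kset ν i := by
  rw [Finset.ssubset_iff_of_subset]
  · exact ⟨j, h, by simp [kset]⟩
  · intro k
    simp only [kset, Finset.mem_filter, Finset.mem_univ, true_and] at h ⊢
    intro hk
    rcases h with h | ⟨h, h'⟩ <;> rcases hk with hk | ⟨hk, hk'⟩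
    · left; omega
    · left; omega
    · left; omega
    · right; exact ⟨by omega, h'.trans hk'⟩

theorem kstat_inj {n : ℕ} (ν : Fin n → ℕ) (i j : Fin n) (h : kstat ν i = kstat ν j) : i = j := by
  by_contra hne
  rw [kstat_kset, kstat_kset] at h
  have : j ∈ kset ν i ∨ i ∈ kset ν j := by
    simp only [kset, Finset.mem_filter, Finset.mem_univ, true_and]
    have : i < j ∨ j < i := lt_or_gt_of_ne hne
    rcases lt_trichotomy (ν i) (ν j) with h | h | h <;> tauto
  rcases this with h1 | h1
  · exact absurd (Finset.card_lt_card (kset_ssub ν i j h1)) (by omega)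
  · exact absurd (Finset.card_lt_card (kset_ssub ν j i h1)) (by omega)

theorem evalPt_eq {n : ℕ} (ν : Fin n → ℕ) (i : Fin n) :
    evalPt ν i = qq ^ (ν i : ℤ) * tt ^ (-(kstat ν i : ℤ)) := by
  simp [evalPt]

theorem evalPt_inj {n : ℕ} (ν : Fin n → ℕ) : Function.Injective (evalPt ν) := by
  intro i j h
  rw [evalPt_eq, evalPt_eq] at h
  have := qt_int_inj _ _ _ _ h
  exact kstat_inj ν i j (by omega)

theorem evalPt_ne {n : ℕ} (ν : Fin n → ℕ) (i : Fin n) : evalPt ν i ≠ 0 := by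
  unfold evalPt
  exact mul_ne_zero (pow_ne_zero _ qq_ne) (zpow_ne_zero _ tt_ne)

theorem kset_comp {n : ℕ} (ν : Fin n → ℕ) (a b : Fin n) (hab : a < b)
    (hadj : ∀ k, k ≤ a ∨ b ≤ k) (hne : ν a ≠ ν b) (i : Fin n) :
    kstat (ν ∘ Equiv.swap a b) i = kstat ν (Equiv.swap a b i) := by
  rw [kstat_kset, kstat_kset]
  apply Finset.card_bij (fun j _ => Equiv.swap a b j)
  · intro j
    simp only [kset, Finset.mem_filter, Finset.mem_univ, true_and, Function.comp]
    rintro (h | ⟨h, h'⟩)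
    · exact Or.inl h
    · right
      refine ⟨h, ?_⟩
      rcases eq_or_ne i a with rfl | hia
      · rcases eq_or_ne j b with rfl | hjb
        · simp at h; exact absurd h.symm hne
        · rw [Equiv.swap_apply_left, Equiv.swap_apply_of_ne_of_ne h'.ne' hjb]
          rcases hadj j with h1 | h1
          · exact absurd h' (not_lt.2 h1)
          · exact lt_of_le_of_ne h1 hjb.symm
      · rcases eq_or_ne i b with rfl | hib
        · have : j ≠ a := by rintro rfl; exact absurd h' hab.not_gt
          rw [Equiv.swap_apply_right, Equiv.swap_apply_of_ne_of_ne this h'.ne']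
          exact hab.trans h'
        · rw [Equiv.swap_apply_of_ne_of_ne hia hib]
          rcases eq_or_ne j a with rfl | hja
          · rw [Equiv.swap_apply_left]; exact h'.trans hab
          · rcases eq_or_ne j b with rfl | hjb
            · rw [Equiv.swap_apply_right]
              rcases hadj i with h1 | h1
              · exact lt_of_le_of_ne h1 hia
              · exact absurd h' (not_lt.2 h1)
            · rw [Equiv.swap_apply_of_ne_of_ne hja hjb]; exact h'
  · intro j _ j' _ h
    exact (Equiv.swap a b).injective h
  · intro j
    simp only [kset, Finset.mem_filter, Finset.mem_univ, true_and, Function.comp]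
    intro h
    refine ⟨Equiv.swap a b j, ?_, by simp⟩
    simp only [Equiv.swap_apply_self]
    rcases h with h | ⟨h, h'⟩
    · exact Or.inl h
    · right
      refine ⟨h, ?_⟩
      rcases eq_or_ne i a with rfl | hia
      · rw [Equiv.swap_apply_left] at h h'
        have : j ≠ i := by rintro rfl; exact absurd h' hab.not_gt
        rw [Equiv.swap_apply_of_ne_of_ne this h'.ne']
        exact hab.trans h'
      · rcases eq_or_ne i b with rfl | hib
        · rw [Equiv.swap_apply_right] at h h'
          have hji : j ≠ i := by rintro rfl; exact hne h
          rw [Equiv.swap_apply_of_ne_of_ne h'.ne' hji]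
          rcases hadj j with h1 | h1
          · exact absurd h' (not_lt.2 h1)
          · exact lt_of_le_of_ne h1 hji.symm
        · rw [Equiv.swap_apply_of_ne_of_ne hia hib] at h h'
          rcases eq_or_ne j a with rfl | hja
          · rw [Equiv.swap_apply_left]; exact h'.trans hab
          · rcases eq_or_ne j b with rfl | hjb
            · rw [Equiv.swap_apply_right]
              rcases hadj i with h1 | h1
              · exact lt_of_le_of_ne h1 hia
              · exact absurd h' (not_lt.2 h1)
            · rw [Equiv.swap_apply_of_ne_of_ne hja hjb]; exact h'

theorem evalPt_swap {n : ℕ} (ν : Fin n → ℕ) (a b : Fin n) (hab : a < b)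
    (hadj : ∀ k, k ≤ a ∨ b ≤ k) (hne : ν a ≠ ν b) :
    evalPt (ν ∘ Equiv.swap a b) = evalPt ν ∘ Equiv.swap a b := by
  ext i
  simp only [evalPt, Function.comp]
  rw [kset_comp ν a b hab hadj hne]

theorem evalPt_adj_eq {n : ℕ} (ν : Fin n → ℕ) (a b : Fin n) (hab : a < b)
    (hadj : ∀ k, k ≤ a ∨ b ≤ k) (he : ν a = ν b) :
    evalPt ν b = tt * evalPt ν a := by
  have h : kstat ν a = kstat ν b + 1 := by
    rw [kstat_kset, kstat_kset]
    have : kset ν a = insert b (kset ν b) := by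
      ext j
      simp only [kset, Finset.mem_filter, Finset.mem_univ, true_and, Finset.mem_insert, he]
      constructor
      · rintro (h | ⟨h, h'⟩)
        · tauto
        · rcases eq_or_ne j b with rfl | hjb
          · tauto
          · right; right
            refine ⟨h, ?_⟩
            rcases hadj j with h1 | h1
            · exact absurd h' (not_lt.2 h1)
            · exact lt_of_le_of_ne h1 hjb.symm
      · rintro (h | h | ⟨h, h'⟩)
        · subst h; tauto
        · tauto
        · exact Or.inr ⟨h, hab.trans h'⟩
    rw [this, Finset.card_insert_of_notMem (by simp [kset])]
  simp only [evalPt]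
  rw [he, h, mul_left_comm, ← zpow_one_add₀ tt_ne]
  congr 2
  push_cast; ring

theorem kstat_lt {n : ℕ} (ν : Fin n → ℕ) (i : Fin n) : kstat ν i < n := by
  rw [kstat_kset]
  calc (kset ν i).card < (Finset.univ : Finset (Fin n)).card := by
        apply Finset.card_lt_card
        rw [Finset.ssubset_univ_iff]
        intro h
        have : i ∈ kset ν i := by rw [h]; simp
        simp [kset] at this
    _ = n := by simp

theorem kstat_sum {n : ℕ} (ν : Fin n → ℕ) (i : Fin n) :
    kstat ν i = ∑ j, if (ν i < ν j ∨ (ν i = ν j ∧ i < j)) then 1 else 0 := by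
  rw [kstat_kset, kset, Finset.card_filter]

theorem evalPt_cons_zero {N : ℕ} (ν : Fin N → ℕ) :
    evalPt (Fin.cons 0 ν : Fin (N + 1) → ℕ) = (Fin.cons (cc N) (evalPt ν) : Fin (N + 1) → K) := by
  ext i
  refine Fin.cases ?_ (fun i => ?_) i
  · have : kstat (Fin.cons 0 ν : Fin (N + 1) → ℕ) 0 = N := by
      rw [kstat_sum, Fin.sum_univ_succ]
      have : ∀ k : Fin N, (if 0 < ν k ∨ 0 = ν k then 1 else 0) = 1 := by
        intro k; rw [if_pos]; omega
      simp [this]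
    simp [evalPt, this, cc]
  · have : kstat (Fin.cons 0 ν : Fin (N + 1) → ℕ) i.succ = kstat ν i := by
      rw [kstat_sum, kstat_sum, Fin.sum_univ_succ]
      simp
    simp [evalPt, this]

/-- `Φ ν = (ν_n + 1, ν_1, …, ν_{n-1})`. -/
def PhiC {N : ℕ} (ν : Fin (N + 1) → ℕ) : Fin (N + 1) → ℕ :=
  Fin.cons (ν (Fin.last N) + 1) (Fin.init ν)

/-- The corresponding map on points. -/
def PsiP {N : ℕ} (x : Fin (N + 1) → K) : Fin (N + 1) → K :=
  Fin.cons (qq * x (Fin.last N)) (Fin.init x)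

theorem evalPt_PhiC {N : ℕ} (ν : Fin (N + 1) → ℕ) : evalPt (PhiC ν) = PsiP (evalPt ν) := by
  ext i
  refine Fin.cases ?_ (fun i => ?_) i
  · have : kstat (PhiC ν) 0 = kstat ν (Fin.last N) := by
      rw [kstat_sum, kstat_sum, Fin.sum_univ_succ, Fin.sum_univ_castSucc]
      simp only [PhiC, Fin.cons_zero, Fin.cons_succ, Fin.init, lt_irrefl, and_false, or_false,
        if_false, zero_add, add_zero]
      apply Finset.sum_congr rfl
      intro k _
      have : ¬ Fin.last N < k.castSucc := not_lt.2 (Fin.le_last _)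
      simp only [this, and_false, or_false, Fin.succ_pos, and_true]
      congr 1
      apply propext; omega
    simp only [evalPt, this, PsiP]
    simp [PhiC, pow_succ]; ring
  · have : kstat (PhiC ν) i.succ = kstat ν i.castSucc := by
      rw [kstat_sum, kstat_sum, Fin.sum_univ_succ, Fin.sum_univ_castSucc]
      simp only [PhiC, Fin.cons_zero, Fin.cons_succ, Fin.init]
      rw [add_comm]
      have h1 : ¬ i.succ < 0 := not_lt.2 (Fin.zero_le _)
      simp only [h1, and_false, or_false, Fin.castSucc_lt_last, and_true, Fin.succ_lt_succ_iff,
        Fin.castSucc_lt_castSucc_iff]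
      congr 2
      apply propext; omega
    simp only [evalPt, this, PsiP]
    simp [PhiC, Fin.init, evalPt]

theorem csize_PhiC {N : ℕ} (ν : Fin (N + 1) → ℕ) : csize (PhiC ν) = csize ν + 1 := by
  simp only [csize, PhiC, Fin.sum_univ_succ, Fin.cons_zero, Fin.cons_succ]
  rw [← Fin.sum_univ_succ, Fin.sum_univ_castSucc]
  simp [Fin.init]; ring

theorem exists_PhiC {N : ℕ} (ν : Fin (N + 1) → ℕ) (h : ν 0 ≠ 0) : ∃ η, PhiC η = ν := by
  refine ⟨Fin.snoc (Fin.tail ν) (ν 0 - 1), ?_⟩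
  unfold PhiC
  rw [Fin.snoc_last, Fin.init_snoc, Nat.sub_add_cancel (Nat.pos_of_ne_zero h)]
  exact Fin.cons_self_tail ν

theorem evalPt_zero_val {N : ℕ} (ν : Fin (N + 1) → ℕ) (h : ν 0 = 0) : evalPt ν 0 = cc N := by
  have := evalPt_cons_zero (Fin.tail ν)
  rw [← h, Fin.cons_self_tail] at this
  rw [this]; simp

theorem evalPt_qexp {n : ℕ} (ν : Fin n → ℕ) (i : Fin n) (a : ℕ) (b : ℤ)
    (h : evalPt ν i = qq ^ a * tt ^ b) : ν i = a := by
  rw [evalPt_eq, ← zpow_natCast qq a] at h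
  have := qt_int_inj _ _ _ _ h
  omega

/-! ### Hecke operators -/

instance : Infinite K := inferInstance

theorem poly_ext_inj {n : ℕ} (f g : MvPolynomial (Fin n) K)
    (h : ∀ x : Fin n → K, Function.Injective x → eval x f = eval x g) : f = g := by
  have hD : (∏ i : Fin n, ∏ j : Fin n, if i = j then (1 : MvPolynomial (Fin n) K) else X i - X j) ≠ 0 := by
    rw [Finset.prod_ne_zero_iff]
    intro i _
    rw [Finset.prod_ne_zero_iff]
    intro j _
    split_ifs with hij
    · exact one_ne_zero
    · rw [sub_ne_zero]
      exact fun h => hij (X_injective h)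
  apply mul_right_cancel₀ hD
  apply MvPolynomial.funext
  intro x
  by_cases hx : Function.Injective x
  · rw [map_mul, map_mul, h x hx]
  · rw [Function.Injective] at hx
    push Not at hx
    obtain ⟨a, b, hab, hne⟩ := hx
    have : eval x (∏ i : Fin n, ∏ j : Fin n,
        if i = j then (1 : MvPolynomial (Fin n) K) else X i - X j) = 0 := by
      rw [map_prod]
      apply Finset.prod_eq_zero (Finset.mem_univ a)
      rw [map_prod]
      apply Finset.prod_eq_zero (Finset.mem_univ b)
      simp [hne, hab]
    rw [map_mul, map_mul, this, mul_zero, mul_zero]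

theorem swap_dvd {n : ℕ} (i j : Fin n) (f : MvPolynomial (Fin n) K) :
    ∃ g, f - swapVars i j f = (X i - X j) * g := by
  let I : Ideal (MvPolynomial (Fin n) K) := Ideal.span {X i - X j}
  have h : (Ideal.Quotient.mkₐ K I) = (Ideal.Quotient.mkₐ K I).comp (rename (Equiv.swap i j)) := by
    apply MvPolynomial.algHom_ext
    intro k
    have hij : (Ideal.Quotient.mkₐ K I) (X i) = (Ideal.Quotient.mkₐ K I) (X j) := by
      simp only [Ideal.Quotient.mkₐ_eq_mk]
      rw [Ideal.Quotient.eq]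
      exact Ideal.mem_span_singleton_self _
    simp only [AlgHom.comp_apply, rename_X]
    rcases eq_or_ne k i with rfl | hi
    · rw [Equiv.swap_apply_left, hij]
    · rcases eq_or_ne k j with rfl | hj
      · rw [Equiv.swap_apply_right, hij]
      · rw [Equiv.swap_apply_of_ne_of_ne hi hj]
  have h2 := DFunLike.congr_fun h f
  simp only [AlgHom.comp_apply, Ideal.Quotient.mkₐ_eq_mk] at h2
  rw [Ideal.Quotient.eq, Ideal.mem_span_singleton] at h2
  exact h2

theorem exactDiv_spec {n : ℕ} (i j : Fin n) (f : MvPolynomial (Fin n) K) :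
    f - swapVars i j f = (X i - X j) * exactDiv (f - swapVars i j f) (X i - X j) := by
  unfold exactDiv
  rw [dif_pos (swap_dvd i j f)]
  exact (swap_dvd i j f).choose_spec

theorem eval_swapVars {n : ℕ} (i j : Fin n) (f : MvPolynomial (Fin n) K) (x : Fin n → K) :
    eval x (swapVars i j f) = eval (x ∘ Equiv.swap i j) f := by
  rw [swapVars, eval_rename]

/-- pointwise Hecke formula -/
def rr (a b : K) : K := (tt * a - b) / (a - b)

theorem eval_hecke {n : ℕ} (i j : Fin n) (f : MvPolynomial (Fin n) K) (x : Fin n → K)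
    (hx : x i ≠ x j) :
    eval x (hecke i j f) = (tt - rr (x i) (x j)) * eval x f
      + rr (x i) (x j) * eval (x ∘ Equiv.swap i j) f := by
  have h := congrArg (eval x) (exactDiv_spec i j f)
  rw [map_mul, map_sub, map_sub, eval_X, eval_X, eval_swapVars] at h
  unfold hecke
  simp only [map_sub, map_mul, eval_C, eval_X]
  have hne : x i - x j ≠ 0 := sub_ne_zero.2 hx
  set e := eval x (exactDiv (f - swapVars i j f) (X i - X j))
  unfold rr
  have : e = (eval x f - eval (x ∘ Equiv.swap i j) f) / (x i - x j) := by
    rw [h]; field_simp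
  rw [this]
  ring

/-- `T_i` with `n = N + 1` -/
def Th {N : ℕ} (i : Fin N) (f : MvPolynomial (Fin (N + 1)) K) : MvPolynomial (Fin (N + 1)) K :=
  hecke i.castSucc i.succ f

/-- the adjacent transposition -/
def sw {N : ℕ} (i : Fin N) : Equiv.Perm (Fin (N + 1)) := Equiv.swap i.castSucc i.succ

theorem sw_adj {N : ℕ} (i : Fin N) (k : Fin (N + 1)) : k ≤ i.castSucc ∨ i.succ ≤ k := by
  rw [Fin.le_iff_val_le_val, Fin.le_iff_val_le_val]
  simp; omega

theorem castSucc_ne_succ' {N : ℕ} (i : Fin N) : i.castSucc ≠ i.succ :=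
  (Fin.castSucc_lt_succ (i := i)).ne

theorem eval_Th {N : ℕ} (i : Fin N) (f : MvPolynomial (Fin (N + 1)) K) (x : Fin (N + 1) → K)
    (hx : Function.Injective x) :
    eval x (Th i f) = (tt - rr (x i.castSucc) (x i.succ)) * eval x f
      + rr (x i.castSucc) (x i.succ) * eval (x ∘ sw i) f :=
  eval_hecke _ _ _ _ (fun h => castSucc_ne_succ' i (hx h))

theorem Th_add {N : ℕ} (i : Fin N) (f g : MvPolynomial (Fin (N + 1)) K) :
    Th i (f + g) = Th i f + Th i g := by
  apply poly_ext_inj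
  intro x hx
  simp only [eval_Th i _ x hx, map_add]; ring

theorem Th_C_mul {N : ℕ} (i : Fin N) (c : K) (g : MvPolynomial (Fin (N + 1)) K) :
    Th i (C c * g) = C c * Th i g := by
  apply poly_ext_inj
  intro x hx
  simp only [eval_Th i _ x hx, map_mul, eval_C]; ring

/-- `T_i` as a linear map -/
def ThL {N : ℕ} (i : Fin N) : MvPolynomial (Fin (N + 1)) K →ₗ[K] MvPolynomial (Fin (N + 1)) K where
  toFun := Th i
  map_add' := Th_add i
  map_smul' c f := by simp [smul_eq_C_mul, Th_C_mul]

theorem Th_sum {N : ℕ} (i : Fin N) {ι : Type*} (s : Finset ι)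
    (f : ι → MvPolynomial (Fin (N + 1)) K) : Th i (∑ a ∈ s, f a) = ∑ a ∈ s, Th i (f a) :=
  map_sum (ThL i) f s

theorem sw_inj {N : ℕ} (i : Fin N) (x : Fin (N + 1) → K) (hx : Function.Injective x) :
    Function.Injective (x ∘ sw i) := hx.comp (sw i).injective

theorem sw_left {N : ℕ} (i : Fin N) : sw i i.castSucc = i.succ := by simp [sw]
theorem sw_right {N : ℕ} (i : Fin N) : sw i i.succ = i.castSucc := by simp [sw]
theorem comp_sw_sw {N : ℕ} {α : Type*} (i : Fin N) (x : Fin (N + 1) → α) :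
    (x ∘ sw i) ∘ sw i = x := by
  ext k; simp [sw]

theorem Th_quad {N : ℕ} (i : Fin N) (f : MvPolynomial (Fin (N + 1)) K) :
    Th i (Th i f) = C tt * f + C (tt - 1) * Th i f := by
  apply poly_ext_inj
  intro x hx
  simp only [map_add, map_mul, eval_C]
  rw [eval_Th i _ x hx, eval_Th i _ x hx, eval_Th i _ _ (sw_inj i x hx), comp_sw_sw]
  simp only [Function.comp, sw_left, sw_right]
  have hne : x i.castSucc - x i.succ ≠ 0 := sub_ne_zero.2 (fun h => castSucc_ne_succ' i (hx h))
  have hne' : x i.succ - x i.castSucc ≠ 0 := sub_ne_zero.2 (fun h => castSucc_ne_succ' i (hx h.symm))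
  generalize eval x f = A
  generalize eval _ f = B
  simp only [rr]
  generalize x i.castSucc = a at *
  generalize x i.succ = b at *
  have : b - a = -(a - b) := by ring
  rw [this]
  field_simp
  ring

theorem totalDegree_X_sub_X {n : ℕ} (i j : Fin n) (hij : i ≠ j) :
    (X i - X j : MvPolynomial (Fin n) K).totalDegree = 1 := by
  apply le_antisymm
  · refine (totalDegree_sub _ _).trans ?_
    simp
  · have : Finsupp.single i 1 ∈ (X i - X j : MvPolynomial (Fin n) K).support := by
      rw [mem_support_iff, coeff_sub, coeff_X, coeff_X, if_pos rfl]
      · rw [if_neg]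
        · simp
        · intro h
          exact hij.symm (Finsupp.single_left_injective one_ne_zero h)
    have := le_totalDegree this
    simpa using this

theorem totalDegree_Th {N : ℕ} (i : Fin N) (f : MvPolynomial (Fin (N + 1)) K) :
    (Th i f).totalDegree ≤ f.totalDegree := by
  have h := exactDiv_spec i.castSucc i.succ f
  unfold Th hecke
  set e := exactDiv (f - swapVars i.castSucc i.succ f) (X i.castSucc - X i.succ)
  refine (totalDegree_sub _ _).trans (max_le ?_ ?_)
  · refine (totalDegree_mul _ _).trans ?_
    simp
  · rcases eq_or_ne e 0 with he | he
    · simp [he]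
    · have hX : (X i.castSucc - X i.succ : MvPolynomial (Fin (N + 1)) K) ≠ 0 := by
        rw [sub_ne_zero]
        exact fun h => castSucc_ne_succ' i (X_injective h)
      have h2 := congrArg totalDegree h
      rw [totalDegree_mul_of_isDomain hX he, totalDegree_X_sub_X _ _ (castSucc_ne_succ' i)] at h2
      have h3 : (f - swapVars i.castSucc i.succ f).totalDegree ≤ f.totalDegree := by
        refine (totalDegree_sub _ _).trans (max_le le_rfl ?_)
        exact totalDegree_rename_le _ _
      have h4 : (C tt * X i.castSucc - X i.succ : MvPolynomial (Fin (N + 1)) K).totalDegree ≤ 1 := by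
        refine (totalDegree_sub _ _).trans (max_le ?_ ?_)
        · refine (totalDegree_mul _ _).trans ?_
          simp
        · simp
      refine (totalDegree_mul _ _).trans ?_
      omega

theorem Th_eq_symm {N : ℕ} (i : Fin N) (f : MvPolynomial (Fin (N + 1)) K)
    (h : Th i f = C tt * f) : rename (sw i) f = f := by
  have hs := exactDiv_spec i.castSucc i.succ f
  unfold Th hecke at h
  set e := exactDiv (f - swapVars i.castSucc i.succ f) (X i.castSucc - X i.succ)
  have h1 : (C tt * X i.castSucc - X i.succ) * e = 0 := by
    have := sub_eq_self.1 h
    exact this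
  rcases mul_eq_zero.1 h1 with h2 | h2
  · exfalso
    have h3 := congrArg (eval (fun k => if k = i.succ then (1 : K) else 0)) h2
    simp [castSucc_ne_succ' i] at h3
  · rw [h2, mul_zero, sub_eq_zero] at hs
    exact hs.symm

/-- scaled evaluation points -/
def sPt {n : ℕ} (s : K) (ν : Fin n → ℕ) : Fin n → K := fun i => s * evalPt ν i

theorem sPt_inj {n : ℕ} (s : K) (hs : s ≠ 0) (ν : Fin n → ℕ) : Function.Injective (sPt s ν) := by
  intro i j h
  exact evalPt_inj ν (mul_left_cancel₀ hs h)

theorem rr_scale (s a b : K) (hs : s ≠ 0) : rr (s * a) (s * b) = rr a b := by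
  unfold rr
  rw [mul_left_comm tt s a, ← mul_sub, ← mul_sub, mul_div_mul_left _ _ hs]

/-- coefficient for the T-action on functions of compositions -/
def rv {N : ℕ} (i : Fin N) (ν : Fin (N + 1) → ℕ) : K :=
  rr (evalPt ν i.castSucc) (evalPt ν i.succ)

theorem rv_eq {N : ℕ} (i : Fin N) (ν : Fin (N + 1) → ℕ) (h : ν i.castSucc = ν i.succ) :
    rv i ν = 0 := by
  unfold rv rr
  rw [evalPt_adj_eq ν _ _ Fin.castSucc_lt_succ (sw_adj i) h]
  simp

theorem sPt_sw {N : ℕ} (s : K) (i : Fin N) (ν : Fin (N + 1) → ℕ) (h : ν i.castSucc ≠ ν i.succ) :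
    sPt s (ν ∘ sw i) = sPt s ν ∘ sw i := by
  unfold sPt sw
  rw [evalPt_swap ν _ _ Fin.castSucc_lt_succ (sw_adj i) h]
  rfl

/-- the T-action on functions on compositions -/
theorem eval_Th_sPt {N : ℕ} (s : K) (hs : s ≠ 0) (i : Fin N) (f : MvPolynomial (Fin (N + 1)) K)
    (ν : Fin (N + 1) → ℕ) :
    eval (sPt s ν) (Th i f) = (tt - rv i ν) * eval (sPt s ν) f
      + rv i ν * eval (sPt s (ν ∘ sw i)) f := by
  rw [eval_Th i f _ (sPt_inj s hs ν)]
  have : rr (sPt s ν i.castSucc) (sPt s ν i.succ) = rv i ν := rr_scale _ _ _ hs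
  rw [this]
  by_cases h : ν i.castSucc = ν i.succ
  · rw [rv_eq i ν h]; ring
  · rw [sPt_sw s i ν h]

theorem csize_sw {N : ℕ} (i : Fin N) (ν : Fin (N + 1) → ℕ) : csize (ν ∘ sw i) = csize ν :=
  Equiv.sum_comp (sw i) ν

theorem eval_aeval {n m : ℕ} (g : Fin n → MvPolynomial (Fin m) K) (f : MvPolynomial (Fin n) K)
    (x : Fin m → K) : eval x (aeval g f) = eval (fun i => eval x (g i)) f := by
  rw [aeval_eq_bind₁, ← coe_aeval_eq_eval, ← coe_aeval_eq_eval]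
  exact aeval_bind₁ x g f

theorem totalDegree_aeval_le {n m : ℕ} (g : Fin n → MvPolynomial (Fin m) K)
    (hg : ∀ i, (g i).totalDegree ≤ 1) (f : MvPolynomial (Fin n) K) :
    (aeval g f).totalDegree ≤ f.totalDegree := by
  rw [aeval_def, eval₂_eq]
  apply totalDegree_finsetSum_le
  intro d hd
  refine (totalDegree_mul _ _).trans ?_
  rw [algebraMap_eq, totalDegree_C, zero_add]
  refine (totalDegree_finsetProd _ _).trans ?_
  refine le_trans ?_ (le_totalDegree hd)
  rw [Finsupp.sum]
  apply Finset.sum_le_sum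
  intro i _
  refine (totalDegree_pow _ _).trans ?_
  calc d i * (g i).totalDegree ≤ d i * 1 := Nat.mul_le_mul_left _ (hg i)
    _ = d i := mul_one _

theorem poly_ext_inj0 {n : ℕ} (f g : MvPolynomial (Fin n) K)
    (h : ∀ x : Fin n → K, Function.Injective x → (∀ i, x i ≠ 0) → eval x f = eval x g) : f = g := by
  have hD : (∏ i : Fin n, (X i : MvPolynomial (Fin n) K)) ≠ 0 := by
    rw [Finset.prod_ne_zero_iff]
    intro i _
    exact X_ne_zero i
  apply mul_right_cancel₀ hD
  apply poly_ext_inj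
  intro x hx
  by_cases h0 : ∀ i, x i ≠ 0
  · rw [map_mul, map_mul, h x hx h0]
  · push Not at h0
    obtain ⟨a, ha⟩ := h0
    have : eval x (∏ i : Fin n, (X i : MvPolynomial (Fin n) K)) = 0 := by
      rw [map_prod]
      apply Finset.prod_eq_zero (Finset.mem_univ a)
      simp [ha]
    rw [map_mul, map_mul, this, mul_zero, mul_zero]

/-- restriction to `x_0 = c` -/
def restr0 {N : ℕ} (c : K) (f : MvPolynomial (Fin (N + 1)) K) : MvPolynomial (Fin N) K :=
  aeval (Fin.cons (C c) X : Fin (N + 1) → MvPolynomial (Fin N) K) f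

theorem eval_restr0 {N : ℕ} (c : K) (f : MvPolynomial (Fin (N + 1)) K) (x : Fin N → K) :
    eval x (restr0 c f) = eval (Fin.cons c x : Fin (N + 1) → K) f := by
  rw [restr0, eval_aeval]
  congr 2
  ext i
  refine Fin.cases ?_ (fun i => ?_) i <;> simp

theorem totalDegree_restr0 {N : ℕ} (c : K) (f : MvPolynomial (Fin (N + 1)) K) :
    (restr0 c f).totalDegree ≤ f.totalDegree := by
  apply totalDegree_aeval_le
  intro i
  refine Fin.cases ?_ (fun i => ?_) i <;> simp

theorem restr0_zero {N : ℕ} (c : K) (f : MvPolynomial (Fin (N + 1)) K) (h : restr0 c f = 0) :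
    ∃ g, f = (X 0 - C c) * g := by
  let I : Ideal (MvPolynomial (Fin (N + 1)) K) := Ideal.span {X 0 - C c}
  have hq : (Ideal.Quotient.mkₐ K I)
      = ((Ideal.Quotient.mkₐ K I).comp (rename Fin.succ)).comp
        (aeval (Fin.cons (C c) X : Fin (N + 1) → MvPolynomial (Fin N) K)) := by
    apply MvPolynomial.algHom_ext
    intro k
    have hij : (Ideal.Quotient.mkₐ K I) (X 0) = (Ideal.Quotient.mkₐ K I) (C c) := by
      simp only [Ideal.Quotient.mkₐ_eq_mk]
      rw [Ideal.Quotient.eq]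
      exact Ideal.mem_span_singleton_self _
    refine Fin.cases ?_ (fun i => ?_) k
    · rw [hij]; simp; rfl
    · simp
  have h2 := DFunLike.congr_fun hq f
  rw [AlgHom.comp_apply] at h2
  have h3 : aeval (Fin.cons (C c) X : Fin (N + 1) → MvPolynomial (Fin N) K) f = 0 := h
  rw [h3, map_zero, Ideal.Quotient.mkₐ_eq_mk, Ideal.Quotient.eq_zero_iff_mem,
    Ideal.mem_span_singleton] at h2
  exact h2

theorem totalDegree_X_sub_C {N : ℕ} (i : Fin N) (c : K) :
    (X i - C c : MvPolynomial (Fin N) K).totalDegree = 1 := by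
  apply le_antisymm
  · refine (totalDegree_sub _ _).trans ?_
    simp
  · have : Finsupp.single i 1 ∈ (X i - C c : MvPolynomial (Fin N) K).support := by
      rw [mem_support_iff, coeff_sub, coeff_X, if_pos rfl, coeff_C, if_neg]
      · simp
      · intro h
        have := DFunLike.congr_fun h i
        simp at this
    have := le_totalDegree this
    simpa using this

theorem X_sub_C_ne {N : ℕ} (i : Fin N) (c : K) : (X i - C c : MvPolynomial (Fin N) K) ≠ 0 := by
  intro h
  have := totalDegree_X_sub_C i c
  rw [h] at this
  simp at this

theorem totalDegree_factor {N : ℕ} (i : Fin N) (c : K) (g : MvPolynomial (Fin N) K) (hg : g ≠ 0) :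
    ((X i - C c) * g).totalDegree = g.totalDegree + 1 := by
  rw [totalDegree_mul_of_isDomain (X_sub_C_ne i c) hg, totalDegree_X_sub_C, add_comm]

/-- `(Ψ⁻¹ f)(x) = f(q x_n, x_1, …, x_{n-1})` -/
def PsiInv {N : ℕ} (f : MvPolynomial (Fin (N + 1)) K) : MvPolynomial (Fin (N + 1)) K :=
  aeval (Fin.cons (C qq * X (Fin.last N)) (fun i => X i.castSucc) :
    Fin (N + 1) → MvPolynomial (Fin (N + 1)) K) f

theorem eval_PsiInv {N : ℕ} (f : MvPolynomial (Fin (N + 1)) K) (x : Fin (N + 1) → K) :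
    eval x (PsiInv f) = eval (PsiP x) f := by
  rw [PsiInv, eval_aeval]
  congr 2
  ext i
  refine Fin.cases ?_ (fun i => ?_) i <;> simp [PsiP, Fin.init]

theorem totalDegree_PsiInv {N : ℕ} (f : MvPolynomial (Fin (N + 1)) K) :
    (PsiInv f).totalDegree ≤ f.totalDegree := by
  apply totalDegree_aeval_le
  intro i
  refine Fin.cases ?_ (fun i => ?_) i
  · simp only [Fin.cons_zero]
    refine (totalDegree_mul _ _).trans ?_
    simp
  · simp

/-- `(Ψ f)(x) = f(x_2, …, x_n, x_1/q)` -/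
def PsiF {N : ℕ} (f : MvPolynomial (Fin (N + 1)) K) : MvPolynomial (Fin (N + 1)) K :=
  aeval (Fin.snoc (fun i : Fin N => X i.succ) (C qq⁻¹ * X 0) :
    Fin (N + 1) → MvPolynomial (Fin (N + 1)) K) f

theorem eval_PsiF {N : ℕ} (f : MvPolynomial (Fin (N + 1)) K) (x : Fin (N + 1) → K) :
    eval x (PsiF f) = eval (Fin.snoc (Fin.tail x) (qq⁻¹ * x 0) : Fin (N + 1) → K) f := by
  rw [PsiF, eval_aeval]
  congr 2
  ext i
  refine Fin.lastCases ?_ (fun i => ?_) i <;> simp [Fin.tail]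

theorem totalDegree_PsiF {N : ℕ} (f : MvPolynomial (Fin (N + 1)) K) :
    (PsiF f).totalDegree ≤ f.totalDegree := by
  apply totalDegree_aeval_le
  intro i
  refine Fin.lastCases ?_ (fun i => ?_) i
  · simp only [Fin.snoc_last]
    refine (totalDegree_mul _ _).trans ?_
    simp
  · simp

theorem PsiP_surj {N : ℕ} (x : Fin (N + 1) → K) :
    PsiP (Fin.snoc (Fin.tail x) (qq⁻¹ * x 0) : Fin (N + 1) → K) = x := by
  unfold PsiP
  rw [Fin.snoc_last, Fin.init_snoc, ← mul_assoc, mul_inv_cancel₀ qq_ne, one_mul,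
    Fin.cons_self_tail]

theorem snoc_PsiP {N : ℕ} (x : Fin (N + 1) → K) :
    (Fin.snoc (Fin.tail (PsiP x)) (qq⁻¹ * PsiP x 0) : Fin (N + 1) → K) = x := by
  unfold PsiP
  rw [Fin.tail_cons, Fin.cons_zero, ← mul_assoc, inv_mul_cancel₀ qq_ne, one_mul,
    Fin.snoc_init_self]

theorem PsiInv_zero {N : ℕ} (g : MvPolynomial (Fin (N + 1)) K) (h : PsiInv g = 0) : g = 0 := by
  apply MvPolynomial.funext
  intro x
  rw [← PsiP_surj x, ← eval_PsiInv, h]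
  simp

theorem PsiInv_PsiF {N : ℕ} (g : MvPolynomial (Fin (N + 1)) K) : PsiInv (PsiF g) = g := by
  apply MvPolynomial.funext
  intro x
  rw [eval_PsiInv, eval_PsiF, snoc_PsiP]

theorem evalPt_ne_cc {N : ℕ} (ν : Fin (N + 1) → ℕ) (h : ν 0 ≠ 0) : evalPt ν 0 ≠ cc N := by
  intro hc
  apply h
  apply evalPt_qexp ν 0 0 (-(N : ℤ))
  rw [hc, cc]; simp

theorem interp_unique (n : ℕ) : ∀ (d : ℕ) (f : MvPolynomial (Fin n) K), f.totalDegree ≤ d →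
    (∀ ν : Fin n → ℕ, csize ν ≤ d → eval (evalPt ν) f = 0) → f = 0 := by
  induction n with
  | zero =>
    intro d f _ hv
    have := hv 0 (by simp [csize])
    rw [f.eq_C_of_isEmpty] at this ⊢
    rw [eval_C] at this
    rw [this, C_0]
  | succ N ihN =>
    intro d
    induction d with
    | zero =>
      intro f hd hv
      have h0 : f.totalDegree = 0 := by omega
      rw [totalDegree_eq_zero_iff_eq_C] at h0
      have := hv 0 (by simp [csize])
      rw [h0, eval_C] at this
      rw [h0, this, C_0]
    | succ d ihd =>
      intro f hd hv
      have hr : restr0 (cc N) f = 0 := by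
        apply ihN (d + 1) _ ((totalDegree_restr0 _ _).trans hd)
        intro ν hν
        rw [eval_restr0, ← evalPt_cons_zero]
        apply hv
        simpa [csize, Fin.sum_univ_succ] using hν
      obtain ⟨g, hg⟩ := restr0_zero _ _ hr
      rcases eq_or_ne g 0 with h0 | h0
      · rw [hg, h0, mul_zero]
      · exfalso
        apply h0
        rw [hg, totalDegree_factor _ _ _ h0] at hd
        apply PsiInv_zero
        apply ihd _ ((totalDegree_PsiInv g).trans (by omega))
        intro ν hν
        rw [eval_PsiInv, ← evalPt_PhiC]
        have h1 := hv (PhiC ν) (by rw [csize_PhiC]; omega)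
        rw [hg, map_mul] at h1
        rcases mul_eq_zero.1 h1 with h2 | h2
        · exfalso
          simp only [map_sub, eval_X, eval_C] at h2
          refine evalPt_ne_cc (PhiC ν) ?_ (sub_eq_zero.1 h2)
          simp [PhiC]
        · exact h2

theorem IsEstar_unique {n : ℕ} (μ : Fin n → ℕ) (f g : MvPolynomial (Fin n) K)
    (hf : IsEstar μ f) (hg : IsEstar μ g) : f = g := by
  obtain ⟨f1, f2, f3⟩ := hf
  obtain ⟨g1, g2, g3⟩ := hg
  have h0 : C (eval (evalPt μ) g) * f - C (eval (evalPt μ) f) * g = 0 := by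
    apply interp_unique n (csize μ)
    · refine (totalDegree_sub _ _).trans (max_le ?_ ?_) <;>
        refine (totalDegree_mul _ _).trans ?_ <;> simpa
    · intro ν hν
      by_cases h : ν = μ
      · subst h; simp; ring
      · simp [f3 ν hν h, g3 ν hν h]
  have h1 : eval (evalPt μ) f ≠ 0 := by
    intro he
    have : f = 0 := by
      apply interp_unique n (csize μ) f f1
      intro ν hν
      by_cases h : ν = μ
      · subst h; exact he
      · exact f3 ν hν h
    rw [this] at f2
    simp at f2
  have h2 := congrArg (coeff (expOf μ)) h0
  rw [coeff_sub, coeff_C_mul, coeff_C_mul, f2, g2] at h2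
  simp only [mul_one, coeff_zero] at h2
  rw [sub_eq_zero] at h2
  rw [h2, ← mul_sub] at h0
  rcases mul_eq_zero.1 h0 with h3 | h3
  · exfalso; apply h1
    exact (C_injective _ _) (h3.trans (C_0).symm)
  · exact sub_eq_zero.1 h3

/-- `T_{m-1} ⋯ T_0 f` -/
def TT {N : ℕ} : ℕ → MvPolynomial (Fin (N + 1)) K → MvPolynomial (Fin (N + 1)) K
  | 0, f => f
  | m + 1, f => if h : m < N then Th ⟨m, h⟩ (TT m f) else TT m f

theorem insertNth_sw {N : ℕ} {α : Type*} (i : Fin N) (x : α) (β : Fin N → α) :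
    (i.succ.insertNth x β : Fin (N + 1) → α) ∘ sw i = i.castSucc.insertNth x β := by
  rw [Fin.eq_insertNth_iff]
  constructor
  · simp [sw_left]
  · ext k
    simp only [Fin.removeNth, Function.comp]
    rcases lt_trichotomy k i with h | h | h
    · have h1 : i.castSucc.succAbove k = k.castSucc := Fin.succAbove_of_castSucc_lt _ _ (by simpa)
      have h2 : i.succ.succAbove k = k.castSucc := Fin.succAbove_of_castSucc_lt _ _ (by
        rw [Fin.lt_def] at *; simp; omega)
      rw [h1, sw, Equiv.swap_apply_of_ne_of_ne, ← h2, Fin.insertNth_apply_succAbove]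
      · rw [ne_eq, Fin.ext_iff]; simp; omega
      · rw [ne_eq, Fin.ext_iff]; simp; omega
    · subst h
      have h1 : k.castSucc.succAbove k = k.succ := Fin.succAbove_castSucc_self k
      have h2 : k.succ.succAbove k = k.castSucc := Fin.succAbove_succ_self k
      rw [h1, sw_right, ← h2, Fin.insertNth_apply_succAbove]
    · have h1 : i.castSucc.succAbove k = k.succ := Fin.succAbove_of_le_castSucc _ _ (by
        simp [h.le])
      have h2 : i.succ.succAbove k = k.succ := Fin.succAbove_of_le_castSucc _ _ (by
        rw [Fin.le_def]; rw [Fin.lt_def] at h; simp; omega)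
      rw [h1, sw, Equiv.swap_apply_of_ne_of_ne, ← h2, Fin.insertNth_apply_succAbove]
      · rw [ne_eq, Fin.ext_iff]; rw [Fin.lt_def] at h; simp; omega
      · rw [ne_eq, Fin.ext_iff]; rw [Fin.lt_def] at h; simp; omega

theorem insertNth_sw' {N : ℕ} {α : Type*} (i : Fin N) (x : α) (β : Fin N → α) :
    (i.castSucc.insertNth x β : Fin (N + 1) → α) ∘ sw i = i.succ.insertNth x β := by
  rw [← insertNth_sw, comp_sw_sw]

theorem insertNth_inj {N : ℕ} (p : Fin (N + 1)) (β : Fin N → K) (hβ : Function.Injective β)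
    (h0 : ∀ i, β i ≠ 0) : Function.Injective (p.insertNth 0 β : Fin (N + 1) → K) := by
  intro a b
  refine Fin.succAboveCases p ?_ (fun a => ?_) a <;> refine Fin.succAboveCases p ?_ (fun b => ?_) b
  · simp
  · simp only [Fin.insertNth_apply_same, Fin.insertNth_apply_succAbove]
    intro h; exact absurd h.symm (h0 _)
  · simp only [Fin.insertNth_apply_same, Fin.insertNth_apply_succAbove]
    intro h; exact absurd h (h0 _)
  · simp only [Fin.insertNth_apply_succAbove]
    intro h; rw [hβ h]

theorem TT_eval_zero {N : ℕ} (f : MvPolynomial (Fin (N + 1)) K) (β : Fin N → K)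
    (hβ : Function.Injective β) (h0 : ∀ i, β i ≠ 0) :
    ∀ (m : ℕ) (hm : m < N + 1), eval ((⟨m, hm⟩ : Fin (N + 1)).insertNth 0 β : Fin (N + 1) → K) (TT m f)
      = tt ^ m * eval (Fin.cons 0 β : Fin (N + 1) → K) f := by
  intro m
  induction m with
  | zero =>
    intro hm
    simp only [TT, pow_zero, one_mul]
    have : (⟨0, hm⟩ : Fin (N + 1)) = 0 := rfl
    rw [this, Fin.insertNth_zero]
    rfl
  | succ m ih =>
    intro hm
    have hmN : m < N := by omega
    have e1 : (⟨m + 1, hm⟩ : Fin (N + 1)) = (⟨m, hmN⟩ : Fin N).succ := rfl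
    have e2 : (⟨m, by omega⟩ : Fin (N + 1)) = (⟨m, hmN⟩ : Fin N).castSucc := rfl
    simp only [TT, hmN, dif_pos]
    rw [e1, eval_Th _ _ _ (insertNth_inj _ β hβ h0), insertNth_sw, ← e2, ih (by omega)]
    have h1 : (Fin.insertNth (⟨m, hmN⟩ : Fin N).succ 0 β : Fin (N + 1) → K)
        (⟨m, hmN⟩ : Fin N).castSucc ≠ 0 := by
      have h2 : (⟨m, hmN⟩ : Fin N).succ.succAbove ⟨m, hmN⟩ = (⟨m, hmN⟩ : Fin N).castSucc :=
        Fin.succAbove_succ_self _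
      rw [← h2, Fin.insertNth_apply_succAbove]
      exact h0 _
    rw [Fin.insertNth_apply_same, ← e2] at *
    have h3 : ∀ a : K, a ≠ 0 → rr a 0 = tt := by
      intro a ha; unfold rr; field_simp; simp
    rw [h3 _ h1, pow_succ]
    ring

theorem totalDegree_TT {N : ℕ} (f : MvPolynomial (Fin (N + 1)) K) (m : ℕ) :
    (TT m f).totalDegree ≤ f.totalDegree := by
  induction m with
  | zero => simp [TT]
  | succ m ih =>
    simp only [TT]
    split_ifs
    · exact (totalDegree_Th _ _).trans ih
    · exact ih

theorem TT_vanish {N : ℕ} (f : MvPolynomial (Fin (N + 1)) K) (d : ℕ)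
    (h : ∀ ν, csize ν < d → eval (evalPt ν) f = 0) (m : ℕ) :
    ∀ ν, csize ν < d → eval (evalPt ν) (TT m f) = 0 := by
  induction m with
  | zero => simpa [TT] using h
  | succ m ih =>
    intro ν hν
    simp only [TT]
    split_ifs
    · have := eval_Th_sPt 1 one_ne_zero ⟨m, by assumption⟩ (TT m f) ν
      have e : ∀ ν : Fin (N + 1) → ℕ, sPt 1 ν = evalPt ν := by intro ν; ext i; simp [sPt]
      simp only [e] at this
      rw [this, ih ν hν, ih _ (by rw [csize_sw]; exact hν)]
      ring
    · exact ih ν hν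

/-- key lemma (b) -/
theorem PsiInv_of_support {N : ℕ} (f : MvPolynomial (Fin (N + 1)) K) (d : ℕ)
    (hd : f.totalDegree ≤ d) (h1 : ∀ ν, csize ν < d → eval (evalPt ν) f = 0)
    (h2 : ∀ ν, csize ν ≤ d → ν 0 ≠ 0 → eval (evalPt ν) f = 0) :
    C (tt ^ N) * PsiInv f = TT N f := by
  set D := PsiF (TT N f) - C (tt ^ N) * f with hD
  have hr : restr0 0 D = 0 := by
    apply poly_ext_inj0
    intro β hβ h0
    rw [eval_restr0, hD, map_sub, map_mul, eval_PsiF, eval_C, Fin.tail_cons, Fin.cons_zero, mul_zero]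
    have := TT_eval_zero f β hβ h0 N (by omega)
    have e : (⟨N, by omega⟩ : Fin (N + 1)) = Fin.last N := rfl
    rw [e, Fin.insertNth_last] at this
    rw [map_zero, sub_eq_zero]
    exact this
  obtain ⟨g, hg⟩ := restr0_zero _ _ hr
  have hg0 : g = 0 := by
    by_contra hg0
    have hDd : D.totalDegree ≤ d := by
      refine (totalDegree_sub _ _).trans (max_le ?_ ?_)
      · exact (totalDegree_PsiF _).trans ((totalDegree_TT f N).trans hd)
      · refine (totalDegree_mul _ _).trans ?_
        rw [totalDegree_C, zero_add]; exact hd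
    rw [hg, totalDegree_factor _ _ _ hg0] at hDd
    have h3 : (X 0 - C (cc N)) * g = 0 := by
      apply interp_unique (N + 1) d
      · rw [totalDegree_factor _ _ _ hg0]; exact hDd
      · intro ν hν
        rw [map_mul]
        by_cases h0 : ν 0 = 0
        · simp [evalPt_zero_val ν h0]
        · have h4 : eval (evalPt ν) D = 0 := by
            rw [hD, map_sub, map_mul, h2 ν hν h0, mul_zero, sub_zero, eval_PsiF]
            obtain ⟨η, rfl⟩ := exists_PhiC ν h0
            rw [evalPt_PhiC, snoc_PsiP]
            apply TT_vanish f d h1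
            rw [csize_PhiC] at hν; omega
          rw [hg, map_mul] at h4
          simp only [map_sub, eval_X, eval_C, sub_zero] at h4
          rcases mul_eq_zero.1 h4 with h5 | h5
          · exact absurd h5 (evalPt_ne ν 0)
          · rw [h5, mul_zero]
    rcases mul_eq_zero.1 h3 with h4 | h4
    · exact X_sub_C_ne _ _ h4
    · exact hg0 h4
  rw [hg0, mul_zero] at hg
  have h5 : PsiF (TT N f) = C (tt ^ N) * f := sub_eq_zero.1 hg
  have h6 := congrArg PsiInv h5
  rw [PsiInv_PsiF] at h6
  rw [h6]
  simp [PsiInv]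

/-! ### Abstract affine Hecke relations -/

structure HeckeRel {E : Type*} [Ring E] [Algebra K E] (N : ℕ) (T S Xi : ℕ → E) : Prop where
  hTS : ∀ i, T i * S i = 1
  hST : ∀ i, S i * T i = 1
  hbr : ∀ i, i + 1 < N → T i * T (i + 1) * T i = T (i + 1) * T i * T (i + 1)
  hcomm : ∀ i j, i + 1 < j → j < N → T i * T j = T j * T i
  hX : ∀ i, i < N → T i * Xi (i + 1) * T i = tt • Xi i
  hX0 : ∀ j, 1 ≤ j → j < N → Xi 0 * T j = T j * Xi 0

def CmS {E : Type*} [Ring E] (S : ℕ → E) : ℕ → E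
  | 0 => 1
  | m + 1 => CmS S m * S m

/-- `T_0 ⋯ T_{m-1}`. -/
def DmT {E : Type*} [Ring E] (T : ℕ → E) : ℕ → E
  | 0 => 1
  | m + 1 => DmT T m * T m

/-- `T_{i+m-1} ⋯ T_i`. -/
def RmT {E : Type*} [Ring E] (T : ℕ → E) (i : ℕ) : ℕ → E
  | 0 => 1
  | m + 1 => T (i + m) * RmT T i m

section
variable {E : Type*} [Ring E] [Algebra K E] {N : ℕ} {T S Xi : ℕ → E}

theorem HeckeRel.commS (h : HeckeRel N T S Xi) (i j : ℕ) (hij : i + 1 < j) (hj : j < N) :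
    S i * T j = T j * S i := by
  have h1 := h.hcomm i j hij hj
  calc S i * T j = S i * (T j * (T i * S i)) := by rw [h.hTS, mul_one]
    _ = S i * (T j * T i) * S i := by noncomm_ring
    _ = S i * (T i * T j) * S i := by rw [h1]
    _ = (S i * T i) * T j * S i := by noncomm_ring
    _ = T j * S i := by rw [h.hST, one_mul]

theorem HeckeRel.commS' (h : HeckeRel N T S Xi) (i j : ℕ) (hij : i + 1 < j) (hj : j < N) :
    S j * T i = T i * S j := by
  have h1 := h.hcomm i j hij hj
  calc S j * T i = S j * (T i * (T j * S j)) := by rw [h.hTS, mul_one]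
    _ = S j * (T i * T j) * S j := by noncomm_ring
    _ = S j * (T j * T i) * S j := by rw [h1]
    _ = (S j * T j) * T i * S j := by noncomm_ring
    _ = T i * S j := by rw [h.hST, one_mul]

theorem HeckeRel.brS (h : HeckeRel N T S Xi) (i : ℕ) (hi : i + 1 < N) :
    S i * S (i + 1) * T i = T (i + 1) * S i * S (i + 1) := by
  have h1 := h.hbr i hi
  have e1 : T i * (T (i+1) * S i * S (i+1)) = S (i+1) * T i := by
    have e2 : T (i+1) * (T i * (T (i+1) * S i * S (i+1))) = T i := by
      calc T (i+1) * (T i * (T (i+1) * S i * S (i+1)))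
          = (T (i+1) * T i * T (i+1)) * S i * S (i+1) := by noncomm_ring
        _ = (T i * T (i+1) * T i) * S i * S (i+1) := by rw [h1]
        _ = T i * T (i+1) * (T i * S i) * S (i+1) := by noncomm_ring
        _ = T i * (T (i+1) * S (i+1)) := by rw [h.hTS i]; noncomm_ring
        _ = T i := by rw [h.hTS, mul_one]
    calc T i * (T (i+1) * S i * S (i+1))
        = (S (i+1) * T (i+1)) * (T i * (T (i+1) * S i * S (i+1))) := by rw [h.hST, one_mul]
      _ = S (i+1) * (T (i+1) * (T i * (T (i+1) * S i * S (i+1)))) := by rw [mul_assoc]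
      _ = S (i+1) * T i := by rw [e2]
  calc S i * S (i + 1) * T i = S i * (S (i+1) * T i) := by rw [mul_assoc]
    _ = S i * (T i * (T (i+1) * S i * S (i+1))) := by rw [e1]
    _ = (S i * T i) * (T (i+1) * S i * S (i+1)) := by noncomm_ring
    _ = _ := by rw [h.hST, one_mul]

theorem HeckeRel.Cm_comm (h : HeckeRel N T S Xi) (m j : ℕ) (hj : m + 1 ≤ j) (hN : j < N) :
    CmS S m * T j = T j * CmS S m := by
  induction m with
  | zero => simp [CmS]
  | succ m ih =>
    simp only [CmS]
    rw [mul_assoc, h.commS m j (by omega) hN, ← mul_assoc, ih (by omega), mul_assoc]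

theorem HeckeRel.Cm_shift (h : HeckeRel N T S Xi) (i m : ℕ) (hi : i + 1 < m) (hm : m ≤ N) :
    CmS S m * T i = T (i + 1) * CmS S m := by
  induction m with
  | zero => omega
  | succ m ih =>
    by_cases hm' : m = i + 1
    · subst hm'
      simp only [CmS]
      calc CmS S i * S i * S (i+1) * T i = CmS S i * (S i * S (i+1) * T i) := by noncomm_ring
        _ = CmS S i * (T (i+1) * S i * S (i+1)) := by rw [h.brS i (by omega)]
        _ = (CmS S i * T (i+1)) * S i * S (i+1) := by noncomm_ring
        _ = _ := by rw [h.Cm_comm i (i+1) le_rfl (by omega)]; noncomm_ring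
    · simp only [CmS]
      rw [mul_assoc, h.commS' i m (by omega) (by omega), ← mul_assoc, ih (by omega) (by omega),
        mul_assoc]

def rhoE {E : Type*} [Ring E] (N : ℕ) (S Xi : ℕ → E) : E := Xi 0 * CmS S N

theorem HeckeRel.rho_shift (h : HeckeRel N T S Xi) (i : ℕ) (hi : i + 1 < N) :
    rhoE N S Xi * T i = T (i + 1) * rhoE N S Xi := by
  unfold rhoE
  rw [mul_assoc, h.Cm_shift i N hi le_rfl, ← mul_assoc, h.hX0 _ (by omega) hi, mul_assoc]

theorem HeckeRel.D_X (h : HeckeRel N T S Xi) (i : ℕ) (hi : i ≤ N) :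
    DmT T i * Xi i = tt ^ i • (Xi 0 * CmS S i) := by
  induction i with
  | zero => simp [DmT, CmS]
  | succ i ih =>
    have h1 : T i * Xi (i+1) = tt • (Xi i * S i) := by
      calc T i * Xi (i+1) = T i * Xi (i+1) * (T i * S i) := by rw [h.hTS, mul_one]
        _ = (T i * Xi (i+1) * T i) * S i := by noncomm_ring
        _ = _ := by rw [h.hX i (by omega), smul_mul_assoc]
    simp only [DmT, CmS]
    rw [mul_assoc, h1, mul_smul_comm, ← mul_assoc, ih (by omega), smul_mul_assoc, smul_smul,
      pow_succ', mul_assoc]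

theorem HeckeRel.Cm_R (h : HeckeRel N T S Xi) (i m : ℕ) :
    CmS S (i + m) * RmT T i m = CmS S i := by
  induction m with
  | zero => simp [RmT]
  | succ m ih =>
    rw [← add_assoc]
    simp only [CmS, RmT]
    rw [mul_assoc, ← mul_assoc (S (i+m)), h.hST, one_mul, ih]

/-- `D_i Ξ_i = t^i ρ R_i`. -/
theorem HeckeRel.M_id (h : HeckeRel N T S Xi) (i m : ℕ) (hi : i + m = N) :
    DmT T i * Xi i = tt ^ i • (rhoE N S Xi * RmT T i m) := by
  rw [h.D_X i (by omega)]
  unfold rhoE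
  rw [mul_assoc, ← hi, h.Cm_R]

theorem HeckeRel.D_inv (h : HeckeRel N T S Xi) (i : ℕ) : ∃ D', D' * DmT T i = 1 := by
  induction i with
  | zero => exact ⟨1, by simp [DmT]⟩
  | succ i ih =>
    obtain ⟨D', hD⟩ := ih
    refine ⟨S i * D', ?_⟩
    simp only [DmT]
    rw [mul_assoc, ← mul_assoc D', hD, one_mul, h.hST]
end

/-! ### The concrete operators -/

abbrev WW (N : ℕ) := {x : Fin (N + 1) → K // Function.Injective x ∧ ∀ i, x i ≠ 0} → K
abbrev YY (N : ℕ) := (Fin (N + 1) → ℕ) → K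

def wsw {N : ℕ} (i : Fin N) (x : {x : Fin (N + 1) → K // Function.Injective x ∧ ∀ i, x i ≠ 0}) :
    {x : Fin (N + 1) → K // Function.Injective x ∧ ∀ i, x i ≠ 0} :=
  ⟨x.1 ∘ sw i, sw_inj i _ x.2.1, fun _ => x.2.2 _⟩

def WT {N : ℕ} (i : Fin N) (F : WW N) : WW N := fun x =>
  (tt - rr (x.1 i.castSucc) (x.1 i.succ)) * F x + rr (x.1 i.castSucc) (x.1 i.succ) * F (wsw i x)

def WX {N : ℕ} (i : Fin (N + 1)) (F : WW N) : WW N := fun x => (x.1 i)⁻¹ * F x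

theorem wsw_wsw {N : ℕ} (i : Fin N) (x) : wsw i (wsw i x) = x := by
  apply Subtype.ext; exact comp_sw_sw i x.1

theorem sw_val_ne {N : ℕ} (i : Fin N) (k : Fin (N + 1)) (h1 : k ≠ i.castSucc) (h2 : k ≠ i.succ) :
    sw i k = k := Equiv.swap_apply_of_ne_of_ne h1 h2

theorem WT_quad {N : ℕ} (i : Fin N) (F : WW N) :
    WT i (WT i F) = tt • F + (tt - 1) • WT i F := by
  funext x
  have h := x.2.1.ne (castSucc_ne_succ' i)
  simp only [WT, wsw_wsw, Pi.add_apply, Pi.smul_apply, smul_eq_mul]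
  simp only [wsw, Function.comp, sw_left, sw_right, rr]
  have h1 := sub_ne_zero.mpr h
  have h2 := sub_ne_zero.mpr h.symm
  generalize F x = a
  generalize F _ = b
  revert h1 h2
  generalize x.1 i.castSucc = y
  generalize x.1 i.succ = z
  intro h1 h2
  field_simp
  ring

theorem WT_WX {N : ℕ} (i : Fin N) (F : WW N) :
    WT i (WX i.succ (WT i F)) = tt • WX i.castSucc F := by
  funext x
  have h := x.2.1.ne (castSucc_ne_succ' i)
  have hy := x.2.2 i.castSucc
  have hz := x.2.2 i.succ
  simp only [WT, WX, wsw_wsw, Pi.smul_apply, smul_eq_mul]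
  simp only [wsw, Function.comp, sw_left, sw_right, rr]
  have h1 := sub_ne_zero.mpr h
  have h2 := sub_ne_zero.mpr h.symm
  generalize F x = a
  generalize F _ = b
  revert h1 h2 hy hz
  generalize x.1 i.castSucc = y
  generalize x.1 i.succ = z
  intro hy hz h1 h2
  field_simp
  ring

theorem WT_WX_far {N : ℕ} (i : Fin N) (k : Fin (N + 1)) (h1 : k ≠ i.castSucc) (h2 : k ≠ i.succ)
    (F : WW N) : WX k (WT i F) = WT i (WX k F) := by
  funext x
  simp only [WT, WX, wsw, Function.comp, sw_val_ne i k h1 h2]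
  ring

theorem WT_far {N : ℕ} (i j : Fin N) (hij : i.1 + 1 < j.1) (F : WW N) :
    WT i (WT j F) = WT j (WT i F) := by
  funext x
  have e1 : sw i j.castSucc = j.castSucc := sw_val_ne _ _
    (by intro h; simp [Fin.ext_iff] at h; omega) (by intro h; simp [Fin.ext_iff] at h; omega)
  have e2 : sw i j.succ = j.succ := sw_val_ne _ _
    (by intro h; simp [Fin.ext_iff] at h; omega) (by intro h; simp [Fin.ext_iff] at h; omega)
  have e3 : sw j i.castSucc = i.castSucc := sw_val_ne _ _
    (by intro h; simp [Fin.ext_iff] at h; omega) (by intro h; simp [Fin.ext_iff] at h; omega)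
  have e4 : sw j i.succ = i.succ := sw_val_ne _ _
    (by intro h; simp [Fin.ext_iff] at h; omega) (by intro h; simp [Fin.ext_iff] at h; omega)
  have e5 : wsw j (wsw i x) = wsw i (wsw j x) := by
    apply Subtype.ext
    funext k
    simp only [wsw, Function.comp]
    by_cases k1 : k = i.castSucc
    · rw [k1, e3, sw_left, e4]
    by_cases k2 : k = i.succ
    · rw [k2, e4, sw_right, e3]
    by_cases k3 : k = j.castSucc
    · rw [k3, e1, sw_left, e2]
    by_cases k4 : k = j.succ
    · rw [k4, e2, sw_right, e1]
    rw [sw_val_ne j k k3 k4, sw_val_ne i k k1 k2, sw_val_ne j k k3 k4]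
  simp only [WT, e5]
  simp only [wsw, Function.comp, e1, e2, e3, e4]
  ring

theorem braid_identity {F : Type*} [Field F] (t a b c f1 f2 f3 f4 f5 f6 : F)
    (h1 : a - b ≠ 0) (h2 : b - a ≠ 0) (h3 : a - c ≠ 0) (h4 : c - a ≠ 0)
    (h5 : b - c ≠ 0) (h6 : c - b ≠ 0) (r : F → F → F)
    (hr : r = fun x y => (t * x - y) / (x - y)) :
    (t - r a b) * ((t - r b c) * ((t - r a b) * f1 + r a b * f2)
        + r b c * ((t - r a c) * f3 + r a c * f4))
      + r a b * ((t - r a c) * ((t - r b a) * f2 + r b a * f1)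
        + r a c * ((t - r b c) * f5 + r b c * f6)) =
    (t - r b c) * ((t - r a b) * ((t - r b c) * f1 + r b c * f3)
        + r a b * ((t - r a c) * f2 + r a c * f5))
      + r b c * ((t - r a c) * ((t - r c b) * f3 + r c b * f1)
        + r a c * ((t - r a b) * f4 + r a b * f6)) := by
  have q1 : b - a = -(a - b) := by ring
  have q2 : c - b = -(b - c) := by ring
  have k1 : r b a = 1 + t - r a b := by
    rw [hr]; simp only []; field_simp; ring
  have k2 : r c b = 1 + t - r b c := by
    rw [hr]; simp only []; field_simp; ring
  have k3 : r a b * r b c - r a b * r a c - r a c * r b c + t * r a c + r a c = t := by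
    rw [hr]; simp only []; field_simp; ring
  rw [k1, k2]
  generalize r a b = u at *
  generalize r b c = v at *
  generalize r a c = w at *
  linear_combination (-(u - v) * f1 + u * f2 - v * f3) * k3

theorem wsw_val {N : ℕ} (i : Fin N) (x) (k : Fin (N + 1)) : (wsw i x).1 k = x.1 (sw i k) := rfl

theorem WT_braid {N : ℕ} (i j : Fin N) (hij : j.1 = i.1 + 1) (F : WW N) :
    WT i (WT j (WT i F)) = WT j (WT i (WT j F)) := by
  funext x
  have e0 : j.castSucc = i.succ := by ext; simp [hij]
  have e1 : sw i j.succ = j.succ := sw_val_ne _ _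
    (by intro h; simp [Fin.ext_iff] at h; omega) (by intro h; simp [Fin.ext_iff] at h; omega)
  have e2 : sw j i.castSucc = i.castSucc := sw_val_ne _ _
    (by intro h; simp [Fin.ext_iff] at h; omega) (by intro h; simp [Fin.ext_iff] at h; omega)
  have e3 : sw j i.succ = j.succ := by rw [← e0, sw_left]
  have e4 : sw j j.succ = i.succ := by rw [sw_right, e0]
  have e5 : wsw i (wsw j (wsw i x)) = wsw j (wsw i (wsw j x)) := by
    apply Subtype.ext
    funext k
    simp only [wsw, Function.comp]
    by_cases k1 : k = i.castSucc
    · simp only [k1, sw_left, sw_right, e1, e2, e3, e4]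
    by_cases k2 : k = i.succ
    · simp only [k2, sw_left, sw_right, e1, e2, e3, e4]
    by_cases k3 : k = j.succ
    · simp only [k3, sw_left, sw_right, e1, e2, e3, e4]
    have k4 : k ≠ j.castSucc := by rw [e0]; exact k2
    simp only [sw_val_ne j k k4 k3, sw_val_ne i k k1 k2]
  have a1 := sub_ne_zero.mpr (x.2.1.ne (castSucc_ne_succ' i))
  have a2 := sub_ne_zero.mpr (x.2.1.ne (castSucc_ne_succ' i)).symm
  have a3 := sub_ne_zero.mpr (x.2.1.ne (castSucc_ne_succ' j))
  have a4 := sub_ne_zero.mpr (x.2.1.ne (castSucc_ne_succ' j)).symm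
  have hne : i.castSucc ≠ j.succ := by intro h; simp [Fin.ext_iff] at h; omega
  have a5 := sub_ne_zero.mpr (x.2.1.ne hne)
  have a6 := sub_ne_zero.mpr (x.2.1.ne hne).symm
  rw [e0] at a3 a4
  have key := braid_identity tt (x.1 i.castSucc) (x.1 i.succ) (x.1 j.succ) (F x) (F (wsw i x))
    (F (wsw j x)) (F (wsw i (wsw j x))) (F (wsw j (wsw i x))) (F (wsw j (wsw i (wsw j x))))
    a1 a2 a5 a6 a3 a4 rr rfl
  simp only [WT, wsw_wsw, e5, e0]
  simp only [wsw_val, Function.comp, sw_left, sw_right, e1, e2, e3, e4]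
  exact key

/-- Restriction to the evaluation points of compositions. -/
def resW {N : ℕ} (F : WW N) : YY N := fun ν => F ⟨evalPt ν, evalPt_inj ν, evalPt_ne ν⟩

theorem resW_surj {N : ℕ} (g : YY N) : ∃ F : WW N, resW F = g := by
  refine ⟨fun x => if h : ∃ ν, evalPt ν = x.1 then g h.choose else 0, ?_⟩
  funext ν
  have h : ∃ ν', evalPt ν' = evalPt ν := ⟨ν, rfl⟩
  simp only [resW]
  rw [dif_pos h]
  congr 1
  funext i
  apply (evalPt_qexp ν i _ (-(kstat h.choose i : ℤ)) _).symm
  have := congrFun h.choose_spec i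
  rw [← this]; rfl

def YTf {N : ℕ} (i : Fin N) (g : YY N) : YY N := fun ν =>
  (tt - rv i ν) * g ν + rv i ν * g (ν ∘ sw i)

def YXf {N : ℕ} (i : Fin (N + 1)) (g : YY N) : YY N := fun ν => (evalPt ν i)⁻¹ * g ν

theorem res_T {N : ℕ} (i : Fin N) (F : WW N) : YTf i (resW F) = resW (WT i F) := by
  funext ν
  simp only [YTf, resW, WT, wsw]
  by_cases h : ν i.castSucc = ν i.succ
  · have h1 := rv_eq i ν h
    rw [h1]
    unfold rv at h1
    rw [h1]; ring
  · have := evalPt_swap ν _ _ Fin.castSucc_lt_succ (sw_adj i) h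
    simp only [rv]
    congr 3
    exact Subtype.ext this

theorem res_X {N : ℕ} (i : Fin (N + 1)) (F : WW N) : YXf i (resW F) = resW (WX i F) := rfl

/-- Linear versions. -/
def YTl {N : ℕ} (i : Fin N) : Module.End K (YY N) where
  toFun := YTf i
  map_add' := by intro a b; funext ν; simp only [YTf, Pi.add_apply]; ring
  map_smul' := by
    intro a b; funext ν
    simp only [YTf, Pi.smul_apply, smul_eq_mul, RingHom.id_apply]; ring

def YXl {N : ℕ} (i : Fin (N + 1)) : Module.End K (YY N) where
  toFun := YXf i
  map_add' := by intro a b; funext ν; simp only [YXf, Pi.add_apply]; ring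
  map_smul' := by
    intro a b; funext ν
    simp only [YXf, Pi.smul_apply, smul_eq_mul, RingHom.id_apply]; ring

def YT (N : ℕ) (i : ℕ) : Module.End K (YY N) := if h : i < N then YTl ⟨i, h⟩ else 1
def YS (N : ℕ) (i : ℕ) : Module.End K (YY N) :=
  if h : i < N then tt⁻¹ • (YTl ⟨i, h⟩ - (tt - 1) • 1) else 1
def YX (N : ℕ) (i : ℕ) : Module.End K (YY N) := if h : i < N + 1 then YXl ⟨i, h⟩ else 1

theorem YT_quad {N : ℕ} (i : Fin N) :
    (YTl i : Module.End K (YY N)) * YTl i = tt • 1 + (tt - 1) • YTl i := by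
  apply LinearMap.ext
  intro g
  obtain ⟨F, rfl⟩ := resW_surj g
  change YTf i (YTf i (resW F)) = tt • resW F + (tt - 1) • YTf i (resW F)
  rw [res_T, res_T, WT_quad]
  rfl

theorem YHecke (N : ℕ) : HeckeRel N (YT N) (YS N) (YX N) where
  hTS := by
    intro i
    unfold YT YS
    split_ifs with h
    · rw [mul_smul_comm, mul_sub, YT_quad, mul_smul_comm, mul_one, add_sub_cancel_right, smul_smul,
        inv_mul_cancel₀ tt_ne, one_smul]
    · simp
  hST := by
    intro i
    unfold YT YS
    split_ifs with h
    · rw [smul_mul_assoc, sub_mul, YT_quad, smul_mul_assoc, one_mul, add_sub_cancel_right, smul_smul,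
        inv_mul_cancel₀ tt_ne, one_smul]
    · simp
  hbr := by
    intro i hi
    unfold YT
    rw [dif_pos hi, dif_pos (by omega : i < N)]
    apply LinearMap.ext
    intro g
    obtain ⟨F, rfl⟩ := resW_surj g
    change YTf _ (YTf _ (YTf _ (resW F))) = YTf _ (YTf _ (YTf _ (resW F)))
    simp only [res_T]
    rw [WT_braid _ _ rfl]
  hcomm := by
    intro i j hij hj
    unfold YT
    rw [dif_pos hj, dif_pos (by omega : i < N)]
    apply LinearMap.ext
    intro g
    obtain ⟨F, rfl⟩ := resW_surj g
    change YTf _ (YTf _ (resW F)) = YTf _ (YTf _ (resW F))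
    simp only [res_T]
    rw [WT_far _ _ hij]
  hX := by
    intro i hi
    unfold YT YX
    rw [dif_pos hi, dif_pos (by omega : i < N + 1), dif_pos (by omega : i + 1 < N + 1)]
    apply LinearMap.ext
    intro g
    obtain ⟨F, rfl⟩ := resW_surj g
    change YTf _ (YXf _ (YTf _ (resW F))) = tt • YXf _ (resW F)
    simp only [res_T, res_X]
    exact congrArg resW (WT_WX ⟨i, hi⟩ F)
  hX0 := by
    intro j h1 hj
    unfold YT YX
    rw [dif_pos hj, dif_pos (by omega : 0 < N + 1)]
    apply LinearMap.ext
    intro g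
    obtain ⟨F, rfl⟩ := resW_surj g
    change YXf _ (YTf _ (resW F)) = YTf _ (YXf _ (resW F))
    simp only [res_T, res_X]
    exact congrArg resW (WT_WX_far _ _ (by intro h; simp [Fin.ext_iff] at h; omega)
      (by intro h; simp [Fin.ext_iff] at h) F)

/-! ### Rearrangements -/

def cnt {n : ℕ} (μ : Fin n → ℕ) (a : ℕ) : ℕ := ∑ i, if μ i = a then 1 else 0

theorem cnt_comp {n : ℕ} (μ : Fin n → ℕ) (σ : Equiv.Perm (Fin n)) (a : ℕ) :
    cnt (μ ∘ σ) a = cnt μ a :=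
  Equiv.sum_comp σ (fun i => if μ i = a then 1 else 0)

theorem exists_perm_of_cnt {n : ℕ} (f g : Fin n → ℕ) (h : ∀ a, cnt f a = cnt g a) :
    ∃ σ : Equiv.Perm (Fin n), f = g ∘ σ := by
  have hc : ∀ a, Fintype.card {x // f x = a} = Fintype.card {x // g x = a} := by
    intro a
    have := h a
    unfold cnt at this
    rw [← Finset.card_filter, ← Finset.card_filter] at this
    rw [Fintype.card_subtype, Fintype.card_subtype]
    convert this
  let e : ∀ a, {x // f x = a} ≃ {x // g x = a} := fun a => Fintype.equivOfCardEq (hc a)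
  refine ⟨(Equiv.sigmaFiberEquiv f).symm.trans ((Equiv.sigmaCongrRight e).trans
    (Equiv.sigmaFiberEquiv g)), ?_⟩
  funext x
  have := (e (f x) ⟨x, rfl⟩).2
  simp only [Function.comp, Equiv.trans_apply]
  exact this.symm

theorem Sn_iff {n : ℕ} (l μ : Fin n → ℕ) : μ ∈ Sn l ↔ ∀ a, cnt μ a = cnt l a := by
  constructor
  · rintro ⟨σ, rfl⟩ a
    exact cnt_comp l σ.symm a
  · intro h
    obtain ⟨σ, hσ⟩ := exists_perm_of_cnt μ l h
    exact ⟨σ.symm, hσ.symm⟩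

theorem Sn_comp {n : ℕ} (l μ : Fin n → ℕ) (σ : Equiv.Perm (Fin n)) (h : μ ∈ Sn l) : μ ∘ σ ∈ Sn l := by
  rw [Sn_iff] at h ⊢
  intro a; rw [cnt_comp, h]

theorem Sn_self {n : ℕ} (l : Fin n → ℕ) : l ∈ Sn l := by rw [Sn_iff]; intro a; rfl

theorem mem_SnFinset {n : ℕ} (l μ : Fin n → ℕ) : μ ∈ SnFinset l ↔ μ ∈ Sn l := by
  simp [SnFinset, Sn]

theorem cnt_insertNth {N : ℕ} (p : Fin (N + 1)) (x : ℕ) (β : Fin N → ℕ) (a : ℕ) :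
    cnt (p.insertNth x β : Fin (N + 1) → ℕ) a = (if x = a then 1 else 0) + cnt β a := by
  unfold cnt
  rw [Fin.sum_univ_succAbove _ p]
  simp

theorem Sn_insertNth {N : ℕ} (p p' : Fin (N + 1)) (x : ℕ) (β β' : Fin N → ℕ) (l : Fin (N + 1) → ℕ)
    (hβ : ∀ a, cnt β a = cnt β' a)
    (h : (p.insertNth x β : Fin (N + 1) → ℕ) ∈ Sn l) :
    (p'.insertNth x β' : Fin (N + 1) → ℕ) ∈ Sn l := by
  rw [Sn_iff] at h ⊢
  intro a
  rw [← h, cnt_insertNth, cnt_insertNth, hβ]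

theorem Sn_val {n : ℕ} (l μ : Fin n → ℕ) (h : μ ∈ Sn l) (i : Fin n) : ∃ j, μ i = l j := by
  obtain ⟨σ, rfl⟩ := h
  exact ⟨_, rfl⟩

theorem sorted_unique {n : ℕ} (key : ℕ → ℕ) (hk : Function.Injective key) (f g : Fin n → ℕ)
    (h : ∀ a, cnt f a = cnt g a) (hf : Antitone (key ∘ f)) (hg : Antitone (key ∘ g)) : f = g := by
  obtain ⟨σ, rfl⟩ := exists_perm_of_cnt f g h
  have h1 : Monotone ((OrderDual.toDual ∘ key ∘ g) ∘ σ) := fun a b hab => hf hab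
  have h2 : Monotone ((OrderDual.toDual ∘ key ∘ g) ∘ (1 : Equiv.Perm (Fin n))) :=
    fun a b hab => hg hab
  have := Tuple.unique_monotone h1 h2
  funext i
  have h3 := congrFun this i
  exact hk h3

/-- Induction principle: from the sorted composition, applying descents. -/
theorem sort_ind {N : ℕ} (key : ℕ → ℕ) (P : (Fin (N + 1) → ℕ) → Prop)
    (hs : ∀ κ, Antitone (key ∘ κ) → P κ)
    (hstep : ∀ κ (i : Fin N), key (κ i.succ) < key (κ i.castSucc) → P κ → P (κ ∘ sw i)) :
    ∀ κ, P κ := by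
  have main : ∀ m : ℕ, ∀ κ, (∑ i : Fin (N + 1), i.1 * key (κ i)) = m → P κ := by
    intro m
    induction m using Nat.strong_induction_on with
    | _ m ih =>
      intro κ hκ
      by_cases hA : Antitone (key ∘ κ)
      · exact hs κ hA
      rw [Fin.antitone_iff_succ_le] at hA
      push Not at hA
      obtain ⟨i, hi⟩ := hA
      simp only [Function.comp] at hi
      have h1 := comp_sw_sw i κ
      rw [← h1]
      apply hstep
      · simp only [Function.comp, sw_left, sw_right]; exact hi
      · refine ih _ ?_ _ rfl
        rw [← hκ]
        have h2 : ∑ k : Fin (N + 1), k.1 * key ((κ ∘ sw i) k)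
            = ∑ k : Fin (N + 1), (sw i k).1 * key (κ k) := by
          rw [← Equiv.sum_comp (sw i)]
          apply Finset.sum_congr rfl
          intro k _
          have : sw i (sw i k) = k := by unfold sw; simp
          simp only [Function.comp, this]
        rw [h2]
        have hne := castSucc_ne_succ' i
        rw [← Finset.add_sum_erase _ _ (Finset.mem_univ i.castSucc),
          ← Finset.add_sum_erase (Finset.univ.erase i.castSucc) _ (a := i.succ) (by simp [hne.symm]),
          ← Finset.add_sum_erase _ (fun k : Fin (N + 1) => k.1 * key (κ k)) (Finset.mem_univ i.castSucc),
          ← Finset.add_sum_erase (Finset.univ.erase i.castSucc) (fun k : Fin (N + 1) => k.1 * key (κ k))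
            (a := i.succ) (by simp [hne.symm])]
        have h3 : ∑ k ∈ (Finset.univ.erase i.castSucc).erase i.succ, (sw i k).1 * key (κ k)
            = ∑ k ∈ (Finset.univ.erase i.castSucc).erase i.succ, k.1 * key (κ k) := by
          apply Finset.sum_congr rfl
          intro k hk
          simp only [Finset.mem_erase] at hk
          rw [sw_val_ne i k hk.2.1 hk.1]
        rw [h3, sw_left, sw_right]
        simp only [Fin.val_succ, Fin.val_castSucc]
        nlinarith
  exact fun κ => main _ κ rfl

/-! ### Moves in families -/

structure MFam (N : ℕ) (O : Set (Fin (N + 1) → ℕ)) (key : ℕ → ℕ) (c : ℕ → ℕ → K)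
    (v : (Fin (N + 1) → ℕ) → YY N) : Prop where
  hO : ∀ κ ∈ O, ∀ i : Fin N, κ ∘ sw i ∈ O
  hkey : Function.Injective key
  hstep : ∀ κ ∈ O, ∀ i : Fin N, key (κ i.succ) < key (κ i.castSucc) →
    YTl i (v κ) = c (κ i.castSucc) (κ i.succ) • v (κ ∘ sw i)
  heq : ∀ κ ∈ O, ∀ i : Fin N, κ i.castSucc = κ i.succ → YTl i (v κ) = tt • v κ

def cst (c : ℕ → ℕ → K) (x y : ℕ) : K := if x = y then tt else c x y

theorem ins_castSucc {N : ℕ} (i : Fin N) (x : ℕ) (β : Fin N → ℕ) :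
    (i.castSucc.insertNth x β : Fin (N + 1) → ℕ) i.succ = β i := by
  have h : i.castSucc.succAbove i = i.succ := Fin.succAbove_castSucc_self i
  conv_lhs => rw [← h]
  exact Fin.insertNth_apply_succAbove (α := fun _ => ℕ) i.castSucc x β i

theorem ins_succ {N : ℕ} (i : Fin N) (x : ℕ) (β : Fin N → ℕ) :
    (i.succ.insertNth x β : Fin (N + 1) → ℕ) i.castSucc = β i := by
  have h : i.succ.succAbove i = i.castSucc := Fin.succAbove_succ_self i
  conv_lhs => rw [← h]
  exact Fin.insertNth_apply_succAbove (α := fun _ => ℕ) i.succ x β i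

theorem ins_self {N : ℕ} (p : Fin (N + 1)) (x : ℕ) (β : Fin N → ℕ) :
    (p.insertNth x β : Fin (N + 1) → ℕ) p = x := by simp

section
variable {N : ℕ} {O : Set (Fin (N + 1) → ℕ)} {key : ℕ → ℕ} {c : ℕ → ℕ → K}
    {v : (Fin (N + 1) → ℕ) → YY N}

theorem MFam.stepR (h : MFam N O key c v) (i : Fin N) (x : ℕ) (β : Fin N → ℕ)
    (hO : (i.castSucc.insertNth x β : Fin (N + 1) → ℕ) ∈ O) (hk : key (β i) ≤ key x) :
    YTl i (v (i.castSucc.insertNth x β)) = cst c x (β i) • v (i.succ.insertNth x β) := by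
  unfold cst
  split_ifs with hx
  · rw [h.heq _ hO i (by rw [ins_self, ins_castSucc, hx])]
    congr 1
    have := insertNth_sw' i x β
    rw [← this]
    congr 1
    funext k
    by_cases k1 : k = i.castSucc
    · rw [k1, Function.comp, sw_left, ins_castSucc, ins_self, hx]
    by_cases k2 : k = i.succ
    · rw [k2, Function.comp, sw_right, ins_castSucc, ins_self, hx]
    rw [Function.comp, sw_val_ne i k k1 k2]
  · rw [h.hstep _ hO i (by
      rw [ins_self, ins_castSucc]
      exact lt_of_le_of_ne hk (fun e => hx (h.hkey e).symm)), ins_self, ins_castSucc, insertNth_sw']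

theorem MFam.stepL (h : MFam N O key c v) (i : Fin N) (x : ℕ) (β : Fin N → ℕ)
    (hO : (i.succ.insertNth x β : Fin (N + 1) → ℕ) ∈ O) (hk : key x ≤ key (β i)) :
    YTl i (v (i.succ.insertNth x β)) = cst c (β i) x • v (i.castSucc.insertNth x β) := by
  unfold cst
  split_ifs with hx
  · rw [h.heq _ hO i (by rw [ins_self, ins_succ, hx])]
    congr 1
    have := insertNth_sw i x β
    rw [← this]
    congr 1
    funext k
    by_cases k1 : k = i.castSucc
    · rw [k1, Function.comp, sw_left, ins_succ, ins_self, hx]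
    by_cases k2 : k = i.succ
    · rw [k2, Function.comp, sw_right, ins_succ, ins_self, hx]
    rw [Function.comp, sw_val_ne i k k1 k2]
  · rw [h.hstep _ hO i (by
      rw [ins_self, ins_succ]
      exact lt_of_le_of_ne hk (fun e => hx (h.hkey e).symm)), ins_self, ins_succ, insertNth_sw]

theorem MFam.O_R (h : MFam N O key c v) (i : Fin N) (x : ℕ) (β : Fin N → ℕ)
    (hO : (i.castSucc.insertNth x β : Fin (N + 1) → ℕ) ∈ O) :
    (i.succ.insertNth x β : Fin (N + 1) → ℕ) ∈ O := by
  rw [← insertNth_sw']; exact h.hO _ hO i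

theorem MFam.O_L (h : MFam N O key c v) (i : Fin N) (x : ℕ) (β : Fin N → ℕ)
    (hO : (i.succ.insertNth x β : Fin (N + 1) → ℕ) ∈ O) :
    (i.castSucc.insertNth x β : Fin (N + 1) → ℕ) ∈ O := by
  rw [← insertNth_sw]; exact h.hO _ hO i

theorem prod_ite_succ (N : ℕ) (f : Fin N → K) (a m : ℕ) (ha : a ≤ m) (hm : m < N) :
    (∏ j : Fin N, if a ≤ j.1 ∧ j.1 < m + 1 then f j else 1)
      = f ⟨m, hm⟩ * ∏ j : Fin N, if a ≤ j.1 ∧ j.1 < m then f j else 1 := by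
  rw [← Finset.mul_prod_erase _ _ (Finset.mem_univ (⟨m, hm⟩ : Fin N)),
    ← Finset.mul_prod_erase _ (fun j : Fin N => if a ≤ j.1 ∧ j.1 < m then f j else 1)
      (Finset.mem_univ (⟨m, hm⟩ : Fin N))]
  simp only [ha, lt_add_iff_pos_right, zero_lt_one, and_self, if_true, lt_irrefl, and_false,
    if_false, one_mul]
  congr 1
  apply Finset.prod_congr rfl
  intro j hj
  have : j.1 ≠ m := by
    intro e; simp [Fin.ext_iff] at hj; exact hj e
  have : (j.1 < m + 1) ↔ j.1 < m := by omega
  simp only [this]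

theorem MFam.moveR (h : MFam N O key c v) (i m : ℕ) (him : i + m < N + 1) (x : ℕ) (β : Fin N → ℕ)
    (hO : ((⟨i, by omega⟩ : Fin (N + 1)).insertNth x β : Fin (N + 1) → ℕ) ∈ O)
    (hk : ∀ j : Fin N, i ≤ j.1 → j.1 < i + m → key (β j) ≤ key x) :
    RmT (YT N) i m (v ((⟨i, by omega⟩ : Fin (N + 1)).insertNth x β))
      = (∏ j : Fin N, if i ≤ j.1 ∧ j.1 < i + m then cst c x (β j) else 1) •
        v ((⟨i + m, him⟩ : Fin (N + 1)).insertNth x β) ∧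
    ((⟨i + m, him⟩ : Fin (N + 1)).insertNth x β : Fin (N + 1) → ℕ) ∈ O := by
  induction m with
  | zero =>
    refine ⟨?_, hO⟩
    rw [Finset.prod_eq_one (fun j _ => if_neg (by omega))]
    simp [RmT]
  | succ m ih =>
    obtain ⟨h1, h2⟩ := ih (by omega) hO (fun j a b => hk j a (by omega))
    have hm : i + m < N := by omega
    have hT : YT N (i + m) = YTl ⟨i + m, hm⟩ := by unfold YT; rw [dif_pos hm]
    refine ⟨?_, h.O_R ⟨i + m, hm⟩ x β h2⟩
    have h3 := h.stepR ⟨i + m, hm⟩ x β h2 (hk ⟨i + m, hm⟩ (by simp) (by simp))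
    simp only [RmT]
    rw [Module.End.mul_apply, h1, map_smul, hT]
    have h4 := prod_ite_succ N (fun j => cst c x (β j)) i (i + m) (by omega) hm
    have h5 : (∏ j : Fin N, if i ≤ j.1 ∧ j.1 < i + (m + 1) then cst c x (β j) else 1) =
      cst c x (β ⟨i + m, hm⟩) * ∏ j : Fin N, if i ≤ j.1 ∧ j.1 < i + m then cst c x (β j) else 1 := h4
    rw [h5, mul_comm, mul_smul]
    congr 1

theorem MFam.moveL (h : MFam N O key c v) (i : ℕ) (him : i < N + 1) (x : ℕ) (β : Fin N → ℕ)
    (hO : ((⟨i, him⟩ : Fin (N + 1)).insertNth x β : Fin (N + 1) → ℕ) ∈ O)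
    (hk : ∀ j : Fin N, j.1 < i → key x ≤ key (β j)) :
    DmT (YT N) i (v ((⟨i, him⟩ : Fin (N + 1)).insertNth x β))
      = (∏ j : Fin N, if 0 ≤ j.1 ∧ j.1 < i then cst c (β j) x else 1) •
        v ((0 : Fin (N + 1)).insertNth x β) := by
  induction i with
  | zero =>
    rw [Finset.prod_eq_one (fun j _ => if_neg (by omega))]
    simp [DmT]
  | succ i ih =>
    have hm : i < N := by omega
    have hT : YT N i = YTl ⟨i, hm⟩ := by unfold YT; rw [dif_pos hm]
    have h3 := h.stepL ⟨i, hm⟩ x β hO (hk ⟨i, hm⟩ (by simp))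
    have h2 := h.O_L ⟨i, hm⟩ x β hO
    have h1 := ih (by omega) h2 (fun j a => hk j (by omega))
    simp only [DmT]
    rw [Module.End.mul_apply, hT]
    have h5 : YTl ⟨i, hm⟩ (v ((⟨i + 1, him⟩ : Fin (N + 1)).insertNth x β))
      = cst c (β ⟨i, hm⟩) x • v ((⟨i, by omega⟩ : Fin (N + 1)).insertNth x β) := h3
    have h4 := prod_ite_succ N (fun j => cst c (β j) x) 0 i (by omega) hm
    rw [h5, map_smul, h1, h4, mul_smul]
end

def YTsupp {N : ℕ} (g : YY N) (ν0 : Fin (N + 1) → ℕ) : Prop := ∀ ν, ν ≠ ν0 → g ν = 0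

theorem YX_supp {N : ℕ} (g : YY N) (ν0 : Fin (N + 1) → ℕ) (h : YTsupp g ν0) (i : Fin (N + 1)) :
    YX N i.1 g = (evalPt ν0 i)⁻¹ • g := by
  unfold YX
  rw [dif_pos i.2]
  funext ν
  change (evalPt ν i)⁻¹ * g ν = (evalPt ν0 i)⁻¹ * g ν
  by_cases hν : ν = ν0
  · rw [hν]
  · rw [h ν hν]; simp

def yrho (N : ℕ) : Module.End K (YY N) := rhoE N (YS N) (YX N)

theorem tt_pow_prod (N : ℕ) (p : Fin N → Prop) [DecidablePred p] :
    (∏ j : Fin N, if p j then tt else 1) = tt ^ (∑ j : Fin N, if p j then 1 else 0) := by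
  rw [← Finset.prod_pow_eq_pow_sum]
  apply Finset.prod_congr rfl
  intro j _
  split_ifs <;> simp

theorem sum_lt_eq (N i : ℕ) (hi : i ≤ N) : (∑ j : Fin N, if j.1 < i then 1 else 0) = i := by
  rw [← Finset.card_filter]
  have : (Finset.univ.filter (fun j : Fin N => j.1 < i)).card = ((Finset.range N).filter (· < i)).card := by
    rw [← Finset.card_map Fin.valEmbedding]
    congr 1
    ext k
    simp only [Finset.mem_map, Finset.mem_filter, Finset.mem_univ, true_and, Finset.mem_range,
      Fin.valEmbedding_apply]
    constructor
    · rintro ⟨a, ha, rfl⟩; exact ⟨a.2, ha⟩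
    · rintro ⟨h1, h2⟩; exact ⟨⟨k, h1⟩, h2, rfl⟩
  rw [this]
  have : (Finset.range N).filter (· < i) = Finset.range i := by
    ext k; simp; omega
  rw [this]; simp

/-- base case of qKZ. -/
theorem qkz_base {N : ℕ} (l w : _) (hl : IsPartition (n := N + 1) l)
    (hw : ∀ i j, l i < l j → w (l i) < w (l j)) (v : (Fin (N + 1) → ℕ) → YY N)
    (hf : MFam N (Sn l) id (fun _ _ => 1) v) (hs : YTsupp (v l) (w ∘ l)) (i : Fin (N + 1)) :
    yrho N (v ((Fin.last N).insertNth (l i) (i.removeNth l)))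
      = (qq ^ w (l i))⁻¹ • v ((0 : Fin (N + 1)).insertNth (l i) (i.removeNth l)) := by
  have hins : (i.insertNth (l i) (i.removeNth l) : Fin (N + 1) → ℕ) = l :=
    Fin.insertNth_self_removeNth i l
  set β := i.removeNth l with hβ
  set x := l i with hx
  have hβv : ∀ j, β j = l (i.succAbove j) := fun j => rfl
  have hge : ∀ j : Fin N, j.1 < i.1 → x ≤ β j := by
    intro j hj
    rw [hβv, hx]
    apply hl
    rw [Fin.succAbove_of_castSucc_lt _ _ (by rw [Fin.lt_def]; exact hj)]
    rw [Fin.le_def]; simp; omega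
  have hle : ∀ j : Fin N, i.1 ≤ j.1 → β j ≤ x := by
    intro j hj
    rw [hβv, hx]
    apply hl
    rw [Fin.succAbove_of_le_castSucc _ _ (by rw [Fin.le_def]; exact hj)]
    rw [Fin.le_def]; simp; omega
  have hO : (i.insertNth x β : Fin (N + 1) → ℕ) ∈ Sn l := by rw [hins]; exact Sn_self l
  obtain ⟨m, hm⟩ : ∃ m, i.1 + m = N := ⟨N - i.1, by omega⟩
  have hR := (hf.moveR i.1 m (by omega) x β hO (fun j a _ => hle j a)).1
  have hD := hf.moveL i.1 i.2 x β hO (fun j a => hge j a)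
  have hM := congrArg (fun A : Module.End K (YY N) => A (v l)) ((YHecke N).M_id i.1 m hm)
  simp only [Module.End.mul_apply, LinearMap.smul_apply] at hM
  rw [YX_supp _ _ hs, map_smul] at hM
  have e1 : v ((⟨i.1, by omega⟩ : Fin (N + 1)).insertNth x β) = v l := by
    congr 1
  have e2 : v ((⟨i.1, i.2⟩ : Fin (N + 1)).insertNth x β) = v l := by
    congr 1
  have e3 : (⟨i.1 + m, by omega⟩ : Fin (N + 1)) = Fin.last N := by ext; simpa using hm
  rw [e1, e3] at hR
  rw [e2] at hD
  rw [hR, hD, map_smul, smul_smul, smul_smul] at hM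
  have c1 : ∀ y, cst (fun _ _ => (1 : K)) x y = if x = y then tt else 1 := fun y => rfl
  have c2 : ∀ y, cst (fun _ _ => (1 : K)) y x = if y = x then tt else 1 := fun y => rfl
  have p1 : (∏ j : Fin N, if i.1 ≤ j.1 ∧ j.1 < i.1 + m then cst (fun _ _ => (1 : K)) x (β j) else 1)
      = tt ^ (∑ j : Fin N, if i.1 ≤ j.1 ∧ x = β j then 1 else 0) := by
    rw [← tt_pow_prod]
    apply Finset.prod_congr rfl
    intro j _
    rw [c1]
    have := j.2
    by_cases a : i.1 ≤ j.1 <;> by_cases b : x = β j <;> simp [a, b, hm]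
  have p2 : (∏ j : Fin N, if 0 ≤ j.1 ∧ j.1 < i.1 then cst (fun _ _ => (1 : K)) (β j) x else 1)
      = tt ^ (∑ j : Fin N, if j.1 < i.1 ∧ β j = x then 1 else 0) := by
    rw [← tt_pow_prod]
    apply Finset.prod_congr rfl
    intro j _
    rw [c2]
    by_cases a : j.1 < i.1 <;> by_cases b : β j = x <;> simp [a, b]
  have p3 : kstat (w ∘ l) i = ∑ j : Fin N, if (x < β j ∨ (x = β j ∧ i.1 ≤ j.1)) then 1 else 0 := by
    rw [kstat_sum, Fin.sum_univ_succAbove _ i]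
    simp only [lt_irrefl, and_false, or_false, if_false, zero_add, Function.comp]
    apply Finset.sum_congr rfl
    intro j _
    have q1 : w (l i) < w (l (i.succAbove j)) ↔ x < β j := by
      constructor
      · intro h
        by_contra h'
        rcases lt_or_eq_of_le (not_lt.mp h') with h2 | h2
        · have := hw _ _ h2; omega
        · rw [hβv] at h2; rw [h2] at h; exact lt_irrefl _ h
      · exact hw _ _
    have q2 : w (l i) = w (l (i.succAbove j)) ↔ x = β j := by
      constructor
      · intro h
        rcases lt_trichotomy (l i) (l (i.succAbove j)) with h2 | h2 | h2
        · have := hw _ _ h2; omega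
        · exact h2
        · have := hw _ _ h2; omega
      · intro h; rw [← hx, h, hβv]
    have q3 : i < i.succAbove j ↔ i.1 ≤ j.1 := by
      rw [Fin.lt_succAbove_iff_le_castSucc, Fin.le_def]; rfl
    simp only [q1, q2, q3]
  have hcount : i.1 + (∑ j : Fin N, if i.1 ≤ j.1 ∧ x = β j then 1 else 0)
      = (∑ j : Fin N, if j.1 < i.1 ∧ β j = x then 1 else 0) + kstat (w ∘ l) i := by
    rw [p3]
    have e0 := sum_lt_eq N i.1 (by omega)
    trans (∑ j : Fin N, if j.1 < i.1 then 1 else 0)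
      + (∑ j : Fin N, if i.1 ≤ j.1 ∧ x = β j then 1 else 0)
    · rw [e0]
    rw [← Finset.sum_add_distrib, ← Finset.sum_add_distrib]
    apply Finset.sum_congr rfl
    intro j _
    have h1 := hge j
    have h2 := hle j
    split_ifs <;> omega
  rw [p1, p2] at hM
  have hev : (evalPt (w ∘ l) i)⁻¹ = (qq ^ w x)⁻¹ * tt ^ (kstat (w ∘ l) i) := by
    unfold evalPt
    rw [mul_inv, zpow_neg, inv_inv, zpow_natCast]
    rfl
  rw [hev] at hM
  have h6 : (qq ^ w x)⁻¹ * tt ^ kstat (w ∘ l) i * tt ^ (∑ j : Fin N, if j.1 < i.1 ∧ β j = x then 1 else 0)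
    = tt ^ (i.1 + (∑ j : Fin N, if i.1 ≤ j.1 ∧ x = β j then 1 else 0)) * (qq ^ w x)⁻¹ := by
    rw [hcount, pow_add]; ring
  rw [h6, mul_smul, ← pow_add] at hM
  exact (smul_right_injective _ (pow_ne_zero _ tt_ne) hM).symm

theorem sw_insertNth_zero {N : ℕ} (i : Fin N) (x : ℕ) (β : Fin (N + 1) → ℕ) :
    ((0 : Fin (N + 2)).insertNth x β : Fin (N + 2) → ℕ) ∘ sw i.succ
      = (0 : Fin (N + 2)).insertNth x (β ∘ sw i) := by
  funext k
  refine Fin.cases ?_ (fun j => ?_) k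
  · have : sw i.succ (0 : Fin (N + 2)) = 0 := sw_val_ne _ _
      (by intro h; simp [Fin.ext_iff] at h) (by intro h; simp [Fin.ext_iff] at h)
    simp [this]
  · have : sw i.succ j.succ = (sw i j).succ := by
      by_cases h1 : j = i.castSucc
      · rw [h1, sw_left, Fin.succ_castSucc, sw_left]
      by_cases h2 : j = i.succ
      · rw [h2, sw_right, sw_right, Fin.succ_castSucc]
      rw [sw_val_ne i j h1 h2, sw_val_ne]
      · rw [← Fin.succ_castSucc]; exact fun h => h1 (Fin.succ_injective _ h)
      · exact fun h => h2 (Fin.succ_injective _ h)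
    simp [this]

theorem sw_insertNth_last {N : ℕ} (i : Fin N) (x : ℕ) (β : Fin (N + 1) → ℕ) :
    ((Fin.last (N + 1)).insertNth x β : Fin (N + 2) → ℕ) ∘ sw i.castSucc
      = (Fin.last (N + 1)).insertNth x (β ∘ sw i) := by
  funext k
  refine Fin.lastCases ?_ (fun j => ?_) k
  · have : sw i.castSucc (Fin.last (N + 1)) = Fin.last (N + 1) := sw_val_ne _ _
      (by intro h; simp [Fin.ext_iff] at h; omega) (by intro h; simp [Fin.ext_iff] at h; omega)
    simp [this]
  · have : sw i.castSucc j.castSucc = (sw i j).castSucc := by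
      by_cases h1 : j = i.castSucc
      · rw [h1, sw_left, sw_left, Fin.succ_castSucc]
      by_cases h2 : j = i.succ
      · rw [h2, sw_right, ← Fin.succ_castSucc, sw_right]
      rw [sw_val_ne i j h1 h2, sw_val_ne]
      · exact fun h => h1 (Fin.castSucc_injective _ h)
      · rw [Fin.succ_castSucc]; exact fun h => h2 (Fin.castSucc_injective _ h)
    simp [this]

theorem antitone_removeNth {N : ℕ} (l : Fin (N + 1) → ℕ) (hl : IsPartition l) (i : Fin (N + 1)) :
    Antitone (i.removeNth l : Fin N → ℕ) := by
  intro a b hab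
  exact hl _ _ (Fin.strictMono_succAbove i |>.monotone hab)

/-- qKZ equations for the whole family. -/
theorem qkz {N : ℕ} (l w : _) (hl : IsPartition (n := N + 1) l)
    (hw : ∀ i j, l i < l j → w (l i) < w (l j)) (v : (Fin (N + 1) → ℕ) → YY N)
    (hf : MFam N (Sn l) id (fun _ _ => 1) v) (hs : YTsupp (v l) (w ∘ l)) (x : ℕ) (β : Fin N → ℕ)
    (hO : ((Fin.last N).insertNth x β : Fin (N + 1) → ℕ) ∈ Sn l) :
    yrho N (v ((Fin.last N).insertNth x β))
      = (qq ^ w x)⁻¹ • v ((0 : Fin (N + 1)).insertNth x β) := by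
  have hbase : ∀ β : Fin N → ℕ, Antitone β → ((Fin.last N).insertNth x β : Fin (N + 1) → ℕ) ∈ Sn l →
      yrho N (v ((Fin.last N).insertNth x β))
      = (qq ^ w x)⁻¹ • v ((0 : Fin (N + 1)).insertNth x β) := by
    intro β hA hO
    obtain ⟨i, hi⟩ := Sn_val l _ hO (Fin.last N)
    rw [ins_self] at hi
    have hβ : β = i.removeNth l := by
      refine sorted_unique id Function.injective_id _ _ ?_ hA (antitone_removeNth l hl i)
      intro a
      have h1 := (Sn_iff _ _).mp hO a
      rw [cnt_insertNth] at h1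
      have h2 : l = i.insertNth x (i.removeNth l) := by
        rw [hi]; exact (Fin.insertNth_self_removeNth i l).symm
      have h3 : cnt l a = cnt (i.insertNth x (i.removeNth l) : Fin (N + 1) → ℕ) a := by rw [← h2]
      rw [h3, cnt_insertNth] at h1
      omega
    rw [hβ, hi]
    exact qkz_base l w hl hw v hf hs i
  cases N with
  | zero => exact hbase β (fun a => a.elim0) hO
  | succ N =>
    revert hO
    refine sort_ind id (fun β => ((Fin.last (N + 1)).insertNth x β : Fin (N + 2) → ℕ) ∈ Sn l →
      yrho (N + 1) (v ((Fin.last (N + 1)).insertNth x β))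
      = (qq ^ w x)⁻¹ • v ((0 : Fin (N + 2)).insertNth x β)) hbase ?_ β
    intro κ i hi ih hO'
    have hO : ((Fin.last (N + 1)).insertNth x κ : Fin (N + 2) → ℕ) ∈ Sn l :=
      Sn_insertNth _ _ _ _ _ _ (fun a => cnt_comp κ (sw i) a) hO'
    have hO0 : ((0 : Fin (N + 2)).insertNth x κ : Fin (N + 2) → ℕ) ∈ Sn l :=
      Sn_insertNth _ _ _ _ _ _ (fun a => rfl) hO
    have h1 := hf.hstep _ hO i.castSucc (by
      have e1 : ((Fin.last (N + 1)).insertNth x κ : Fin (N + 2) → ℕ) i.castSucc.castSucc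
        = κ i.castSucc := by simp
      have e2 : ((Fin.last (N + 1)).insertNth x κ : Fin (N + 2) → ℕ) i.castSucc.succ
        = κ i.succ := by
          rw [Fin.succ_castSucc, Fin.insertNth_last']; exact Fin.snoc_castSucc (α := fun _ => ℕ) x κ i.succ
      rw [e1, e2]; exact hi)
    have h2 := hf.hstep _ hO0 i.succ (by
      have e1 : ((0 : Fin (N + 2)).insertNth x κ : Fin (N + 2) → ℕ) i.succ.castSucc
        = κ i.castSucc := by rw [← Fin.succ_castSucc]; simp
      have e2 : ((0 : Fin (N + 2)).insertNth x κ : Fin (N + 2) → ℕ) i.succ.succ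
        = κ i.succ := by simp
      rw [e1, e2]; exact hi)
    rw [sw_insertNth_last, one_smul] at h1
    rw [sw_insertNth_zero, one_smul] at h2
    rw [← h1, ← h2, ← map_smul, ← ih hO]
    have h3 := congrArg (fun A : Module.End K (YY (N + 1)) => A (v ((Fin.last (N + 1)).insertNth x κ)))
      ((YHecke (N + 1)).rho_shift i.1 (by omega))
    simp only [Module.End.mul_apply] at h3
    have t1 : YT (N + 1) i.1 = YTl i.castSucc := by
      unfold YT; rw [dif_pos (by omega : i.1 < N + 1)]; rfl
    have t2 : YT (N + 1) (i.1 + 1) = YTl i.succ := by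
      unfold YT; rw [dif_pos (by omega : i.1 + 1 < N + 1)]; rfl
    rw [t1, t2] at h3
    exact h3

/-! ### From polynomials to functions on compositions -/

def evd {N : ℕ} (d : ℕ) (f : MvPolynomial (Fin (N + 1)) K) : YY N :=
  fun ν => if csize ν ≤ d then eval (evalPt ν) f else 0

theorem sPt_one {n : ℕ} (ν : Fin n → ℕ) : sPt 1 ν = evalPt ν := by
  funext i; simp [sPt]

theorem evd_Th {N : ℕ} (d : ℕ) (i : Fin N) (f : MvPolynomial (Fin (N + 1)) K) :
    evd d (Th i f) = YTl i (evd d f) := by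
  funext ν
  change _ = (tt - rv i ν) * evd d f ν + rv i ν * evd d f (ν ∘ sw i)
  unfold evd
  rw [csize_sw]
  split_ifs
  · rw [← sPt_one, eval_Th_sPt 1 one_ne_zero, sPt_one, sPt_one]
  · simp

theorem evd_add {N : ℕ} (d : ℕ) (f g : MvPolynomial (Fin (N + 1)) K) :
    evd d (f + g) = evd d f + evd d g := by
  funext ν
  simp only [evd, Pi.add_apply, map_add]
  split_ifs <;> simp

theorem evd_C_mul {N : ℕ} (d : ℕ) (a : K) (f : MvPolynomial (Fin (N + 1)) K) :
    evd d (C a * f) = a • evd d f := by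
  funext ν
  simp only [evd, Pi.smul_apply, map_mul, eval_C, smul_eq_mul]
  split_ifs <;> simp

theorem evd_sum {N : ℕ} (d : ℕ) {ι : Type*} (s : Finset ι) (f : ι → MvPolynomial (Fin (N + 1)) K) :
    evd d (∑ a ∈ s, f a) = ∑ a ∈ s, evd d (f a) := by
  funext ν
  rw [Finset.sum_apply]
  simp only [evd, map_sum]
  split_ifs <;> simp

/-- scaling of variables -/
def scl {n : ℕ} (s : K) (f : MvPolynomial (Fin n) K) : MvPolynomial (Fin n) K :=
  aeval (fun i => C s * X i : Fin n → MvPolynomial (Fin n) K) f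

theorem eval_scl {n : ℕ} (s : K) (f : MvPolynomial (Fin n) K) (x : Fin n → K) :
    eval x (scl s f) = eval (fun i => s * x i) f := by
  rw [scl, eval_aeval]
  congr 2
  ext i
  simp

theorem scl_sum {n : ℕ} (s : K) {ι : Type*} (S : Finset ι) (f : ι → MvPolynomial (Fin n) K) :
    scl s (∑ a ∈ S, f a) = ∑ a ∈ S, scl s (f a) := by
  unfold scl; rw [map_sum]

theorem scl_C_mul {n : ℕ} (s a : K) (f : MvPolynomial (Fin n) K) :
    scl s (C a * f) = C a * scl s f := by
  unfold scl; rw [map_mul]; simp [MvPolynomial.algebraMap_eq]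

theorem totalDegree_scl {n : ℕ} (s : K) (f : MvPolynomial (Fin n) K) :
    (scl s f).totalDegree ≤ f.totalDegree := by
  apply totalDegree_aeval_le
  intro i
  refine (totalDegree_mul _ _).trans ?_
  simp

theorem scl_Th {N : ℕ} (s : K) (hs : s ≠ 0) (i : Fin N) (f : MvPolynomial (Fin (N + 1)) K) :
    scl s (Th i f) = Th i (scl s f) := by
  apply poly_ext_inj
  intro x hx
  have hx' : Function.Injective (fun i => s * x i) := fun a b h => hx (mul_left_cancel₀ hs h)
  rw [eval_scl, eval_Th _ _ _ hx', eval_Th _ _ _ hx, rr_scale _ _ _ hs, eval_scl, eval_scl]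
  rfl

/-- Polynomial version of `MFam`. -/
structure PFam (N : ℕ) (O : Set (Fin (N + 1) → ℕ)) (key : ℕ → ℕ) (c : ℕ → ℕ → K)
    (v : (Fin (N + 1) → ℕ) → MvPolynomial (Fin (N + 1)) K) : Prop where
  hO : ∀ κ ∈ O, ∀ i : Fin N, κ ∘ sw i ∈ O
  hkey : Function.Injective key
  hstep : ∀ κ ∈ O, ∀ i : Fin N, key (κ i.succ) < key (κ i.castSucc) →
    Th i (v κ) = C (c (κ i.castSucc) (κ i.succ)) * v (κ ∘ sw i)
  heq : ∀ κ ∈ O, ∀ i : Fin N, κ i.castSucc = κ i.succ → Th i (v κ) = C tt * v κ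

theorem PFam.toM {N : ℕ} {O : Set (Fin (N + 1) → ℕ)} {key : ℕ → ℕ} {c : ℕ → ℕ → K}
    {v : (Fin (N + 1) → ℕ) → MvPolynomial (Fin (N + 1)) K} (h : PFam N O key c v) (d : ℕ) :
    MFam N O key c (fun κ => evd d (v κ)) where
  hO := h.hO
  hkey := h.hkey
  hstep κ hκ i hi := by rw [← evd_Th, h.hstep κ hκ i hi, evd_C_mul]
  heq κ hκ i hi := by rw [← evd_Th, h.heq κ hκ i hi, evd_C_mul]

theorem PFam.scl {N : ℕ} {O : Set (Fin (N + 1) → ℕ)} {key : ℕ → ℕ} {c : ℕ → ℕ → K}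
    {v : (Fin (N + 1) → ℕ) → MvPolynomial (Fin (N + 1)) K} (h : PFam N O key c v) (s : K) (hs : s ≠ 0) :
    PFam N O key c (fun κ => scl s (v κ)) where
  hO := h.hO
  hkey := h.hkey
  hstep κ hκ i hi := by rw [← scl_Th s hs, h.hstep κ hκ i hi, scl_C_mul]
  heq κ hκ i hi := by rw [← scl_Th s hs, h.heq κ hκ i hi, scl_C_mul]

section
variable {N : ℕ} {O : Set (Fin (N + 1) → ℕ)} {key : ℕ → ℕ} {c : ℕ → ℕ → K}
    {v : (Fin (N + 1) → ℕ) → YY N}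

theorem prod_tpow {N : ℕ} (f : Fin N → K) (h : ∀ j, ∃ e : ℕ, f j = tt ^ e) :
    ∃ e : ℕ, ∏ j, f j = tt ^ e := by
  choose e he using h
  exact ⟨∑ j, e j, by rw [← Finset.prod_pow_eq_pow_sum]; exact Finset.prod_congr rfl fun j _ => he j⟩

theorem MFam.eigen (hf : MFam N O key c v) (hc : ∀ x y, ∃ e : ℕ, cst c x y = tt ^ e) (w : ℕ → ℕ)
    (hρ : ∀ (x : ℕ) (β : Fin N → ℕ), ((Fin.last N).insertNth x β : Fin (N + 1) → ℕ) ∈ O →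
      yrho N (v ((Fin.last N).insertNth x β)) = (qq ^ w x)⁻¹ • v ((0 : Fin (N + 1)).insertNth x β))
    (α : Fin (N + 1) → ℕ) (hα : α ∈ O) (i : Fin (N + 1))
    (h1 : ∀ j, i ≤ j → key (α j) ≤ key (α i)) (h2 : ∀ j, j ≤ i → key (α i) ≤ key (α j)) :
    ∃ e : ℤ, YX N i.1 (v α) = ((qq ^ w (α i))⁻¹ * tt ^ e) • v α := by
  have hins : (i.insertNth (α i) (i.removeNth α) : Fin (N + 1) → ℕ) = α :=
    Fin.insertNth_self_removeNth i α
  set β := i.removeNth α with hβ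
  set x := α i with hx
  have hβv : ∀ j, β j = α (i.succAbove j) := fun j => rfl
  have hge : ∀ j : Fin N, j.1 < i.1 → key x ≤ key (β j) := by
    intro j hj
    rw [hβv, hx]
    apply h2
    rw [Fin.succAbove_of_castSucc_lt _ _ (by rw [Fin.lt_def]; exact hj)]
    rw [Fin.le_def]; simp; omega
  have hle : ∀ j : Fin N, i.1 ≤ j.1 → key (β j) ≤ key x := by
    intro j hj
    rw [hβv, hx]
    apply h1
    rw [Fin.succAbove_of_le_castSucc _ _ (by rw [Fin.le_def]; exact hj)]
    rw [Fin.le_def]; simp; omega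
  have hO : (i.insertNth x β : Fin (N + 1) → ℕ) ∈ O := by rw [hins]; exact hα
  obtain ⟨m, hm⟩ : ∃ m, i.1 + m = N := ⟨N - i.1, by omega⟩
  have hR := hf.moveR i.1 m (by omega) x β hO (fun j a _ => hle j a)
  have hD := hf.moveL i.1 i.2 x β hO (fun j a => hge j a)
  have e1 : v ((⟨i.1, by omega⟩ : Fin (N + 1)).insertNth x β) = v α := by
    congr 1
  have e2 : v ((⟨i.1, i.2⟩ : Fin (N + 1)).insertNth x β) = v α := by
    congr 1
  have e3 : (⟨i.1 + m, by omega⟩ : Fin (N + 1)) = Fin.last N := by ext; simpa using hm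
  obtain ⟨hR, hR2⟩ := hR
  rw [e1, e3] at hR
  rw [e3] at hR2
  rw [e2] at hD
  obtain ⟨a, ha⟩ := prod_tpow (fun j : Fin N => if i.1 ≤ j.1 ∧ j.1 < i.1 + m then cst c x (β j) else 1)
    (fun j => by split_ifs; exacts [hc _ _, ⟨0, by simp⟩])
  obtain ⟨b, hb⟩ := prod_tpow (fun j : Fin N => if 0 ≤ j.1 ∧ j.1 < i.1 then cst c (β j) x else 1)
    (fun j => by split_ifs; exacts [hc _ _, ⟨0, by simp⟩])
  rw [ha] at hR
  rw [hb] at hD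
  have hM := congrArg (fun A : Module.End K (YY N) => A (v α)) ((YHecke N).M_id i.1 m hm)
  simp only [Module.End.mul_apply, LinearMap.smul_apply] at hM
  have hρ' : rhoE N (YS N) (YX N) (v ((Fin.last N).insertNth x β)) = (qq ^ w x)⁻¹ • v ((0 : Fin (N + 1)).insertNth x β) := hρ x β hR2
  rw [hR, map_smul, hρ'] at hM
  have hv0 : v ((0 : Fin (N + 1)).insertNth x β) = (tt ^ b)⁻¹ • DmT (YT N) i.1 (v α) := by
    rw [hD, smul_smul, inv_mul_cancel₀ (pow_ne_zero _ tt_ne), one_smul]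
  rw [hv0, ← map_smul, ← map_smul, ← map_smul, ← map_smul] at hM
  obtain ⟨D', hD'⟩ := (YHecke N).D_inv i.1
  have hM2 := congrArg D' hM
  have hid : ∀ y, D' (DmT (YT N) i.1 y) = y := fun y => by
    have := congrArg (fun A : Module.End K (YY N) => A y) hD'
    simpa using this
  rw [hid, hid] at hM2
  refine ⟨(i.1 : ℤ) + a - b, ?_⟩
  rw [hM2, smul_smul, smul_smul, smul_smul]
  congr 1
  rw [zpow_sub₀ tt_ne, zpow_add₀ tt_ne, zpow_natCast, zpow_natCast, zpow_natCast]
  field_simp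

theorem MFam.eigen_supp (hf : MFam N O key c v) (hc : ∀ x y, ∃ e : ℕ, cst c x y = tt ^ e) (w : ℕ → ℕ)
    (hρ : ∀ (x : ℕ) (β : Fin N → ℕ), ((Fin.last N).insertNth x β : Fin (N + 1) → ℕ) ∈ O →
      yrho N (v ((Fin.last N).insertNth x β)) = (qq ^ w x)⁻¹ • v ((0 : Fin (N + 1)).insertNth x β))
    (α : Fin (N + 1) → ℕ) (hα : α ∈ O) (i : Fin (N + 1))
    (h1 : ∀ j, i ≤ j → key (α j) ≤ key (α i)) (h2 : ∀ j, j ≤ i → key (α i) ≤ key (α j))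
    (ν : Fin (N + 1) → ℕ) (hν : ν i ≠ w (α i)) : v α ν = 0 := by
  obtain ⟨e, he⟩ := hf.eigen hc w hρ α hα i h1 h2
  by_contra h0
  apply hν
  have := congrFun he ν
  unfold YX at this
  rw [dif_pos i.2] at this
  change (evalPt ν i)⁻¹ * v α ν = _ * v α ν at this
  have h3 := mul_right_cancel₀ h0 this
  apply evalPt_qexp ν i _ (-e)
  rw [← inv_inv (evalPt ν i), h3, mul_inv, inv_inv, zpow_neg]

theorem MFam.low (hf : MFam N O key c v) (hc : ∀ x y, ∃ e : ℕ, cst c x y = tt ^ e) (w : ℕ → ℕ)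
    (hρ : ∀ (x : ℕ) (β : Fin N → ℕ), ((Fin.last N).insertNth x β : Fin (N + 1) → ℕ) ∈ O →
      yrho N (v ((Fin.last N).insertNth x β)) = (qq ^ w x)⁻¹ • v ((0 : Fin (N + 1)).insertNth x β))
    (d : ℕ) (hd : ∀ α ∈ O, csize (w ∘ α) = d) (ν : Fin (N + 1) → ℕ) (hν : csize ν < d)
    (α : Fin (N + 1) → ℕ) (hα : α ∈ O) : v α ν = 0 := by
  have key_fact : ∀ α : Fin (N + 1) → ℕ, α ∈ O → ∀ ν, csize ν < d → v α ν = 0 := by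
    intro α
    apply sort_ind key (fun α => α ∈ O → ∀ ν, csize ν < d → v α ν = 0)
    · intro κ hκ hκO ν hν
      have hne : ν ≠ w ∘ κ := by
        rintro rfl
        rw [hd κ hκO] at hν; omega
      obtain ⟨i, hi⟩ := Function.ne_iff.mp hne
      exact hf.eigen_supp hc w hρ κ hκO i (fun j hj => hκ hj) (fun j hj => hκ hj) ν hi
    · intro κ i hk ih hO ν hν
      have hκ : κ ∈ O := by
        have := hf.hO _ hO i
        rwa [comp_sw_sw] at this
      have h := congrFun (hf.hstep κ hκ i hk) ν
      have hl : YTl i (v κ) ν = (tt - rv i ν) * v κ ν + rv i ν * v κ (ν ∘ sw i) := rfl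
      rw [hl, ih hκ ν hν, ih hκ _ (by rw [csize_sw]; exact hν)] at h
      simp only [mul_zero, add_zero, Pi.smul_apply, smul_eq_mul] at h
      obtain ⟨e, he⟩ := hc (κ i.castSucc) (κ i.succ)
      rw [cst, if_neg (by intro hh; rw [hh] at hk; exact lt_irrefl _ hk)] at he
      rw [he] at h
      exact (mul_eq_zero.mp h.symm).resolve_left (pow_ne_zero _ tt_ne)
  exact key_fact α hα ν hν
end

/-! ### Rotations -/

def gRot {N : ℕ} {A : Type*} (g : A → A) (x : Fin (N + 1) → A) : Fin (N + 1) → A :=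
  Fin.cons (g (x (Fin.last N))) (Fin.init x)

theorem gRot_iter {N : ℕ} {A : Type*} (g : A → A) (x : Fin (N + 1) → A) (j : ℕ) (hj : j ≤ N + 1)
    (i : Fin (N + 1)) : (gRot g)^[j] x i =
      if h : i.1 < j then g (x ⟨N + 1 - j + i.1, by omega⟩) else x ⟨i.1 - j, by omega⟩ := by
  induction j generalizing i with
  | zero => simp
  | succ j ih =>
    rw [Function.iterate_succ_apply']
    unfold gRot
    refine Fin.cases ?_ (fun i => ?_) i
    · rw [Fin.cons_zero]
      change g ((gRot g)^[j] x (Fin.last N)) = _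
      rw [ih (by omega), dif_neg (by simp; omega), dif_pos (by simp)]
      congr 3
      simp
    · rw [Fin.cons_succ]
      change ((gRot g)^[j] x i.castSucc) = _
      rw [ih (by omega)]
      simp only [Fin.val_castSucc, Fin.val_succ]
      by_cases h : i.1 < j
      · rw [dif_pos h, dif_pos (by omega)]
        congr 3
        omega
      · rw [dif_neg h, dif_neg (by omega)]
        congr 2
        omega

theorem PsiP_gRot {N : ℕ} : (PsiP : (Fin (N + 1) → K) → _) = gRot (fun x => qq * x) := rfl
theorem PhiC_gRot {N : ℕ} : (PhiC : (Fin (N + 1) → ℕ) → _) = gRot (fun x => x + 1) := rfl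

theorem evalPt_PhiC_iter {N : ℕ} (ν : Fin (N + 1) → ℕ) (j : ℕ) :
    evalPt (PhiC^[j] ν) = PsiP^[j] (evalPt ν) := by
  induction j with
  | zero => rfl
  | succ j ih => rw [Function.iterate_succ_apply', Function.iterate_succ_apply', evalPt_PhiC, ih]

theorem csize_PhiC_iter {N : ℕ} (ν : Fin (N + 1) → ℕ) (j : ℕ) :
    csize (PhiC^[j] ν) = csize ν + j := by
  induction j with
  | zero => rfl
  | succ j ih => rw [Function.iterate_succ_apply', csize_PhiC, ih]; ring

section
variable {N : ℕ} {O : Set (Fin (N + 1) → ℕ)} {key : ℕ → ℕ}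
    {P : (Fin (N + 1) → ℕ) → MvPolynomial (Fin (N + 1)) K}

def czero (x _y : ℕ) : K := if x = 0 then tt else 1

theorem cst_czero (x y : ℕ) : ∃ e : ℕ, cst czero x y = tt ^ e := by
  unfold cst czero
  split_ifs
  exacts [⟨1, by simp⟩, ⟨1, by simp⟩, ⟨0, by simp⟩]

theorem PFam.TT_zero (hf : PFam N O key czero P) (hk0 : ∀ α ∈ O, ∀ i, key (α i) ≤ key 0) (β : Fin N → ℕ)
    (hO : (Fin.cons 0 β : Fin (N + 1) → ℕ) ∈ O) (m : ℕ) (hm : m < N + 1) :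
    TT m (P (Fin.cons 0 β)) = C (tt ^ m) * P ((⟨m, hm⟩ : Fin (N + 1)).insertNth 0 β) ∧
      ((⟨m, hm⟩ : Fin (N + 1)).insertNth 0 β : Fin (N + 1) → ℕ) ∈ O := by
  induction m with
  | zero =>
    have : (⟨0, hm⟩ : Fin (N + 1)) = 0 := rfl
    rw [this, Fin.insertNth_zero']
    exact ⟨by simp [TT], hO⟩
  | succ m ih =>
    obtain ⟨h1, h2⟩ := ih (by omega)
    have hmN : m < N := by omega
    have e1 : (⟨m, by omega⟩ : Fin (N + 1)) = (⟨m, hmN⟩ : Fin N).castSucc := rfl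
    have e2 : (⟨m + 1, hm⟩ : Fin (N + 1)) = (⟨m, hmN⟩ : Fin N).succ := rfl
    simp only [TT, dif_pos hmN]
    rw [h1, Th_C_mul]
    rw [e1] at h2 ⊢
    rw [e2]
    set i : Fin N := ⟨m, hmN⟩
    have hsw : (i.castSucc.insertNth 0 β : Fin (N + 1) → ℕ) ∘ sw i = i.succ.insertNth 0 β := by
      rw [← insertNth_sw, comp_sw_sw]
    refine ⟨?_, by rw [← hsw]; exact hf.hO _ h2 i⟩
    have : Th i (P (i.castSucc.insertNth 0 β)) = C tt * P (i.succ.insertNth 0 β) := by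
      by_cases hb : β i = 0
      · rw [hf.heq _ h2 i (by rw [ins_self, ins_castSucc, hb])]
        congr 2
        rw [← hsw]
        funext k
        by_cases hk : k = i.castSucc
        · rw [hk, Function.comp, sw_left, ins_self, ins_castSucc, hb]
        · by_cases hk' : k = i.succ
          · rw [hk', Function.comp, sw_right, ins_self, ins_castSucc, hb]
          · rw [Function.comp, sw_val_ne _ _ hk hk']
      · have hlt : key (β i) < key 0 := lt_of_le_of_ne
          (by have := hk0 _ h2 i.succ; rwa [ins_castSucc] at this) (fun h => hb (hf.hkey h))
        rw [hf.hstep _ h2 i (by rw [ins_self, ins_castSucc]; exact hlt), hsw, ins_self]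
        simp [czero]
    rw [this, ← mul_assoc, ← C_mul, pow_succ]

theorem PFam.rot_step (hf : PFam N O key czero P) (hk0 : ∀ α ∈ O, ∀ i, key (α i) ≤ key 0) (w : ℕ → ℕ)
    (hw0 : w 0 = 0) (d : ℕ) (hd : ∀ α ∈ O, csize (w ∘ α) = d) (hdeg : ∀ α ∈ O, (P α).totalDegree ≤ d)
    (hρ : ∀ (x : ℕ) (β : Fin N → ℕ), ((Fin.last N).insertNth x β : Fin (N + 1) → ℕ) ∈ O →
      yrho N (evd d (P ((Fin.last N).insertNth x β)))
        = (qq ^ w x)⁻¹ • evd d (P ((0 : Fin (N + 1)).insertNth x β)))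
    (hOr : ∀ α ∈ O, gRot id α ∈ O)
    (α : Fin (N + 1) → ℕ) (hα : α ∈ O) (h0 : α (Fin.last N) = 0) (x : Fin (N + 1) → K) :
    eval x (P α) = eval (PsiP x) (P (gRot id α)) := by
  have hM := hf.toM d
  have hr : gRot id α = Fin.cons 0 (Fin.init α) := by unfold gRot; rw [h0]; rfl
  have hO := hOr α hα
  have hps := PsiInv_of_support (P (gRot id α)) d (hdeg _ hO)
    (fun ν hν => by
      have := hM.low cst_czero w hρ d hd ν hν _ hO
      simpa [evd, hν.le] using this)
    (fun ν hν hν0 => by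
      have := hM.eigen_supp cst_czero w hρ _ hO 0 (fun j _ => by have := hk0 _ hO j; rw [hr, Fin.cons_zero]; rwa [hr] at this)
        (fun j hj => by rw [Fin.le_zero_iff.mp hj]) ν (by rw [hr, Fin.cons_zero, hw0]; exact hν0)
      simpa [evd, hν] using this)
  rw [hr] at hO
  have ht := (hf.TT_zero hk0 (Fin.init α) hO N (by omega)).1
  have e1 : (⟨N, by omega⟩ : Fin (N + 1)) = Fin.last N := rfl
  have e2 : ((Fin.last N).insertNth 0 (Fin.init α) : Fin (N + 1) → ℕ) = α := by
    rw [Fin.insertNth_last', ← h0, Fin.snoc_init_self]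
  rw [e1, e2, ← hr, ← hps] at ht
  have h3 : (C (tt ^ N) : MvPolynomial (Fin (N + 1)) K) ≠ 0 := by
    rw [Ne, C_eq_zero]; exact pow_ne_zero _ tt_ne
  rw [← mul_left_cancel₀ h3 ht, eval_PsiInv]

theorem PFam.vanish (hf : PFam N O key czero P) (hk0 : ∀ α ∈ O, ∀ i, key (α i) ≤ key 0) (w : ℕ → ℕ)
    (hkm : ∀ α ∈ O, ∀ i j, α i ≠ 0 → α i ≤ α j → key (α i) ≤ key (α j))
    (hw0 : w 0 = 0) (d : ℕ) (hd : ∀ α ∈ O, csize (w ∘ α) = d) (hdeg : ∀ α ∈ O, (P α).totalDegree ≤ d)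
    (hρ : ∀ (x : ℕ) (β : Fin N → ℕ), ((Fin.last N).insertNth x β : Fin (N + 1) → ℕ) ∈ O →
      yrho N (evd d (P ((Fin.last N).insertNth x β)))
        = (qq ^ w x)⁻¹ • evd d (P ((0 : Fin (N + 1)).insertNth x β)))
    (hOr : ∀ α ∈ O, gRot id α ∈ O)
    (l : Fin (N + 1) → ℕ) (hl : IsPartition l) (hlO : l ∈ O) (k : ℕ) (hkN : k ≤ N + 1)
    (hk : ∀ i, l i = 0 ↔ k ≤ i.1) (ν : Fin (N + 1) → ℕ) (hν : csize ν ≤ d + k)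
    (hν0 : ∀ i : Fin (N + 1), i.1 < k → ν i ≠ 0)
    (hne : ν ≠ fun i => w (l i) + if i.1 < k then 1 else 0) :
    eval (fun i => qq⁻¹ * evalPt ν i) (P l) = 0 := by
  have hgr : ∀ j, (gRot id)^[j] l ∈ O := by
    intro j
    induction j with
    | zero => exact hlO
    | succ j ih => rw [Function.iterate_succ_apply']; exact hOr _ ih
  have hit : ∀ (x : Fin (N + 1) → K) j, j ≤ N + 1 - k →
      eval x (P l) = eval (PsiP^[j] x) (P ((gRot id)^[j] l)) := by
    intro x j
    induction j with
    | zero => intro _; rfl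
    | succ j ih =>
      intro hj
      rw [ih (by omega), hf.rot_step hk0 w hw0 d hd hdeg hρ hOr _ (hgr j), Function.iterate_succ_apply',
        Function.iterate_succ_apply']
      rw [gRot_iter _ _ _ (by omega), dif_neg (by simp; omega), hk]
      simp; omega
  rw [hit _ (N + 1 - k) le_rfl]
  set η : Fin (N + 1) → ℕ := fun i => if h : i.1 < N + 1 - k then ν ⟨i.1 + k, by omega⟩
    else ν ⟨i.1 - (N + 1 - k), by omega⟩ - 1 with hη
  have hφ : PhiC^[k] η = ν := by
    funext i
    rw [PhiC_gRot, gRot_iter _ _ _ hkN]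
    split_ifs with h
    · simp only [hη]
      rw [dif_neg (by omega)]
      have : (⟨N + 1 - k + i.1 - (N + 1 - k), by omega⟩ : Fin (N + 1)) = i := by ext; simp
      rw [this]
      have := hν0 i h
      omega
    · simp only [hη]
      rw [dif_pos (by omega)]
      congr 1
      ext; simp; omega
  have hpt : PsiP^[N + 1 - k] (fun i => qq⁻¹ * evalPt ν i) = evalPt η := by
    have h1 : evalPt ν = PsiP^[k] (evalPt η) := by rw [← hφ, evalPt_PhiC_iter]
    have hφ' := hφ
    funext i
    rw [PsiP_gRot, gRot_iter _ _ _ (by omega), h1, PsiP_gRot]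
    split_ifs with h
    · rw [gRot_iter _ _ _ (by omega), dif_neg (by simp; omega), ← mul_assoc, mul_inv_cancel₀ qq_ne, one_mul]
      congr 1
      ext; simp; omega
    · rw [gRot_iter _ _ _ (by omega), dif_pos (by simp; omega), ← mul_assoc, inv_mul_cancel₀ qq_ne, one_mul]
      congr 1
      ext; simp; omega
  rw [hpt]
  set α := (gRot id)^[N + 1 - k] l with hα
  have hαv : ∀ i : Fin (N + 1), α i = if h : i.1 < N + 1 - k then 0 else l ⟨i.1 - (N + 1 - k), by omega⟩ := by
    intro i
    rw [hα, gRot_iter _ _ _ (by omega)]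
    split_ifs with h
    · simp only [id]; rw [hk]; simp; omega
    · rfl
  have hcs : csize η ≤ d := by
    have := csize_PhiC_iter η k
    rw [hφ] at this; omega
  have hneη : η ≠ w ∘ α := by
    intro h
    apply hne
    rw [← hφ, h]
    funext i
    rw [PhiC_gRot, gRot_iter _ _ _ hkN]
    split_ifs with h
    · simp only [Function.comp]
      rw [hαv, dif_neg (by simp)]
      congr 3
      ext; simp
    · simp only [Function.comp]
      rw [hαv, dif_pos (by simp; omega), (hk i).mpr (by omega)]
      rfl
  have hanti : Antitone (key ∘ α) := by
    intro i j hij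
    rw [Fin.le_def] at hij
    simp only [Function.comp]
    rw [hαv i, hαv j]
    by_cases hi : i.1 < N + 1 - k
    · rw [dif_pos hi, ← hαv j]; exact hk0 _ (hgr _) _
    · rw [dif_neg hi, dif_neg (by omega)]
      apply hkm _ hlO
      · rw [Ne, hk]; simp; omega
      · apply hl; rw [Fin.le_def]; simp; omega
  obtain ⟨i, hi⟩ := Function.ne_iff.mp hneη
  have := (hf.toM d).eigen_supp cst_czero w hρ α (hgr _) i (fun j hj => hanti hj) (fun j hj => hanti hj) η hi
  simpa [evd, hcs] using this
end

/-! ### Loop polynomials -/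

/-- local factor -/
def loc {n : ℕ} {R : Type*} [CommRing R] (F A : Finset (Fin n)) (i : Fin n) (z : R) : R :=
  if i ∈ A then 1 - z else if i ∈ F then z else 1

theorem loop_lemma {n : ℕ} {R : Type*} [CommRing R] (t : R) (F A : Finset (Fin n)) (Z : Fin n → R)
    (s : Finset (Fin n)) :
    ∏ i ∈ s, loc F A i (t * Z i) = t ^ (s.filter (fun i => i ∈ F ∪ A)).card * ∏ i ∈ s, loc F A i (Z i)
      + (1 - t) * ∑ d ∈ s.filter (fun i => i ∈ A), t ^ (s.filter (fun i => i < d ∧ i ∈ F ∪ A)).card *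
        ∏ i ∈ s, (if i < d then loc F A i (Z i) else if i = d then 1 else loc F A i (t * Z i)) := by
  induction s using Finset.induction_on_max with
  | empty => simp
  | insert m s hm ih =>
    have hms : m ∉ s := fun h => lt_irrefl _ (hm m h)
    have hold : ∀ d ∈ s.filter (fun i => i ∈ A),
        t ^ ((insert m s).filter (fun i => i < d ∧ i ∈ F ∪ A)).card *
        ∏ i ∈ insert m s, (if i < d then loc F A i (Z i) else if i = d then 1 else loc F A i (t * Z i))
        = loc F A m (t * Z m) * (t ^ (s.filter (fun i => i < d ∧ i ∈ F ∪ A)).card *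
        ∏ i ∈ s, (if i < d then loc F A i (Z i) else if i = d then 1 else loc F A i (t * Z i))) := by
      intro d hd
      have hdm := hm d (Finset.mem_filter.mp hd).1
      rw [Finset.prod_insert hms, if_neg (not_lt.mpr hdm.le), if_neg hdm.ne', Finset.filter_insert,
        if_neg (by intro h; exact absurd h.1 (not_lt.mpr hdm.le))]
      ring
    rw [Finset.prod_insert hms, ih, Finset.prod_insert hms, Finset.filter_insert, Finset.filter_insert]
    have hmf : ∀ (p : Fin n → Prop) [DecidablePred p], m ∉ s.filter p := fun p _ h => hms (Finset.mem_filter.mp h).1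
    by_cases hA : m ∈ A
    · rw [if_pos (Finset.mem_union_right _ hA), if_pos hA, Finset.sum_insert (hmf _),
        Finset.sum_congr rfl hold, ← Finset.mul_sum, Finset.card_insert_of_notMem (hmf _)]
      rw [Finset.prod_insert hms, if_neg (lt_irrefl _), if_pos rfl, Finset.filter_insert,
        if_neg (by intro h; exact lt_irrefl _ h.1)]
      have e1 : s.filter (fun i => i < m ∧ i ∈ F ∪ A) = s.filter (fun i => i ∈ F ∪ A) := by
        apply Finset.filter_congr
        intro i hi
        exact and_iff_right (hm i hi)
      have e2 : ∏ i ∈ s, (if i < m then loc F A i (Z i) else if i = m then 1 else loc F A i (t * Z i))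
          = ∏ i ∈ s, loc F A i (Z i) := by
        apply Finset.prod_congr rfl
        intro i hi
        rw [if_pos (hm i hi)]
      rw [e1, e2]
      have l1 : loc F A m (t * Z m) = 1 - t * Z m := if_pos hA
      have l2 : loc F A m (Z m) = 1 - Z m := if_pos hA
      rw [l1, l2]
      ring
    · rw [if_neg hA, Finset.sum_congr rfl hold, ← Finset.mul_sum]
      by_cases hF : m ∈ F
      · rw [if_pos (Finset.mem_union_left _ hF), Finset.card_insert_of_notMem (hmf _)]
        have l1 : loc F A m (t * Z m) = t * Z m := by unfold loc; rw [if_neg hA, if_pos hF]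
        have l2 : loc F A m (Z m) = Z m := by unfold loc; rw [if_neg hA, if_pos hF]
        rw [l1, l2]
        ring
      · rw [if_neg (by simp [hA, hF])]
        have l1 : loc F A m (t * Z m) = 1 := by unfold loc; rw [if_neg hA, if_neg hF]
        have l2 : loc F A m (Z m) = 1 := by unfold loc; rw [if_neg hA, if_neg hF]
        rw [l1, l2]
        ring

/-- height -/
def mm {n : ℕ} (S A : Finset (Fin n)) (i : Fin n) : ℤ :=
  ((S.filter (· < i)).card : ℤ) - (A.filter (· < i)).card

/-- loop polynomial -/
def PP {n : ℕ} (S F A : Finset (Fin n)) : Polynomial K :=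
  ∏ i, loc F A i (Polynomial.C (tt ^ mm S A i) * Polynomial.X)

theorem mm_insert_S {n : ℕ} (S A : Finset (Fin n)) (x i : Fin n) (hx : x ∉ S) :
    mm (insert x S) A i = mm S A i + if x < i then 1 else 0 := by
  unfold mm
  rw [Finset.filter_insert]
  split_ifs
  · rw [Finset.card_insert_of_notMem (by simp [hx])]; push_cast; ring
  · ring

theorem mm_erase_A {n : ℕ} (S A : Finset (Fin n)) (x i : Fin n) (hx : x ∈ A) :
    mm S (A.erase x) i = mm S A i + if x < i then 1 else 0 := by
  have : A = insert x (A.erase x) := (Finset.insert_erase hx).symm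
  unfold mm
  conv_rhs => rw [this]
  rw [Finset.filter_insert]
  split_ifs
  · rw [Finset.card_insert_of_notMem (by simp)]; push_cast; ring
  · ring

theorem C_tt_succ (m : ℤ) : Polynomial.C (tt ^ (m + 1)) * (Polynomial.X : Polynomial K)
    = Polynomial.C tt * (Polynomial.C (tt ^ m) * Polynomial.X) := by
  rw [zpow_add₀ tt_ne, zpow_one, Polynomial.C_mul]; ring

theorem loc_erase {n : ℕ} {R : Type*} [CommRing R] (F A : Finset (Fin n)) (i d : Fin n) (h : i ≠ d) (z : R) :
    loc F (A.erase d) i z = loc F A i z := by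
  unfold loc
  simp [h]

theorem loc_none {n : ℕ} {R : Type*} [CommRing R] (F A : Finset (Fin n)) (i : Fin n) (hF : i ∉ F) (hA : i ∉ A)
    (z : R) : loc F A i z = 1 := by
  unfold loc; rw [if_neg hA, if_neg hF]

theorem loc_erase_self {n : ℕ} {R : Type*} [CommRing R] (F A : Finset (Fin n)) (d : Fin n) (hF : d ∉ F) (z : R) :
    loc F (A.erase d) d z = 1 := loc_none _ _ _ hF (by simp) z

theorem prod_split_Ioi {n : ℕ} {R : Type*} [CommRing R] (f : Fin n → R) (x : Fin n) :
    ∏ i, f i = (∏ i ∈ Finset.Iic x, f i) * ∏ i ∈ Finset.Ioi x, f i := by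
  have : Finset.Ioi x = (Finset.Iic x)ᶜ := by ext i; simp
  rw [this, Finset.prod_mul_prod_compl]

theorem prod_split_Iio {n : ℕ} {R : Type*} [CommRing R] (f : Fin n → R) (x : Fin n) :
    ∏ i, f i = (∏ i ∈ Finset.Iio x, f i) * (f x * ∏ i ∈ Finset.Ioi x, f i) := by
  rw [prod_split_Ioi f x, ← Finset.Iio_insert, Finset.prod_insert (by simp)]
  ring

/-- opening the start at `x`, moving right -/
theorem PP_right {n : ℕ} (S F A : Finset (Fin n)) (hFA : Disjoint F A) (x : Fin n) (hS : x ∉ S) :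
    PP (insert x S) F A =
      Polynomial.C tt ^ ((Finset.Ioi x).filter (fun i => i ∈ F ∪ A)).card * PP S F A
      + (1 - Polynomial.C tt) * ∑ d ∈ (Finset.Ioi x).filter (fun i => i ∈ A),
        Polynomial.C tt ^ ((Finset.Ioi x).filter (fun i => i < d ∧ i ∈ F ∪ A)).card * PP S F (A.erase d) := by
  have h1 : PP (insert x S) F A = (∏ i ∈ Finset.Iic x, loc F A i (Polynomial.C (tt ^ mm S A i) * Polynomial.X))
      * ∏ i ∈ Finset.Ioi x, loc F A i (Polynomial.C tt * (Polynomial.C (tt ^ mm S A i) * Polynomial.X)) := by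
    unfold PP
    rw [prod_split_Ioi _ x]
    congr 1
    · apply Finset.prod_congr rfl
      intro i hi
      rw [mm_insert_S _ _ _ _ hS, if_neg (by simpa using hi), add_zero]
    · apply Finset.prod_congr rfl
      intro i hi
      rw [mm_insert_S _ _ _ _ hS, if_pos (by simpa using hi), C_tt_succ]
  rw [h1, loop_lemma, mul_add]
  congr 1
  · unfold PP
    rw [prod_split_Ioi _ x]
    rw [mul_left_comm]
  · rw [mul_left_comm, Finset.mul_sum]
    refine congrArg (fun y => (1 - Polynomial.C tt) * y) ?_
    apply Finset.sum_congr rfl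
    intro d hd
    rw [mul_left_comm]
    congr 1
    unfold PP
    rw [prod_split_Ioi _ x]
    obtain ⟨hd1, hd2⟩ := Finset.mem_filter.mp hd
    have hxd : x < d := by simpa using hd1
    congr 1
    · apply Finset.prod_congr rfl
      intro i hi
      have hix : i ≤ x := by simpa using hi
      rw [loc_erase _ _ _ _ (hix.trans_lt hxd).ne, mm_erase_A _ _ _ _ hd2,
        if_neg (not_lt.mpr (hix.trans hxd.le)), add_zero]
    · apply Finset.prod_congr rfl
      intro i hi
      rw [mm_erase_A _ _ _ _ hd2]
      by_cases hid : i < d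
      · rw [if_pos hid, if_neg (not_lt.mpr hid.le), add_zero, loc_erase _ _ _ _ hid.ne]
      · rw [if_neg hid]
        by_cases hid2 : i = d
        · rw [if_pos hid2, hid2, loc_erase_self _ _ _ (Finset.disjoint_right.mp hFA hd2)]
        · rw [if_neg hid2, loc_erase _ _ _ _ hid2,
            if_pos (lt_of_le_of_ne (not_lt.mp hid) (Ne.symm hid2)), C_tt_succ]

/-- shift of the variable by `t^e` -/
def shp (e : ℤ) (p : Polynomial K) : Polynomial K := p.comp (Polynomial.C (tt ^ e) * Polynomial.X)

theorem loc_comp {n : ℕ} (F A : Finset (Fin n)) (i : Fin n) (z w : Polynomial K) :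
    (loc F A i z).comp w = loc F A i (z.comp w) := by
  unfold loc
  split_ifs <;> simp

theorem shp_PP {n : ℕ} (e : ℤ) (S F A : Finset (Fin n)) :
    shp e (PP S F A) = ∏ i, loc F A i (Polynomial.C (tt ^ (mm S A i + e)) * Polynomial.X) := by
  unfold shp PP
  rw [Polynomial.prod_comp]
  apply Finset.prod_congr rfl
  intro i _
  rw [loc_comp]
  congr 1
  rw [zpow_add₀ tt_ne, Polynomial.C_mul]
  simp; ring

/-- wrapping around -/
theorem PP_wrap {n : ℕ} (S F A : Finset (Fin n)) (hFA : Disjoint F A) (x : Fin n) (hS : x ∉ S)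
    (hxF : x ∉ F) (hxA : x ∉ A) :
    shp 1 (PP S F A) =
      Polynomial.C tt ^ ((Finset.Iio x).filter (fun i => i ∈ F ∪ A)).card * PP (insert x S) F A
      + (1 - Polynomial.C tt) * ∑ d ∈ (Finset.Iio x).filter (fun i => i ∈ A),
        Polynomial.C tt ^ ((Finset.Iio x).filter (fun i => i < d ∧ i ∈ F ∪ A)).card * PP S F (A.erase d) := by
  have hx1 : ∀ z : Polynomial K, loc F A x z = 1 := loc_none _ _ _ hxF hxA
  have h1 : shp 1 (PP S F A) = (∏ i ∈ Finset.Iio x, loc F A i (Polynomial.C tt * (Polynomial.C (tt ^ mm S A i) * Polynomial.X)))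
      * ∏ i ∈ Finset.Ioi x, loc F A i (Polynomial.C tt * (Polynomial.C (tt ^ mm S A i) * Polynomial.X)) := by
    rw [shp_PP, prod_split_Iio _ x, hx1, one_mul]
    simp only [C_tt_succ]
  rw [h1, loop_lemma, add_mul]
  congr 1
  · unfold PP
    rw [prod_split_Iio _ x, hx1, one_mul, mul_assoc]
    congr 2
    · apply Finset.prod_congr rfl
      intro i hi
      rw [mm_insert_S _ _ _ _ hS, if_neg (not_lt.mpr (le_of_lt (by simpa using hi))), add_zero]
    · apply Finset.prod_congr rfl
      intro i hi
      rw [mm_insert_S _ _ _ _ hS, if_pos (by simpa using hi), C_tt_succ]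
  · rw [mul_assoc, Finset.sum_mul]
    refine congrArg (fun y => (1 - Polynomial.C tt) * y) ?_
    apply Finset.sum_congr rfl
    intro d hd
    rw [mul_assoc]
    congr 1
    unfold PP
    rw [prod_split_Iio _ x]
    obtain ⟨hd1, hd2⟩ := Finset.mem_filter.mp hd
    have hxd : d < x := by simpa using hd1
    rw [loc_none F (A.erase d) x hxF (fun h => hxA (Finset.mem_of_mem_erase h)), one_mul]
    congr 1
    · apply Finset.prod_congr rfl
      intro i hi
      rw [mm_erase_A _ _ _ _ hd2]
      by_cases hid : i < d
      · rw [if_pos hid, if_neg (not_lt.mpr hid.le), add_zero, loc_erase _ _ _ _ hid.ne]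
      · rw [if_neg hid]
        by_cases hid2 : i = d
        · rw [if_pos hid2, hid2, loc_erase_self _ _ _ (Finset.disjoint_right.mp hFA hd2)]
        · rw [if_neg hid2, loc_erase _ _ _ _ hid2,
            if_pos (lt_of_le_of_ne (not_lt.mp hid) (Ne.symm hid2)), C_tt_succ]
    · apply Finset.prod_congr rfl
      intro i hi
      have hix : x < i := by simpa using hi
      rw [loc_erase _ _ _ _ (hxd.trans hix).ne', mm_erase_A _ _ _ _ hd2,
        if_pos (hxd.trans hix), C_tt_succ]

theorem card_filter_lt_succ {n : ℕ} (S : Finset (Fin (n + 1))) (i : Fin n) :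
    (S.filter (· < i.succ)).card = (S.filter (· < i.castSucc)).card + if i.castSucc ∈ S then 1 else 0 := by
  have : S.filter (· < i.succ) = S.filter (· < i.castSucc) ∪ S.filter (· = i.castSucc) := by
    rw [← Finset.filter_or]
    apply Finset.filter_congr
    intro k _
    rw [Fin.lt_def, Fin.lt_def, Fin.ext_iff]; simp; omega
  rw [this, Finset.card_union_of_disjoint]
  · congr 1
    rw [Finset.filter_eq']
    split_ifs <;> simp
  · rw [Finset.disjoint_filter]
    intro k _ h h2
    exact h.ne h2

/-- crossing lemma -/
theorem PP_cross {n : ℕ} (S F A : Finset (Fin n)) (hc : S.card < A.card) :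
    (PP S F A).eval 1 = 0 := by
  obtain ⟨i, hiA, hi0⟩ : ∃ i ∈ A, mm S A i = 0 := by
    by_contra hcon
    push Not at hcon
    -- counts with threshold k
    have hk : ∀ k : ℕ, (A.filter (fun i => i.1 < k)).card ≤ (S.filter (fun i => i.1 < k)).card := by
      intro k
      induction k with
      | zero => simp
      | succ k ih =>
        by_cases hkn : k < n
        · have e : ∀ T : Finset (Fin n), (T.filter (fun i => i.1 < k + 1)).card
              = (T.filter (fun i => i.1 < k)).card + if (⟨k, hkn⟩ : Fin n) ∈ T then 1 else 0 := by
            intro T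
            have : T.filter (fun i => i.1 < k + 1) = T.filter (fun i => i.1 < k) ∪ T.filter (· = ⟨k, hkn⟩) := by
              rw [← Finset.filter_or]
              apply Finset.filter_congr
              intro j _
              rw [Fin.ext_iff]; simp; omega
            rw [this, Finset.card_union_of_disjoint]
            · congr 1
              rw [Finset.filter_eq']
              split_ifs <;> simp
            · rw [Finset.disjoint_filter]
              intro j _ h h2
              rw [h2] at h
              simp at h
          rw [e, e]
          by_cases hA : (⟨k, hkn⟩ : Fin n) ∈ A
          · have := hcon _ hA
            have e2 : ∀ T : Finset (Fin n), T.filter (fun i => i.1 < k) = T.filter (· < (⟨k, hkn⟩ : Fin n)) := by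
              intro T; apply Finset.filter_congr; intro j _; rfl
            rw [mm, ← e2, ← e2] at this
            rw [if_pos hA]
            omega
          · rw [if_neg hA]; omega
        · have e : ∀ T : Finset (Fin n), T.filter (fun i => i.1 < k + 1) = T.filter (fun i => i.1 < k) := by
            intro T
            apply Finset.filter_congr
            intro j _
            have := j.2
            omega
          rw [e, e]; exact ih
    have := hk n
    rw [Finset.filter_true_of_mem (fun i _ => i.2), Finset.filter_true_of_mem (fun i _ => i.2)] at this
    omega
  unfold PP
  rw [Polynomial.eval_prod]
  apply Finset.prod_eq_zero (Finset.mem_univ i)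
  unfold loc
  rw [if_pos hiA, hi0]
  simp

theorem PP_noSA {n : ℕ} (F : Finset (Fin n)) : PP ∅ F ∅ = Polynomial.X ^ F.card := by
  unfold PP mm loc
  simp

/-! ### The functional tau -/

def tau (q : K) : Polynomial K →ₗ[K] K :=
  Polynomial.lsum (fun j => LinearMap.mulRight K ((1 - q * tt ^ j)⁻¹))

theorem tau_monomial (q : K) (j : ℕ) (a : K) :
    tau q (Polynomial.monomial j a) = a * (1 - q * tt ^ j)⁻¹ := by
  unfold tau
  rw [Polynomial.lsum_apply, Polynomial.sum_monomial_index] <;> simp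

theorem tau_C_mul (q a : K) (p : Polynomial K) : tau q (Polynomial.C a * p) = a * tau q p := by
  rw [← Polynomial.smul_eq_C_mul, map_smul, smul_eq_mul]

theorem tau_X_pow (q : K) (j : ℕ) : tau q (Polynomial.X ^ j) = (1 - q * tt ^ j)⁻¹ := by
  rw [← Polynomial.monomial_one_right_eq_X_pow, tau_monomial, one_mul]

theorem tau_shift (q : K) (hq : ∀ j : ℕ, 1 - q * tt ^ j ≠ 0) (p : Polynomial K) :
    q * tau q (shp 1 p) = tau q p - p.eval 1 := by
  induction p using Polynomial.induction_on' with
  | add p r hp hr =>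
    have : shp 1 (p + r) = shp 1 p + shp 1 r := by unfold shp; rw [Polynomial.add_comp]
    rw [this, map_add, mul_add, hp, hr, map_add, Polynomial.eval_add]
    ring
  | monomial j a =>
    have : shp 1 (Polynomial.monomial j a) = Polynomial.monomial j (a * tt ^ j) := by
      unfold shp
      rw [Polynomial.monomial_comp, mul_pow, ← Polynomial.C_pow, zpow_one, ← mul_assoc, ← Polynomial.C_mul,
        Polynomial.C_mul_X_pow_eq_monomial]
    rw [this, tau_monomial, tau_monomial, Polynomial.eval_monomial, one_pow, mul_one]
    field_simp [hq j]
    ring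

theorem filter_card_sub {n : ℕ} (T : Finset (Fin n)) (x : Fin n) (hx : x ∉ T) :
    ((Finset.Ioi x).filter (fun i => i ∈ T)).card + ((Finset.Iio x).filter (fun i => i ∈ T)).card = T.card := by
  rw [← Finset.card_union_of_disjoint]
  · congr 1
    ext i
    simp only [Finset.mem_union, Finset.mem_filter, Finset.mem_Ioi, Finset.mem_Iio]
    constructor
    · rintro (h | h) <;> exact h.2
    · intro h
      have : x ≠ i := fun hh => hx (hh ▸ h)
      rcases lt_or_gt_of_ne this with h1 | h1
      · exact Or.inl ⟨h1, h⟩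
      · exact Or.inr ⟨h1, h⟩
  · rw [Finset.disjoint_left]
    intro i h1 h2
    simp only [Finset.mem_filter, Finset.mem_Ioi, Finset.mem_Iio] at h1 h2
    exact lt_asymm h1.1 h2.1

theorem tau_step {n : ℕ} (q : K) (hq : ∀ j : ℕ, 1 - q * tt ^ j ≠ 0) (S F A : Finset (Fin n))
    (hFA : Disjoint F A) (x : Fin n) (hS : x ∉ S) (hxF : x ∉ F) (hxA : x ∉ A) (hc : S.card < A.card) :
    (1 - q * tt ^ (F ∪ A).card) * tau q (PP (insert x S) F A) =
      (1 - tt) * ∑ d ∈ A, (tt ^ ((F ∪ A).filter (fun k => strictlyBetweenCyc x d k)).card *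
        (if d < x then q else 1)) * tau q (PP S F (A.erase d)) := by
  have h1 := congrArg (tau q) (PP_right S F A hFA x hS)
  have h2 := congrArg (tau q) (PP_wrap S F A hFA x hS hxF hxA)
  have h3 := tau_shift q hq (PP S F A)
  rw [PP_cross S F A hc, sub_zero] at h3
  have e1 : (1 - Polynomial.C tt : Polynomial K) = Polynomial.C (1 - tt) := by simp
  simp only [map_add, ← Polynomial.C_pow, tau_C_mul, e1, map_sum] at h1 h2
  have hxT : x ∉ F ∪ A := by simp [hxF, hxA]
  have hcard := filter_card_sub (F ∪ A) x hxT
  set f1 := ((Finset.Ioi x).filter (fun i => i ∈ F ∪ A)).card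
  set f2 := ((Finset.Iio x).filter (fun i => i ∈ F ∪ A)).card
  have hsplit : ∑ d ∈ A, (tt ^ ((F ∪ A).filter (fun k => strictlyBetweenCyc x d k)).card *
        (if d < x then q else 1)) * tau q (PP S F (A.erase d))
      = (∑ d ∈ (Finset.Ioi x).filter (fun i => i ∈ A),
          tt ^ ((Finset.Ioi x).filter (fun i => i < d ∧ i ∈ F ∪ A)).card * tau q (PP S F (A.erase d)))
        + ∑ d ∈ (Finset.Iio x).filter (fun i => i ∈ A), q * tt ^ f1 *
          (tt ^ ((Finset.Iio x).filter (fun i => i < d ∧ i ∈ F ∪ A)).card * tau q (PP S F (A.erase d))) := by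
    have hA : A = (Finset.Ioi x).filter (fun i => i ∈ A) ∪ (Finset.Iio x).filter (fun i => i ∈ A) := by
      ext i
      simp only [Finset.mem_union, Finset.mem_filter, Finset.mem_Ioi, Finset.mem_Iio]
      constructor
      · intro h
        have : x ≠ i := fun hh => hxA (hh ▸ h)
        rcases lt_or_gt_of_ne this with h1 | h1
        · exact Or.inl ⟨h1, h⟩
        · exact Or.inr ⟨h1, h⟩
      · rintro (h | h) <;> exact h.2
    have hdis : Disjoint ((Finset.Ioi x).filter (fun i => i ∈ A)) ((Finset.Iio x).filter (fun i => i ∈ A)) := by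
      rw [Finset.disjoint_left]
      intro i h1 h2
      simp only [Finset.mem_filter, Finset.mem_Ioi, Finset.mem_Iio] at h1 h2
      exact lt_asymm h1.1 h2.1
    have hsum : ∀ f : Fin n → K, ∑ d ∈ A, f d = ∑ d ∈ (Finset.Ioi x).filter (fun i => i ∈ A), f d
        + ∑ d ∈ (Finset.Iio x).filter (fun i => i ∈ A), f d := by
      intro f
      rw [← Finset.sum_union hdis]
      exact congrArg (fun T => ∑ d ∈ T, f d) hA
    rw [hsum]
    congr 1
    · apply Finset.sum_congr rfl
      intro d hd
      simp only [Finset.mem_filter, Finset.mem_Ioi] at hd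
      rw [if_neg (not_lt.mpr hd.1.le), mul_one]
      congr 3
      ext k
      simp only [Finset.mem_filter, Finset.mem_Ioi]
      unfold strictlyBetweenCyc
      constructor
      · rintro ⟨h, h1 | h1⟩
        · exact ⟨h1.2.1, h1.2.2, h⟩
        · exact absurd h1.1 (lt_asymm hd.1)
      · rintro ⟨h1, h2, h3⟩
        exact ⟨h3, Or.inl ⟨hd.1, h1, h2⟩⟩
    · apply Finset.sum_congr rfl
      intro d hd
      simp only [Finset.mem_filter, Finset.mem_Iio] at hd
      rw [if_pos hd.1]
      have : ((F ∪ A).filter (fun k => strictlyBetweenCyc x d k)).card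
          = f1 + ((Finset.Iio x).filter (fun i => i < d ∧ i ∈ F ∪ A)).card := by
        rw [← Finset.card_union_of_disjoint]
        · congr 1
          ext k
          rw [Finset.mem_union, Finset.mem_filter, Finset.mem_filter, Finset.mem_filter, Finset.mem_Ioi,
            Finset.mem_Iio]
          unfold strictlyBetweenCyc
          constructor
          · rintro ⟨h, h1 | h1⟩
            · exact absurd h1.1 (lt_asymm hd.1)
            · rcases h1.2 with h2 | h2
              · exact Or.inl ⟨h2, h⟩
              · exact Or.inr ⟨h2.trans hd.1, h2, h⟩
          · rintro (⟨h1, h2⟩ | ⟨h1, h2, h3⟩)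
            · exact ⟨h2, Or.inr ⟨hd.1, Or.inl h1⟩⟩
            · exact ⟨h3, Or.inr ⟨hd.1, Or.inr h2⟩⟩
        · rw [Finset.disjoint_left]
          intro i h1 h2
          simp only [Finset.mem_filter, Finset.mem_Ioi, Finset.mem_Iio] at h1 h2
          exact lt_asymm h1.1 h2.1
      rw [this, pow_add]
      ring
  rw [hsplit, ← Finset.mul_sum]
  rw [← hcard, pow_add]
  rw [h2] at h3
  generalize (∑ d ∈ (Finset.Ioi x).filter (fun i => i ∈ A),
          tt ^ ((Finset.Ioi x).filter (fun i => i < d ∧ i ∈ F ∪ A)).card * tau q (PP S F (A.erase d))) = s1 at *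
  generalize (∑ d ∈ (Finset.Iio x).filter (fun i => i ∈ A),
          tt ^ ((Finset.Iio x).filter (fun i => i < d ∧ i ∈ F ∪ A)).card * tau q (PP S F (A.erase d))) = s2 at *
  generalize tau q (PP (insert x S) F A) = P at *
  generalize tau q (PP S F A) = P' at *
  linear_combination h1 - tt ^ f1 * h3

/-! ### Sequential summation -/

theorem update_sum {n : ℕ} {R : Type*} [CommRing R] (x : Fin n) (U : Finset (Fin n)) (hx : x ∉ U)
    (f : (Fin n → Fin n) → R) :
    ∑ p ∈ Finset.univ.filter (fun p : Fin n → Fin n => ∀ j, j ∉ insert x U → p j = j), f p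
      = ∑ d, ∑ p ∈ Finset.univ.filter (fun p : Fin n → Fin n => ∀ j, j ∉ U → p j = j),
          f (Function.update p x d) := by
  rw [← Finset.sum_product']
  symm
  apply Finset.sum_bij' (fun (a : Fin n × (Fin n → Fin n)) _ => Function.update a.2 x a.1)
    (fun p _ => (p x, Function.update p x x))
  · intro a ha
    simp only [Finset.mem_product, Finset.mem_univ, true_and, Finset.mem_filter] at ha ⊢
    intro j hj
    have hjx : j ≠ x := fun h => hj (by simp [h])
    rw [Function.update_of_ne hjx]
    exact ha j (fun h => hj (by simp [h]))
  · intro p hp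
    simp only [Finset.mem_product, Finset.mem_univ, true_and, Finset.mem_filter] at hp ⊢
    intro j hj
    by_cases hjx : j = x
    · rw [hjx, Function.update_self]
    · rw [Function.update_of_ne hjx]
      exact hp j (by simp [hj, hjx])
  · intro a ha
    simp only [Finset.mem_product, Finset.mem_univ, true_and, Finset.mem_filter] at ha
    ext1
    · simp
    · simp only [Function.update_idem]
      rw [Function.update_eq_self_iff]
      exact (ha x hx).symm
  · intro p hp
    simp
  · intro a ha
    rfl

theorem seq_lemma {n : ℕ} {R κ : Type*} [CommRing R] [LinearOrder κ] (kf : Fin n → κ)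
    (w : Fin n → Fin n → Finset (Fin n) → R)
    (Z : Finset (Fin n) → Finset (Fin n) → R) (Inv : Finset (Fin n) → Finset (Fin n) → Prop)
    (hbase : ∀ M, Inv ∅ M → Z ∅ M = 1)
    (hkf : Function.Injective kf)
    (hstep : ∀ x U M, x ∉ U → (∀ y ∈ U, kf y < kf x) → Inv (insert x U) M →
      Z (insert x U) M = ∑ d, w x d M * Z U (insert d M))
    (hinv : ∀ x U M d, x ∉ U → (∀ y ∈ U, kf y < kf x) → Inv (insert x U) M → w x d M ≠ 0 →
      Inv U (insert d M))
    (U : Finset (Fin n)) : ∀ M, Inv U M →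
    ∑ p ∈ Finset.univ.filter (fun p : Fin n → Fin n => ∀ j, j ∉ U → p j = j),
      ∏ j ∈ U, w j (p j) (M ∪ (U.filter (fun j' => kf j < kf j')).image p) = Z U M := by
  induction U using Finset.induction_on_max_value kf with
  | empty =>
    intro M hM
    rw [hbase M hM]
    have : Finset.univ.filter (fun p : Fin n → Fin n => ∀ j, j ∉ (∅ : Finset (Fin n)) → p j = j) = {id} := by
      ext p
      simp only [Finset.mem_filter, Finset.mem_univ, true_and, Finset.mem_singleton, Finset.notMem_empty,
        not_false_eq_true, forall_true_left]
      exact ⟨fun h => funext h, fun h j => by rw [h]; rfl⟩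
    rw [this]
    simp
  | insert x U hx hmax ih =>
    intro M hM
    have hlt : ∀ y ∈ U, kf y < kf x := fun y hy =>
      lt_of_le_of_ne (hmax y hy) (fun h => hx (hkf h ▸ hy))
    rw [update_sum x U hx, hstep x U M hx hlt hM]
    apply Finset.sum_congr rfl
    intro d _
    by_cases hw : w x d M = 0
    · rw [hw, zero_mul]
      apply Finset.sum_eq_zero
      intro p _
      apply Finset.prod_eq_zero (Finset.mem_insert_self x U)
      rw [Function.update_self]
      have : (insert x U).filter (fun j' => kf x < kf j') = ∅ := by
        apply Finset.filter_false_of_mem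
        intro y hy
        rcases Finset.mem_insert.mp hy with h | h
        · rw [h]; exact lt_irrefl _
        · exact not_lt.mpr (hmax y h)
      rw [this]
      simpa using hw
    · rw [← ih (insert d M) (hinv x U M d hx hlt hM hw), Finset.mul_sum]
      apply Finset.sum_congr rfl
      intro p _
      rw [Finset.prod_insert hx, Function.update_self]
      have : (insert x U).filter (fun j' => kf x < kf j') = ∅ := by
        apply Finset.filter_false_of_mem
        intro y hy
        rcases Finset.mem_insert.mp hy with h | h
        · rw [h]; exact lt_irrefl _
        · exact not_lt.mpr (hmax y h)
      rw [this, Finset.image_empty, Finset.union_empty]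
      congr 1
      apply Finset.prod_congr rfl
      intro j hj
      have hjx : j ≠ x := fun h => hx (h ▸ hj)
      rw [Function.update_of_ne hjx, Finset.filter_insert, if_pos (hlt j hj), Finset.image_insert,
        Function.update_self]
      have : (U.filter (fun j' => kf j < kf j')).image (Function.update p x d)
          = (U.filter (fun j' => kf j < kf j')).image p := by
        apply Finset.image_congr
        intro y hy
        rw [Function.update_of_ne]
        rintro rfl
        exact hx (Finset.mem_filter.mp hy).1
      rw [this]
      congr 1
      ext k
      simp only [Finset.mem_union, Finset.mem_insert]
      tauto

/-! ### The classic layer: summing over pairings -/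

section classic
variable {n : ℕ}

def Sb (u d : Fin n → ℕ) (U : Finset (Fin n)) (b : ℕ) : Finset (Fin n) :=
  U.filter (fun i => u i = b ∧ d i ≠ b)
def Fb (d : Fin n → ℕ) (b : ℕ) : Finset (Fin n) := Finset.univ.filter (fun i => d i ≠ 0 ∧ d i < b)
def Acb (u d : Fin n → ℕ) (M : Finset (Fin n)) (b : ℕ) : Finset (Fin n) :=
  Finset.univ.filter (fun i => d i = b ∧ u i ≠ b ∧ i ∉ M)

def Wb (R : ℕ) (u d : Fin n → ℕ) (U M : Finset (Fin n)) (b : ℕ) : K :=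
  (1 - qq ^ (b - R + 1) * tt ^ (Fb d b).card) *
    tau (qq ^ (b - R + 1)) (PP (Sb u d U b) (Fb d b) (Acb u d M b))

def fsb (u d : Fin n → ℕ) (M : Finset (Fin n)) (a : ℕ) : Finset (Fin n) :=
  Finset.univ.filter (fun k => d k ≠ 0 ∧ k ∉ M ∧ ¬ (d k = a ∧ u k = a))

def ccond (u d : Fin n → ℕ) (x dd : Fin n) (M : Finset (Fin n)) : Prop :=
  d dd = u x ∧ dd ∉ M ∧ (dd ≠ x → u dd ≠ u x ∧ d x ≠ u x)

def cwv (R : ℕ) (u d : Fin n → ℕ) (x dd : Fin n) (M : Finset (Fin n)) : K :=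
  if dd = x then 1 else
    (1 - tt) * tt ^ ((fsb u d M (u x)).filter (fun k => strictlyBetweenCyc x dd k)).card
      / (1 - qq ^ (u x - R + 1) * tt ^ (fsb u d M (u x)).card)
      * (if dd < x then qq ^ (u x - R + 1) else 1)

def cw (R : ℕ) (u d : Fin n → ℕ) (x dd : Fin n) (M : Finset (Fin n)) : K :=
  if ccond u d x dd M then cwv R u d x dd M else 0

structure CInv (R L : ℕ) (u d : Fin n → ℕ) (U M : Finset (Fin n)) : Prop where
  hU : ∀ y ∈ U, R ≤ u y ∧ u y ≤ L
  hM : ∀ k ∈ M, ∀ y ∈ U, u y ≤ d k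
  hc : ∀ b, R ≤ b → b ≤ L → (U.filter (fun j => u j = b)).card
    = (Finset.univ.filter (fun k => d k = b ∧ k ∉ M)).card
  ht : ∀ k, u k = d k → u k ≠ 0 → (k ∈ U ↔ k ∉ M)

theorem Acb_insert_ne (u d : Fin n → ℕ) (M : Finset (Fin n)) (b : ℕ) (k : Fin n) (hk : ¬ (d k = b ∧ u k ≠ b)) :
    Acb u d (insert k M) b = Acb u d M b := by
  ext i
  simp only [Acb, Finset.mem_filter, Finset.mem_univ, true_and, Finset.mem_insert]
  constructor
  · rintro ⟨h1, h2, h3⟩; exact ⟨h1, h2, fun h => h3 (Or.inr h)⟩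
  · rintro ⟨h1, h2, h3⟩
    refine ⟨h1, h2, ?_⟩
    rintro (h | h)
    · exact hk (h ▸ ⟨h1, h2⟩)
    · exact h3 h

theorem Sb_insert_ne (u d : Fin n → ℕ) (U : Finset (Fin n)) (b : ℕ) (k : Fin n) (hk : ¬ (u k = b ∧ d k ≠ b)) :
    Sb u d (insert k U) b = Sb u d U b := by
  unfold Sb
  rw [Finset.filter_insert, if_neg hk]

theorem Acb_insert_eq (u d : Fin n → ℕ) (M : Finset (Fin n)) (b : ℕ) (k : Fin n) :
    Acb u d (insert k M) b = (Acb u d M b).erase k := by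
  ext i
  simp only [Acb, Finset.mem_filter, Finset.mem_univ, true_and, Finset.mem_insert, Finset.mem_erase]
  tauto

theorem CInv.cards {R L : ℕ} {u d : Fin n → ℕ} {U M : Finset (Fin n)} (h : CInv R L u d U M)
    (b : ℕ) (h0 : b ≠ 0) (hR : R ≤ b) (hL : b ≤ L) : (Sb u d U b).card = (Acb u d M b).card := by
  have h1 := h.hc b hR hL
  have e1 : (U.filter (fun j => u j = b)).card = (Sb u d U b).card
      + (Finset.univ.filter (fun k => (u k = b ∧ d k = b) ∧ k ∉ M)).card := by
    rw [Sb, ← Finset.card_union_of_disjoint]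
    · congr 1
      ext i
      simp only [Finset.mem_union, Finset.mem_filter, Finset.mem_univ, true_and]
      have := h.ht i
      constructor
      · rintro ⟨h1, h2⟩
        by_cases hd : d i = b
        · exact Or.inr ⟨⟨h2, hd⟩, (this (h2.trans hd.symm) (h2 ▸ h0)).mp h1⟩
        · exact Or.inl ⟨h1, h2, hd⟩
      · rintro (⟨h1, h2, h3⟩ | ⟨⟨h1, h2⟩, h3⟩)
        · exact ⟨h1, h2⟩
        · exact ⟨(this (h1.trans h2.symm) (h1 ▸ h0)).mpr h3, h1⟩
    · rw [Finset.disjoint_left]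
      intro i h1 h2
      simp only [Finset.mem_filter, Finset.mem_univ, true_and] at h1 h2
      exact h1.2.2 h2.1.2
  have e2 : (Finset.univ.filter (fun k => d k = b ∧ k ∉ M)).card = (Acb u d M b).card
      + (Finset.univ.filter (fun k => (u k = b ∧ d k = b) ∧ k ∉ M)).card := by
    rw [Acb, ← Finset.card_union_of_disjoint]
    · congr 1
      ext i
      simp only [Finset.mem_union, Finset.mem_filter, Finset.mem_univ, true_and]
      tauto
    · rw [Finset.disjoint_left]
      intro i h1 h2
      simp only [Finset.mem_filter, Finset.mem_univ, true_and] at h1 h2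
      exact h1.2.1 h2.1.1
  omega

theorem Fb_Acb_disj (u d : Fin n → ℕ) (M : Finset (Fin n)) (b : ℕ) : Disjoint (Fb d b) (Acb u d M b) := by
  rw [Finset.disjoint_left]
  intro i h1 h2
  simp only [Fb, Acb, Finset.mem_filter, Finset.mem_univ, true_and] at h1 h2
  omega

theorem one_sub_qt_ne' (a : ℕ) (j : ℕ) : 1 - qq ^ (a + 1) * tt ^ j ≠ 0 := one_sub_qt_ne _ _ (by omega)

theorem cw_step (R L : ℕ) (hR : 1 ≤ R) (u d : Fin n → ℕ) (hdL : ∀ i, d i ≤ L)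
    (hval : ∀ i, u i ≠ 0 → d i ≠ 0 → u i ≤ d i)
    (x : Fin n) (U M : Finset (Fin n)) (hx : x ∉ U)
    (hlt : ∀ y ∈ U, u y < u x ∨ (u y = u x ∧ y < x)) (h : CInv R L u d (insert x U) M) :
    ∏ b ∈ Finset.Icc R L, Wb R u d (insert x U) M b
      = ∑ dd, cw R u d x dd M * ∏ b ∈ Finset.Icc R L, Wb R u d U (insert dd M) b := by
  obtain ⟨hxR, hxL⟩ := h.hU x (Finset.mem_insert_self _ _)
  by_cases hdx : d x = u x
  · rw [Finset.sum_eq_single x]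
    · have hxM : x ∉ M := (h.ht x hdx.symm (by omega)).mp (Finset.mem_insert_self _ _)
      rw [cw, if_pos ⟨hdx, hxM, fun h => absurd rfl h⟩, cwv, if_pos rfl, one_mul]
      apply Finset.prod_congr rfl
      intro b _
      unfold Wb
      rw [Sb_insert_ne _ _ _ _ _ (by rintro ⟨h1, h2⟩; exact h2 (hdx.trans h1)),
        Acb_insert_ne _ _ _ _ _ (by rintro ⟨h1, h2⟩; exact h2 (hdx.symm.trans h1))]
    · intro dd _ hne
      rw [cw, if_neg, zero_mul]
      rintro ⟨_, _, h3⟩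
      exact (h3 hne).2 hdx
    · intro h; exact absurd (Finset.mem_univ _) h
  · have hmem : u x ∈ Finset.Icc R L := Finset.mem_Icc.mpr ⟨hxR, hxL⟩
    have hcd : ∀ dd, ccond u d x dd M ↔ dd ∈ Acb u d M (u x) := by
      intro dd
      simp only [ccond, Acb, Finset.mem_filter, Finset.mem_univ, true_and]
      constructor
      · rintro ⟨h1, h2, h3⟩
        have : dd ≠ x := by rintro rfl; exact hdx h1
        exact ⟨h1, (h3 this).1, h2⟩
      · rintro ⟨h1, h2, h3⟩
        exact ⟨h1, h3, fun _ => ⟨h2, hdx⟩⟩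
    have hfs : fsb u d M (u x) = Fb d (u x) ∪ Acb u d M (u x) := by
      ext k
      simp only [fsb, Fb, Acb, Finset.mem_union, Finset.mem_filter, Finset.mem_univ, true_and]
      constructor
      · rintro ⟨h1, h2, h3⟩
        rcases lt_trichotomy (d k) (u x) with h4 | h4 | h4
        · exact Or.inl ⟨h1, h4⟩
        · exact Or.inr ⟨h4, fun h => h3 ⟨h4, h⟩, h2⟩
        · exfalso
          have hc := h.hc (d k) (by omega) (hdL k)
          rw [Finset.card_eq_zero.mpr] at hc
          · have hk : k ∈ Finset.univ.filter (fun i => d i = d k ∧ i ∉ M) := by simp [h2]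
            rw [eq_comm, Finset.card_eq_zero] at hc
            rw [hc] at hk
            simp at hk
          · rw [Finset.filter_eq_empty_iff]
            intro y hy
            rcases Finset.mem_insert.mp hy with h5 | h5
            · rw [h5]; omega
            · have := hlt y h5; omega
      · rintro (⟨h1, h2⟩ | ⟨h1, h2, h3⟩)
        · refine ⟨h1, fun hk => ?_, fun h => by omega⟩
          have := h.hM k hk x (Finset.mem_insert_self _ _)
          omega
        · exact ⟨by omega, h3, fun h => h2 h.2⟩
    have hxF : x ∉ Fb d (u x) := by
      simp only [Fb, Finset.mem_filter, Finset.mem_univ, true_and]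
      rintro ⟨h1, h2⟩
      have := hval x (by omega) h1
      omega
    have hxA : x ∉ Acb u d M (u x) := by
      simp [Acb, hdx]
    have hxS : x ∉ Sb u d U (u x) := by simp [Sb, hx]
    have hSi : Sb u d (insert x U) (u x) = insert x (Sb u d U (u x)) := by
      unfold Sb
      rw [Finset.filter_insert, if_pos ⟨rfl, hdx⟩]
    have hcard := h.cards (u x) (by omega) hxR hxL
    rw [hSi, Finset.card_insert_of_notMem hxS] at hcard
    have key := tau_step (qq ^ (u x - R + 1)) (one_sub_qt_ne' _) (Sb u d U (u x)) (Fb d (u x)) (Acb u d M (u x))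
      (Fb_Acb_disj _ _ _ _) x hxS hxF hxA (by omega)
    rw [← Finset.mul_prod_erase _ _ hmem]
    have hoth : ∀ dd ∈ Acb u d M (u x), ∏ b ∈ Finset.Icc R L, Wb R u d U (insert dd M) b
        = Wb R u d U (insert dd M) (u x) * ∏ b ∈ (Finset.Icc R L).erase (u x), Wb R u d (insert x U) M b := by
      intro dd hdd
      simp only [Acb, Finset.mem_filter, Finset.mem_univ, true_and] at hdd
      rw [← Finset.mul_prod_erase _ _ hmem]
      congr 1
      apply Finset.prod_congr rfl
      intro b hb
      have hb' := Finset.ne_of_mem_erase hb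
      unfold Wb
      rw [Sb_insert_ne _ _ _ _ _ (by rintro ⟨h1, h2⟩; exact hb' h1.symm),
        Acb_insert_ne _ _ _ _ _ (by rintro ⟨h1, h2⟩; exact hb' (h1.symm.trans hdd.1))]
    have hsum : ∑ dd, cw R u d x dd M * ∏ b ∈ Finset.Icc R L, Wb R u d U (insert dd M) b
        = (∑ dd ∈ Acb u d M (u x), cwv R u d x dd M * Wb R u d U (insert dd M) (u x))
          * ∏ b ∈ (Finset.Icc R L).erase (u x), Wb R u d (insert x U) M b := by
      rw [Finset.sum_mul]
      rw [← Finset.sum_subset (Finset.subset_univ (Acb u d M (u x)))]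
      · apply Finset.sum_congr rfl
        intro dd hdd
        rw [cw, if_pos ((hcd dd).mpr hdd), hoth dd hdd, mul_assoc]
      · intro dd _ hdd
        rw [cw, if_neg (fun h => hdd ((hcd dd).mp h)), zero_mul]
    rw [hsum]
    congr 1
    unfold Wb
    rw [hSi]
    have hne := one_sub_qt_ne' (u x - R) (Fb d (u x) ∪ Acb u d M (u x)).card
    apply mul_left_cancel₀ hne
    rw [mul_left_comm, key, Finset.mul_sum, Finset.mul_sum, Finset.mul_sum]
    apply Finset.sum_congr rfl
    intro dd hdd
    have hddx : dd ≠ x := fun h => hxA (h ▸ hdd)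
    rw [Acb_insert_eq, cwv, if_neg hddx, hfs]
    field_simp

theorem cw_inv (R L : ℕ) (u d : Fin n → ℕ)
    (x : Fin n) (U M : Finset (Fin n)) (hx : x ∉ U) (dd : Fin n)
    (hlt : ∀ y ∈ U, u y < u x ∨ (u y = u x ∧ y < x)) (h : CInv R L u d (insert x U) M)
    (hw : cw R u d x dd M ≠ 0) : CInv R L u d U (insert dd M) := by
  have hcd : ccond u d x dd M := by
    by_contra hc
    exact hw (by rw [cw, if_neg hc])
  obtain ⟨h1, h2, h3⟩ := hcd
  refine ⟨fun y hy => h.hU y (Finset.mem_insert_of_mem hy), ?_, ?_, ?_⟩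
  · intro k hk y hy
    rcases Finset.mem_insert.mp hk with h4 | h4
    · rw [h4, h1]; have := hlt y hy; omega
    · exact h.hM k h4 y (Finset.mem_insert_of_mem hy)
  · intro b hR hL
    have hc := h.hc b hR hL
    have e : Finset.univ.filter (fun k => d k = b ∧ k ∉ insert dd M)
        = (Finset.univ.filter (fun k => d k = b ∧ k ∉ M)).erase dd := by
      ext i
      simp only [Finset.mem_filter, Finset.mem_univ, true_and, Finset.mem_insert, Finset.mem_erase]
      tauto
    rw [e]
    by_cases hb : u x = b
    · rw [Finset.filter_insert, if_pos hb, Finset.card_insert_of_notMem (by simp [hx])] at hc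
      rw [Finset.card_erase_of_mem (by simp [h1, hb, h2])]
      omega
    · rw [Finset.filter_insert, if_neg hb] at hc
      rw [Finset.erase_eq_of_notMem (by simp [h1, hb])]
      exact hc
  · intro k hk hk0
    have h4 := h.ht k hk hk0
    by_cases hkx : k = x
    · subst hkx
      have : dd = k := by
        by_contra hne
        exact (h3 hne).2 hk.symm
      simp [hx, this]
    · rw [Finset.mem_insert] at h4 ⊢
      have hkd : k ≠ dd := by
        rintro rfl
        exact (h3 hkx).1 (hk.trans h1)
      tauto

/-- validity of a classic pairing -/
structure CVal (u d : Fin n → ℕ) (p : Fin n → Fin n) : Prop where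
  triv : ∀ j, u j = 0 → p j = j
  label : ∀ j, u j ≠ 0 → d (p j) = u j
  inj : ∀ j j', u j ≠ 0 → u j' ≠ 0 → p j = p j' → j = j'
  below : ∀ j, u j ≠ 0 → (d j ≠ 0 → u j ≤ d j) ∧ (d j = u j → p j = j)

def WB (R L : ℕ) (u d : Fin n → ℕ) : K :=
  if (∀ i, u i ≠ 0 → d i ≠ 0 → u i ≤ d i) then
    ∏ b ∈ Finset.Icc R L, Wb R u d (Finset.univ.filter (fun i => u i ≠ 0)) ∅ b else 0

def kfun (u : Fin n → ℕ) (j : Fin n) : ℕ ×ₗ Fin n := toLex (u j, j)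

theorem kfun_lt (u : Fin n → ℕ) (i j : Fin n) : kfun u i < kfun u j ↔ (u i < u j ∨ (u i = u j ∧ i < j)) := by
  unfold kfun
  rw [Prod.Lex.toLex_lt_toLex]

theorem kfun_inj (u : Fin n → ℕ) : Function.Injective (kfun u) := by
  intro i j h
  have := congrArg (fun z => (ofLex z).2) h
  exact this

theorem cprod_eq (R : ℕ) (u d : Fin n → ℕ) (hval : ∀ i, u i ≠ 0 → d i ≠ 0 → u i ≤ d i) (p : Fin n → Fin n)
    (hp : ∀ j, j ∉ Finset.univ.filter (fun i => u i ≠ 0) → p j = j) :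
    ∏ j ∈ Finset.univ.filter (fun i => u i ≠ 0), cw R u d j (p j)
      (∅ ∪ ((Finset.univ.filter (fun i => u i ≠ 0)).filter (fun j' => kfun u j < kfun u j')).image p)
      = if CVal u d p then ∏ j, cweight u d p R j else 0 := by
  set U := Finset.univ.filter (fun i => u i ≠ 0) with hU
  have hMem : ∀ j k, k ∈ (∅ ∪ (U.filter (fun j' => kfun u j < kfun u j')).image p)
      ↔ ∃ j', earlier u j' j ∧ p j' = k := by
    intro j k
    rw [Finset.empty_union, Finset.mem_image]
    apply exists_congr
    intro j'
    rw [Finset.mem_filter, hU, Finset.mem_filter, kfun_lt]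
    unfold earlier
    simp only [Finset.mem_univ, true_and]
    constructor
    · rintro ⟨⟨h1, h2⟩, h3⟩
      refine ⟨⟨h1, ?_⟩, h3⟩
      rcases h2 with h2 | h2
      · exact Or.inl h2
      · exact Or.inr ⟨h2.1.symm, h2.2⟩
    · rintro ⟨⟨h1, h2⟩, h3⟩
      refine ⟨⟨h1, ?_⟩, h3⟩
      rcases h2 with h2 | h2
      · exact Or.inl h2
      · exact Or.inr ⟨h2.1.symm, h2.2⟩
  split_ifs with hv
  · have hout : ∀ j, j ∉ U → cweight u d p R j = 1 := by
      intro j hj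
      rw [cweight, if_pos (Or.inr (hp j hj))]
    rw [← Finset.prod_subset (Finset.subset_univ U) (fun j _ hj => hout j hj)]
    apply Finset.prod_congr rfl
    intro j hj
    have hj0 : u j ≠ 0 := by simpa [hU] using hj
    set M := (∅ ∪ (U.filter (fun j' => kfun u j < kfun u j')).image p) with hMdef
    have hcc : ccond u d j (p j) M := by
      refine ⟨hv.label j hj0, ?_, ?_⟩
      · rw [hMem]
        rintro ⟨j', h1, h2⟩
        have := hv.inj j' j h1.1 hj0 h2
        subst this
        unfold earlier at h1
        rcases h1.2 with h | h
        · exact lt_irrefl _ h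
        · exact lt_irrefl _ h.2
      · intro hne
        refine ⟨fun h => ?_, fun h => hne ((hv.below j hj0).2 h)⟩
        have h0 : u (p j) ≠ 0 := by rw [h]; exact hj0
        have := (hv.below (p j) h0).2 (by rw [hv.label j hj0, h])
        exact hne (hv.inj _ _ h0 hj0 this)
    have hfree : freeClassic u d p j = (fsb u d M (u j) : Set (Fin n)) := by
      ext k
      simp only [freeClassic, fsb, Set.mem_setOf_eq, Finset.coe_filter, Finset.mem_univ, true_and]
      rw [hMem]
      push Not
      have : (d k = u j ∧ u k ≠ 0 ∧ p k = k) ↔ (d k = u j ∧ u k = u j) := by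
        constructor
        · rintro ⟨h1, h2, h3⟩
          refine ⟨h1, ?_⟩
          have := hv.label k h2
          rw [h3] at this
          rw [← this, h1]
        · rintro ⟨h1, h2⟩
          exact ⟨h1, h2 ▸ hj0, (hv.below k (h2 ▸ hj0)).2 (h1.trans h2.symm)⟩
      have h' : (d k = u j → u k ≠ 0 → p k ≠ k) ↔ (d k = u j → u k ≠ u j) := by
        constructor
        · intro h h1 h2
          have := this.mpr ⟨h1, h2⟩
          exact h this.1 this.2.1 this.2.2
        · intro h h1 h2 h3
          exact h h1 (this.mp ⟨h1, h2, h3⟩).2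
      rw [h']
    rw [cw, if_pos hcc, cwv, cweight]
    by_cases hpj : p j = j
    · rw [if_pos hpj, if_pos (Or.inr hpj)]
    · rw [if_neg hpj, if_neg (not_or.mpr ⟨hj0, hpj⟩), hfree, Set.ncard_coe_finset]
      have hs : {k | k ∈ (fsb u d M (u j) : Set (Fin n)) ∧ strictlyBetweenCyc j (p j) k}
          = ((fsb u d M (u j)).filter (fun k => strictlyBetweenCyc j (p j) k) : Set (Fin n)) := by
        ext k
        simp
      rw [hs, Set.ncard_coe_finset]
  · by_contra hne
    apply hv
    have hall : ∀ j ∈ U, ccond u d j (p j) (∅ ∪ (U.filter (fun j' => kfun u j < kfun u j')).image p) := by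
      intro j hj
      by_contra hc
      exact hne (Finset.prod_eq_zero hj (by rw [cw, if_neg hc]))
    have hUm : ∀ j, u j ≠ 0 → j ∈ U := fun j hj => by simp [hU, hj]
    have hi : ∀ j j', u j ≠ 0 → u j' ≠ 0 → kfun u j < kfun u j' → p j ≠ p j' := by
      intro j j' h1 h2 h3 h4
      have := (hall j (hUm j h1)).2.1
      rw [hMem] at this
      apply this
      refine ⟨j', ⟨h2, ?_⟩, h4.symm⟩
      rw [kfun_lt] at h3
      rcases h3 with h3 | h3
      · exact Or.inl h3
      · exact Or.inr ⟨h3.1.symm, h3.2⟩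
    refine ⟨fun j hj => hp j (by simp [hU, hj]), fun j hj => (hall j (hUm j hj)).1, ?_, ?_⟩
    · intro j j' h1 h2 h3
      rcases lt_trichotomy (kfun u j) (kfun u j') with h | h | h
      · exact absurd h3 (hi j j' h1 h2 h)
      · exact kfun_inj u h
      · exact absurd h3.symm (hi j' j h2 h1 h)
    · intro j hj
      refine ⟨fun h => hval j hj h, fun h => ?_⟩
      by_contra hne
      exact ((hall j (hUm j hj)).2.2 hne).2 h

theorem classic_sum (R L : ℕ) (hR : 1 ≤ R) (u d : Fin n → ℕ) (hu : ∀ i, u i ≠ 0 → R ≤ u i ∧ u i ≤ L)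
    (hdL : ∀ i, d i ≤ L)
    (hc : ∀ b, R ≤ b → b ≤ L → (Finset.univ.filter (fun j => u j = b)).card
      = (Finset.univ.filter (fun k => d k = b)).card) :
    ∑ p ∈ Finset.univ.filter (fun p => CVal u d p), ∏ j, cweight u d p R j = WB R L u d := by
  unfold WB
  split_ifs with hval
  · have hinv : CInv R L u d (Finset.univ.filter (fun i => u i ≠ 0)) ∅ := by
      refine ⟨fun y hy => hu y (by simpa using hy), by simp, ?_, ?_⟩
      · intro b h1 h2
        have := hc b h1 h2
        simp only [Finset.notMem_empty, not_false_eq_true, and_true]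
        rw [← this]
        congr 1
        ext i
        simp only [Finset.mem_filter, Finset.mem_univ, true_and]
        constructor
        · rintro ⟨_, h⟩; exact h
        · intro h; exact ⟨by omega, h⟩
      · intro k _ hk
        simp [hk]
    have := seq_lemma (kfun u) (cw R u d) (fun U M => ∏ b ∈ Finset.Icc R L, Wb R u d U M b)
      (CInv R L u d) (by
        intro M hM
        apply Finset.prod_eq_one
        intro b hb
        rw [Finset.mem_Icc] at hb
        have h1 := hM.cards b (by omega) hb.1 hb.2
        have h2 : Sb u d ∅ b = ∅ := by simp [Sb]
        rw [h2, Finset.card_empty, eq_comm, Finset.card_eq_zero] at h1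
        unfold Wb
        rw [h2, h1, PP_noSA, tau_X_pow, mul_inv_cancel₀ (one_sub_qt_ne' _ _)])
      (kfun_inj u)
      (by
        intro x U M hx hlt hI
        exact cw_step R L hR u d hdL hval x U M hx (fun y hy => (kfun_lt u y x).mp (hlt y hy)) hI)
      (by
        intro x U M dd hx hlt hI hw
        exact cw_inv R L u d x U M hx dd (fun y hy => (kfun_lt u y x).mp (hlt y hy)) hI hw)
      (Finset.univ.filter (fun i => u i ≠ 0)) ∅ hinv
    rw [← this, Finset.sum_congr rfl (fun p hp => cprod_eq R u d hval p (Finset.mem_filter.mp hp).2)]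
    rw [← Finset.sum_filter, Finset.filter_filter]
    apply Finset.sum_congr _ (fun _ _ => rfl)
    ext p
    simp only [Finset.mem_filter, Finset.mem_univ, true_and]
    constructor
    · intro h; exact ⟨fun j hj => h.triv j (by simpa using hj), h⟩
    · exact fun h => h.2
  · apply Finset.sum_eq_zero
    intro p hp
    exfalso
    apply hval
    intro i h1 h2
    exact ((Finset.mem_filter.mp hp).2.below i h1).1 h2

end classic

/-! ### The signed layer: summing over pairings -/

section signed
variable {n : ℕ}

def PE (S F A : Finset (Fin n)) : K := (PP S F A).eval 1

theorem PE_eq (S F A : Finset (Fin n)) : PE S F A = ∏ i, loc F A i (tt ^ mm S A i) := by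
  unfold PE PP
  rw [Polynomial.eval_prod]
  apply Finset.prod_congr rfl
  intro i _
  unfold loc
  split_ifs <;> simp

theorem PE_right (S F A : Finset (Fin n)) (hFA : Disjoint F A) (x : Fin n) (hS : x ∉ S) (hc : S.card < A.card) :
    PE (insert x S) F A = (1 - tt) * ∑ d ∈ (Finset.Ioi x).filter (fun i => i ∈ A),
        tt ^ ((Finset.Ioi x).filter (fun i => i < d ∧ i ∈ F ∪ A)).card * PE S F (A.erase d) := by
  unfold PE
  rw [PP_right S F A hFA x hS, Polynomial.eval_add, Polynomial.eval_mul, PP_cross S F A hc, mul_zero, zero_add,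
    Polynomial.eval_mul, Polynomial.eval_finsetSum]
  simp

theorem PE_neg (S F A : Finset (Fin n)) (x : Fin n) (hS : x ∉ S) (hF : x ∉ F) (hA : x ∉ A) :
    PE S (insert x F) A = PE S F A - PE (insert x S) F (insert x A) := by
  simp only [PE_eq]
  have hm : ∀ i, mm (insert x S) (insert x A) i = mm S A i := by
    intro i
    have h1 := mm_erase_A (insert x S) (insert x A) x i (Finset.mem_insert_self _ _)
    rw [Finset.erase_insert hA] at h1
    have h2 := mm_insert_S S A x i hS
    linarith
  simp only [hm]
  have hx := Finset.mem_univ x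
  rw [← Finset.mul_prod_erase _ _ hx, ← Finset.mul_prod_erase _ (fun i => loc F A i (tt ^ mm S A i)) hx,
    ← Finset.mul_prod_erase _ (fun i => loc F (insert x A) i (tt ^ mm S A i)) hx]
  have h1 : ∏ i ∈ Finset.univ.erase x, loc (insert x F) A i (tt ^ mm S A i)
      = ∏ i ∈ Finset.univ.erase x, loc F A i (tt ^ mm S A i) := by
    apply Finset.prod_congr rfl
    intro i hi
    have := Finset.ne_of_mem_erase hi
    unfold loc
    simp [this]
  have h2 : ∏ i ∈ Finset.univ.erase x, loc F (insert x A) i (tt ^ mm S A i)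
      = ∏ i ∈ Finset.univ.erase x, loc F A i (tt ^ mm S A i) := by
    apply Finset.prod_congr rfl
    intro i hi
    have := Finset.ne_of_mem_erase hi
    unfold loc
    simp [this]
  rw [h1, h2, loc_none F A x hF hA]
  have h3 : loc (insert x F) A x (tt ^ mm S A x) = tt ^ mm S A x := by unfold loc; simp [hA]
  have h4 : loc F (insert x A) x (tt ^ mm S A x) = 1 - tt ^ mm S A x := by unfold loc; simp
  rw [h3, h4]
  ring

def ab (u : Fin n → ℤ) (i : Fin n) : ℕ := (u i).natAbs

def sFb (u : Fin n → ℤ) (d : Fin n → ℕ) (U M : Finset (Fin n)) (b : ℕ) : Finset (Fin n) :=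
  Finset.univ.filter (fun i => d i < b ∨ (d i = b ∧ i ∉ M ∧ i ∈ U ∧ ab u i = b ∧ u i < 0))
def sAb (u : Fin n → ℤ) (d : Fin n → ℕ) (U M : Finset (Fin n)) (b : ℕ) : Finset (Fin n) :=
  Finset.univ.filter (fun i => d i = b ∧ i ∉ M ∧ ¬ (i ∈ U ∧ ab u i = b))

def sgnU (u : Fin n → ℤ) (d : Fin n → ℕ) (U : Finset (Fin n)) : K :=
  ∏ j ∈ U, if u j < 0 ∧ d j ≠ ab u j then -1 else 1

def Vb (u : Fin n → ℤ) (d : Fin n → ℕ) (U M : Finset (Fin n)) (b : ℕ) : K :=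
  PE (Sb (ab u) d U b) (sFb u d U M b) (sAb u d U M b)

def scond (u : Fin n → ℤ) (d : Fin n → ℕ) (x dd : Fin n) (M : Finset (Fin n)) : Prop :=
  d dd = ab u x ∧ dd ∉ M ∧ x ≤ dd ∧ (0 < u x → d x = ab u x → dd = x)

def sgv (u : Fin n → ℤ) (x dd : Fin n) (M : Finset (Fin n)) : K :=
  if dd = x then 1 else (if 0 < u x then 1 else -1) * (1 - tt) *
    tt ^ ((Finset.Ioi x).filter (fun k => k < dd ∧ k ∉ M)).card

def sgw (u : Fin n → ℤ) (d : Fin n → ℕ) (x dd : Fin n) (M : Finset (Fin n)) : K :=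
  if scond u d x dd M then sgv u x dd M else 0

structure SInv (L : ℕ) (u : Fin n → ℤ) (d : Fin n → ℕ) (U M : Finset (Fin n)) : Prop where
  hU : ∀ y ∈ U, 1 ≤ ab u y ∧ ab u y ≤ L
  hM : ∀ k ∈ M, ∀ y ∈ U, ab u y < d k ∨ (ab u y = d k ∧ y < k)
  hc : ∀ b, 1 ≤ b → b ≤ L → (U.filter (fun j => ab u j = b)).card
    = (Finset.univ.filter (fun k => d k = b ∧ k ∉ M)).card

theorem SInv.cards {L : ℕ} {u : Fin n → ℤ} {d : Fin n → ℕ} {U M : Finset (Fin n)} (h : SInv L u d U M)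
    (b : ℕ) (hR : 1 ≤ b) (hL : b ≤ L) : (Sb (ab u) d U b).card = (sAb u d U M b).card := by
  have h1 := h.hc b hR hL
  have e1 : (U.filter (fun j => ab u j = b)).card = (Sb (ab u) d U b).card
      + (Finset.univ.filter (fun k => (k ∈ U ∧ ab u k = b) ∧ d k = b)).card := by
    rw [Sb, ← Finset.card_union_of_disjoint]
    · congr 1
      ext i
      simp only [Finset.mem_union, Finset.mem_filter, Finset.mem_univ, true_and]
      tauto
    · rw [Finset.disjoint_left]
      intro i h1 h2
      simp only [Finset.mem_filter, Finset.mem_univ, true_and] at h1 h2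
      exact h1.2.2 h2.2
  have e2 : (Finset.univ.filter (fun k => d k = b ∧ k ∉ M)).card = (sAb u d U M b).card
      + (Finset.univ.filter (fun k => (k ∈ U ∧ ab u k = b) ∧ d k = b)).card := by
    rw [sAb, ← Finset.card_union_of_disjoint]
    · congr 1
      ext i
      simp only [Finset.mem_union, Finset.mem_filter, Finset.mem_univ, true_and]
      constructor
      · tauto
      · rintro (h2 | h2)
        · exact ⟨h2.1, h2.2.1⟩
        · refine ⟨h2.2, fun hk => ?_⟩
          rcases h.hM i hk i h2.1.1 with h3 | h3
          · omega
          · exact lt_irrefl _ h3.2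
    · rw [Finset.disjoint_left]
      intro i h1 h2
      simp only [Finset.mem_filter, Finset.mem_univ, true_and] at h1 h2
      exact h1.2.2 h2.1
  omega

theorem sF_A_disj (u : Fin n → ℤ) (d : Fin n → ℕ) (U M : Finset (Fin n)) (b : ℕ) :
    Disjoint (sFb u d U M b) (sAb u d U M b) := by
  rw [Finset.disjoint_left]
  intro i h1 h2
  simp only [sFb, sAb, Finset.mem_filter, Finset.mem_univ, true_and] at h1 h2
  rcases h1 with h1 | h1
  · omega
  · exact h2.2.2 ⟨h1.2.2.1, h1.2.2.2.1⟩

theorem Vb_congr (u : Fin n → ℤ) (d : Fin n → ℕ) (U M : Finset (Fin n)) (b : ℕ) (x dd : Fin n)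
    (hx : ab u x ≠ b) (hd : d dd ≠ b) : Vb u d (insert x U) M b = Vb u d U (insert dd M) b := by
  unfold Vb
  rw [Sb_insert_ne _ _ _ _ _ (fun h => hx h.1)]
  congr 1
  · ext i
    simp only [sFb, Finset.mem_filter, Finset.mem_univ, true_and, Finset.mem_insert]
    constructor
    · rintro (h | ⟨h1, h2, h3 | h3, h4, h5⟩)
      · exact Or.inl h
      · exact absurd (h3 ▸ h4) hx
      · refine Or.inr ⟨h1, ?_, h3, h4, h5⟩
        rintro (h | h)
        · exact hd (h ▸ h1)
        · exact h2 h
    · rintro (h | ⟨h1, h2, h3, h4, h5⟩)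
      · exact Or.inl h
      · exact Or.inr ⟨h1, fun h => h2 (Or.inr h), Or.inr h3, h4, h5⟩
  · ext i
    simp only [sAb, Finset.mem_filter, Finset.mem_univ, true_and, Finset.mem_insert]
    constructor
    · rintro ⟨h1, h2, h3⟩
      refine ⟨h1, ?_, fun h => h3 ⟨Or.inr h.1, h.2⟩⟩
      rintro (h | h)
      · exact hd (h ▸ h1)
      · exact h2 h
    · rintro ⟨h1, h2, h3⟩
      refine ⟨h1, fun h => h2 (Or.inr h), ?_⟩
      rintro ⟨h | h, h4⟩
      · exact hx (h ▸ h4)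
      · exact h3 ⟨h, h4⟩

theorem between_card {L : ℕ} {u : Fin n → ℤ} {d : Fin n → ℕ} {U M : Finset (Fin n)} {x : Fin n}
    (hdL : ∀ i, d i ≤ L)
    (hlt : ∀ y ∈ U, ab u y < ab u x ∨ (ab u y = ab u x ∧ y < x)) (h : SInv L u d (insert x U) M)
    (k : Fin n) (hk : x < k) : k ∉ M ↔ k ∈ sFb u d (insert x U) M (ab u x) ∪ sAb u d (insert x U) M (ab u x) := by
  obtain ⟨hx1, hxL⟩ := h.hU x (Finset.mem_insert_self _ _)
  simp only [sFb, sAb, Finset.mem_union, Finset.mem_filter, Finset.mem_univ, true_and]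
  constructor
  · intro h2
    rcases lt_trichotomy (d k) (ab u x) with h4 | h4 | h4
    · exact Or.inl (Or.inl h4)
    · refine Or.inr ⟨h4, h2, ?_⟩
      rintro ⟨h5, h6⟩
      rcases Finset.mem_insert.mp h5 with h7 | h7
      · exact absurd h7 hk.ne'
      · rcases hlt k h7 with h8 | h8
        · omega
        · exact lt_asymm h8.2 hk
    · exfalso
      have hc := h.hc (d k) (by omega) (hdL k)
      rw [Finset.card_eq_zero.mpr] at hc
      · have hk : k ∈ Finset.univ.filter (fun i => d i = d k ∧ i ∉ M) := by simp [h2]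
        rw [eq_comm, Finset.card_eq_zero] at hc
        rw [hc] at hk
        simp at hk
      · rw [Finset.filter_eq_empty_iff]
        intro y hy
        rcases Finset.mem_insert.mp hy with h5 | h5
        · rw [h5]; omega
        · have := hlt y h5; omega
  · rintro ((h1 | h1) | h1)
    · intro hM
      have := h.hM k hM x (Finset.mem_insert_self _ _)
      omega
    · exact h1.2.1
    · exact h1.2.1

theorem sgn_step (L : ℕ) (u : Fin n → ℤ) (d : Fin n → ℕ) (hdL : ∀ i, d i ≤ L)
    (hvp : ∀ i, 0 < u i → ab u i ≤ d i) (hvn : ∀ i, u i < 0 → d i ≤ ab u i)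
    (x : Fin n) (U M : Finset (Fin n)) (hx : x ∉ U)
    (hlt : ∀ y ∈ U, ab u y < ab u x ∨ (ab u y = ab u x ∧ y < x)) (h : SInv L u d (insert x U) M) :
    sgnU u d (insert x U) * ∏ b ∈ Finset.Icc 1 L, Vb u d (insert x U) M b
      = ∑ dd, sgw u d x dd M * (sgnU u d U * ∏ b ∈ Finset.Icc 1 L, Vb u d U (insert dd M) b) := by
  obtain ⟨hxR, hxL⟩ := h.hU x (Finset.mem_insert_self _ _)
  have hxM : d x = ab u x → x ∉ M := by
    intro hd hM
    rcases h.hM x hM x (Finset.mem_insert_self _ _) with h1 | h1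
    · omega
    · exact lt_irrefl _ h1.2
  have hmem : ab u x ∈ Finset.Icc 1 L := Finset.mem_Icc.mpr ⟨hxR, hxL⟩
  have hx0 : u x ≠ 0 := by
    intro h0; unfold ab at hxR; rw [h0] at hxR; simp at hxR
  have hsg : sgnU u d (insert x U) = (if u x < 0 ∧ d x ≠ ab u x then -1 else 1) * sgnU u d U := by
    unfold sgnU; rw [Finset.prod_insert hx]
  have hoth : ∀ dd, d dd = ab u x → ∏ b ∈ Finset.Icc 1 L, Vb u d U (insert dd M) b
      = Vb u d U (insert dd M) (ab u x) * ∏ b ∈ (Finset.Icc 1 L).erase (ab u x), Vb u d (insert x U) M b := by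
    intro dd hdd
    rw [← Finset.mul_prod_erase _ _ hmem]
    congr 1
    apply Finset.prod_congr rfl
    intro b hb
    have hb' := Finset.ne_of_mem_erase hb
    rw [Vb_congr u d U M b x dd (Ne.symm hb') (by rw [hdd]; exact Ne.symm hb')]
  have hred : (if u x < 0 ∧ d x ≠ ab u x then -1 else 1) * Vb u d (insert x U) M (ab u x)
      = ∑ dd, sgw u d x dd M * Vb u d U (insert dd M) (ab u x) →
      sgnU u d (insert x U) * ∏ b ∈ Finset.Icc 1 L, Vb u d (insert x U) M b
      = ∑ dd, sgw u d x dd M * (sgnU u d U * ∏ b ∈ Finset.Icc 1 L, Vb u d U (insert dd M) b) := by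
    intro hr
    have : ∀ dd, sgw u d x dd M * (sgnU u d U * ∏ b ∈ Finset.Icc 1 L, Vb u d U (insert dd M) b)
        = (sgw u d x dd M * Vb u d U (insert dd M) (ab u x)) *
          (sgnU u d U * ∏ b ∈ (Finset.Icc 1 L).erase (ab u x), Vb u d (insert x U) M b) := by
      intro dd
      by_cases hc : scond u d x dd M
      · rw [hoth dd hc.1]; ring
      · rw [sgw, if_neg hc]; ring
    rw [Finset.sum_congr rfl (fun dd _ => this dd), ← Finset.sum_mul, ← hr, hsg,
      ← Finset.mul_prod_erase _ _ hmem]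
    ring
  apply hred
  clear hred hoth hsg
  have hcard := h.cards (ab u x) hxR hxL
  have hxS : x ∉ Sb (ab u) d U (ab u x) := by simp [Sb, hx]
  have hcnt : ∀ dd, (Finset.Ioi x).filter (fun k => k < dd ∧ k ∉ M)
      = (Finset.Ioi x).filter (fun k => k < dd ∧
        k ∈ sFb u d (insert x U) M (ab u x) ∪ sAb u d (insert x U) M (ab u x)) := by
    intro dd
    apply Finset.filter_congr
    intro k hk
    rw [Finset.mem_Ioi] at hk
    rw [between_card hdL hlt h k hk]
  have hAmem : ∀ dd, x < dd → (dd ∈ sAb u d (insert x U) M (ab u x) ↔ (d dd = ab u x ∧ dd ∉ M)) := by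
    intro dd hdd
    simp only [sAb, Finset.mem_filter, Finset.mem_univ, true_and]
    constructor
    · rintro ⟨h1, h2, _⟩; exact ⟨h1, h2⟩
    · rintro ⟨h1, h2⟩
      refine ⟨h1, h2, ?_⟩
      rintro ⟨h3, h4⟩
      rcases Finset.mem_insert.mp h3 with h5 | h5
      · exact absurd h5 hdd.ne'
      · rcases hlt dd h5 with h6 | h6
        · omega
        · exact lt_asymm h6.2 hdd
  by_cases hdx : d x = ab u x
  · have hS' : Sb (ab u) d (insert x U) (ab u x) = Sb (ab u) d U (ab u x) :=
      Sb_insert_ne _ _ _ _ _ (fun h => h.2 hdx)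
    have hA' : sAb u d U (insert x M) (ab u x) = sAb u d (insert x U) M (ab u x) := by
      ext i
      simp only [sAb, Finset.mem_filter, Finset.mem_univ, true_and, Finset.mem_insert]
      by_cases hi : i = x
      · subst hi; simp
      · simp [hi]
    have hxA : x ∉ sAb u d (insert x U) M (ab u x) := by simp [sAb]
    rw [if_neg (fun h => h.2 hdx), one_mul]
    by_cases hpos : 0 < u x
    · rw [Finset.sum_eq_single x]
      · rw [sgw, if_pos ⟨hdx, hxM hdx, le_rfl, fun _ _ => rfl⟩, sgv, if_pos rfl, one_mul]
        unfold Vb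
        rw [hS', hA']
        congr 1
        ext i
        simp only [sFb, Finset.mem_filter, Finset.mem_univ, true_and, Finset.mem_insert]
        by_cases hi : i = x
        · subst hi; simp [hdx, not_lt.mpr hpos.le]
        · simp [hi]
      · intro dd _ hne
        rw [sgw, if_neg, zero_mul]
        rintro ⟨_, _, _, h4⟩
        exact hne (h4 hpos hdx)
      · intro h; exact absurd (Finset.mem_univ _) h
    · have hneg : u x < 0 := lt_of_le_of_ne (not_lt.mp hpos) hx0
      set F0 := sFb u d U (insert x M) (ab u x) with hF0
      have hF' : sFb u d (insert x U) M (ab u x) = insert x F0 := by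
        ext i
        simp only [hF0, sFb, Finset.mem_filter, Finset.mem_univ, true_and, Finset.mem_insert]
        by_cases hi : i = x
        · subst hi; simp [hdx, hneg, hxM hdx]
        · simp [hi]
      have hxF0 : x ∉ F0 := by
        simp [hF0, sFb, hdx]
      rw [← Finset.add_sum_erase _ _ (Finset.mem_univ x)]
      rw [sgw, if_pos ⟨hdx, hxM hdx, le_rfl, fun _ _ => rfl⟩, sgv, if_pos rfl, one_mul]
      have hV1 : Vb u d (insert x U) M (ab u x) = PE (Sb (ab u) d U (ab u x)) (insert x F0)
          (sAb u d (insert x U) M (ab u x)) := by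
        unfold Vb; rw [hS', hF']
      have hV2 : Vb u d U (insert x M) (ab u x) = PE (Sb (ab u) d U (ab u x)) F0
          (sAb u d (insert x U) M (ab u x)) := by
        unfold Vb; rw [hA']
      rw [hV1, hV2, PE_neg _ _ _ _ hxS hxF0 hxA, sub_eq_add_neg]
      congr 1
      set A := sAb u d (insert x U) M (ab u x) with hA
      have hdis : Disjoint F0 (insert x A) := by
        rw [Finset.disjoint_insert_right]
        refine ⟨hxF0, ?_⟩
        have := sF_A_disj u d (insert x U) M (ab u x)
        rw [hF'] at this
        exact Finset.disjoint_of_subset_left (Finset.subset_insert _ _) this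
      rw [PE_right _ _ _ hdis x hxS (by rw [Finset.card_insert_of_notMem hxA, ← hcard, hS']; omega)]
      rw [Finset.mul_sum, ← Finset.sum_neg_distrib]
      symm
      rw [← Finset.sum_subset (s₁ := (Finset.Ioi x).filter (fun i => i ∈ insert x A))]
      · apply Finset.sum_congr rfl
        intro dd hdd
        rw [Finset.mem_filter, Finset.mem_Ioi] at hdd
        have hne : dd ≠ x := hdd.1.ne'
        have hddA : dd ∈ A := (Finset.mem_insert.mp hdd.2).resolve_left hne
        have h1 := (hAmem dd hdd.1).mp hddA
        rw [sgw, if_pos ⟨h1.1, h1.2, hdd.1.le, fun h => absurd h hpos⟩, sgv, if_neg hne, if_neg hpos, hcnt dd, hF']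
        have hcc : (Finset.Ioi x).filter (fun k => k < dd ∧ k ∈ insert x F0 ∪ A)
            = (Finset.Ioi x).filter (fun k => k < dd ∧ k ∈ F0 ∪ insert x A) := by
          apply Finset.filter_congr
          intro k hk
          rw [Finset.mem_Ioi] at hk
          simp [hk.ne']
        rw [hcc]
        have hV : Vb u d U (insert dd M) (ab u x) = PE (Sb (ab u) d U (ab u x)) F0 ((insert x A).erase dd) := by
          unfold Vb
          congr 1
          · ext i
            simp only [hF0, sFb, Finset.mem_filter, Finset.mem_univ, true_and, Finset.mem_insert]
            by_cases hi : i = dd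
            · subst hi
              simp only [true_or, not_true_eq_false, false_and, and_false, or_false, h1.1, lt_irrefl, false_or, hne]
              constructor
              · tauto
              · rintro ⟨_, _, h5, h6⟩
                rcases hlt i h5 with h7 | h7
                · omega
                · exact absurd h7.2 (lt_asymm hdd.1)
            · by_cases hi2 : i = x
              · subst hi2; simp [hx]
              · simp [hi, hi2]
          · ext i
            simp only [hA, sAb, Finset.mem_filter, Finset.mem_univ, true_and, Finset.mem_insert, Finset.mem_erase]
            by_cases hi : i = dd
            · subst hi
              simp
            · by_cases hi2 : i = x
              · subst hi2; simp [hx, hi, hdx, hxM hdx]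
              · simp [hi, hi2]
        rw [hV]
        ring
      · intro dd hdd
        rw [Finset.mem_filter, Finset.mem_Ioi] at hdd
        simp [hdd.1.ne']
      · intro dd hdd hnd
        have hne := Finset.ne_of_mem_erase hdd
        rw [sgw, if_neg, zero_mul]
        rintro ⟨h1, h2, h3, h4⟩
        apply hnd
        have hlt' : x < dd := lt_of_le_of_ne h3 (Ne.symm hne)
        rw [Finset.mem_filter, Finset.mem_Ioi]
        exact ⟨hlt', Finset.mem_insert_of_mem ((hAmem dd hlt').mpr ⟨h1, h2⟩)⟩
  · have hS' : Sb (ab u) d (insert x U) (ab u x) = insert x (Sb (ab u) d U (ab u x)) := by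
      unfold Sb
      rw [Finset.filter_insert, if_pos ⟨rfl, hdx⟩]
    rw [hS', Finset.card_insert_of_notMem hxS] at hcard
    set A := sAb u d (insert x U) M (ab u x) with hA
    set F := sFb u d (insert x U) M (ab u x) with hF
    have hV0 : Vb u d (insert x U) M (ab u x) = PE (insert x (Sb (ab u) d U (ab u x))) F A := by
      unfold Vb; rw [hS']
    rw [hV0, PE_right _ _ _ (sF_A_disj _ _ _ _ _) x hxS (Nat.lt_of_lt_of_eq (Nat.lt_succ_self _) hcard), Finset.mul_sum, Finset.mul_sum]
    symm
    rw [← Finset.sum_subset (Finset.subset_univ ((Finset.Ioi x).filter (fun i => i ∈ A)))]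
    · apply Finset.sum_congr rfl
      intro dd hdd
      rw [Finset.mem_filter, Finset.mem_Ioi] at hdd
      have hne : dd ≠ x := hdd.1.ne'
      have h1 := (hAmem dd hdd.1).mp hdd.2
      rw [sgw, if_pos ⟨h1.1, h1.2, hdd.1.le, fun _ h => absurd h hdx⟩, sgv, if_neg hne, hcnt dd]
      have hs : (if u x < 0 ∧ d x ≠ ab u x then (-1 : K) else 1) = if 0 < u x then 1 else -1 := by
        rcases lt_or_gt_of_ne hx0 with h | h
        · rw [if_pos ⟨h, hdx⟩, if_neg (not_lt.mpr h.le)]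
        · rw [if_neg (fun h' => lt_asymm h h'.1), if_pos h]
      rw [hs]
      have hV : Vb u d U (insert dd M) (ab u x) = PE (Sb (ab u) d U (ab u x)) F (A.erase dd) := by
        unfold Vb
        congr 1
        · ext i
          simp only [hF, sFb, Finset.mem_filter, Finset.mem_univ, true_and, Finset.mem_insert]
          by_cases hi : i = dd
          · subst hi
            simp only [true_or, not_true_eq_false, false_and, and_false, or_false, h1.1, lt_irrefl, false_or, hne]
            constructor
            · tauto
            · rintro ⟨_, _, h5, h6⟩
              rcases hlt i h5 with h7 | h7
              · omega
              · exact absurd h7.2 (lt_asymm hdd.1)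
          · by_cases hi2 : i = x
            · subst hi2; simp [hx, hdx]
            · simp [hi, hi2]
        · ext i
          simp only [hA, sAb, Finset.mem_filter, Finset.mem_univ, true_and, Finset.mem_insert, Finset.mem_erase]
          by_cases hi : i = dd
          · subst hi
            simp
          · by_cases hi2 : i = x
            · subst hi2; simp [hx, hi, hdx]
            · simp [hi, hi2]
      rw [hV]
      ring
    · intro dd _ hnd
      rw [sgw, if_neg, zero_mul]
      rintro ⟨h1, h2, h3, h4⟩
      apply hnd
      have hne : dd ≠ x := by rintro rfl; exact hdx h1
      have hlt' : x < dd := lt_of_le_of_ne h3 (Ne.symm hne)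
      rw [Finset.mem_filter, Finset.mem_Ioi]
      exact ⟨hlt', (hAmem dd hlt').mpr ⟨h1, h2⟩⟩

theorem sgn_inv (L : ℕ) (u : Fin n → ℤ) (d : Fin n → ℕ)
    (x : Fin n) (U M : Finset (Fin n)) (hx : x ∉ U) (dd : Fin n)
    (hlt : ∀ y ∈ U, ab u y < ab u x ∨ (ab u y = ab u x ∧ y < x)) (h : SInv L u d (insert x U) M)
    (hw : sgw u d x dd M ≠ 0) : SInv L u d U (insert dd M) := by
  have hcd : scond u d x dd M := by
    by_contra hc
    exact hw (by rw [sgw, if_neg hc])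
  obtain ⟨h1, h2, h3, h4⟩ := hcd
  refine ⟨fun y hy => h.hU y (Finset.mem_insert_of_mem hy), ?_, ?_⟩
  · intro k hk y hy
    rcases Finset.mem_insert.mp hk with h4 | h4
    · rw [h4, h1]
      rcases hlt y hy with h5 | h5
      · exact Or.inl h5
      · exact Or.inr ⟨h5.1, lt_of_lt_of_le h5.2 h3⟩
    · exact h.hM k h4 y (Finset.mem_insert_of_mem hy)
  · intro b hR hL
    have hc := h.hc b hR hL
    have e : Finset.univ.filter (fun k => d k = b ∧ k ∉ insert dd M)
        = (Finset.univ.filter (fun k => d k = b ∧ k ∉ M)).erase dd := by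
      ext i
      simp only [Finset.mem_filter, Finset.mem_univ, true_and, Finset.mem_insert, Finset.mem_erase]
      tauto
    rw [e]
    by_cases hb : ab u x = b
    · rw [Finset.filter_insert, if_pos hb, Finset.card_insert_of_notMem (by simp [hx])] at hc
      rw [Finset.card_erase_of_mem (by simp [h1, hb, h2])]
      omega
    · rw [Finset.filter_insert, if_neg hb] at hc
      rw [Finset.erase_eq_of_notMem (by simp [h1, hb])]
      exact hc

end signed

section signed2
variable {n : ℕ}

/-- validity of a signed pairing -/
structure SVal (u : Fin n → ℤ) (d : Fin n → ℕ) (p : Fin n → Fin n) : Prop where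
  triv : ∀ j, u j = 0 → p j = j
  label : ∀ j, u j ≠ 0 → d (p j) = (u j).natAbs
  inj : ∀ j j', u j ≠ 0 → u j' ≠ 0 → p j = p j' → j = j'
  nowrap : ∀ j, u j ≠ 0 → j ≤ p j
  pos : ∀ j, 0 < u j → d j ≠ 0 ∧ (u j).natAbs ≤ d j ∧ ((d j : ℤ) = u j → p j = j)
  neg : ∀ j, u j < 0 → d j = 0 ∨ d j ≤ (u j).natAbs

def SOK (x : ℤ) (v : ℕ) : Prop := (0 < x → x.natAbs ≤ v) ∧ (x < 0 → v ≤ x.natAbs)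

def VB (L : ℕ) (u : Fin n → ℤ) (d : Fin n → ℕ) : K :=
  if (∀ i, SOK (u i) (d i)) then
    sgnU u d (Finset.univ.filter (fun i => ab u i ≠ 0)) *
      ∏ b ∈ Finset.Icc 1 L, Vb u d (Finset.univ.filter (fun i => ab u i ≠ 0)) ∅ b else 0

theorem ab_ne (u : Fin n → ℤ) (i : Fin n) : ab u i ≠ 0 ↔ u i ≠ 0 := by
  unfold ab; simp

theorem sprod_eq (u : Fin n → ℤ) (d : Fin n → ℕ) (hval : ∀ i, SOK (u i) (d i)) (p : Fin n → Fin n)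
    (hp : ∀ j, j ∉ Finset.univ.filter (fun i => ab u i ≠ 0) → p j = j) :
    ∏ j ∈ Finset.univ.filter (fun i => ab u i ≠ 0), sgw u d j (p j)
      (∅ ∪ ((Finset.univ.filter (fun i => ab u i ≠ 0)).filter (fun j' => kfun (ab u) j < kfun (ab u) j')).image p)
      = if SVal u d p then ∏ j, sweight u d p j else 0 := by
  set U := Finset.univ.filter (fun i => ab u i ≠ 0) with hU
  have hMem : ∀ j k, k ∈ (∅ ∪ (U.filter (fun j' => kfun (ab u) j < kfun (ab u) j')).image p)
      ↔ ∃ j', earlier (ab u) j' j ∧ p j' = k := by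
    intro j k
    rw [Finset.empty_union, Finset.mem_image]
    apply exists_congr
    intro j'
    rw [Finset.mem_filter, hU, Finset.mem_filter, kfun_lt]
    unfold earlier
    simp only [Finset.mem_univ, true_and]
    constructor
    · rintro ⟨⟨h1, h2⟩, h3⟩
      refine ⟨⟨h1, ?_⟩, h3⟩
      rcases h2 with h2 | h2
      · exact Or.inl h2
      · exact Or.inr ⟨h2.1.symm, h2.2⟩
    · rintro ⟨⟨h1, h2⟩, h3⟩
      refine ⟨⟨h1, ?_⟩, h3⟩
      rcases h2 with h2 | h2
      · exact Or.inl h2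
      · exact Or.inr ⟨h2.1.symm, h2.2⟩
  split_ifs with hv
  · have hout : ∀ j, j ∉ U → sweight u d p j = 1 := by
      intro j hj
      rw [sweight, if_pos (Or.inr (hp j hj))]
    rw [← Finset.prod_subset (Finset.subset_univ U) (fun j _ hj => hout j hj)]
    apply Finset.prod_congr rfl
    intro j hj
    have hj0' : ab u j ≠ 0 := (Finset.mem_filter.mp hj).2
    have hj0 : u j ≠ 0 := (ab_ne u j).mp hj0'
    set M := (∅ ∪ (U.filter (fun j' => kfun (ab u) j < kfun (ab u) j')).image p) with hMdef
    have hcc : scond u d j (p j) M := by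
      refine ⟨hv.label j hj0, ?_, hv.nowrap j hj0, ?_⟩
      · rw [hMem]
        rintro ⟨j', h1, h2⟩
        have := hv.inj j' j ((ab_ne u j').mp h1.1) hj0 h2
        subst this
        unfold earlier at h1
        rcases h1.2 with h | h
        · exact lt_irrefl _ h
        · exact lt_irrefl _ h.2
      · intro h1 h2
        apply (hv.pos j h1).2.2
        rw [h2]; unfold ab
        omega
    rw [sgw, if_pos hcc, sgv, sweight]
    by_cases hpj : p j = j
    · rw [if_pos hpj, if_pos (Or.inr hpj)]
    · rw [if_neg hpj, if_neg (not_or.mpr ⟨hj0, hpj⟩)]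
      have hdis : Disjoint {k | k ∈ freeSigned u d p j ∧ j < k ∧ k < p j} {k : Fin n | d k = 0 ∧ j < k ∧ k < p j} := by
        rw [Set.disjoint_left]
        rintro k ⟨h1, _⟩ ⟨h2, _⟩
        exact h1.1 h2
      rw [← Set.ncard_union_eq hdis (Set.toFinite _) (Set.toFinite _)]
      have hs : {k | k ∈ freeSigned u d p j ∧ j < k ∧ k < p j} ∪ {k : Fin n | d k = 0 ∧ j < k ∧ k < p j}
          = (((Finset.Ioi j).filter (fun k => k < p j ∧ k ∉ M) : Finset (Fin n)) : Set (Fin n)) := by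
        ext k
        simp only [Set.mem_union, Set.mem_setOf_eq, Finset.coe_filter, Finset.mem_Ioi, freeSigned]
        rw [hMem]
        push Not
        constructor
        · rintro (⟨⟨h1, h2⟩, h3, h4⟩ | ⟨h1, h3, h4⟩)
          · exact ⟨h3, h4, h2⟩
          · refine ⟨h3, h4, ?_⟩
            rintro j' h5 rfl
            rw [hv.label j' ((ab_ne u j').mp h5.1)] at h1
            exact h5.1 h1
        · rintro ⟨h3, h4, h5⟩
          by_cases hd : d k = 0
          · exact Or.inr ⟨hd, h3, h4⟩
          · exact Or.inl ⟨⟨hd, h5⟩, h3, h4⟩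
      rw [hs, Set.ncard_coe_finset]
  · by_contra hne
    apply hv
    have hall : ∀ j ∈ U, scond u d j (p j) (∅ ∪ (U.filter (fun j' => kfun (ab u) j < kfun (ab u) j')).image p) := by
      intro j hj
      by_contra hc
      exact hne (Finset.prod_eq_zero hj (by rw [sgw, if_neg hc]))
    have hUm : ∀ j, u j ≠ 0 → j ∈ U := fun j hj => by
      rw [hU, Finset.mem_filter]; exact ⟨Finset.mem_univ _, (ab_ne u j).mpr hj⟩
    have hi : ∀ j j', u j ≠ 0 → u j' ≠ 0 → kfun (ab u) j < kfun (ab u) j' → p j ≠ p j' := by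
      intro j j' h1 h2 h3 h4
      have := (hall j (hUm j h1)).2.1
      rw [hMem] at this
      apply this
      refine ⟨j', ⟨(ab_ne u j').mpr h2, ?_⟩, h4.symm⟩
      rw [kfun_lt] at h3
      rcases h3 with h3 | h3
      · exact Or.inl h3
      · exact Or.inr ⟨h3.1.symm, h3.2⟩
    refine ⟨fun j hj => hp j (by simp [hU, ab, hj]), fun j hj => (hall j (hUm j hj)).1, ?_,
      fun j hj => (hall j (hUm j hj)).2.2.1, ?_, ?_⟩
    · intro j j' h1 h2 h3
      rcases lt_trichotomy (kfun (ab u) j) (kfun (ab u) j') with h | h | h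
      · exact absurd h3 (hi j j' h1 h2 h)
      · exact kfun_inj (ab u) h
      · exact absurd h3.symm (hi j' j h2 h1 h)
    · intro j hj
      have h1 := (hval j).1 hj
      refine ⟨by omega, h1, fun h => ?_⟩
      exact (hall j (hUm j (by omega))).2.2.2 hj (by unfold ab; omega)
    · intro j hj
      exact Or.inr ((hval j).2 hj)

theorem signed_sum (L : ℕ) (u : Fin n → ℤ) (d : Fin n → ℕ) (hu : ∀ i, ab u i ≤ L)
    (hdL : ∀ i, d i ≤ L)
    (hc : ∀ b, 1 ≤ b → b ≤ L → (Finset.univ.filter (fun j => ab u j = b)).card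
      = (Finset.univ.filter (fun k => d k = b)).card) :
    ∑ p ∈ Finset.univ.filter (fun p => SVal u d p), ∏ j, sweight u d p j = VB L u d := by
  unfold VB
  split_ifs with hval
  · have hinv : SInv L u d (Finset.univ.filter (fun i => ab u i ≠ 0)) ∅ := by
      refine ⟨fun y hy => ⟨Nat.one_le_iff_ne_zero.mpr (Finset.mem_filter.mp hy).2, hu y⟩, by simp, ?_⟩
      intro b h1 h2
      have := hc b h1 h2
      simp only [Finset.notMem_empty, not_false_eq_true, and_true]
      rw [← this]
      congr 1
      ext i
      simp only [Finset.mem_filter, Finset.mem_univ, true_and]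
      constructor
      · rintro ⟨_, h⟩; exact h
      · intro h; exact ⟨by omega, h⟩
    have := seq_lemma (kfun (ab u)) (sgw u d) (fun U M => sgnU u d U * ∏ b ∈ Finset.Icc 1 L, Vb u d U M b)
      (SInv L u d) (by
        intro M hM
        have hs : sgnU u d ∅ = 1 := by simp [sgnU]
        rw [hs, one_mul]
        apply Finset.prod_eq_one
        intro b hb
        rw [Finset.mem_Icc] at hb
        have h1 := hM.cards b hb.1 hb.2
        have h2 : Sb (ab u) d ∅ b = ∅ := by simp [Sb]
        rw [h2, Finset.card_empty, eq_comm, Finset.card_eq_zero] at h1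
        unfold Vb PE
        rw [h2, h1, PP_noSA]
        simp)
      (kfun_inj (ab u))
      (by
        intro x U M hx hlt hI
        exact sgn_step L u d hdL (fun i h => (hval i).1 h) (fun i h => (hval i).2 h) x U M hx
          (fun y hy => (kfun_lt (ab u) y x).mp (hlt y hy)) hI)
      (by
        intro x U M dd hx hlt hI hw
        exact sgn_inv L u d x U M hx dd (fun y hy => (kfun_lt (ab u) y x).mp (hlt y hy)) hI hw)
      (Finset.univ.filter (fun i => ab u i ≠ 0)) ∅ hinv
    rw [← this, Finset.sum_congr rfl (fun p hp => sprod_eq u d hval p (Finset.mem_filter.mp hp).2)]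
    rw [← Finset.sum_filter, Finset.filter_filter]
    apply Finset.sum_congr _ (fun _ _ => rfl)
    ext p
    simp only [Finset.mem_filter, Finset.mem_univ, true_and]
    constructor
    · intro h; exact ⟨fun j hj => h.triv j (by simpa [ab] using hj), h⟩
    · exact fun h => h.2
  · apply Finset.sum_eq_zero
    intro p hp
    exfalso
    apply hval
    intro i
    have h := (Finset.mem_filter.mp hp).2
    refine ⟨fun h1 => (h.pos i h1).2.1, fun h1 => ?_⟩
    rcases h.neg i h1 with h2 | h2 <;> omega

/-! closed form -/

def mb (α d : Fin n → ℕ) (b : ℕ) (i : Fin n) : ℤ :=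
  ((Finset.univ.filter (fun j => j < i ∧ α j = b)).card : ℤ) - (Finset.univ.filter (fun j => j < i ∧ d j = b)).card

def zb (α d : Fin n → ℕ) (b : ℕ) (i : Fin n) : K := tt ^ mb α d b i

def zz (α d : Fin n → ℕ) (i : Fin n) : K := if d i = 0 then 0 else zb α d (d i) i

def ll {R : Type*} [CommRing R] (c X : R) (x v : ℕ) (z : R) : R :=
  if x = 0 then 1 - z else if x = v then X + c * z else if x < v then X * (1 - z) else -(c * (1 - z))

def AL (L : ℕ) (c : K) (d α : Fin n → ℕ) (i : Fin n) : MvPolynomial (Fin n) K :=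
  C (∏ b ∈ Finset.Ioc (d i) L, zb α d b i) * ll (C c) (X i) (α i) (d i) (C (zz α d i))

def AA (L : ℕ) (c : K) (d α : Fin n → ℕ) : MvPolynomial (Fin n) K := ∏ i, AL L c d α i

def ballw (c : K) (i : Fin n) (x : ℤ) : MvPolynomial (Fin n) K :=
  if 0 < x then X i else if x < 0 then C c else 1

def locs (x : ℤ) (v b : ℕ) (z : K) : K :=
  if v = b ∧ x.natAbs ≠ b then 1 - z else if v < b ∨ (v = b ∧ x.natAbs = b ∧ x < 0) then z else 1

theorem mm_mb (u : Fin n → ℤ) (d : Fin n → ℕ) (b : ℕ) (hb : b ≠ 0) (i : Fin n) :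
    mm (Sb (ab u) d (Finset.univ.filter (fun i => ab u i ≠ 0)) b)
      (sAb u d (Finset.univ.filter (fun i => ab u i ≠ 0)) ∅ b) i = mb (ab u) d b i := by
  unfold mm mb
  have e1 : (Finset.univ.filter (fun j => j < i ∧ ab u j = b)).card =
      ((Sb (ab u) d (Finset.univ.filter (fun i => ab u i ≠ 0)) b).filter (· < i)).card
      + (Finset.univ.filter (fun j => j < i ∧ ab u j = b ∧ d j = b)).card := by
    rw [← Finset.card_union_of_disjoint]
    · congr 1
      ext k
      simp only [Sb, Finset.mem_union, Finset.mem_filter, Finset.mem_univ, true_and]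
      constructor
      · rintro ⟨h1, h2⟩
        by_cases h3 : d k = b
        · exact Or.inr ⟨h1, h2, h3⟩
        · exact Or.inl ⟨⟨by omega, h2, h3⟩, h1⟩
      · tauto
    · rw [Finset.disjoint_left]
      intro k h1 h2
      simp only [Sb, Finset.mem_filter, Finset.mem_univ, true_and] at h1 h2
      exact h1.1.2.2 h2.2.2
  have e2 : (Finset.univ.filter (fun j => j < i ∧ d j = b)).card =
      ((sAb u d (Finset.univ.filter (fun i => ab u i ≠ 0)) ∅ b).filter (· < i)).card
      + (Finset.univ.filter (fun j => j < i ∧ ab u j = b ∧ d j = b)).card := by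
    rw [← Finset.card_union_of_disjoint]
    · congr 1
      ext k
      simp only [sAb, Finset.mem_union, Finset.mem_filter, Finset.mem_univ, true_and, Finset.notMem_empty,
        not_false_eq_true]
      constructor
      · rintro ⟨h1, h2⟩
        by_cases h3 : ab u k = b
        · exact Or.inr ⟨h1, h3, h2⟩
        · exact Or.inl ⟨⟨h2, fun h => h3 h.2⟩, h1⟩
      · tauto
    · rw [Finset.disjoint_left]
      intro k h1 h2
      simp only [sAb, Finset.mem_filter, Finset.mem_univ, true_and, Finset.notMem_empty,
        not_false_eq_true] at h1 h2
      exact h1.1.2 ⟨by omega, h2.2.1⟩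
  rw [e1, e2]
  push_cast
  ring

theorem Vb_closed (u : Fin n → ℤ) (d : Fin n → ℕ) (b : ℕ) (hb : b ≠ 0) :
    Vb u d (Finset.univ.filter (fun i => ab u i ≠ 0)) ∅ b = ∏ i, locs (u i) (d i) b (zb (ab u) d b i) := by
  unfold Vb
  rw [PE_eq]
  apply Finset.prod_congr rfl
  intro i _
  rw [mm_mb u d b hb]
  unfold loc locs zb
  have h1 : i ∈ sAb u d (Finset.univ.filter (fun i => ab u i ≠ 0)) ∅ b ↔ (d i = b ∧ (u i).natAbs ≠ b) := by
    simp only [sAb, Finset.mem_filter, Finset.mem_univ, true_and, Finset.notMem_empty, not_false_eq_true]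
    change _ ∧ ¬ (_ ∧ (u i).natAbs = b) ↔ _
    unfold ab
    constructor
    · rintro ⟨h1, h2⟩; exact ⟨h1, fun h => h2 ⟨by omega, h⟩⟩
    · rintro ⟨h1, h2⟩; exact ⟨h1, fun h => h2 h.2⟩
  have h2 : i ∈ sFb u d (Finset.univ.filter (fun i => ab u i ≠ 0)) ∅ b ↔
      (d i < b ∨ (d i = b ∧ (u i).natAbs = b ∧ u i < 0)) := by
    simp only [sFb, Finset.mem_filter, Finset.mem_univ, true_and, Finset.notMem_empty, not_false_eq_true]
    unfold ab
    constructor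
    · rintro (h | h)
      · exact Or.inl h
      · exact Or.inr ⟨h.1, h.2.2.1, h.2.2.2⟩
    · rintro (h | h)
      · exact Or.inl h
      · exact Or.inr ⟨h.1, by omega, h.2.1, h.2.2⟩
  simp only [h1, h2]

theorem locs_prod (L : ℕ) (x : ℤ) (v : ℕ) (hv : v ≤ L) (z : ℕ → K) :
    ∏ b ∈ Finset.Icc 1 L, locs x v b (z b) = (if v = 0 then 1 else locs x v v (z v)) * ∏ b ∈ Finset.Ioc v L, z b := by
  have h1 : ∀ b ∈ Finset.Ioc v L, locs x v b (z b) = z b := by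
    intro b hb
    rw [Finset.mem_Ioc] at hb
    unfold locs
    rw [if_neg (by omega), if_pos (Or.inl hb.1)]
  by_cases h0 : v = 0
  · rw [if_pos h0, one_mul]
    subst h0
    exact Finset.prod_congr rfl h1
  · rw [if_neg h0]
    have hu : Finset.Icc 1 L = (Finset.Ico 1 v ∪ {v}) ∪ Finset.Ioc v L := by
      ext b
      simp only [Finset.mem_union, Finset.mem_Icc, Finset.mem_Ico, Finset.mem_singleton, Finset.mem_Ioc]
      omega
    rw [hu, Finset.prod_union, Finset.prod_union, Finset.prod_singleton, Finset.prod_congr rfl h1]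
    · congr 1
      rw [Finset.prod_eq_one, one_mul]
      intro b hb
      rw [Finset.mem_Ico] at hb
      unfold locs
      rw [if_neg (by omega), if_neg (by omega)]
    · rw [Finset.disjoint_left]; intro b; simp; omega
    · rw [Finset.disjoint_left]; intro b; simp; omega

theorem signs_sum (L : ℕ) (c : K) (α d : Fin n → ℕ) (hdL : ∀ i, d i ≤ L) :
    ∑ u ∈ Fintype.piFinset (fun i => ({(α i : ℤ), -(α i : ℤ)} : Finset ℤ)),
      C (VB L u d) * ∏ i, ballw c i (u i) = AA L c d α := by
  have hterm : ∀ u ∈ Fintype.piFinset (fun i => ({(α i : ℤ), -(α i : ℤ)} : Finset ℤ)),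
      C (VB L u d) * ∏ i, ballw c i (u i) = ∏ i, (if SOK (u i) (d i) then
        C ((if u i < 0 ∧ d i ≠ (u i).natAbs then -1 else 1) *
          ((if d i = 0 then 1 else locs (u i) (d i) (d i) (zb α d (d i) i)) * ∏ b ∈ Finset.Ioc (d i) L, zb α d b i))
          * ballw c i (u i) else 0) := by
    intro u hu
    have hab : ab u = α := by
      funext i
      have := Fintype.mem_piFinset.mp hu i
      simp only [Finset.mem_insert, Finset.mem_singleton] at this
      unfold ab
      omega
    unfold VB
    by_cases hv : ∀ i, SOK (u i) (d i)
    · rw [if_pos hv]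
      have h1 : sgnU u d (Finset.univ.filter (fun i => ab u i ≠ 0))
          = ∏ i, if u i < 0 ∧ d i ≠ (u i).natAbs then (-1 : K) else 1 := by
        unfold sgnU
        apply Finset.prod_subset (Finset.subset_univ _)
        intro i _ hi
        rw [if_neg]
        rintro ⟨h, _⟩
        apply hi
        rw [Finset.mem_filter]
        exact ⟨Finset.mem_univ _, by unfold ab; omega⟩
      have h2 : ∏ b ∈ Finset.Icc 1 L, Vb u d (Finset.univ.filter (fun i => ab u i ≠ 0)) ∅ b
          = ∏ i, ((if d i = 0 then 1 else locs (u i) (d i) (d i) (zb α d (d i) i)) * ∏ b ∈ Finset.Ioc (d i) L, zb α d b i) := by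
        rw [Finset.prod_congr rfl (fun b hb => Vb_closed u d b (by rw [Finset.mem_Icc] at hb; omega)),
          Finset.prod_comm, hab]
        apply Finset.prod_congr rfl
        intro i _
        exact locs_prod L (u i) (d i) (hdL i) (fun b => zb α d b i)
      rw [h1, h2, ← Finset.prod_mul_distrib, map_prod, ← Finset.prod_mul_distrib]
      apply Finset.prod_congr rfl
      intro i _
      rw [if_pos (hv i)]
    · rw [if_neg hv]
      push Not at hv
      obtain ⟨i, hi⟩ := hv
      symm
      rw [map_zero, zero_mul]
      exact Finset.prod_eq_zero (Finset.mem_univ i) (if_neg hi)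
  rw [Finset.sum_congr rfl hterm]
  rw [← Finset.prod_univ_sum (t := fun i => ({(α i : ℤ), -(α i : ℤ)} : Finset ℤ))
    (f := fun i x => (if SOK x (d i) then
        C ((if x < 0 ∧ d i ≠ x.natAbs then -1 else 1) *
          ((if d i = 0 then 1 else locs x (d i) (d i) (zb α d (d i) i)) * ∏ b ∈ Finset.Ioc (d i) L, zb α d b i))
          * ballw c i x else 0))]
  unfold AA
  apply Finset.prod_congr rfl
  intro i _
  unfold AL zz
  generalize zb α d (d i) i = z
  generalize ∏ b ∈ Finset.Ioc (d i) L, zb α d b i = Z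
  generalize d i = v
  generalize α i = x
  by_cases hx : x = 0
  · subst hx
    have : ({((0 : ℕ) : ℤ), -((0 : ℕ) : ℤ)} : Finset ℤ) = {0} := by simp
    rw [this, Finset.sum_singleton]
    have hok : SOK 0 v := by constructor <;> intro h <;> omega
    rw [if_pos hok]
    unfold ll ballw locs
    by_cases hv : v = 0
    · simp [hv]
    · simp [hv, Ne.symm hv, mul_comm]
  · rw [Finset.sum_pair (by omega)]
    unfold SOK ll ballw locs
    have hx0 : 0 < x := Nat.pos_of_ne_zero hx
    have hx1 : ¬ ((x : ℤ) < 0) := by omega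
    rcases lt_trichotomy x v with h | h | h
    · have hv : v ≠ 0 := by omega
      simp [hx, hx1, hx0, h, h.le, h.ne, hv, not_le.mpr h, h.ne']
      ring
    · subst h
      simp [hx, hx1, hx0]
      ring
    · simp [hx, hx1, hx0, h, h.le, h.ne, not_le.mpr h, h.ne', not_lt.mpr h.le]
      by_cases hv : v = 0
      · simp [hv]; ring
      · simp [hv]; ring

end signed2

/-! ### Exchange relations for the classic layer -/

section Brel

def locB {A : Type*} [CommRing A] (u x b : ℕ) (z : A) : A :=
  if x = b then (if u = b then 1 else 1 - z) else if x ≠ 0 ∧ x < b then z else 1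

def DD {A : Type*} [CommRing A] (t ti : A) (b u v x y : ℕ) (z : A) : A :=
  locB u x b z * locB v y b ((if u = b then t else 1) * (if x = b then ti else 1) * z)

def vOK (u x : ℕ) : Prop := u ≠ 0 → x ≠ 0 → u ≤ x

variable {F A : Type*} [Field F] [CommRing A] [Algebra F A]

/-- abstract two-site weight -/
def VV (t : F) (Φ : ℕ → A →ₗ[F] F) (Z : ℕ → A) (I : Finset ℕ) (u v x y : ℕ) : F :=
  if vOK u x ∧ vOK v y then
    ∏ b ∈ I, Φ b (DD (algebraMap F A t) (algebraMap F A t⁻¹) b u v x y (Z b)) else 0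

theorem prod_scale1 (t : F) (I : Finset ℕ) (f g : ℕ → F) (x : ℕ) (hx : x ∈ I) (h1 : f x = t * g x)
    (h2 : ∀ b ∈ I, b ≠ x → f b = g b) : ∏ b ∈ I, f b = t * ∏ b ∈ I, g b := by
  rw [← Finset.mul_prod_erase I f hx, ← Finset.mul_prod_erase I g hx, h1, mul_assoc]
  congr 2
  apply Finset.prod_congr rfl
  intro b hb
  rw [Finset.mem_erase] at hb
  exact h2 b hb.2 hb.1

theorem VV_R1 (t : F) (ht : t ≠ 0) (Φ : ℕ → A →ₗ[F] F) (Z : ℕ → A) (R L : ℕ) (hR : 1 ≤ R)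
    (u v x y : ℕ) (hu : u ≠ 0 → R ≤ u ∧ u ≤ L) (hv : v ≠ 0 → R ≤ v ∧ v ≤ L) (hxL : x ≤ L) (hyL : y ≤ L)
    (huv : v < u) (hxy : x ≠ y) (hxy' : x = 0 ∨ (y ≠ 0 ∧ y < x)) :
    (if x = 0 then t else 1) * VV t Φ Z (Finset.Icc R L) u v y x = t * VV t Φ Z (Finset.Icc R L) v u x y := by
  have hta : algebraMap F A t * algebraMap F A t⁻¹ = 1 := by
    rw [← map_mul, mul_inv_cancel₀ ht, map_one]
  have hs : ∀ b p, Φ b (algebraMap F A t * p) = t * Φ b p := by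
    intro b p; rw [← Algebra.smul_def, map_smul, smul_eq_mul]
  unfold VV
  by_cases hok : vOK u y ∧ vOK v x
  swap
  · rw [if_neg hok, if_neg (fun h : _ ∧ _ => hok h.symm)]; simp
  rw [if_pos hok, if_pos hok.symm]
  unfold vOK at hok
  have huy : u ≤ y := hok.1 (by omega) (by omega)
  by_cases hx : x = 0
  · rw [if_pos hx]
    congr 1
    apply Finset.prod_congr rfl
    intro b hb
    rw [Finset.mem_Icc] at hb
    congr 1
    unfold DD locB
    grind
  · rw [if_neg hx, one_mul]
    apply prod_scale1 t _ _ _ x (by rw [Finset.mem_Icc]; omega)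
    · rw [← hs]
      congr 1
      unfold DD locB
      grind
    · intro b hb hbx
      rw [Finset.mem_Icc] at hb
      congr 1
      unfold DD locB
      grind

theorem VV_R3 (t : F) (ht : t ≠ 0) (Φ : ℕ → A →ₗ[F] F) (Z : ℕ → A) (R L : ℕ) (hR : 1 ≤ R)
    (u x y : ℕ) (hu : u ≠ 0 → R ≤ u ∧ u ≤ L) (hx0 : x ≠ 0 → R - 1 ≤ x) (hxL : x ≤ L) (hyL : y ≤ L)
    (hy0 : y ≠ 0 → R - 1 ≤ y)
    (hxy : x ≠ y) (hxy' : x = 0 ∨ (y ≠ 0 ∧ y < x)) :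
    (if x = 0 then t else 1) * VV t Φ Z (Finset.Icc R L) u u y x = t * VV t Φ Z (Finset.Icc R L) u u x y := by
  have hta : algebraMap F A t * algebraMap F A t⁻¹ = 1 := by
    rw [← map_mul, mul_inv_cancel₀ ht, map_one]
  have hs : ∀ b p, Φ b (algebraMap F A t * p) = t * Φ b p := by
    intro b p; rw [← Algebra.smul_def, map_smul, smul_eq_mul]
  unfold VV
  by_cases hok : vOK u y ∧ vOK u x
  swap
  · rw [if_neg hok, if_neg (fun h : _ ∧ _ => hok h.symm)]; simp
  rw [if_pos hok, if_pos hok.symm]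
  unfold vOK at hok
  by_cases hx : x = 0
  · rw [if_pos hx]
    congr 1
    apply Finset.prod_congr rfl
    intro b hb
    rw [Finset.mem_Icc] at hb
    congr 1
    unfold DD locB
    grind
  · rw [if_neg hx, one_mul]
    apply prod_scale1 t _ _ _ x (by rw [Finset.mem_Icc]; omega)
    · rw [← hs]
      congr 1
      unfold DD locB
      grind
    · intro b hb hbx
      rw [Finset.mem_Icc] at hb
      congr 1
      unfold DD locB
      grind

theorem VV_R4 (t : F) (ht : t ≠ 0) (Φ : ℕ → A →ₗ[F] F) (Z : ℕ → A) (R L : ℕ) (hR : 1 ≤ R)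
    (u v x : ℕ) (hu : u ≠ 0 → R ≤ u ∧ u ≤ L) (hv : v ≠ 0 → R ≤ v ∧ v ≤ L) :
    VV t Φ Z (Finset.Icc R L) u v x x = VV t Φ Z (Finset.Icc R L) v u x x := by
  have hta : algebraMap F A t * algebraMap F A t⁻¹ = 1 := by
    rw [← map_mul, mul_inv_cancel₀ ht, map_one]
  unfold VV
  by_cases hok : vOK u x ∧ vOK v x
  swap
  · rw [if_neg hok, if_neg (fun h : _ ∧ _ => hok h.symm)]
  rw [if_pos hok, if_pos hok.symm]
  unfold vOK at hok
  apply Finset.prod_congr rfl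
  intro b hb
  rw [Finset.mem_Icc] at hb
  congr 1
  unfold DD locB
  grind

theorem VV_R2 (t : F) (ht : t ≠ 0) (Φ : ℕ → A →ₗ[F] F) (Z : ℕ → A) (R L : ℕ) (hR : 1 ≤ R)
    (u v x y : ℕ) (hu : u ≠ 0 → R ≤ u ∧ u ≤ L) (hv : v ≠ 0 → R ≤ v ∧ v ≤ L) (hxL : x ≤ L) (hyL : y ≤ L)
    (huv : v < u) (hxy : x ≠ y) (hxy' : x = 0 ∨ (y ≠ 0 ∧ y < x)) :
    (if x = 0 then t else 1) * VV t Φ Z (Finset.Icc R L) v u y x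
      = VV t Φ Z (Finset.Icc R L) u v x y + (t - 1) * VV t Φ Z (Finset.Icc R L) v u x y := by
  have hta : algebraMap F A t * algebraMap F A t⁻¹ = 1 := by
    rw [← map_mul, mul_inv_cancel₀ ht, map_one]
  have hs : ∀ b p, Φ b (algebraMap F A t * p) = t * Φ b p := by
    intro b p; rw [← Algebra.smul_def, map_smul, smul_eq_mul]
  have huR := hu (by omega)
  by_cases huy : u ≤ y
  · -- compare everything with the third weight
    have e1 : VV t Φ Z (Finset.Icc R L) v u y x * (if x = 0 then t else 1)
        = t * ∏ b ∈ Finset.Icc R L, Φ b (if b = y ∧ u = y then 1 - Z b else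
          DD (algebraMap F A t) (algebraMap F A t⁻¹) b v u x y (Z b)) := by
      unfold VV
      rw [if_pos (by unfold vOK; constructor <;> intros <;> omega)]
      by_cases hx : x = 0
      · rw [if_pos hx, mul_comm]
        congr 1
        apply Finset.prod_congr rfl
        intro b hb
        rw [Finset.mem_Icc] at hb
        congr 1
        unfold DD locB
        grind
      · rw [if_neg hx, mul_one]
        apply prod_scale1 t _ _ _ x (by rw [Finset.mem_Icc]; omega)
        · rw [← hs]
          congr 1
          unfold DD locB
          grind
        · intro b hb hbx
          rw [Finset.mem_Icc] at hb
          congr 1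
          unfold DD locB
          grind
    have e2 : VV t Φ Z (Finset.Icc R L) u v x y = ∏ b ∈ Finset.Icc R L, Φ b (if b = y ∧ u = y then 1 - algebraMap F A t * Z b else
          DD (algebraMap F A t) (algebraMap F A t⁻¹) b v u x y (Z b)) := by
      unfold VV
      rw [if_pos (by unfold vOK; constructor <;> intros <;> omega)]
      apply Finset.prod_congr rfl
      intro b hb
      rw [Finset.mem_Icc] at hb
      congr 1
      unfold DD locB
      grind
    have e3 : VV t Φ Z (Finset.Icc R L) v u x y = ∏ b ∈ Finset.Icc R L, Φ b (if b = y ∧ u = y then 1 else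
          DD (algebraMap F A t) (algebraMap F A t⁻¹) b v u x y (Z b)) := by
      unfold VV
      rw [if_pos (by unfold vOK; constructor <;> intros <;> omega)]
      apply Finset.prod_congr rfl
      intro b hb
      rw [Finset.mem_Icc] at hb
      congr 1
      unfold DD locB
      grind
    rw [mul_comm, e1, e2, e3]
    by_cases huy' : u = y
    · have hyI : y ∈ Finset.Icc R L := by rw [Finset.mem_Icc]; omega
      have hsplit : ∀ w : ℕ → A, ∏ b ∈ Finset.Icc R L, Φ b (if b = y ∧ u = y then w b else
          DD (algebraMap F A t) (algebraMap F A t⁻¹) b v u x y (Z b)) = Φ y (w y) *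
          ∏ b ∈ (Finset.Icc R L).erase y, Φ b (DD (algebraMap F A t) (algebraMap F A t⁻¹) b v u x y (Z b)) := by
        intro w
        rw [← Finset.mul_prod_erase _ _ hyI, if_pos ⟨rfl, huy'⟩]
        congr 1
        apply Finset.prod_congr rfl
        intro b hb
        rw [Finset.mem_erase] at hb
        rw [if_neg (by tauto)]
      rw [hsplit (fun b => 1 - Z b), hsplit (fun b => 1 - algebraMap F A t * Z b), hsplit (fun _ => 1)]
      simp only [map_sub, hs]
      ring
    · simp only [huy', and_false, if_false]
      ring
  · have e3 : VV t Φ Z (Finset.Icc R L) v u x y = 0 := by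
      unfold VV
      rw [if_neg]
      unfold vOK
      intro h
      have := h.2 (by omega) (by omega)
      omega
    rw [e3, mul_zero, add_zero]
    unfold VV
    by_cases hok : vOK v y ∧ vOK u x
    swap
    · rw [if_neg hok, if_neg (fun h : _ ∧ _ => hok h.symm), mul_zero]
    rw [if_pos hok, if_pos hok.symm]
    unfold vOK at hok
    by_cases hx : x = 0
    · rw [if_pos hx]
      symm
      apply prod_scale1 t _ _ _ u (by rw [Finset.mem_Icc]; omega)
      · rw [← hs]
        congr 1
        unfold DD locB
        grind
      · intro b hb hbx
        rw [Finset.mem_Icc] at hb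
        congr 1
        unfold DD locB
        grind
    · rw [if_neg hx, one_mul]
      have hux : u ≤ x := hok.2 (by omega) hx
      by_cases hux' : u = x
      · apply Finset.prod_congr rfl
        intro b hb
        rw [Finset.mem_Icc] at hb
        congr 1
        unfold DD locB
        grind
      · have h1 : ∏ b ∈ Finset.Icc R L, Φ b (DD (algebraMap F A t) (algebraMap F A t⁻¹) b v u y x (Z b)) =
            t * ∏ b ∈ Finset.Icc R L, Φ b (if b = x then DD (algebraMap F A t) (algebraMap F A t⁻¹) b u v x y (Z b) else
              DD (algebraMap F A t) (algebraMap F A t⁻¹) b v u y x (Z b)) := by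
          apply prod_scale1 t _ _ _ x (by rw [Finset.mem_Icc]; omega)
          · rw [← hs, if_pos rfl]
            congr 1
            unfold DD locB
            grind
          · intro b hb hbx
            rw [if_neg hbx]
        rw [h1]
        symm
        apply prod_scale1 t _ _ _ u (by rw [Finset.mem_Icc]; omega)
        · rw [← hs, if_neg hux']
          congr 1
          unfold DD locB
          grind
        · intro b hb hbx
          rw [Finset.mem_Icc] at hb
          congr 1
          unfold DD locB
          grind

end Brel

/-! ### Closed form of the classic weights -/

section Bclosed

def lc {n : ℕ} (f : Fin n → ℕ) (b : ℕ) (i : Fin n) : ℕ := (Finset.univ.filter (fun j => j < i ∧ f j = b)).card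

theorem mb_lc {n : ℕ} (u d : Fin n → ℕ) (b : ℕ) (i : Fin n) : mb u d b i = (lc u b i : ℤ) - lc d b i := rfl

theorem lc_sum {n : ℕ} (f : Fin n → ℕ) (b : ℕ) (i : Fin n) :
    lc f b i = ∑ j, if (j < i ∧ f j = b) then 1 else 0 := by
  unfold lc; rw [Finset.card_filter]

theorem lc_succ {N : ℕ} (f : Fin (N + 1) → ℕ) (b : ℕ) (i : Fin N) :
    lc f b i.succ = lc f b i.castSucc + if f i.castSucc = b then 1 else 0 := by
  have := card_filter_lt_succ (Finset.univ.filter (fun j => f j = b)) i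
  rw [Finset.filter_filter, Finset.filter_filter] at this
  simp only [Finset.mem_filter, Finset.mem_univ, true_and] at this
  unfold lc
  simp only [and_comm] at this ⊢
  exact this

theorem lc_sw {N : ℕ} (f : Fin (N + 1) → ℕ) (b : ℕ) (i : Fin N) (j : Fin (N + 1)) (hj : j ≠ i.succ) :
    lc (f ∘ sw i) b j = lc f b j := by
  rw [lc_sum, lc_sum, ← Equiv.sum_comp (sw i)]
  apply Finset.sum_congr rfl
  intro k _
  have h1 : (f ∘ sw i) (sw i k) = f k := by
    have := congrFun (comp_sw_sw i f) k
    exact this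
  have h2 : sw i k < j ↔ k < j := by
    have hj' : j.1 ≠ i.1 + 1 := fun h => hj (Fin.ext (by simpa using h))
    by_cases hk1 : k = i.castSucc
    · subst hk1; rw [sw_left, Fin.lt_def, Fin.lt_def]; simp; omega
    · by_cases hk2 : k = i.succ
      · subst hk2; rw [sw_right, Fin.lt_def, Fin.lt_def]; simp; omega
      · rw [sw_val_ne i k hk1 hk2]
  rw [h1]
  simp only [h2]

theorem lc_zero {N : ℕ} (f : Fin (N + 1) → ℕ) (b : ℕ) : lc f b 0 = 0 := by
  unfold lc; simp

theorem lc_rot {N : ℕ} (f : Fin (N + 1) → ℕ) (b : ℕ) (i : Fin N) :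
    lc (gRot id f) b i.succ = lc f b i.castSucc + if f (Fin.last N) = b then 1 else 0 := by
  rw [lc_sum, lc_sum, Fin.sum_univ_succ, Fin.sum_univ_castSucc]
  have h1 : ¬ (Fin.last N < i.castSucc) := not_lt.mpr (Fin.le_last _)
  simp only [gRot, Fin.cons_zero, Fin.cons_succ, Fin.succ_pos, true_and, id, h1, false_and, if_false, add_zero,
    Fin.succ_lt_succ_iff, Fin.castSucc_lt_castSucc_iff, Fin.init]
  rw [add_comm]

theorem lc_last {N : ℕ} (f : Fin (N + 1) → ℕ) (b : ℕ) :
    lc f b (Fin.last N) + (if f (Fin.last N) = b then 1 else 0) = (Finset.univ.filter (fun j => f j = b)).card := by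
  rw [lc_sum, Finset.card_filter, Fin.sum_univ_castSucc, Fin.sum_univ_castSucc]
  simp only [Fin.castSucc_lt_last, true_and, lt_irrefl, false_and, if_false, add_zero]

def PB {n : ℕ} (u d : Fin n → ℕ) (b : ℕ) : Polynomial K :=
  ∏ j, locB (u j) (d j) b (Polynomial.C (tt ^ mb u d b j) * Polynomial.X)

theorem mm_mb' {n : ℕ} (u d : Fin n → ℕ) (b : ℕ) (hb : b ≠ 0) (i : Fin n) :
    mm (Sb u d (Finset.univ.filter (fun i => u i ≠ 0)) b) (Acb u d ∅ b) i = mb u d b i := by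
  unfold mm mb
  have e1 : (Finset.univ.filter (fun j => j < i ∧ u j = b)).card =
      ((Sb u d (Finset.univ.filter (fun i => u i ≠ 0)) b).filter (· < i)).card
      + (Finset.univ.filter (fun j => j < i ∧ u j = b ∧ d j = b)).card := by
    rw [← Finset.card_union_of_disjoint]
    · congr 1
      ext k
      simp only [Sb, Finset.mem_union, Finset.mem_filter, Finset.mem_univ, true_and]
      constructor
      · rintro ⟨h1, h2⟩
        by_cases h3 : d k = b
        · exact Or.inr ⟨h1, h2, h3⟩
        · exact Or.inl ⟨⟨by omega, h2, h3⟩, h1⟩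
      · tauto
    · rw [Finset.disjoint_left]
      intro k h1 h2
      simp only [Sb, Finset.mem_filter, Finset.mem_univ, true_and] at h1 h2
      exact h1.1.2.2 h2.2.2
  have e2 : (Finset.univ.filter (fun j => j < i ∧ d j = b)).card =
      ((Acb u d ∅ b).filter (· < i)).card
      + (Finset.univ.filter (fun j => j < i ∧ u j = b ∧ d j = b)).card := by
    rw [← Finset.card_union_of_disjoint]
    · congr 1
      ext k
      simp only [Acb, Finset.mem_union, Finset.mem_filter, Finset.mem_univ, true_and, Finset.notMem_empty,
        not_false_eq_true]
      tauto
    · rw [Finset.disjoint_left]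
      intro k h1 h2
      simp only [Acb, Finset.mem_filter, Finset.mem_univ, true_and, Finset.notMem_empty,
        not_false_eq_true] at h1 h2
      tauto
  rw [e1, e2]
  push_cast
  ring

theorem PB_PP {n : ℕ} (u d : Fin n → ℕ) (b : ℕ) (hb : b ≠ 0) :
    PP (Sb u d (Finset.univ.filter (fun i => u i ≠ 0)) b) (Fb d b) (Acb u d ∅ b) = PB u d b := by
  unfold PP PB
  apply Finset.prod_congr rfl
  intro i _
  rw [mm_mb' u d b hb]
  unfold loc locB
  simp only [Acb, Fb, Finset.mem_filter, Finset.mem_univ, true_and, Finset.notMem_empty, not_false_eq_true, and_true]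
  by_cases h1 : d i = b
  · by_cases h2 : u i = b
    · simp [h1, h2]
    · simp [h1, h2]
  · simp [h1]

theorem Wb_closed {n : ℕ} (R : ℕ) (u d : Fin n → ℕ) (b : ℕ) (hb : b ≠ 0) :
    Wb R u d (Finset.univ.filter (fun i => u i ≠ 0)) ∅ b =
      (1 - qq ^ (b - R + 1) * tt ^ (Fb d b).card) * tau (qq ^ (b - R + 1)) (PB u d b) := by
  unfold Wb; rw [PB_PP u d b hb]

def RS {N : ℕ} (u d : Fin (N + 1) → ℕ) (i : Fin N) (b : ℕ) : Polynomial K :=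
  ∏ j ∈ (Finset.univ.erase i.castSucc).erase i.succ, locB (u j) (d j) b (Polynomial.C (tt ^ mb u d b j) * Polynomial.X)

theorem PB_split {N : ℕ} (u d : Fin (N + 1) → ℕ) (i : Fin N) (b : ℕ) :
    PB u d b = RS u d i b * DD (algebraMap K (Polynomial K) tt) (algebraMap K (Polynomial K) tt⁻¹) b
      (u i.castSucc) (u i.succ) (d i.castSucc) (d i.succ) (Polynomial.C (tt ^ mb u d b i.castSucc) * Polynomial.X) := by
  unfold PB RS DD
  rw [← Finset.mul_prod_erase Finset.univ _ (Finset.mem_univ i.castSucc),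
    ← Finset.mul_prod_erase (Finset.univ.erase i.castSucc) _
      (Finset.mem_erase.mpr ⟨(castSucc_ne_succ' i).symm, Finset.mem_univ _⟩), ← mul_assoc, mul_comm]
  congr 3
  rw [← mul_assoc]
  congr 1
  have : mb u d b i.succ = (if u i.castSucc = b then 1 else 0) + (if d i.castSucc = b then -1 else 0) + mb u d b i.castSucc := by
    rw [mb_lc, mb_lc, lc_succ, lc_succ]
    push_cast
    split_ifs <;> ring
  rw [this, zpow_add₀ tt_ne, zpow_add₀ tt_ne, Polynomial.C_mul, Polynomial.C_mul]
  congr 1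
  congr 1
  · split_ifs <;> simp [Polynomial.algebraMap_eq]
  · split_ifs <;> simp [Polynomial.algebraMap_eq]

def PhiB {N : ℕ} (R : ℕ) (u d : Fin (N + 1) → ℕ) (i : Fin N) (b : ℕ) : Polynomial K →ₗ[K] K :=
  ((1 - qq ^ (b - R + 1) * tt ^ (Fb d b).card) • tau (qq ^ (b - R + 1))) ∘ₗ LinearMap.mulLeft K (RS u d i b)

theorem Fb_comp {n : ℕ} (d : Fin n → ℕ) (s : Equiv.Perm (Fin n)) (b : ℕ) : (Fb (d ∘ s) b).card = (Fb d b).card := by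
  unfold Fb
  apply Finset.card_equiv s
  intro k
  simp

theorem RS_congr {N : ℕ} (u d u' d' : Fin (N + 1) → ℕ) (i : Fin N) (b : ℕ) (hu : u' = u ∨ u' = u ∘ sw i)
    (hd : d' = d ∨ d' = d ∘ sw i) : RS u' d' i b = RS u d i b := by
  unfold RS
  apply Finset.prod_congr rfl
  intro j hj
  simp only [Finset.mem_erase, Finset.mem_univ, and_true] at hj
  have e : sw i j = j := sw_val_ne i j hj.2 hj.1
  rcases hu with rfl | rfl <;> rcases hd with rfl | rfl <;>
    simp only [mb_lc, Function.comp, e] <;>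
    simp only [show (fun x => u (sw i x)) = u ∘ sw i from rfl, show (fun x => d (sw i x)) = d ∘ sw i from rfl,
      lc_sw _ b i j hj.1]

def rOK {N : ℕ} (u d : Fin (N + 1) → ℕ) (i : Fin N) : Prop :=
  ∀ j, j ≠ i.castSucc → j ≠ i.succ → vOK (u j) (d j)

theorem rOK_congr {N : ℕ} (u d u' d' : Fin (N + 1) → ℕ) (i : Fin N) (hu : u' = u ∨ u' = u ∘ sw i)
    (hd : d' = d ∨ d' = d ∘ sw i) : rOK u' d' i ↔ rOK u d i := by
  unfold rOK
  apply forall_congr'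
  intro j
  apply imp_congr_right
  intro h1
  apply imp_congr_right
  intro h2
  have e : sw i j = j := sw_val_ne i j h1 h2
  rcases hu with rfl | rfl <;> rcases hd with rfl | rfl <;> simp [e]

theorem WB_VV {N : ℕ} (R L : ℕ) (hR : 1 ≤ R) (u d u' d' : Fin (N + 1) → ℕ) (i : Fin N) (hu : u' = u ∨ u' = u ∘ sw i)
    (hd : d' = d ∨ d' = d ∘ sw i) : WB R L u' d' = if rOK u d i then
      VV tt (PhiB R u d i) (fun b => Polynomial.C (tt ^ mb u d b i.castSucc) * Polynomial.X) (Finset.Icc R L)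
        (u' i.castSucc) (u' i.succ) (d' i.castSucc) (d' i.succ) else 0 := by
  have h1 : (∀ j, u' j ≠ 0 → d' j ≠ 0 → u' j ≤ d' j) ↔
      (rOK u d i ∧ (vOK (u' i.castSucc) (d' i.castSucc) ∧ vOK (u' i.succ) (d' i.succ))) := by
    rw [← rOK_congr u d u' d' i hu hd]
    constructor
    · intro h
      exact ⟨fun j _ _ => h j, h _, h _⟩
    · rintro ⟨h1, h2, h3⟩ j
      by_cases hj1 : j = i.castSucc
      · subst hj1; exact h2
      · by_cases hj2 : j = i.succ
        · subst hj2; exact h3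
        · exact h1 j hj1 hj2
  unfold WB VV
  by_cases hr : rOK u d i
  · rw [if_pos hr]
    by_cases hv : vOK (u' i.castSucc) (d' i.castSucc) ∧ vOK (u' i.succ) (d' i.succ)
    · rw [if_pos (h1.mpr ⟨hr, hv⟩), if_pos hv]
      apply Finset.prod_congr rfl
      intro b hb
      rw [Finset.mem_Icc] at hb
      rw [Wb_closed R _ _ b (by omega), PB_split _ _ i, RS_congr u d u' d' i b hu hd]
      have e1 : (Fb d' b).card = (Fb d b).card := by
        rcases hd with rfl | rfl
        · rfl
        · exact Fb_comp _ _ _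
      have hne := castSucc_ne_succ' i
      have e2 : mb u' d' b i.castSucc = mb u d b i.castSucc := by
        rcases hu with rfl | rfl <;> rcases hd with rfl | rfl <;> simp only [mb_lc, lc_sw _ b i _ hne]
      rw [e1, e2]
      rfl
    · rw [if_neg (fun h => hv (h1.mp h).2), if_neg hv]
  · rw [if_neg hr, if_neg (fun h => hr (h1.mp h).1)]

theorem WB_ex {N : ℕ} (R L : ℕ) (hR : 1 ≤ R) (u d : Fin (N + 1) → ℕ) (i : Fin N)
    (hu : ∀ j, u j ≠ 0 → R ≤ u j ∧ u j ≤ L) (hdL : ∀ j, d j ≤ L) (hdR : ∀ j, d j ≠ 0 → R - 1 ≤ d j)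
    (hxy : d i.castSucc ≠ d i.succ) (hxy' : d i.castSucc = 0 ∨ (d i.succ ≠ 0 ∧ d i.succ < d i.castSucc)) :
    (if u i.succ < u i.castSucc then tt * WB R L (u ∘ sw i) d else
      if u i.castSucc < u i.succ then WB R L (u ∘ sw i) d + (tt - 1) * WB R L u d else tt * WB R L u d)
    = (if d i.castSucc = 0 then tt else 1) * WB R L u (d ∘ sw i) := by
  have a1 := WB_VV R L hR u d (u ∘ sw i) d i (Or.inr rfl) (Or.inl rfl)
  have a2 := WB_VV R L hR u d u d i (Or.inl rfl) (Or.inl rfl)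
  have a3 := WB_VV R L hR u d u (d ∘ sw i) i (Or.inl rfl) (Or.inr rfl)
  simp only [Function.comp, sw_left, sw_right] at a1 a3
  rw [a1, a2, a3]
  by_cases hr : rOK u d i
  · rw [if_pos hr, if_pos hr, if_pos hr]
    rcases lt_trichotomy (u i.succ) (u i.castSucc) with h | h | h
    · rw [if_pos h]
      exact (VV_R1 tt tt_ne _ _ R L hR _ _ _ _ (hu _) (hu _) (hdL _) (hdL _) h hxy hxy').symm
    · rw [if_neg (by omega), if_neg (by omega), h]
      exact (VV_R3 tt tt_ne _ _ R L hR _ _ _ (hu _) (hdR _) (hdL _) (hdL _) (hdR _) hxy hxy').symm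
    · rw [if_neg (by omega), if_pos h]
      exact (VV_R2 tt tt_ne _ _ R L hR _ _ _ _ (hu _) (hu _) (hdL _) (hdL _) h hxy hxy').symm
  · rw [if_neg hr, if_neg hr, if_neg hr]; simp

theorem WB_ex_eq {N : ℕ} (R L : ℕ) (hR : 1 ≤ R) (u d : Fin (N + 1) → ℕ) (i : Fin N)
    (hu : ∀ j, u j ≠ 0 → R ≤ u j ∧ u j ≤ L) (hxy : d i.castSucc = d i.succ) :
    WB R L (u ∘ sw i) d = WB R L u d := by
  have a1 := WB_VV R L hR u d (u ∘ sw i) d i (Or.inr rfl) (Or.inl rfl)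
  have a2 := WB_VV R L hR u d u d i (Or.inl rfl) (Or.inl rfl)
  simp only [Function.comp, sw_left, sw_right] at a1
  rw [a1, a2, hxy, VV_R4 tt tt_ne _ _ R L hR _ _ _ (hu _) (hu _)]

end Bclosed

/-! ### Rotation of the classic weights -/

section Brot

theorem locB_comp (u x b : ℕ) (z w : Polynomial K) : (locB u x b z).comp w = locB u x b (z.comp w) := by
  unfold locB
  split_ifs <;> simp

theorem shp_PB {n : ℕ} (e : ℤ) (u d : Fin n → ℕ) (b : ℕ) :
    shp e (PB u d b) = ∏ j, locB (u j) (d j) b (Polynomial.C (tt ^ (mb u d b j + e)) * Polynomial.X) := by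
  unfold shp PB
  rw [Polynomial.prod_comp]
  apply Finset.prod_congr rfl
  intro i _
  rw [locB_comp]
  congr 1
  rw [zpow_add₀ tt_ne, Polynomial.C_mul]
  simp; ring

def ee (x y b : ℕ) : ℤ := (if x = b then 1 else 0) - (if y = b then 1 else 0)

theorem mb_last {N : ℕ} (u d : Fin (N + 1) → ℕ) (b : ℕ)
    (hc : (Finset.univ.filter (fun j => u j = b)).card = (Finset.univ.filter (fun j => d j = b)).card) :
    mb u d b (Fin.last N) + ee (u (Fin.last N)) (d (Fin.last N)) b = 0 := by
  rw [← lc_last, ← lc_last] at hc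
  rw [mb_lc]
  unfold ee
  have := congrArg (Nat.cast : ℕ → ℤ) hc
  push_cast at this
  linarith

theorem PB_rot {N : ℕ} (u d : Fin (N + 1) → ℕ) (b : ℕ)
    (hc : (Finset.univ.filter (fun j => u j = b)).card = (Finset.univ.filter (fun j => d j = b)).card) :
    PB (gRot id u) (gRot id d) b = shp (ee (u (Fin.last N)) (d (Fin.last N)) b) (PB u d b) := by
  rw [shp_PB]
  unfold PB
  rw [Fin.prod_univ_succ, Fin.prod_univ_castSucc, mul_comm, mb_last u d b hc]
  congr 1
  · apply Finset.prod_congr rfl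
    intro i _
    have : mb (gRot id u) (gRot id d) b i.succ = mb u d b i.castSucc + ee (u (Fin.last N)) (d (Fin.last N)) b := by
      rw [mb_lc, mb_lc, lc_rot, lc_rot]
      unfold ee
      push_cast
      ring
    rw [this]
    rfl
  · rw [mb_lc, lc_zero, lc_zero]
    simp [gRot]

theorem shp_shp (e f : ℤ) (p : Polynomial K) : shp e (shp f p) = shp (e + f) p := by
  unfold shp
  rw [Polynomial.comp_assoc]
  congr 1
  rw [zpow_add₀ tt_ne, Polynomial.C_mul]
  simp; ring

theorem shp_zero (p : Polynomial K) : shp 0 p = p := by unfold shp; simp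

theorem Fb_rot {N : ℕ} (d : Fin (N + 1) → ℕ) (b : ℕ) : (Fb (gRot id d) b).card = (Fb d b).card := by
  unfold Fb
  rw [Finset.card_filter, Finset.card_filter, Fin.sum_univ_succ, Fin.sum_univ_castSucc, add_comm]
  rfl

theorem PB_eval_one {N : ℕ} (u d : Fin (N + 1) → ℕ) (b : ℕ) (hb : b ≠ 0)
    (hc : (Finset.univ.filter (fun j => u j = b)).card = (Finset.univ.filter (fun j => d j = b)).card)
    (hx : u (Fin.last N) = b) (hy : d (Fin.last N) ≠ b) : (PB u d b).eval 1 = 0 := by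
  rw [← PB_PP u d b hb]
  set S := Sb u d (Finset.univ.filter (fun i => u i ≠ 0)) b with hS
  have hl : Fin.last N ∈ S := by
    rw [hS]; simp only [Sb, Finset.mem_filter, Finset.mem_univ, true_and]; exact ⟨by omega, hx, hy⟩
  have e1 : PP S (Fb d b) (Acb u d ∅ b) = PP (S.erase (Fin.last N)) (Fb d b) (Acb u d ∅ b) := by
    unfold PP
    apply Finset.prod_congr rfl
    intro i _
    have : mm S (Acb u d ∅ b) i = mm (S.erase (Fin.last N)) (Acb u d ∅ b) i := by
      unfold mm
      congr 3
      ext k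
      simp only [Finset.mem_filter, Finset.mem_erase]
      constructor
      · rintro ⟨h1, h2⟩
        exact ⟨⟨fun h => absurd (h ▸ h2) (not_lt.mpr (Fin.le_last _)), h1⟩, h2⟩
      · rintro ⟨⟨_, h1⟩, h2⟩; exact ⟨h1, h2⟩
    rw [this]
  rw [e1]
  apply PP_cross
  have hcard : S.card = (Acb u d ∅ b).card := by
    have f1 : (Finset.univ.filter (fun j => u j = b)).card = S.card +
        (Finset.univ.filter (fun j => u j = b ∧ d j = b)).card := by
      rw [← Finset.card_union_of_disjoint]
      · congr 1
        ext k
        simp only [hS, Sb, Finset.mem_union, Finset.mem_filter, Finset.mem_univ, true_and]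
        constructor
        · intro h2
          by_cases h3 : d k = b
          · exact Or.inr ⟨h2, h3⟩
          · exact Or.inl ⟨by omega, h2, h3⟩
        · tauto
      · rw [Finset.disjoint_left]
        intro k h1 h2
        simp only [hS, Sb, Finset.mem_filter, Finset.mem_univ, true_and] at h1 h2
        exact h1.2.2 h2.2
    have f2 : (Finset.univ.filter (fun j => d j = b)).card = (Acb u d ∅ b).card +
        (Finset.univ.filter (fun j => u j = b ∧ d j = b)).card := by
      rw [← Finset.card_union_of_disjoint]
      · congr 1
        ext k
        simp only [Acb, Finset.mem_union, Finset.mem_filter, Finset.mem_univ, true_and, Finset.notMem_empty,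
          not_false_eq_true]
        tauto
      · rw [Finset.disjoint_left]
        intro k h1 h2
        simp only [Acb, Finset.mem_filter, Finset.mem_univ, true_and, Finset.notMem_empty,
          not_false_eq_true] at h1 h2
        tauto
    omega
  rw [← hcard]
  exact Finset.card_erase_lt_of_mem hl

theorem Wb_rot {N : ℕ} (R : ℕ) (u d : Fin (N + 1) → ℕ) (b : ℕ) (hb : b ≠ 0)
    (hc : (Finset.univ.filter (fun j => u j = b)).card = (Finset.univ.filter (fun j => d j = b)).card) :
    (if u (Fin.last N) = b then qq ^ (b - R + 1) else 1) *
      Wb R (gRot id u) (gRot id d) (Finset.univ.filter (fun i => gRot id u i ≠ 0)) ∅ b =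
    (if d (Fin.last N) = b then qq ^ (b - R + 1) else 1) *
      Wb R u d (Finset.univ.filter (fun i => u i ≠ 0)) ∅ b := by
  rw [Wb_closed _ _ _ _ hb, Wb_closed _ _ _ _ hb, Fb_rot, PB_rot u d b hc]
  have hq := one_sub_qt_ne' (b - R)
  by_cases h1 : u (Fin.last N) = b <;> by_cases h2 : d (Fin.last N) = b
  · rw [if_pos h1, if_pos h2]
    have : ee (u (Fin.last N)) (d (Fin.last N)) b = 0 := by unfold ee; simp [h1, h2]
    rw [this, shp_zero]
  · rw [if_pos h1, if_neg h2]
    have : ee (u (Fin.last N)) (d (Fin.last N)) b = 1 := by unfold ee; simp [h1, h2]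
    rw [this, mul_left_comm, tau_shift _ hq, PB_eval_one u d b hb hc h1 h2, sub_zero, one_mul]
  · rw [if_neg h1, if_pos h2]
    have : ee (u (Fin.last N)) (d (Fin.last N)) b = -1 := by unfold ee; simp [h1, h2]
    have h3 := tau_shift _ hq (PB (gRot id u) (gRot id d) b)
    have h4 : (PB (gRot id u) (gRot id d) b).eval 1 = 0 := by
      unfold PB
      rw [Polynomial.eval_prod]
      apply Finset.prod_eq_zero (Finset.mem_univ 0)
      rw [mb_lc, lc_zero, lc_zero]
      unfold locB
      have g1 : gRot id d 0 = b := by unfold gRot; simpa using h2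
      have g2 : gRot id u 0 ≠ b := by unfold gRot; simpa using h1
      rw [if_pos g1, if_neg g2]
      simp
    rw [h4, sub_zero, PB_rot u d b hc, this, shp_shp] at h3
    rw [this, ← h3, add_neg_cancel, shp_zero, one_mul, mul_left_comm]
  · rw [if_neg h1, if_neg h2]
    have : ee (u (Fin.last N)) (d (Fin.last N)) b = 0 := by unfold ee; simp [h1, h2]
    rw [this, shp_zero]

theorem q_ind_prod (R L x : ℕ) (hR : 1 ≤ R) (hx : x ≠ 0 → R - 1 ≤ x) (hxL : x ≤ L) :
    ∏ b ∈ Finset.Icc R L, (if x = b then qq ^ (b - R + 1) else 1) = qq ^ (x - (R - 1)) := by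
  rw [Finset.prod_ite_eq]
  split_ifs with h
  · rw [Finset.mem_Icc] at h
    congr 1; omega
  · rw [Finset.mem_Icc] at h
    have : x - (R - 1) = 0 := by
      by_cases hx0 : x = 0
      · omega
      · have := hx hx0; omega
    rw [this, pow_zero]

theorem WB_rot {N : ℕ} (R L : ℕ) (hR : 1 ≤ R) (u d : Fin (N + 1) → ℕ)
    (hu : ∀ j, u j ≠ 0 → R ≤ u j ∧ u j ≤ L) (hdL : ∀ j, d j ≤ L) (hdR : ∀ j, d j ≠ 0 → R - 1 ≤ d j)
    (hc : ∀ b, R ≤ b → b ≤ L →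
      (Finset.univ.filter (fun j => u j = b)).card = (Finset.univ.filter (fun j => d j = b)).card) :
    qq ^ (u (Fin.last N) - (R - 1)) * WB R L (gRot id u) (gRot id d) =
      qq ^ (d (Fin.last N) - (R - 1)) * WB R L u d := by
  have h1 : (∀ i, gRot id u i ≠ 0 → gRot id d i ≠ 0 → gRot id u i ≤ gRot id d i) ↔
      (∀ i, u i ≠ 0 → d i ≠ 0 → u i ≤ d i) := by
    rw [Fin.forall_fin_succ, Fin.forall_fin_succ']
    unfold gRot
    simp only [Fin.cons_zero, Fin.cons_succ, id, Fin.init]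
    tauto
  unfold WB
  by_cases h : ∀ i, u i ≠ 0 → d i ≠ 0 → u i ≤ d i
  · rw [if_pos h, if_pos (h1.mpr h)]
    rw [← q_ind_prod R L (u (Fin.last N)) hR, ← q_ind_prod R L (d (Fin.last N)) hR,
      ← Finset.prod_mul_distrib, ← Finset.prod_mul_distrib]
    · apply Finset.prod_congr rfl
      intro b hb
      rw [Finset.mem_Icc] at hb
      exact Wb_rot R u d b (by omega) (hc b hb.1 hb.2)
    · exact hdR _
    · exact hdL _
    · intro h; have := hu _ h; omega
    · by_cases h0 : u (Fin.last N) = 0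
      · omega
      · exact (hu _ h0).2
  · rw [if_neg h, if_neg (fun h' => h (h1.mp h')), mul_zero, mul_zero]

end Brot

/-! ### The classic step -/

section gamma

def wlev {n : ℕ} (l : Fin n → ℕ) (r : ℕ) : Fin n → ℕ := fun i => l i - r

def gam {n : ℕ} (r L : ℕ) (l : Fin n → ℕ) (G : (Fin n → ℕ) → MvPolynomial (Fin n) K) (α : Fin n → ℕ) :
    MvPolynomial (Fin n) K :=
  ∑ κ ∈ SnFinset (lamTrunc l (r + 1)), C (WB (r + 1) L κ α) * G κ

theorem trunc_val {n : ℕ} (L : ℕ) (l : Fin n → ℕ) (hL : ∀ i, l i ≤ L) (r : ℕ) (α : Fin n → ℕ)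
    (hα : α ∈ Sn (lamTrunc l r)) (j : Fin n) : α j ≤ L ∧ (α j ≠ 0 → r ≤ α j) := by
  obtain ⟨k, hk⟩ := Sn_val _ _ hα j
  rw [hk]
  unfold lamTrunc
  have := hL k
  split_ifs with h
  · exact ⟨this, fun _ => h⟩
  · exact ⟨Nat.zero_le _, fun h => absurd rfl h⟩

theorem cnt_card {n : ℕ} (μ : Fin n → ℕ) (a : ℕ) : cnt μ a = (Finset.univ.filter (fun j => μ j = a)).card := by
  unfold cnt; rw [Finset.card_filter]

theorem trunc_cnt {n : ℕ} (l : Fin n → ℕ) (r : ℕ) (α κ : Fin n → ℕ)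
    (hα : α ∈ Sn (lamTrunc l r)) (hκ : κ ∈ Sn (lamTrunc l (r + 1))) (b : ℕ) (hb : r + 1 ≤ b) :
    (Finset.univ.filter (fun j => κ j = b)).card = (Finset.univ.filter (fun j => α j = b)).card := by
  rw [← cnt_card, ← cnt_card, (Sn_iff _ _).mp hα, (Sn_iff _ _).mp hκ]
  unfold cnt
  apply Finset.sum_congr rfl
  intro i _
  unfold lamTrunc
  congr 1
  apply propext
  split_ifs <;> omega

/-- the Hecke action on a standard family -/
theorem PFam.act {N : ℕ} {O : Set (Fin (N + 1) → ℕ)} {G : (Fin (N + 1) → ℕ) → MvPolynomial (Fin (N + 1)) K}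
    (h : PFam N O id (fun _ _ => 1) G) (κ : Fin (N + 1) → ℕ) (hκ : κ ∈ O) (i : Fin N) :
    Th i (G κ) = C (if κ i.succ < κ i.castSucc then 1 else if κ i.castSucc < κ i.succ then tt else 0) * G (κ ∘ sw i)
      + C (if κ i.succ < κ i.castSucc then 0 else if κ i.castSucc < κ i.succ then tt - 1 else tt) * G κ := by
  rcases lt_trichotomy (κ i.succ) (κ i.castSucc) with h1 | h1 | h1
  · rw [h.hstep κ hκ i h1, if_pos h1, if_pos h1]
    simp
  · rw [h.heq κ hκ i h1.symm]
    simp [h1]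
  · have h2 := h.hstep (κ ∘ sw i) (h.hO κ hκ i) i (by simpa [sw_left, sw_right] using h1)
    rw [comp_sw_sw, C_1, one_mul] at h2
    have h3 := Th_quad i (G (κ ∘ sw i))
    rw [h2] at h3
    rw [h3, if_neg (by omega), if_pos h1, if_neg (by omega), if_pos h1]

def keyK (L x : ℕ) : ℕ := if x = 0 then L + 1 else if x = L + 1 then 0 else x

theorem keyK_inj (L : ℕ) : Function.Injective (keyK L) := by
  intro x y h
  unfold keyK at h
  split_ifs at h <;> omega

theorem gam_Th {N : ℕ} (r L : ℕ) (l : Fin (N + 1) → ℕ)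
    (G : (Fin (N + 1) → ℕ) → MvPolynomial (Fin (N + 1)) K)
    (hG : PFam N (Sn (lamTrunc l (r + 1))) id (fun _ _ => 1) G) (α : Fin (N + 1) → ℕ) (i : Fin N) :
    Th i (gam r L l G α) = ∑ κ ∈ SnFinset (lamTrunc l (r + 1)),
      C (if κ i.succ < κ i.castSucc then tt * WB (r + 1) L (κ ∘ sw i) α else
      if κ i.castSucc < κ i.succ then WB (r + 1) L (κ ∘ sw i) α + (tt - 1) * WB (r + 1) L κ α
        else tt * WB (r + 1) L κ α) * G κ := by
  unfold gam
  rw [Th_sum]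
  have h1 : ∀ κ ∈ SnFinset (lamTrunc l (r + 1)), Th i (C (WB (r + 1) L κ α) * G κ) =
      C (WB (r + 1) L κ α * (if κ i.succ < κ i.castSucc then 1 else if κ i.castSucc < κ i.succ then tt else 0))
        * G (κ ∘ sw i)
      + C (WB (r + 1) L κ α * (if κ i.succ < κ i.castSucc then 0 else if κ i.castSucc < κ i.succ then tt - 1 else tt))
        * G κ := by
    intro κ hκ
    rw [Th_C_mul, hG.act κ ((mem_SnFinset _ _).mp hκ) i, mul_add, C_mul, C_mul]
    ring
  rw [Finset.sum_congr rfl h1, Finset.sum_add_distrib]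
  have h2 : ∑ κ ∈ SnFinset (lamTrunc l (r + 1)),
      C (WB (r + 1) L κ α * (if κ i.succ < κ i.castSucc then 1 else if κ i.castSucc < κ i.succ then tt else 0))
        * G (κ ∘ sw i) = ∑ κ ∈ SnFinset (lamTrunc l (r + 1)),
      C (WB (r + 1) L (κ ∘ sw i) α * (if κ i.castSucc < κ i.succ then 1 else if κ i.succ < κ i.castSucc then tt else 0))
        * G κ := by
    apply Finset.sum_nbij' (fun κ => κ ∘ sw i) (fun κ => κ ∘ sw i)
    · intro κ hκ
      rw [mem_SnFinset] at hκ ⊢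
      exact Sn_comp _ _ _ hκ
    · intro κ hκ
      rw [mem_SnFinset] at hκ ⊢
      exact Sn_comp _ _ _ hκ
    · intro κ _; exact comp_sw_sw i κ
    · intro κ _; exact comp_sw_sw i κ
    · intro κ _
      rw [comp_sw_sw]
      simp only [Function.comp, sw_left, sw_right]
  rw [h2, ← Finset.sum_add_distrib]
  apply Finset.sum_congr rfl
  intro κ _
  rw [← add_mul, ← C_add]
  congr 2
  rcases lt_trichotomy (κ i.succ) (κ i.castSucc) with h1 | h1 | h1
  · rw [if_neg (by omega), if_pos h1, if_pos h1, if_pos h1]; ring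
  · simp [h1]; ring
  · rw [if_pos h1, if_neg (by omega), if_pos h1, if_neg (by omega), if_pos h1]; ring

theorem gam_PFam {N : ℕ} (r L : ℕ) (l : Fin (N + 1) → ℕ) (hL : ∀ i, l i ≤ L)
    (G : (Fin (N + 1) → ℕ) → MvPolynomial (Fin (N + 1)) K)
    (hG : PFam N (Sn (lamTrunc l (r + 1))) id (fun _ _ => 1) G) :
    PFam N (Sn (lamTrunc l r)) (keyK L) czero (gam r L l G) where
  hO κ hκ i := Sn_comp _ _ _ hκ
  hkey := keyK_inj L
  hstep α hα i hlt := by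
    have v1 := trunc_val L l hL r α hα
    have w1 := (v1 i.castSucc).1
    have w2 := (v1 i.succ).1
    unfold keyK at hlt
    have hxy : α i.castSucc ≠ α i.succ := by intro h; rw [h] at hlt; exact lt_irrefl _ hlt
    have hxy' : α i.castSucc = 0 ∨ (α i.succ ≠ 0 ∧ α i.succ < α i.castSucc) := by
      split_ifs at hlt <;> omega
    rw [gam_Th r L l G hG]
    unfold gam
    rw [Finset.mul_sum]
    apply Finset.sum_congr rfl
    intro κ hκ
    rw [mem_SnFinset] at hκ
    have v2 := trunc_val L l hL (r + 1) κ hκ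
    rw [WB_ex (r + 1) L (by omega) κ α i (fun j h => ⟨(v2 j).2 h, (v2 j).1⟩) (fun j => (v1 j).1)
      (fun j h => by have := (v1 j).2 h; omega) hxy hxy', C_mul, mul_assoc]
    rfl
  heq α hα i he := by
    rw [gam_Th r L l G hG]
    unfold gam
    rw [Finset.mul_sum]
    apply Finset.sum_congr rfl
    intro κ hκ
    rw [mem_SnFinset] at hκ
    have v2 := trunc_val L l hL (r + 1) κ hκ
    rw [WB_ex_eq (r + 1) L (by omega) κ α i (fun j h => ⟨(v2 j).2 h, (v2 j).1⟩) he, ← mul_assoc, ← C_mul]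
    congr 2
    split_ifs <;> ring

def rotP (N : ℕ) : Equiv.Perm (Fin (N + 1)) := (finRotate (N + 1)).symm

theorem gRot_rotP {N : ℕ} (κ : Fin (N + 1) → ℕ) : gRot id κ = κ ∘ rotP N := by
  funext j
  unfold gRot rotP
  refine Fin.cases ?_ (fun i => ?_) j
  · rw [Fin.cons_zero, Function.comp, id]
    congr 1
  · rw [Fin.cons_succ, Function.comp]
    unfold Fin.init
    congr 1
    rw [Equiv.eq_symm_apply]
    exact finRotate_of_lt i.2

theorem gRot_ins {N : ℕ} (x : ℕ) (β : Fin N → ℕ) :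
    gRot id ((Fin.last N).insertNth x β : Fin (N + 1) → ℕ) = ((0 : Fin (N + 1)).insertNth x β : Fin (N + 1) → ℕ) := by
  unfold gRot
  rw [Fin.insertNth_zero, Fin.insertNth_last]
  simp

theorem ins_last_init {N : ℕ} (κ : Fin (N + 1) → ℕ) :
    ((Fin.last N).insertNth (κ (Fin.last N)) (Fin.init κ) : Fin (N + 1) → ℕ) = κ := by
  rw [Fin.insertNth_last]; simp

theorem gam_rho {N : ℕ} (r L : ℕ) (l : Fin (N + 1) → ℕ) (hL : ∀ i, l i ≤ L) (d : ℕ)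
    (G : (Fin (N + 1) → ℕ) → MvPolynomial (Fin (N + 1)) K)
    (hρ : ∀ x β, ((Fin.last N).insertNth x β : Fin (N + 1) → ℕ) ∈ Sn (lamTrunc l (r + 1)) →
      yrho N (evd d (G ((Fin.last N).insertNth x β))) = (qq ^ (x - r))⁻¹ • evd d (G ((0 : Fin (N + 1)).insertNth x β)))
    (x : ℕ) (β : Fin N → ℕ) (hα : ((Fin.last N).insertNth x β : Fin (N + 1) → ℕ) ∈ Sn (lamTrunc l r)) :
    yrho N (evd d (gam r L l G ((Fin.last N).insertNth x β)))
      = (qq ^ (x - r))⁻¹ • evd d (gam r L l G ((0 : Fin (N + 1)).insertNth x β)) := by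
  rw [← gRot_ins]
  set α : Fin (N + 1) → ℕ := (Fin.last N).insertNth x β with hαd
  have hx : α (Fin.last N) = x := by rw [hαd]; simp
  have v1 := trunc_val L l hL r α hα
  unfold gam
  rw [evd_sum, evd_sum, map_sum, Finset.smul_sum]
  apply Finset.sum_nbij' (fun κ => κ ∘ rotP N) (fun κ => κ ∘ (rotP N).symm)
  · intro κ hκ
    rw [mem_SnFinset] at hκ ⊢
    exact Sn_comp _ _ _ hκ
  · intro κ hκ
    rw [mem_SnFinset] at hκ ⊢
    exact Sn_comp _ _ _ hκ
  · intro κ _; funext j; simp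
  · intro κ _; funext j; simp
  · intro κ hκ
    rw [mem_SnFinset] at hκ
    have v2 := trunc_val L l hL (r + 1) κ hκ
    rw [← gRot_rotP]
    have h1 := hρ (κ (Fin.last N)) (Fin.init κ) (by rw [ins_last_init]; exact hκ)
    rw [← gRot_ins, ins_last_init] at h1
    rw [evd_C_mul, evd_C_mul, map_smul, h1, smul_smul, smul_smul]
    congr 1
    have h2 := WB_rot (r + 1) L (by omega) κ α (fun j h => ⟨(v2 j).2 h, (v2 j).1⟩) (fun j => (v1 j).1)
      (fun j h => by have := (v1 j).2 h; omega) (fun b hb _ => trunc_cnt l r α κ hα hκ b hb)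
    rw [hx, Nat.add_sub_cancel] at h2
    have q1 : qq ^ (κ (Fin.last N) - r) ≠ 0 := pow_ne_zero _ qq_ne
    have q2 : qq ^ (x - r) ≠ 0 := pow_ne_zero _ qq_ne
    field_simp
    linear_combination -h2

theorem csize_Sn {n : ℕ} (f : ℕ → ℕ) (l α : Fin n → ℕ) (h : α ∈ Sn l) : csize (f ∘ α) = csize (f ∘ l) := by
  obtain ⟨σ, rfl⟩ := h
  unfold csize
  exact Equiv.sum_comp σ.symm (fun i => f (l i))

theorem trunc_partition {n : ℕ} (l : Fin n → ℕ) (hl : IsPartition l) (r : ℕ) : IsPartition (lamTrunc l r) := by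
  intro i j hij
  have := hl i j hij
  unfold lamTrunc
  split_ifs <;> omega

theorem gam_vanish0 {N : ℕ} (r L : ℕ) (l : Fin (N + 1) → ℕ) (hl : IsPartition l) (hL : ∀ i, l i ≤ L)
    (d : ℕ) (hw : csize ((fun x => x - r) ∘ (lamTrunc l r)) = d)
    (G : (Fin (N + 1) → ℕ) → MvPolynomial (Fin (N + 1)) K)
    (hG : PFam N (Sn (lamTrunc l (r + 1))) id (fun _ _ => 1) G)
    (hdeg : ∀ κ ∈ Sn (lamTrunc l (r + 1)), (G κ).totalDegree ≤ d)
    (hq : ∀ x β, ((Fin.last N).insertNth x β : Fin (N + 1) → ℕ) ∈ Sn (lamTrunc l (r + 1)) →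
      yrho N (evd d (G ((Fin.last N).insertNth x β))) = (qq ^ (x - r))⁻¹ • evd d (G ((0 : Fin (N + 1)).insertNth x β)))
    (k : ℕ) (hkN : k ≤ N + 1) (hk : ∀ i : Fin (N + 1), lamTrunc l r i = 0 ↔ k ≤ i.1)
    (ν : Fin (N + 1) → ℕ) (hν : csize ν ≤ d + k) (hν0 : ∀ i, i.1 < k → ν i ≠ 0)
    (hne : ν ≠ fun i => lamTrunc l r i - r + if i.1 < k then 1 else 0) :
    eval (fun i => qq⁻¹ * evalPt ν i) (gam r L l G (lamTrunc l r)) = 0 := by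
  have hP := gam_PFam r L l hL G hG
  have a1 : ∀ α ∈ Sn (lamTrunc l r), ∀ i, keyK L (α i) ≤ keyK L 0 := by
    intro α hα i
    have := (trunc_val L l hL r α hα i).1
    unfold keyK
    split_ifs <;> omega
  have a2 : ∀ α ∈ Sn (lamTrunc l r), ∀ i j, α i ≠ 0 → α i ≤ α j → keyK L (α i) ≤ keyK L (α j) := by
    intro α hα i j h1 h2
    have g1 := (trunc_val L l hL r α hα i).1
    have g2 := (trunc_val L l hL r α hα j).1
    unfold keyK
    split_ifs <;> omega
  have a3 : ∀ α ∈ Sn (lamTrunc l r), csize ((fun x => x - r) ∘ α) = d := by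
    intro α hα
    rw [csize_Sn _ _ _ hα, hw]
  have a4 : ∀ α ∈ Sn (lamTrunc l r), (gam r L l G α).totalDegree ≤ d := by
    intro α hα
    unfold gam
    apply totalDegree_finsetSum_le
    intro κ hκ
    rw [mem_SnFinset] at hκ
    refine (totalDegree_mul _ _).trans ?_
    rw [totalDegree_C, zero_add]
    exact hdeg κ hκ
  have a5 : ∀ α ∈ Sn (lamTrunc l r), gRot id α ∈ Sn (lamTrunc l r) := by
    intro α hα
    rw [gRot_rotP]
    exact Sn_comp _ _ _ hα
  exact hP.vanish a1 (fun x => x - r) a2 (Nat.zero_sub r) d a3 a4 (gam_rho r L l hL d G hq) a5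
    (lamTrunc l r) (trunc_partition l hl r) (Sn_self _) k hkN hk ν hν hν0 hne

theorem gam_vanish {N : ℕ} (r L : ℕ) (hr : 1 ≤ r) (l : Fin (N + 1) → ℕ) (hl : IsPartition l) (hL : ∀ i, l i ≤ L)
    (G : (Fin (N + 1) → ℕ) → MvPolynomial (Fin (N + 1)) K)
    (hG : PFam N (Sn (lamTrunc l (r + 1))) id (fun _ _ => 1) G)
    (hdeg : ∀ κ ∈ Sn (lamTrunc l (r + 1)), (G κ).totalDegree ≤ csize (wlev l r))
    (hV : ∀ ν, csize ν ≤ csize (wlev l r) → ν ≠ wlev l r →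
      eval (fun i => qq ^ r * evalPt ν i) (G (lamTrunc l (r + 1))) = 0)
    (k : ℕ) (hkN : k ≤ N + 1) (hk : ∀ i : Fin (N + 1), l i < r ↔ k ≤ i.1)
    (ν : Fin (N + 1) → ℕ) (hν : csize ν ≤ csize (wlev l r) + k) (hν0 : ∀ i, i.1 < k → ν i ≠ 0)
    (hne : ν ≠ wlev l (r - 1)) :
    eval (fun i => qq ^ (r - 1) * evalPt ν i) (gam r L l G (lamTrunc l r)) = 0 := by
  have hqr : qq ^ r ≠ 0 := pow_ne_zero _ qq_ne
  have hS := hG.scl (qq ^ r) hqr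
  have hw : (fun x => x - r) ∘ (lamTrunc l (r + 1)) = wlev l r := by
    funext i
    simp only [Function.comp, lamTrunc, wlev]
    split_ifs <;> omega
  have hw' : csize ((fun x => x - r) ∘ (lamTrunc l r)) = csize (wlev l r) := by
    congr 1
    funext i
    simp only [Function.comp, lamTrunc, wlev]
    split_ifs <;> omega
  have hsupp : YTsupp (evd (csize (wlev l r)) (scl (qq ^ r) (G (lamTrunc l (r + 1)))))
      ((fun x => x - r) ∘ lamTrunc l (r + 1)) := by
    rw [hw]
    intro ν hν
    unfold evd
    split_ifs with h
    · rw [eval_scl]; exact hV ν h hν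
    · rfl
  have hq := qkz (lamTrunc l (r + 1)) (fun x => x - r) (trunc_partition l hl _) (by
      intro i j hij
      simp only [lamTrunc] at hij ⊢
      split_ifs at hij ⊢ <;> omega) _ (hS.toM (csize (wlev l r))) hsupp
  have hgs : ∀ α, scl (qq ^ r) (gam r L l G α) = gam r L l (fun κ => scl (qq ^ r) (G κ)) α := by
    intro α
    unfold gam
    rw [scl_sum]
    simp only [scl_C_mul]
  have b1 : ∀ i : Fin (N + 1), lamTrunc l r i = 0 ↔ k ≤ i.1 := by
    intro i
    rw [← hk i]
    unfold lamTrunc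
    split_ifs <;> omega
  have b2 : ν ≠ fun i => lamTrunc l r i - r + if i.1 < k then 1 else 0 := by
    intro h
    apply hne
    rw [h]
    funext i
    have := hk i
    simp only [lamTrunc, wlev]
    split_ifs <;> omega
  have hvan := gam_vanish0 r L l hl hL (csize (wlev l r)) hw' (fun κ => scl (qq ^ r) (G κ)) hS
    (fun κ hκ => (totalDegree_scl _ _).trans (hdeg κ hκ)) hq k hkN b1 ν hν hν0 b2
  rw [← hgs, eval_scl] at hvan
  rw [← hvan]
  congr 2
  funext i
  obtain ⟨r', rfl⟩ : ∃ r', r = r' + 1 := ⟨r - 1, by omega⟩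
  rw [Nat.add_sub_cancel, pow_succ, mul_assoc, ← mul_assoc qq, mul_inv_cancel₀ qq_ne, one_mul]

end gamma

/-! ### The signed step: Hecke relations -/

section signedHecke

/-- two-site weight of the signed layer -/
def gg {F : Type*} [Field F] (t ti c X Y : F) (x y u v : ℕ) (zu zv : F) : F :=
  (if v < x then t else 1) * (if v < u then ti else 1) * ll c X x u zu *
    ll c Y y v (zv * (if v = x then t else 1) * (if v = u then ti else 1))

theorem gg_lt1 {F : Type*} [Field F] (t ti c X Y : F) (x y u v : ℕ) (zu zv : F) (ht : t * ti = 1)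
    (hv : v = 0 → zv = 0) (huv : v < u) (hxy : x ≠ y) (hxy' : x = 0 ∨ (y ≠ 0 ∧ y < x)) :
    (1 - t) * Y * gg t ti c X Y x y u v zu zv - (1 - t) * Y * gg t ti c Y X x y u v zu zv
      + (X - Y) * (if x = 0 then 1 else t) * gg t ti c Y X y x u v zu zv = (X - Y) * gg t ti c X Y x y v u zv zu := by
  unfold gg ll
  rcases Nat.eq_zero_or_pos x with hx0 | hx0 <;> rcases Nat.eq_zero_or_pos y with hy0 | hy0 <;>
  rcases Nat.eq_zero_or_pos v with hv0 | hv0 <;>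
  rcases lt_trichotomy x v with h1 | h1 | h1 <;> rcases lt_trichotomy x u with h2 | h2 | h2 <;>
  rcases lt_trichotomy y v with h3 | h3 | h3 <;> rcases lt_trichotomy y u with h4 | h4 | h4 <;>
  first
  | (exfalso; omega)
  | (simp (disch := omega) only [if_pos, if_neg]; grind)

theorem gg_lt2 {F : Type*} [Field F] (t ti c X Y : F) (x y u v : ℕ) (zu zv : F) (ht : t * ti = 1)
    (hv : v = 0 → zv = 0) (huv : v < u) (hxy : x ≠ y) (hxy' : y = 0 ∨ (x ≠ 0 ∧ x < y)) :
    (1 - t) * Y * gg t ti c X Y x y u v zu zv - (1 - t) * X * gg t ti c Y X x y u v zu zv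
      + (X - Y) * (if y = 0 then t else 1) * gg t ti c Y X y x u v zu zv = (X - Y) * gg t ti c X Y x y v u zv zu := by
  unfold gg ll
  rcases Nat.eq_zero_or_pos x with hx0 | hx0 <;> rcases Nat.eq_zero_or_pos y with hy0 | hy0 <;>
  rcases Nat.eq_zero_or_pos v with hv0 | hv0 <;>
  rcases lt_trichotomy x v with h1 | h1 | h1 <;> rcases lt_trichotomy x u with h2 | h2 | h2 <;>
  rcases lt_trichotomy y v with h3 | h3 | h3 <;> rcases lt_trichotomy y u with h4 | h4 | h4 <;>
  first
  | (exfalso; omega)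
  | (simp (disch := omega) only [if_pos, if_neg]; grind)

theorem gg_lt3 {F : Type*} [Field F] (t ti c X Y : F) (x u v : ℕ) (zu zv : F) (ht : t * ti = 1)
    (hv : v = 0 → zv = 0) (huv : v < u) :
    (1 - t) * Y * gg t ti c X Y x x u v zu zv + (t * X - Y) * gg t ti c Y X x x u v zu zv
       = (X - Y) * gg t ti c X Y x x v u zv zu := by
  unfold gg ll
  rcases Nat.eq_zero_or_pos x with hx0 | hx0 <;>
  rcases Nat.eq_zero_or_pos v with hv0 | hv0 <;>
  rcases lt_trichotomy x v with h1 | h1 | h1 <;> rcases lt_trichotomy x u with h2 | h2 | h2 <;>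
  first
  | (exfalso; omega)
  | (simp (disch := omega) only [if_pos, if_neg]; grind)

theorem gg_eq1 {F : Type*} [Field F] (t ti c X Y : F) (x y u : ℕ) (zu : F) (ht : t * ti = 1)
    (hv : u = 0 → zu = 0) (hxy : x ≠ y) (hxy' : x = 0 ∨ (y ≠ 0 ∧ y < x)) :
    (1 - t) * Y * gg t ti c X Y x y u u zu zu - (1 - t) * Y * gg t ti c Y X x y u u zu zu
      + (X - Y) * (if x = 0 then 1 else t) * gg t ti c Y X y x u u zu zu = (X - Y) * (t * gg t ti c X Y x y u u zu zu) := by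
  unfold gg ll
  rcases Nat.eq_zero_or_pos x with hx0 | hx0 <;> rcases Nat.eq_zero_or_pos y with hy0 | hy0 <;>
  rcases Nat.eq_zero_or_pos u with hv0 | hv0 <;>
  rcases lt_trichotomy x u with h2 | h2 | h2 <;> rcases lt_trichotomy y u with h4 | h4 | h4 <;>
  first
  | (exfalso; omega)
  | (simp (disch := omega) only [if_pos, if_neg]; grind)

theorem gg_eq2 {F : Type*} [Field F] (t ti c X Y : F) (x y u : ℕ) (zu : F) (ht : t * ti = 1)
    (hv : u = 0 → zu = 0) (hxy : x ≠ y) (hxy' : y = 0 ∨ (x ≠ 0 ∧ x < y)) :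
    (1 - t) * Y * gg t ti c X Y x y u u zu zu - (1 - t) * X * gg t ti c Y X x y u u zu zu
      + (X - Y) * (if y = 0 then t else 1) * gg t ti c Y X y x u u zu zu = (X - Y) * (t * gg t ti c X Y x y u u zu zu) := by
  unfold gg ll
  rcases Nat.eq_zero_or_pos x with hx0 | hx0 <;> rcases Nat.eq_zero_or_pos y with hy0 | hy0 <;>
  rcases Nat.eq_zero_or_pos u with hv0 | hv0 <;>
  rcases lt_trichotomy x u with h2 | h2 | h2 <;> rcases lt_trichotomy y u with h4 | h4 | h4 <;>
  first
  | (exfalso; omega)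
  | (simp (disch := omega) only [if_pos, if_neg]; grind)

theorem gg_eq3 {F : Type*} [Field F] (t ti c X Y : F) (x u : ℕ) (zu : F) (ht : t * ti = 1)
    (hv : u = 0 → zu = 0) :
    (1 - t) * Y * gg t ti c X Y x x u u zu zu + (t * X - Y) * gg t ti c Y X x x u u zu zu
       = (X - Y) * (t * gg t ti c X Y x x u u zu zu) := by
  unfold gg ll
  rcases Nat.eq_zero_or_pos x with hx0 | hx0 <;>
  rcases Nat.eq_zero_or_pos u with hv0 | hv0 <;>
  rcases lt_trichotomy x u with h2 | h2 | h2 <;>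
  first
  | (exfalso; omega)
  | (simp (disch := omega) only [if_pos, if_neg]; grind)

end signedHecke

section signedHecke2

def aloc {n : ℕ} (L : ℕ) (c : K) (d α : Fin n → ℕ) (x : Fin n → K) (i : Fin n) : K :=
  (∏ b ∈ Finset.Ioc (d i) L, zb α d b i) * ll c (x i) (α i) (d i) (zz α d i)

theorem eval_AA {n : ℕ} (L : ℕ) (c : K) (d α : Fin n → ℕ) (x : Fin n → K) :
    eval x (AA L c d α) = ∏ i, aloc L c d α x i := by
  unfold AA AL aloc
  rw [map_prod]
  apply Finset.prod_congr rfl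
  intro i _
  rw [map_mul, eval_C]
  congr 1
  unfold ll
  split_ifs <;> simp

def Rest {N : ℕ} (L : ℕ) (c : K) (d α : Fin (N + 1) → ℕ) (x : Fin (N + 1) → K) (i : Fin N) : K :=
  ∏ j ∈ (Finset.univ.erase i.castSucc).erase i.succ, aloc L c d α x j

def EE {N : ℕ} (L : ℕ) (d α : Fin (N + 1) → ℕ) (i : Fin N) (u : ℕ) : K :=
  ∏ b ∈ Finset.Ioc u L, zb α d b i.castSucc

def z0 {N : ℕ} (d α : Fin (N + 1) → ℕ) (i : Fin N) (u : ℕ) : K :=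
  if u = 0 then 0 else zb α d u i.castSucc

theorem mb_succ {N : ℕ} (d α : Fin (N + 1) → ℕ) (i : Fin N) (b : ℕ) :
    zb α d b i.succ = zb α d b i.castSucc * (if b = α i.castSucc then tt else 1) * (if b = d i.castSucc then tt⁻¹ else 1) := by
  unfold zb
  rw [mb_lc, mb_lc, lc_succ, lc_succ]
  have ht := tt_ne
  rw [show ((lc α b i.castSucc + (if α i.castSucc = b then 1 else 0) : ℕ) : ℤ) - ((lc d b i.castSucc + (if d i.castSucc = b then 1 else 0) : ℕ) : ℤ)
    = ((lc α b i.castSucc : ℤ) - lc d b i.castSucc) + (if α i.castSucc = b then 1 else 0) + (if d i.castSucc = b then -1 else 0) by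
      push_cast; split_ifs <;> ring, zpow_add₀ ht, zpow_add₀ ht]
  simp only [eq_comm (a := b)]
  congr 1
  · congr 1
    split_ifs <;> simp
  · split_ifs <;> simp

theorem prod_Ioc_ite (u L x : ℕ) (a : K) (hx : x ≤ L) :
    ∏ b ∈ Finset.Ioc u L, (if b = x then a else 1) = if u < x then a else 1 := by
  rw [Finset.prod_ite_eq']
  simp [hx]

theorem eval_AA_split {N : ℕ} (L : ℕ) (c : K) (d α : Fin (N + 1) → ℕ) (x : Fin (N + 1) → K) (i : Fin N)
    (hd : ∀ j, d j ≤ L) (hα : ∀ j, α j ≤ L) :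
    eval x (AA L c d α) = Rest L c d α x i * (EE L d α i (d i.castSucc) * EE L d α i (d i.succ)) *
      gg tt tt⁻¹ c (x i.castSucc) (x i.succ) (α i.castSucc) (α i.succ) (d i.castSucc) (d i.succ)
        (z0 d α i (d i.castSucc)) (z0 d α i (d i.succ)) := by
  rw [eval_AA]
  unfold Rest
  rw [← Finset.mul_prod_erase Finset.univ _ (Finset.mem_univ i.castSucc),
    ← Finset.mul_prod_erase (Finset.univ.erase i.castSucc) _
      (Finset.mem_erase.mpr ⟨(castSucc_ne_succ' i).symm, Finset.mem_univ _⟩)]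
  have h1 : aloc L c d α x i.castSucc = EE L d α i (d i.castSucc) *
      ll c (x i.castSucc) (α i.castSucc) (d i.castSucc) (z0 d α i (d i.castSucc)) := rfl
  have h2 : aloc L c d α x i.succ = EE L d α i (d i.succ) * (if d i.succ < α i.castSucc then tt else 1) *
      (if d i.succ < d i.castSucc then tt⁻¹ else 1) *
      ll c (x i.succ) (α i.succ) (d i.succ) (z0 d α i (d i.succ) * (if d i.succ = α i.castSucc then tt else 1)
        * (if d i.succ = d i.castSucc then tt⁻¹ else 1)) := by
    unfold aloc
    congr 1
    · rw [Finset.prod_congr rfl (fun b _ => mb_succ d α i b), Finset.prod_mul_distrib, Finset.prod_mul_distrib,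
        prod_Ioc_ite _ _ _ _ (hα _), prod_Ioc_ite _ _ _ _ (hd _)]
      rfl
    · congr 1
      unfold zz z0
      rw [mb_succ]
      split_ifs <;> simp
  rw [h1, h2]
  unfold gg
  ring

theorem zb_congr {N : ℕ} (d α d' α' : Fin (N + 1) → ℕ) (i : Fin N) (b : ℕ) (j : Fin (N + 1)) (hj : j ≠ i.succ)
    (hα : α' = α ∨ α' = α ∘ sw i) (hd : d' = d ∨ d' = d ∘ sw i) : zb α' d' b j = zb α d b j := by
  unfold zb
  congr 1
  rw [mb_lc, mb_lc]
  rcases hα with rfl | rfl <;> rcases hd with rfl | rfl <;> simp only [lc_sw _ b i j hj]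

theorem EE_congr {N : ℕ} (L : ℕ) (d α d' α' : Fin (N + 1) → ℕ) (i : Fin N) (u : ℕ)
    (hα : α' = α ∨ α' = α ∘ sw i) (hd : d' = d ∨ d' = d ∘ sw i) : EE L d' α' i u = EE L d α i u := by
  unfold EE
  exact Finset.prod_congr rfl (fun b _ => zb_congr d α d' α' i b _ (castSucc_ne_succ' i) hα hd)

theorem z0_congr {N : ℕ} (d α d' α' : Fin (N + 1) → ℕ) (i : Fin N) (u : ℕ)
    (hα : α' = α ∨ α' = α ∘ sw i) (hd : d' = d ∨ d' = d ∘ sw i) : z0 d' α' i u = z0 d α i u := by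
  unfold z0
  rw [zb_congr d α d' α' i u _ (castSucc_ne_succ' i) hα hd]

theorem comp_eq_of {N : ℕ} {A : Type*} (i : Fin N) (f f' : Fin (N + 1) → A) (h : f' = f ∨ f' = f ∘ sw i) (j : Fin (N + 1))
    (e : sw i j = j) : f' j = f j := by
  rcases h with rfl | rfl
  · rfl
  · rw [Function.comp, e]

theorem Rest_congr {N : ℕ} (L : ℕ) (c : K) (d α d' α' : Fin (N + 1) → ℕ) (x x' : Fin (N + 1) → K) (i : Fin N)
    (hα : α' = α ∨ α' = α ∘ sw i) (hd : d' = d ∨ d' = d ∘ sw i) (hx : x' = x ∨ x' = x ∘ sw i) :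
    Rest L c d' α' x' i = Rest L c d α x i := by
  unfold Rest
  apply Finset.prod_congr rfl
  intro j hj
  simp only [Finset.mem_erase, Finset.mem_univ, and_true] at hj
  have e : sw i j = j := sw_val_ne i j hj.2 hj.1
  unfold aloc zz
  rw [comp_eq_of i α α' hα j e, comp_eq_of i d d' hd j e, comp_eq_of i x x' hx j e]
  simp only [zb_congr d α d' α' i _ j hj.1 hα hd]

/-- the local identity, with global weights -/
theorem AA_local {N : ℕ} (L : ℕ) (c : K) (d α : Fin (N + 1) → ℕ) (x : Fin (N + 1) → K) (i : Fin N)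
    (hd : ∀ j, d j ≤ L) (hα : ∀ j, α j ≤ L) (hx : x i.castSucc ≠ x i.succ) (hlt : d i.succ ≤ d i.castSucc)
    (P Q : K)
    (hP : P = if α i.castSucc = α i.succ then 0 else if α i.castSucc = 0 ∨ (α i.succ ≠ 0 ∧ α i.succ < α i.castSucc) then
      (if α i.castSucc = 0 then 1 else tt) else (if α i.succ = 0 then tt else 1))
    (hQ : Q = if α i.castSucc = α i.succ then rr (x i.castSucc) (x i.succ) else
      if α i.castSucc = 0 ∨ (α i.succ ≠ 0 ∧ α i.succ < α i.castSucc) then - (tt - rr (x i.castSucc) (x i.succ)) else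
        - (1 - rr (x i.castSucc) (x i.succ))) :
    (tt - rr (x i.castSucc) (x i.succ)) * eval x (AA L c d α) + Q * eval (x ∘ sw i) (AA L c d α)
      + P * eval (x ∘ sw i) (AA L c d (α ∘ sw i))
      = if d i.succ < d i.castSucc then eval x (AA L c (d ∘ sw i) α) else tt * eval x (AA L c d α) := by
  have hα' : ∀ j, (α ∘ sw i) j ≤ L := fun j => hα _
  have hd' : ∀ j, (d ∘ sw i) j ≤ L := fun j => hd _
  rw [eval_AA_split L c d α x i hd hα, eval_AA_split L c d α (x ∘ sw i) i hd hα,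
    eval_AA_split L c d (α ∘ sw i) (x ∘ sw i) i hd hα', eval_AA_split L c (d ∘ sw i) α x i hd' hα]
  rw [Rest_congr L c d α d α x (x ∘ sw i) i (Or.inl rfl) (Or.inl rfl) (Or.inr rfl),
    Rest_congr L c d α d (α ∘ sw i) x (x ∘ sw i) i (Or.inr rfl) (Or.inl rfl) (Or.inr rfl),
    Rest_congr L c d α (d ∘ sw i) α x x i (Or.inl rfl) (Or.inr rfl) (Or.inl rfl)]
  simp only [EE_congr L d α d (α ∘ sw i) i _ (Or.inr rfl) (Or.inl rfl), EE_congr L d α (d ∘ sw i) α i _ (Or.inl rfl) (Or.inr rfl),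
    z0_congr d α d (α ∘ sw i) i _ (Or.inr rfl) (Or.inl rfl), z0_congr d α (d ∘ sw i) α i _ (Or.inl rfl) (Or.inr rfl)]
  simp only [Function.comp, sw_left, sw_right]
  have hz : d i.succ = 0 → z0 d α i (d i.succ) = 0 := fun h => by unfold z0; rw [if_pos h]
  have hzz : d i.succ = d i.castSucc → z0 d α i (d i.castSucc) = z0 d α i (d i.succ) := fun h => by rw [h]
  have ht : tt * tt⁻¹ = 1 := mul_inv_cancel₀ tt_ne
  generalize Rest L c d α x i = R
  generalize hu : d i.castSucc = u at *
  generalize hv : d i.succ = v at *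
  generalize α i.castSucc = a at *
  generalize α i.succ = b at *
  generalize x i.castSucc = X at *
  generalize x i.succ = Y at *
  generalize z0 d α i v = zv at *
  have hXY : X - Y ≠ 0 := sub_ne_zero.2 hx
  have r1 : (tt - rr X Y) * (X - Y) = (1 - tt) * Y := by unfold rr; field_simp; ring
  have r2 : (1 - rr X Y) * (X - Y) = (1 - tt) * X := by unfold rr; field_simp; ring
  have r3 : rr X Y * (X - Y) = tt * X - Y := by unfold rr; field_simp
  generalize rr X Y = ρ at *
  apply mul_right_cancel₀ hXY
  rcases hlt.lt_or_eq with h | h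
  · rw [if_pos h]
    by_cases hab : a = b
    · rw [if_pos hab] at hP hQ
      subst hab hP hQ
      linear_combination (R * (EE L d α i u * EE L d α i v)) * gg_lt3 tt tt⁻¹ c X Y a u v (z0 d α i u) zv ht hz h
        + R * (EE L d α i u * EE L d α i v) * gg tt tt⁻¹ c X Y a a u v (z0 d α i u) zv * r1
        + R * (EE L d α i u * EE L d α i v) * gg tt tt⁻¹ c Y X a a u v (z0 d α i u) zv * r3
    · rw [if_neg hab] at hP hQ
      by_cases hc : a = 0 ∨ (b ≠ 0 ∧ b < a)
      · rw [if_pos hc] at hP hQ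
        subst hQ hP
        linear_combination (R * (EE L d α i u * EE L d α i v)) * gg_lt1 tt tt⁻¹ c X Y a b u v (z0 d α i u) zv ht hz h hab hc
          + R * (EE L d α i u * EE L d α i v) * gg tt tt⁻¹ c X Y a b u v (z0 d α i u) zv * r1
          - R * (EE L d α i u * EE L d α i v) * gg tt tt⁻¹ c Y X a b u v (z0 d α i u) zv * r1
      · rw [if_neg hc] at hP hQ
        subst hQ hP
        linear_combination (R * (EE L d α i u * EE L d α i v)) * gg_lt2 tt tt⁻¹ c X Y a b u v (z0 d α i u) zv ht hz h hab (by omega)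
          + R * (EE L d α i u * EE L d α i v) * gg tt tt⁻¹ c X Y a b u v (z0 d α i u) zv * r1
          - R * (EE L d α i u * EE L d α i v) * gg tt tt⁻¹ c Y X a b u v (z0 d α i u) zv * r2
  · rw [if_neg (by omega)]
    rw [hzz h]
    rw [← h]
    by_cases hab : a = b
    · rw [if_pos hab] at hP hQ
      subst hab hP hQ
      linear_combination (R * (EE L d α i v * EE L d α i v)) * gg_eq3 tt tt⁻¹ c X Y a v zv ht hz
        + R * (EE L d α i v * EE L d α i v) * gg tt tt⁻¹ c X Y a a v v zv zv * r1
        + R * (EE L d α i v * EE L d α i v) * gg tt tt⁻¹ c Y X a a v v zv zv * r3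
    · rw [if_neg hab] at hP hQ
      by_cases hc : a = 0 ∨ (b ≠ 0 ∧ b < a)
      · rw [if_pos hc] at hP hQ
        subst hQ hP
        linear_combination (R * (EE L d α i v * EE L d α i v)) * gg_eq1 tt tt⁻¹ c X Y a b v zv ht hz hab hc
          + R * (EE L d α i v * EE L d α i v) * gg tt tt⁻¹ c X Y a b v v zv zv * r1
          - R * (EE L d α i v * EE L d α i v) * gg tt tt⁻¹ c Y X a b v v zv zv * r1
      · rw [if_neg hc] at hP hQ
        subst hQ hP
        linear_combination (R * (EE L d α i v * EE L d α i v)) * gg_eq2 tt tt⁻¹ c X Y a b v zv ht hz hab (by omega)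
          + R * (EE L d α i v * EE L d α i v) * gg tt tt⁻¹ c X Y a b v v zv zv * r1
          - R * (EE L d α i v * EE L d α i v) * gg tt tt⁻¹ c Y X a b v v zv zv * r2

def Gst {n : ℕ} (r L : ℕ) (l : Fin n → ℕ) (c : K) (γ : (Fin n → ℕ) → MvPolynomial (Fin n) K) (μ : Fin n → ℕ) :
    MvPolynomial (Fin n) K :=
  ∑ α ∈ SnFinset (lamTrunc l r), AA L c μ α * γ α

theorem Gst_Th {N : ℕ} (r L : ℕ) (l : Fin (N + 1) → ℕ) (hL : ∀ i, l i ≤ L) (c : K)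
    (γ : (Fin (N + 1) → ℕ) → MvPolynomial (Fin (N + 1)) K)
    (hγ : PFam N (Sn (lamTrunc l r)) (keyK L) czero γ) (μ : Fin (N + 1) → ℕ) (hμ : μ ∈ Sn (lamTrunc l r)) (i : Fin N)
    (hlt : μ i.succ ≤ μ i.castSucc) :
    Th i (Gst r L l c γ μ) = if μ i.succ < μ i.castSucc then Gst r L l c γ (μ ∘ sw i) else C tt * Gst r L l c γ μ := by
  apply poly_ext_inj
  intro x hx
  rw [eval_Th i _ x hx]
  have hne : x i.castSucc ≠ x i.succ := fun h => castSucc_ne_succ' i (hx h)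
  set ρ := rr (x i.castSucc) (x i.succ) with hρ
  let P : (Fin (N + 1) → ℕ) → K := fun α => if α i.castSucc = α i.succ then 0 else
      if α i.castSucc = 0 ∨ (α i.succ ≠ 0 ∧ α i.succ < α i.castSucc) then
      (if α i.castSucc = 0 then 1 else tt) else (if α i.succ = 0 then tt else 1)
  let Q : (Fin (N + 1) → ℕ) → K := fun α => if α i.castSucc = α i.succ then ρ else
      if α i.castSucc = 0 ∨ (α i.succ ≠ 0 ∧ α i.succ < α i.castSucc) then - (tt - ρ) else - (1 - ρ)
  have hW : ∀ α ∈ Sn (lamTrunc l r), ρ * eval (x ∘ sw i) (γ α) = P (α ∘ sw i) * eval x (γ (α ∘ sw i)) + Q α * eval x (γ α) := by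
    intro α hα
    have v1 := trunc_val L l hL r α hα
    have w1 := (v1 i.castSucc).1
    have w2 := (v1 i.succ).1
    have e1 := eval_Th i (γ α) x hx
    rw [← hρ] at e1
    by_cases hab : α i.castSucc = α i.succ
    · have h := hγ.heq α hα i hab
      rw [h, map_mul, eval_C] at e1
      have p0 : P (α ∘ sw i) = 0 := by
        simp only [P, Function.comp, sw_left, sw_right]; rw [if_pos hab.symm]
      have q0 : Q α = ρ := by simp only [Q]; rw [if_pos hab]
      rw [p0, q0]
      linear_combination -e1
    · by_cases hc : α i.castSucc = 0 ∨ (α i.succ ≠ 0 ∧ α i.succ < α i.castSucc)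
      · have h := hγ.hstep α hα i (by unfold keyK; split_ifs <;> omega)
        rw [h, map_mul, eval_C] at e1
        have p0 : P (α ∘ sw i) = czero (α i.castSucc) (α i.succ) := by
          simp only [P, Function.comp, sw_left, sw_right, czero]
          rw [if_neg (fun h => hab h.symm), if_neg (by omega)]
        have q0 : Q α = - (tt - ρ) := by simp only [Q]; rw [if_neg hab, if_pos hc]
        rw [p0, q0]
        linear_combination -e1
      · have h := hγ.hstep (α ∘ sw i) (Sn_comp _ _ _ hα) i (by
          simp only [Function.comp, sw_left, sw_right]; unfold keyK; split_ifs <;> omega)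
        rw [comp_sw_sw] at h
        have h2 := Th_quad i (γ (α ∘ sw i))
        rw [h, Th_C_mul] at h2
        have h3 := congrArg (eval x) h2
        simp only [map_add, map_mul, eval_C, e1] at h3
        have p0 : P (α ∘ sw i) = if α i.succ = 0 then 1 else tt := by
          simp only [P, Function.comp, sw_left, sw_right]
          rw [if_neg (fun h => hab h.symm), if_pos (by omega)]
        have q0 : Q α = - (1 - ρ) := by simp only [Q]; rw [if_neg hab, if_neg hc]
        rw [p0, q0]
        simp only [Function.comp, sw_left, sw_right, czero] at h3
        split_ifs at h3 ⊢
        · apply mul_left_cancel₀ tt_ne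
          linear_combination h3
        · linear_combination h3
  have hF : ρ * eval (x ∘ sw i) (Gst r L l c γ μ) =
      ∑ α ∈ SnFinset (lamTrunc l r), (P α * eval (x ∘ sw i) (AA L c μ (α ∘ sw i)) + Q α * eval (x ∘ sw i) (AA L c μ α)) * eval x (γ α) := by
    unfold Gst
    rw [map_sum, Finset.mul_sum]
    have h1 : ∀ α ∈ SnFinset (lamTrunc l r), ρ * eval (x ∘ sw i) (AA L c μ α * γ α) =
        P (α ∘ sw i) * eval (x ∘ sw i) (AA L c μ α) * eval x (γ (α ∘ sw i))
        + Q α * eval (x ∘ sw i) (AA L c μ α) * eval x (γ α) := by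
      intro α hα
      rw [mem_SnFinset] at hα
      rw [map_mul]
      linear_combination eval (x ∘ sw i) (AA L c μ α) * hW α hα
    rw [Finset.sum_congr rfl h1, Finset.sum_add_distrib]
    simp only [add_mul]
    rw [Finset.sum_add_distrib]
    congr 1
    apply Finset.sum_nbij' (fun κ => κ ∘ sw i) (fun κ => κ ∘ sw i)
    · intro κ hκ
      rw [mem_SnFinset] at hκ ⊢
      exact Sn_comp _ _ _ hκ
    · intro κ hκ
      rw [mem_SnFinset] at hκ ⊢
      exact Sn_comp _ _ _ hκ
    · intro κ _; exact comp_sw_sw i κ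
    · intro κ _; exact comp_sw_sw i κ
    · intro κ _
      rw [comp_sw_sw]
  rw [hF]
  have hT : ∀ α ∈ SnFinset (lamTrunc l r), (tt - ρ) * eval x (AA L c μ α) + Q α * eval (x ∘ sw i) (AA L c μ α)
      + P α * eval (x ∘ sw i) (AA L c μ (α ∘ sw i)) = if μ i.succ < μ i.castSucc then eval x (AA L c (μ ∘ sw i) α) else tt * eval x (AA L c μ α) := by
    intro α hα
    rw [mem_SnFinset] at hα
    exact AA_local L c μ α x i (fun j => (trunc_val L l hL r μ hμ j).1) (fun j => (trunc_val L l hL r α hα j).1) hne hlt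
      (P α) (Q α) rfl rfl
  have hE : (tt - ρ) * eval x (Gst r L l c γ μ) = ∑ α ∈ SnFinset (lamTrunc l r), (tt - ρ) * eval x (AA L c μ α) * eval x (γ α) := by
    unfold Gst
    rw [map_sum, Finset.mul_sum]
    exact Finset.sum_congr rfl (fun α _ => by rw [map_mul, mul_assoc])
  rw [hE, ← Finset.sum_add_distrib]
  have hR : eval x (if μ i.succ < μ i.castSucc then Gst r L l c γ (μ ∘ sw i) else C tt * Gst r L l c γ μ) =
      ∑ α ∈ SnFinset (lamTrunc l r), (if μ i.succ < μ i.castSucc then eval x (AA L c (μ ∘ sw i) α) else tt * eval x (AA L c μ α)) * eval x (γ α) := by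
    split_ifs
    · unfold Gst
      rw [map_sum]
      exact Finset.sum_congr rfl (fun α _ => by rw [map_mul])
    · rw [map_mul, eval_C]
      unfold Gst
      rw [map_sum, Finset.mul_sum]
      exact Finset.sum_congr rfl (fun α _ => by rw [map_mul, mul_assoc])
  rw [hR]
  apply Finset.sum_congr rfl
  intro α hα
  linear_combination eval x (γ α) * hT α hα

theorem Gst_PFam {N : ℕ} (r L : ℕ) (l : Fin (N + 1) → ℕ) (hL : ∀ i, l i ≤ L) (c : K)
    (γ : (Fin (N + 1) → ℕ) → MvPolynomial (Fin (N + 1)) K)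
    (hγ : PFam N (Sn (lamTrunc l r)) (keyK L) czero γ) :
    PFam N (Sn (lamTrunc l r)) id (fun _ _ => 1) (Gst r L l c γ) where
  hO κ hκ i := Sn_comp _ _ _ hκ
  hkey := Function.injective_id
  hstep μ hμ i h := by
    have h : μ i.succ < μ i.castSucc := h
    rw [Gst_Th r L l hL c γ hγ μ hμ i (le_of_lt h), if_pos h, C_1, one_mul]
  heq μ hμ i h := by
    rw [Gst_Th r L l hL c γ hγ μ hμ i h.ge, if_neg (by omega)]

end signedHecke2

section levels

theorem evalPt_first_zero {N : ℕ} (ν : Fin (N + 1) → ℕ) (i : Fin (N + 1)) (h0 : ν i = 0) (h1 : ∀ j, j < i → ν j ≠ 0) :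
    evalPt ν i = cc N := by
  have hk : kstat ν i = N := by
    unfold kstat
    have e1 : {j : Fin (N + 1) | j < i ∧ ν i < ν j} = (Finset.Iio i : Set (Fin (N + 1))) := by
      ext j; simp only [Set.mem_setOf_eq, Finset.coe_Iio, Set.mem_Iio]
      exact ⟨fun h => h.1, fun h => ⟨h, by have := h1 j h; omega⟩⟩
    have e2 : {j : Fin (N + 1) | i < j ∧ ν i ≤ ν j} = (Finset.Ioi i : Set (Fin (N + 1))) := by
      ext j; simp only [Set.mem_setOf_eq, Finset.coe_Ioi, Set.mem_Ioi]
      exact ⟨fun h => h.1, fun h => ⟨h, by omega⟩⟩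
    rw [e1, e2, Set.ncard_coe_finset, Set.ncard_coe_finset, Fin.card_Iio, Fin.card_Ioi]
    omega
  unfold evalPt
  rw [h0, hk, pow_zero, one_mul]
  rfl

theorem Sn_csize {n : ℕ} (l α : Fin n → ℕ) (h : α ∈ Sn l) : csize α = csize l := csize_Sn id l α h

theorem eq_of_le_csize {n : ℕ} (a b : Fin n → ℕ) (h : ∀ i, a i ≤ b i) (hs : csize b ≤ csize a) : a = b := by
  unfold csize at hs
  have := (Finset.sum_eq_sum_iff_of_le (s := Finset.univ) (fun i _ => h i)).1 (le_antisymm (Finset.sum_le_sum (fun i _ => h i)) hs)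
  funext i; exact this i (Finset.mem_univ i)

theorem mb_agree {n : ℕ} (α d : Fin n → ℕ) (b : ℕ) (i : Fin n) (h : ∀ j, j < i → α j = d j) : mb α d b i = 0 := by
  unfold mb
  rw [sub_eq_zero]
  congr 2
  ext j
  simp only [Finset.mem_filter, Finset.mem_univ, true_and]
  constructor
  · rintro ⟨h1, h2⟩; exact ⟨h1, by rw [← h j h1]; exact h2⟩
  · rintro ⟨h1, h2⟩; exact ⟨h1, by rw [h j h1]; exact h2⟩

theorem AA_part_zero {n : ℕ} (L : ℕ) (c : K) (d α : Fin n → ℕ) (hd : IsPartition d) (hα : α ∈ Sn d) (hne : α ≠ d) :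
    AA L c d α = 0 := by
  have hex : ∃ i, α i ≠ d i := by
    by_contra hcon
    push Not at hcon
    exact hne (funext hcon)
  obtain ⟨i, hi, hmin⟩ : ∃ i, α i ≠ d i ∧ ∀ j, j < i → α j = d j := by
    have hw := (Finset.univ.filter (fun i => α i ≠ d i)).min'_mem (by obtain ⟨i, hi⟩ := hex; exact ⟨i, by simpa using hi⟩)
    refine ⟨_, by simpa using hw, fun j hj => ?_⟩
    by_contra hcon
    have := Finset.min'_le (Finset.univ.filter (fun i => α i ≠ d i)) j (by simpa using hcon)
    exact absurd hj (not_lt.2 this)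
  have hdi : d i ≠ 0 := by
    intro h0
    apply hne
    symm
    apply eq_of_le_csize
    · intro j
      by_cases hj : j < i
      · rw [hmin j hj]
      · have := hd i j (not_lt.1 hj); omega
    · rw [Sn_csize d α hα]
  unfold AA
  apply Finset.prod_eq_zero (Finset.mem_univ i)
  unfold AL
  have hz : zz α d i = 1 := by
    unfold zz zb
    rw [if_neg hdi, mb_agree α d _ i hmin, zpow_zero]
  rw [hz]
  unfold ll
  rw [if_neg hi]
  simp

theorem AA_diag {n : ℕ} (L : ℕ) (c : K) (d : Fin n → ℕ) :
    AA L c d d = ∏ i, (if d i = 0 then 1 else X i + C c) := by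
  unfold AA
  apply Finset.prod_congr rfl
  intro i _
  unfold AL ll zz zb
  have h : ∀ b, mb d d b i = 0 := fun b => mb_agree d d b i (fun _ _ => rfl)
  simp only [h, zpow_zero]
  split_ifs <;> simp

/-- the linear form of a local factor -/
theorem AL_form {n : ℕ} (L : ℕ) (c : K) (d α : Fin n → ℕ) (i : Fin n) :
    ∃ A B : K, AL L c d α i = C B * X i + C A ∧ (α i = 0 → B = 0) ∧ (d i < α i → B = 0) := by
  unfold AL ll
  generalize (∏ b ∈ Finset.Ioc (d i) L, zb α d b i) = e
  generalize zz α d i = z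
  split_ifs with h1 h2 h3
  · exact ⟨e * (1 - z), 0, by simp, fun _ => rfl, fun _ => rfl⟩
  · exact ⟨e * (c * z), e, by simp only [C_mul]; ring, fun h => absurd h h1, fun h => by omega⟩
  · exact ⟨0, e * (1 - z), by simp only [C_mul, C_sub, C_1, C_0]; ring, fun h => absurd h h1, fun h => by omega⟩
  · exact ⟨-(e * (c * (1 - z))), 0, by simp only [C_mul, C_sub, C_1, C_0, C_neg]; ring, fun _ => rfl, fun _ => rfl⟩

theorem AA_degree {n : ℕ} (L : ℕ) (c : K) (d α : Fin n → ℕ) :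
    (AA L c d α).totalDegree ≤ (Finset.univ.filter (fun i => α i ≠ 0)).card := by
  unfold AA
  refine (totalDegree_finset_prod _ _).trans ?_
  rw [Finset.card_filter]
  apply Finset.sum_le_sum
  intro i _
  obtain ⟨A, B, h, hB, _⟩ := AL_form L c d α i
  rw [h]
  by_cases h0 : α i = 0
  · rw [hB h0, if_neg (fun hh => hh h0)]; simp
  · rw [if_pos h0]
    refine (totalDegree_add _ _).trans (max_le ?_ (by simp))
    refine (totalDegree_mul _ _).trans ?_
    simp

/-- top coefficient of a product of linear forms times a polynomial -/
theorem coeff_linprod {n : ℕ} (A B : Fin n → K) (U : Finset (Fin n)) (hB : ∀ i, i ∉ U → B i = 0)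
    (g : MvPolynomial (Fin n) K) (d : ℕ) (hg : g.totalDegree ≤ d) (m : Fin n →₀ ℕ) (hm : ∑ i, m i = U.card + d) :
    coeff m ((∏ i, (C (B i) * X i + C (A i))) * g) = (∏ i ∈ U, B i) * (∏ i ∈ Finset.univ \ U, A i) *
      (if (∑ i ∈ U, Finsupp.single i 1) ≤ m then coeff (m - ∑ i ∈ U, Finsupp.single i 1) g else 0) := by
  rw [Finset.prod_add, Finset.sum_mul, coeff_sum]
  have key : ∀ S : Finset (Fin n), (∏ i ∈ S, (C (B i) * X i : MvPolynomial (Fin n) K)) * (∏ i ∈ Finset.univ \ S, C (A i)) * g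
      = monomial (∑ i ∈ S, Finsupp.single i 1) ((∏ i ∈ S, B i) * (∏ i ∈ Finset.univ \ S, A i)) * g := by
    intro S
    congr 1
    have e1 : (monomial (∑ i ∈ S, Finsupp.single i 1) (1 : K)) = ∏ i ∈ S, (X i : MvPolynomial (Fin n) K) := by
      rw [monomial_sum_one]
      rfl
    rw [← mul_one ((∏ i ∈ S, B i) * (∏ i ∈ Finset.univ \ S, A i)), ← C_mul_monomial, e1, Finset.prod_mul_distrib, C_mul,
      map_prod, map_prod]
    ring
  rw [Finset.sum_eq_single U]
  · rw [key, coeff_monomial_mul']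
    split_ifs <;> simp
  · intro S _ hS
    rw [key, coeff_monomial_mul']
    split_ifs with hle
    · by_cases hsub : S ⊆ U
      · have hcard : S.card < U.card := Finset.card_lt_card (Finset.ssubset_iff_subset_ne.2 ⟨hsub, hS⟩)
        rw [coeff_eq_zero_of_totalDegree_lt, mul_zero]
        refine lt_of_le_of_lt hg ?_
        have e2 : ∑ i, (∑ j ∈ S, Finsupp.single j 1 : Fin n →₀ ℕ) i = S.card := by
          simp only [Finsupp.finsetSum_apply]
          rw [Finset.sum_comm]
          simp [Finsupp.single_apply]
        have e3 : ∑ i, (m - ∑ j ∈ S, Finsupp.single j 1 : Fin n →₀ ℕ) i + S.card = U.card + d := by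
          rw [← hm, ← e2, ← Finset.sum_add_distrib]
          apply Finset.sum_congr rfl
          intro i _
          have := hle i
          rw [Finsupp.tsub_apply]
          omega
        have e4 : ∑ i ∈ (m - ∑ j ∈ S, Finsupp.single j 1 : Fin n →₀ ℕ).support, (m - ∑ j ∈ S, Finsupp.single j 1 : Fin n →₀ ℕ) i
            = ∑ i, (m - ∑ j ∈ S, Finsupp.single j 1 : Fin n →₀ ℕ) i := by
          apply Finset.sum_subset (Finset.subset_univ _)
          intro i _ hi
          simpa using hi
        rw [e4]
        omega
      · obtain ⟨i, hi, hi'⟩ := Finset.not_subset.1 hsub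
        rw [Finset.prod_eq_zero hi (hB i hi'), zero_mul, zero_mul]
    · rfl
  · intro h; exact absurd (Finset.mem_powerset.2 (Finset.subset_univ U)) h

theorem WB_part {N : ℕ} (r L : ℕ) (l : Fin (N + 1) → ℕ) : WB (r + 1) L (lamTrunc l (r + 1)) (lamTrunc l r) = 1 := by
  unfold WB
  rw [if_pos]
  · apply Finset.prod_eq_one
    intro b hb
    rw [Finset.mem_Icc] at hb
    rw [Wb_closed _ _ _ b (by omega)]
    have hmb : ∀ j, mb (lamTrunc l (r + 1)) (lamTrunc l r) b j = 0 := by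
      intro j
      rw [mb_lc, sub_eq_zero]
      congr 1
      rw [lc_sum, lc_sum]
      apply Finset.sum_congr rfl
      intro k _
      congr 2
      unfold lamTrunc
      apply propext
      split_ifs <;> omega
    have hPB : PB (lamTrunc l (r + 1)) (lamTrunc l r) b = Polynomial.X ^ (Fb (lamTrunc l r) b).card := by
      unfold PB Fb
      rw [Finset.card_filter, ← Finset.prod_pow_eq_pow_sum]
      apply Finset.prod_congr rfl
      intro j _
      rw [hmb, zpow_zero, Polynomial.C_1, one_mul]
      unfold locB lamTrunc
      split_ifs <;> first | (exfalso; omega) | simp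
    rw [hPB, tau_X_pow]
    exact mul_inv_cancel₀ (one_sub_qt_ne _ _ (by omega))
  · intro i
    unfold lamTrunc
    split_ifs <;> omega

theorem trunc_card {n : ℕ} (l α : Fin n → ℕ) (h : α ∈ Sn l) :
    (Finset.univ.filter (fun i => α i ≠ 0)).card = (Finset.univ.filter (fun i => l i ≠ 0)).card := by
  rw [Finset.card_filter, Finset.card_filter]
  exact csize_Sn (fun x => if x ≠ 0 then 1 else 0) l α h

theorem csize_wlev {n : ℕ} (l : Fin n → ℕ) (r : ℕ) (hr : 1 ≤ r) :
    csize (wlev l (r - 1)) = (Finset.univ.filter (fun i => lamTrunc l r i ≠ 0)).card + csize (wlev l r) := by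
  unfold csize
  rw [Finset.card_filter, ← Finset.sum_add_distrib]
  apply Finset.sum_congr rfl
  intro i _
  unfold wlev lamTrunc
  split_ifs <;> omega

theorem coeff_Gst {N : ℕ} (r L : ℕ) (hr : 1 ≤ r) (l : Fin (N + 1) → ℕ) (hL : ∀ i, l i ≤ L) (c : K)
    (γ : (Fin (N + 1) → ℕ) → MvPolynomial (Fin (N + 1)) K)
    (hdeg : ∀ α, (γ α).totalDegree ≤ csize (wlev l r))
    (hco : ∀ α, coeff (expOf (wlev l r)) (γ α) = WB (r + 1) L (lamTrunc l (r + 1)) α)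
    (μ : Fin (N + 1) → ℕ) (hμ : μ ∈ Sn (lamTrunc l r)) :
    coeff (expOf (wlev l (r - 1))) (Gst r L l c γ μ) = if μ = lamTrunc l r then 1 else 0 := by
  have hU : ∀ U : Finset (Fin (N + 1)), U.card = (Finset.univ.filter (fun i => lamTrunc l r i ≠ 0)).card →
      (∑ i ∈ U, Finsupp.single i 1) ≤ expOf (wlev l (r - 1)) → U = Finset.univ.filter (fun i => lamTrunc l r i ≠ 0) := by
    intro U hcard hle
    apply Finset.eq_of_subset_of_card_le _ (le_of_eq hcard.symm)
    intro i hi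
    have h1 := hle i
    rw [Finsupp.finsetSum_apply, Finset.sum_eq_single_of_mem i hi (fun j _ hj => by simp [hj]), Finsupp.single_eq_same] at h1
    have h2 : (expOf (wlev l (r - 1))) i = l i - (r - 1) := rfl
    rw [h2] at h1
    simp only [Finset.mem_filter, Finset.mem_univ, true_and]
    unfold lamTrunc
    rw [if_pos (by omega)]
    omega
  have hsub : ∀ i : Fin (N + 1), (∑ i ∈ Finset.univ.filter (fun i => lamTrunc l r i ≠ 0), Finsupp.single i 1 : Fin (N + 1) →₀ ℕ) i
      = if lamTrunc l r i ≠ 0 then 1 else 0 := by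
    intro i
    rw [Finsupp.finsetSum_apply, Finset.sum_filter, Finset.sum_eq_single i (fun j _ hj => by simp [hj]) (by simp)]
    simp
  have hexp : expOf (wlev l (r - 1)) - (∑ i ∈ Finset.univ.filter (fun i => lamTrunc l r i ≠ 0), Finsupp.single i 1)
      = expOf (wlev l r) := by
    ext i
    rw [Finsupp.tsub_apply, hsub]
    have h2 : (expOf (wlev l (r - 1))) i = l i - (r - 1) := rfl
    have h3 : (expOf (wlev l r)) i = l i - r := rfl
    rw [h2, h3]
    unfold lamTrunc
    split_ifs <;> omega
  have hle0 : (∑ i ∈ Finset.univ.filter (fun i => lamTrunc l r i ≠ 0), Finsupp.single i 1) ≤ expOf (wlev l (r - 1)) := by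
    intro i
    rw [hsub]
    have h2 : (expOf (wlev l (r - 1))) i = l i - (r - 1) := rfl
    rw [h2]
    unfold lamTrunc
    split_ifs <;> omega
  have hm : ∑ i, (expOf (wlev l (r - 1))) i = (Finset.univ.filter (fun i => lamTrunc l r i ≠ 0)).card + csize (wlev l r) :=
    csize_wlev l r hr
  unfold Gst
  rw [coeff_sum, Finset.sum_eq_single (lamTrunc l r)]
  · split_ifs with hμl
    · subst hμl
      rw [AA_diag]
      have e : ∏ i, (if lamTrunc l r i = 0 then 1 else (X i + C c : MvPolynomial (Fin (N + 1)) K)) =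
          ∏ i, (C (if lamTrunc l r i = 0 then 0 else 1) * X i + C (if lamTrunc l r i = 0 then 1 else c)) := by
        apply Finset.prod_congr rfl
        intro i _
        split_ifs <;> simp
      rw [e, coeff_linprod _ _ (Finset.univ.filter (fun i => lamTrunc l r i ≠ 0)) (by
        intro i hi; simp only [Finset.mem_filter, Finset.mem_univ, true_and, not_not] at hi; rw [if_pos hi]) _ _ (hdeg _) _ hm,
        if_pos hle0, hexp, hco, WB_part, mul_one, Finset.prod_eq_one, Finset.prod_eq_one, one_mul]
      · intro i hi
        simp only [Finset.mem_sdiff, Finset.mem_filter, Finset.mem_univ, true_and, not_not] at hi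
        rw [if_pos hi]
      · intro i hi
        simp only [Finset.mem_filter, Finset.mem_univ, true_and] at hi
        rw [if_neg hi]
    · have hex : ∃ i, μ i < lamTrunc l r i := by
        by_contra hcon
        push Not at hcon
        exact hμl (eq_of_le_csize _ _ hcon (le_of_eq (Sn_csize _ _ hμ))).symm
      obtain ⟨i0, hi0⟩ := hex
      choose A B hAB hB0 hB1 using AL_form L c μ (lamTrunc l r)
      unfold AA
      rw [Finset.prod_congr rfl (fun i _ => hAB i), coeff_linprod _ _ (Finset.univ.filter (fun i => lamTrunc l r i ≠ 0)) (by
        intro i hi; simp only [Finset.mem_filter, Finset.mem_univ, true_and, not_not] at hi; exact hB0 i hi) _ _ (hdeg _) _ hm,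
        Finset.prod_eq_zero (i := i0) (by simp only [Finset.mem_filter, Finset.mem_univ, true_and]; omega) (hB1 i0 hi0)]
      simp
  · intro α hα hne
    rw [mem_SnFinset] at hα
    have hcard := trunc_card _ _ hα
    choose A B hAB hB0 hB1 using AL_form L c μ α
    unfold AA
    rw [Finset.prod_congr rfl (fun i _ => hAB i), coeff_linprod _ _ (Finset.univ.filter (fun i => α i ≠ 0)) (by
      intro i hi; simp only [Finset.mem_filter, Finset.mem_univ, true_and, not_not] at hi; exact hB0 i hi) _ _ (hdeg _) _
      (by rw [hcard]; exact hm)]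
    split_ifs with hle
    · have hUe := hU _ hcard hle
      rw [hUe, hexp, hco]
      have : WB (r + 1) L (lamTrunc l (r + 1)) α = 0 := by
        unfold WB
        apply if_neg
        intro hall
        apply hne
        symm
        apply eq_of_le_csize _ _ _ (le_of_eq (Sn_csize _ _ hα))
        intro i
        by_cases hi : r ≤ l i
        · have hi' : i ∈ Finset.univ.filter (fun i => α i ≠ 0) := by
            rw [hUe]; simp only [Finset.mem_filter, Finset.mem_univ, true_and]; unfold lamTrunc; rw [if_pos hi]; omega
          simp only [Finset.mem_filter, Finset.mem_univ, true_and] at hi'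
          have g1 := (trunc_val L l hL r α hα i).2 hi'
          have g2 := hall i
          unfold lamTrunc at g2 ⊢
          rw [if_pos hi]
          split_ifs at g2 with hh
          · exact g2 (by omega) hi'
          · omega
        · unfold lamTrunc; rw [if_neg hi]; exact Nat.zero_le _
      rw [this, mul_zero]
    · rw [mul_zero]
  · intro h
    exact absurd ((mem_SnFinset _ _).2 (Sn_self _)) h

end levels

/-- Level `s+1` family with `m` rows above, built by the row recursion. -/
def HH {n : ℕ} (L : ℕ) (l : Fin n → ℕ) : ℕ → ℕ → (Fin n → ℕ) → MvPolynomial (Fin n) K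
  | 0, _ => fun _ => 1
  | m + 1, s => Gst (s + 1) L l (-(qq ^ s) / tt ^ (n - 1)) (gam (s + 1) L l (HH L l m (s + 1)))

structure LevOK (N : ℕ) (l : Fin (N + 1) → ℕ) (s : ℕ) (G : (Fin (N + 1) → ℕ) → MvPolynomial (Fin (N + 1)) K) : Prop where
  H : PFam N (Sn (lamTrunc l (s + 1))) id (fun _ _ => 1) G
  deg : ∀ κ ∈ Sn (lamTrunc l (s + 1)), (G κ).totalDegree ≤ csize (wlev l s)
  V : ∀ ν, csize ν ≤ csize (wlev l s) → ν ≠ wlev l s →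
    eval (fun i => qq ^ s * evalPt ν i) (G (lamTrunc l (s + 1))) = 0
  co : ∀ κ ∈ Sn (lamTrunc l (s + 1)), coeff (expOf (wlev l s)) (G κ) = if κ = lamTrunc l (s + 1) then 1 else 0

theorem LevOK_base {N : ℕ} (L : ℕ) (l : Fin (N + 1) → ℕ) (hL : ∀ i, l i ≤ L) : LevOK N l L (fun _ => 1) := by
  have ht : lamTrunc l (L + 1) = fun _ => 0 := by
    funext i; unfold lamTrunc; rw [if_neg]; have := hL i; omega
  have hw : wlev l L = fun _ => 0 := by
    funext i; unfold wlev; have := hL i; omega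
  have hS : ∀ κ ∈ Sn (lamTrunc l (L + 1)), κ = fun _ => 0 := by
    intro κ hκ; funext i
    obtain ⟨j, hj⟩ := Sn_val _ _ hκ i
    rw [hj, ht]
  have hT : ∀ i : Fin N, Th i (1 : MvPolynomial (Fin (N + 1)) K) = C tt * 1 := by
    intro i
    apply poly_ext_inj
    intro x hx
    rw [eval_Th i _ x hx]
    simp
  refine ⟨⟨fun κ hκ i => Sn_comp _ _ _ hκ, Function.injective_id, ?_, fun κ hκ i _ => hT i⟩, ?_, ?_, ?_⟩
  · intro κ hκ i h
    rw [hS κ hκ] at h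
    simp at h
  · intro κ hκ; simp
  · intro ν hν hne
    exfalso; apply hne
    rw [hw] at hν ⊢
    refine (eq_of_le_csize _ _ (fun i => Nat.zero_le _) hν).symm
  · intro κ hκ
    rw [hS κ hκ, ht, if_pos rfl, hw]
    have : expOf (fun _ : Fin (N + 1) => 0) = 0 := by ext i; simp [expOf]
    rw [this]; simp

theorem LevOK_step {N : ℕ} (L : ℕ) (l : Fin (N + 1) → ℕ) (hl : IsPartition l) (hL : ∀ i, l i ≤ L) (s : ℕ)
    (G : (Fin (N + 1) → ℕ) → MvPolynomial (Fin (N + 1)) K) (hG : LevOK N l (s + 1) G) :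
    LevOK N l s (Gst (s + 1) L l (-(qq ^ s) / tt ^ N) (gam (s + 1) L l G)) := by
  have hcs := csize_wlev l (s + 1) (by omega)
  rw [Nat.add_sub_cancel] at hcs
  have hgd : ∀ α, (gam (s + 1) L l G α).totalDegree ≤ csize (wlev l (s + 1)) := by
    intro α
    unfold gam
    refine totalDegree_finsetSum_le ?_
    intro κ hκ
    refine (totalDegree_mul _ _).trans ?_
    rw [totalDegree_C, zero_add]
    exact hG.deg κ ((mem_SnFinset _ _).1 hκ)
  have hgc : ∀ α, coeff (expOf (wlev l (s + 1))) (gam (s + 1) L l G α) = WB (s + 1 + 1) L (lamTrunc l (s + 1 + 1)) α := by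
    intro α
    unfold gam
    rw [coeff_sum, Finset.sum_eq_single (lamTrunc l (s + 1 + 1))]
    · rw [coeff_C_mul, hG.co _ (Sn_self _), if_pos rfl, mul_one]
    · intro κ hκ hne
      rw [coeff_C_mul, hG.co _ ((mem_SnFinset _ _).1 hκ), if_neg hne, mul_zero]
    · intro h; exact absurd ((mem_SnFinset _ _).2 (Sn_self _)) h
  have hgP := gam_PFam (s + 1) L l hL G hG.H
  refine ⟨Gst_PFam (s + 1) L l hL _ _ hgP, ?_, ?_, ?_⟩
  · intro κ hκ
    unfold Gst
    refine totalDegree_finsetSum_le ?_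
    intro α hα
    refine (totalDegree_mul _ _).trans ?_
    rw [hcs, ← trunc_card _ _ ((mem_SnFinset _ _).1 hα)]
    exact Nat.add_le_add (AA_degree L _ κ α) (hgd α)
  · intro ν hν hne
    have hred : Gst (s + 1) L l (-(qq ^ s) / tt ^ N) (gam (s + 1) L l G) (lamTrunc l (s + 1)) =
        (∏ i, (if lamTrunc l (s + 1) i = 0 then 1 else X i + C (-(qq ^ s) / tt ^ N))) *
          gam (s + 1) L l G (lamTrunc l (s + 1)) := by
      unfold Gst
      rw [Finset.sum_eq_single (lamTrunc l (s + 1)), AA_diag]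
      · intro α hα hne
        rw [AA_part_zero L _ _ α (trunc_partition l hl _) ((mem_SnFinset _ _).1 hα) hne, zero_mul]
      · intro h; exact absurd ((mem_SnFinset _ _).2 (Sn_self _)) h
    rw [hred, map_mul, mul_eq_zero]
    by_cases h0 : ∃ i, s + 1 ≤ l i ∧ ν i = 0
    · left
      obtain ⟨i, hi, hi0⟩ := h0
      have hne' : (Finset.univ.filter (fun i => ν i = 0)).Nonempty := ⟨i, by simpa using hi0⟩
      have hm := Finset.min'_mem _ hne'
      have hle := Finset.min'_le (Finset.univ.filter (fun i => ν i = 0)) i (by simpa using hi0)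
      have hlt : ∀ j, j < (Finset.univ.filter (fun i => ν i = 0)).min' hne' → ν j ≠ 0 := fun j hj h =>
        absurd (Finset.min'_le (Finset.univ.filter (fun i => ν i = 0)) j (by simpa using h)) (not_le.2 hj)
      generalize (Finset.univ.filter (fun i => ν i = 0)).min' hne' = k at hm hle hlt
      rw [map_prod]
      apply Finset.prod_eq_zero (Finset.mem_univ k)
      have hk : lamTrunc l (s + 1) k ≠ 0 := by
        have := hl k i hle
        unfold lamTrunc
        rw [if_pos (by omega)]; omega
      rw [if_neg hk, map_add, eval_X, eval_C, evalPt_first_zero ν k (by simpa using hm) hlt]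
      unfold cc
      rw [zpow_neg, zpow_natCast]
      ring
    · right
      push Not at h0
      have hpre : ∀ i : Fin (N + 1), l i < s + 1 ↔ (Finset.univ.filter (fun i => lamTrunc l (s + 1) i ≠ 0)).card ≤ i.1 := by
        intro i
        constructor
        · intro h
          have : (Finset.univ.filter (fun i => lamTrunc l (s + 1) i ≠ 0)) ⊆ Finset.Iio i := by
            intro j hj
            simp only [Finset.mem_filter, Finset.mem_univ, true_and] at hj
            rw [Finset.mem_Iio]
            by_contra hc
            have := hl i j (not_lt.1 hc)
            apply hj; unfold lamTrunc; rw [if_neg]; omega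
          have := Finset.card_le_card this
          rwa [Fin.card_Iio] at this
        · intro h
          by_contra hc
          have : Finset.Iic i ⊆ (Finset.univ.filter (fun i => lamTrunc l (s + 1) i ≠ 0)) := by
            intro j hj
            simp only [Finset.mem_filter, Finset.mem_univ, true_and]
            rw [Finset.mem_Iic] at hj
            have := hl j i hj
            unfold lamTrunc; rw [if_pos (by omega)]; omega
          have := Finset.card_le_card this
          rw [Fin.card_Iic] at this
          omega
      have hcard : (Finset.univ.filter (fun i => lamTrunc l (s + 1) i ≠ 0)).card ≤ N + 1 := by
        have := Finset.card_le_univ (Finset.univ.filter (fun i => lamTrunc l (s + 1) i ≠ 0))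
        rwa [Fintype.card_fin] at this
      have := gam_vanish (s + 1) L (by omega) l hl hL G hG.H hG.deg hG.V _ hcard hpre ν (by omega)
        (fun i hi => h0 i (by by_contra hc; have := (hpre i).1 (by omega); omega)) hne
      exact this
  · intro κ hκ
    exact coeff_Gst (s + 1) L (by omega) l hL _ _ hgd hgc κ hκ

theorem LevOK_HH {N : ℕ} (L : ℕ) (l : Fin (N + 1) → ℕ) (hl : IsPartition l) (hL : ∀ i, l i ≤ L) (m s : ℕ)
    (h : s + m = L) : LevOK N l s (HH L l m s) := by
  induction m generalizing s with
  | zero => subst h; exact LevOK_base _ l hL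
  | succ m ih => exact LevOK_step L l hl hL s _ (ih (s + 1) (by omega))

theorem lamTrunc_one {n : ℕ} (l : Fin n → ℕ) : lamTrunc l 1 = l := by
  funext i; unfold lamTrunc; split_ifs <;> omega

theorem GG_props {N : ℕ} (L : ℕ) (l : Fin (N + 1) → ℕ) (hl : IsPartition l) (hL : ∀ i, l i ≤ L) :
    PFam N (Sn l) id (fun _ _ => 1) (HH L l L 0) ∧ (∀ κ ∈ Sn l, (HH L l L 0 κ).totalDegree ≤ csize l) ∧
    (∀ ν, csize ν ≤ csize l → ν ≠ l → eval (evalPt ν) (HH L l L 0 l) = 0) ∧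
    (∀ κ ∈ Sn l, coeff (expOf l) (HH L l L 0 κ) = if κ = l then 1 else 0) := by
  have h := LevOK_HH L l hl hL L 0 (by omega)
  have hw : wlev l 0 = l := by funext i; simp [wlev]
  obtain ⟨h1, h2, h3, h4⟩ := h
  rw [zero_add, lamTrunc_one] at h1 h2 h3 h4
  rw [hw] at h2 h3 h4
  refine ⟨h1, h2, ?_, h4⟩
  intro ν hν hne
  have := h3 ν hν hne
  simpa only [pow_zero, one_mul] using this

section Chains
variable {D M : Type} [CommRing M]

def prvRow (d : D) {m : ℕ} (x : Fin m → D) (i : Fin m) : D :=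
  if i.1 = 0 then d else x (rowBelow i)

theorem prvRow_cons (d e : D) {m : ℕ} (y : Fin m → D) (i : Fin m) :
    prvRow d (Fin.cons e y : Fin (m + 1) → D) i.succ = prvRow e y i := by
  unfold prvRow
  rw [if_neg (by simp)]
  split_ifs with h
  · have : rowBelow i.succ = 0 := by ext; simp [rowBelow, h]
    rw [this, Fin.cons_zero]
  · have : rowBelow i.succ = (rowBelow i).succ := by ext; simp [rowBelow]; omega
    rw [this, Fin.cons_succ]

def chn (S : ℕ → D → Finset D) : (m : ℕ) → ℕ → D → Finset (Fin m → D)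
  | 0, _, _ => {Fin.elim0}
  | m + 1, s, d => (S s d).biUnion (fun e => (chn S m (s + 1) e).image (Fin.cons e))

def chR (S : ℕ → D → Finset D) (w : ℕ → D → D → M) : ℕ → ℕ → D → M
  | 0, _, _ => 1
  | m + 1, s, d => ∑ e ∈ S s d, w s d e * chR S w m (s + 1) e

theorem chn_mem (S : ℕ → D → Finset D) (m s : ℕ) (d : D) (x : Fin m → D) :
    x ∈ chn S m s d ↔ ∀ i, x i ∈ S (s + i.1) (prvRow d x i) := by
  induction m generalizing s d with
  | zero => simp [chn]; exact Subsingleton.elim _ _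
  | succ m ih =>
    simp only [chn, Finset.mem_biUnion, Finset.mem_image]
    rw [Fin.forall_fin_succ]
    constructor
    · rintro ⟨e, he, y, hy, rfl⟩
      refine ⟨?_, fun i => ?_⟩
      · simpa [prvRow] using he
      · rw [prvRow_cons, Fin.cons_succ]
        have := (ih (s + 1) e y).1 hy i
        rwa [Fin.val_succ, show s + (i.1 + 1) = s + 1 + i.1 by ring]
    · rintro ⟨h0, h1⟩
      refine ⟨x 0, by simpa [prvRow] using h0, Fin.tail x, ?_, Fin.cons_self_tail x⟩
      rw [ih]
      intro i
      have := h1 i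
      rw [← Fin.cons_self_tail x, prvRow_cons, Fin.cons_succ] at this
      rwa [Fin.val_succ, show s + (i.1 + 1) = s + 1 + i.1 by ring] at this

theorem chn_sum (S : ℕ → D → Finset D) (w : ℕ → D → D → M) (m s : ℕ) (d : D) :
    ∑ x ∈ chn S m s d, ∏ i, w (s + i.1) (prvRow d x i) (x i) = chR S w m s d := by
  induction m generalizing s d with
  | zero => simp [chn, chR]
  | succ m ih =>
    simp only [chn, chR]
    rw [Finset.sum_biUnion]
    · apply Finset.sum_congr rfl
      intro e he
      rw [Finset.sum_image (fun a _ b _ h => Fin.cons_right_injective _ h), ← ih, Finset.mul_sum]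
      apply Finset.sum_congr rfl
      intro y _
      rw [Fin.prod_univ_succ]
      congr 1
      · apply Finset.prod_congr rfl
        intro i _
        rw [prvRow_cons, Fin.cons_succ, Fin.val_succ, show s + (i.1 + 1) = s + 1 + i.1 by ring]
    · intro a _ b _ hab
      rw [Function.onFun, Finset.disjoint_left]
      intro x hx hx'
      rw [Finset.mem_image] at hx hx'
      obtain ⟨y, _, rfl⟩ := hx
      obtain ⟨z, _, h⟩ := hx'
      apply hab
      have := congrFun h 0
      simpa using this.symm
end Chains

/-- Row data: regular row, classic pairing, signed row, signed pairing. -/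
abbrev RowD (n : ℕ) := (Fin n → ℕ) × (Fin n → Fin n) × (Fin n → ℤ) × (Fin n → Fin n)

def sgnF {n : ℕ} (A : Finset (Fin n → ℕ)) : Finset (Fin n → ℤ) :=
  A.biUnion (fun α => Fintype.piFinset (fun i => ({(α i : ℤ), -(α i : ℤ)} : Finset ℤ)))

theorem mem_pm {n : ℕ} (α : Fin n → ℕ) (u : Fin n → ℤ) :
    u ∈ Fintype.piFinset (fun i => ({(α i : ℤ), -(α i : ℤ)} : Finset ℤ)) ↔ ab u = α := by
  rw [Fintype.mem_piFinset, funext_iff]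
  apply forall_congr'
  intro i
  rw [Finset.mem_insert, Finset.mem_singleton]
  unfold ab
  omega

theorem mem_sgnF {n : ℕ} (A : Finset (Fin n → ℕ)) (u : Fin n → ℤ) : u ∈ sgnF A ↔ ab u ∈ A := by
  unfold sgnF
  simp only [Finset.mem_biUnion, mem_pm]
  constructor
  · rintro ⟨a, h, rfl⟩; exact h
  · intro h; exact ⟨_, h, rfl⟩

theorem sum_sgnF {n : ℕ} {M : Type} [AddCommMonoid M] (A : Finset (Fin n → ℕ)) (f : (Fin n → ℤ) → M) :
    ∑ u ∈ sgnF A, f u = ∑ α ∈ A, ∑ u ∈ Fintype.piFinset (fun i => ({(α i : ℤ), -(α i : ℤ)} : Finset ℤ)), f u := by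
  unfold sgnF
  rw [Finset.sum_biUnion]
  intro a _ b _ hab
  rw [Function.onFun, Finset.disjoint_left]
  intro u h1 h2
  exact hab (((mem_pm _ _).1 h1).symm.trans ((mem_pm _ _).1 h2))

def cOK {n : ℕ} (s : ℕ) (d : RowD n) (κ : Fin n → ℕ) (p : Fin n → Fin n) : Prop :=
  if s = 0 then p = id else CVal κ (ab d.2.2.1) p

def rowS {n : ℕ} (l μ : Fin n → ℕ) (s : ℕ) (d : RowD n) : Finset (RowD n) :=
  ((if s = 0 then {μ} else SnFinset (lamTrunc l (s + 1))) ×ˢ Finset.univ ×ˢ sgnF (SnFinset (lamTrunc l (s + 1))) ×ˢ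
    Finset.univ).filter (fun e => cOK s d e.1 e.2.1 ∧ SVal e.2.2.1 e.1 e.2.2.2)

def roww {n : ℕ} (s : ℕ) (d e : RowD n) : MvPolynomial (Fin n) K :=
  C ((∏ j, if 0 < s then cweight e.1 (ab d.2.2.1) e.2.1 (s + 1) j else 1) * ∏ j, sweight e.2.2.1 e.1 e.2.2.2 j) *
    ∏ i, ballw (-(qq ^ s) / tt ^ (n - 1)) i (e.2.2.1 i)

theorem row_sum {n : ℕ} (L : ℕ) (l : Fin n → ℕ) (hL : ∀ i, l i ≤ L) (μ : Fin n → ℕ) (hμ : μ ∈ Sn l) (s : ℕ)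
    (d : RowD n) (G : (Fin n → ℕ) → MvPolynomial (Fin n) K) (B : Finset (Fin n → ℕ))
    (hB : B = if s = 0 then {μ} else SnFinset (lamTrunc l (s + 1))) :
    ∑ e ∈ rowS l μ s d, roww s d e * G (ab e.2.2.1) =
      ∑ κ ∈ B, (∑ p ∈ Finset.univ.filter (cOK s d κ), C (∏ j, if 0 < s then cweight κ (ab d.2.2.1) p (s + 1) j else 1)) *
        Gst (s + 1) L l (-(qq ^ s) / tt ^ (n - 1)) G κ := by
  have hBS : ∀ κ ∈ B, κ ∈ Sn (lamTrunc l (s + 1)) := by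
    intro κ hκ
    rw [hB] at hκ
    split_ifs at hκ with h
    · rw [Finset.mem_singleton] at hκ
      subst h
      rw [hκ, zero_add, lamTrunc_one]; exact hμ
    · exact (mem_SnFinset _ _).1 hκ
  unfold rowS
  rw [← hB, Finset.sum_filter, Finset.sum_product]
  apply Finset.sum_congr rfl
  intro κ hκ
  have hκS := hBS κ hκ
  have hκL := fun i => (trunc_val L l hL _ κ hκS i).1
  rw [Finset.sum_product, Finset.sum_filter, Finset.sum_mul]
  apply Finset.sum_congr rfl
  intro p _
  by_cases hp : cOK s d κ p
  swap
  · simp only [hp, false_and, if_false, Finset.sum_const_zero, zero_mul]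
  simp only [hp, true_and, if_true]
  rw [Finset.sum_product, sum_sgnF]
  unfold Gst
  rw [Finset.mul_sum]
  apply Finset.sum_congr rfl
  intro α hα
  rw [mem_SnFinset] at hα
  rw [← signs_sum L _ α κ hκL, Finset.sum_mul, Finset.mul_sum]
  apply Finset.sum_congr rfl
  intro u hu
  rw [mem_pm] at hu
  rw [← signed_sum L u κ (by rw [hu]; exact fun i => (trunc_val L l hL _ α hα i).1) hκL
    (by rw [hu]; intro b _ _; rw [← cnt_card, ← cnt_card, (Sn_iff _ _).1 hα, (Sn_iff _ _).1 hκS]),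
    map_sum, Finset.sum_mul, Finset.sum_mul, Finset.mul_sum, Finset.sum_filter]
  apply Finset.sum_congr rfl
  intro σ _
  by_cases h : SVal u κ σ
  · rw [if_pos h, if_pos h]
    unfold roww
    rw [C_mul]
    simp only [hu]
    generalize (C (∏ j, if 0 < s then cweight κ (ab d.2.2.1) p (s + 1) j else 1) : MvPolynomial (Fin n) K) = A1
    ring
  · rw [if_neg h, if_neg h]

theorem chR_gam {n : ℕ} (L : ℕ) (l : Fin n → ℕ) (hL : ∀ i, l i ≤ L) (μ : Fin n → ℕ) (hμ : μ ∈ Sn l) (m s : ℕ)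
    (hs : 1 ≤ s) (hm : s + m = L) (d : RowD n) (hd : ab d.2.2.1 ∈ Sn (lamTrunc l s)) :
    chR (rowS l μ) roww m s d = gam s L l (HH L l m s) (ab d.2.2.1) := by
  induction m generalizing s d with
  | zero =>
    have hs : s = L := hm
    subst hs
    have ht : lamTrunc l (s + 1) = fun _ => 0 := by
      funext i; unfold lamTrunc; rw [if_neg]; have := hL i; omega
    have hS : SnFinset (lamTrunc l (s + 1)) = {fun _ => 0} := by
      ext κ
      rw [mem_SnFinset, Finset.mem_singleton]
      constructor
      · intro h; funext i; obtain ⟨j, hj⟩ := Sn_val _ _ h i; rw [hj, ht]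
      · intro h; rw [h, ← ht]; exact Sn_self _
    unfold gam chR
    rw [hS, Finset.sum_singleton]
    unfold WB HH
    rw [if_pos (fun i h => absurd rfl h)]
    simp
  | succ m ih =>
    have h1 : ∀ e ∈ rowS l μ s d, roww s d e * chR (rowS l μ) roww m (s + 1) e =
        roww s d e * gam (s + 1) L l (HH L l m (s + 1)) (ab e.2.2.1) := by
      intro e he
      rw [ih (s + 1) (by omega) (by omega)]
      unfold rowS at he
      simp only [Finset.mem_filter, Finset.mem_product, mem_sgnF, mem_SnFinset] at he
      exact he.1.2.2.1
    unfold chR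
    rw [Finset.sum_congr rfl h1, row_sum L l hL μ hμ s d _ _ rfl, if_neg (by omega)]
    rw [show HH L l (m + 1) s = Gst (s + 1) L l (-(qq ^ s) / tt ^ (n - 1)) (gam (s + 1) L l (HH L l m (s + 1))) from rfl]
    generalize gam (s + 1) L l (HH L l m (s + 1)) = G'
    unfold gam
    apply Finset.sum_congr rfl
    intro κ hκ
    rw [mem_SnFinset] at hκ
    congr 1
    rw [← classic_sum (s + 1) L (by omega) κ (ab d.2.2.1) (fun i hi => ⟨(trunc_val L l hL _ κ hκ i).2 hi, (trunc_val L l hL _ κ hκ i).1⟩)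
      (fun i => (trunc_val L l hL _ _ hd i).1) (fun b hb _ => trunc_cnt l s _ _ hd hκ b hb), map_sum]
    have : cOK s d κ = CVal κ (ab d.2.2.1) := by funext p; unfold cOK; rw [if_neg (by omega)]
    simp only [this, if_pos (show 0 < s by omega)]

theorem chR_top {n : ℕ} (L : ℕ) (l : Fin n → ℕ) (hL : ∀ i, l i ≤ L) (μ : Fin n → ℕ) (hμ : μ ∈ Sn l) (d : RowD n) :
    chR (rowS l μ) roww L 0 d = HH L l L 0 μ := by
  rcases L with _ | m
  · rfl
  · have h1 : ∀ e ∈ rowS l μ 0 d, roww 0 d e * chR (rowS l μ) roww m (0 + 1) e =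
        roww 0 d e * gam (0 + 1) (m + 1) l (HH (m + 1) l m (0 + 1)) (ab e.2.2.1) := by
      intro e he
      rw [chR_gam (m + 1) l hL μ hμ m (0 + 1) (by omega) (by omega)]
      unfold rowS at he
      simp only [Finset.mem_filter, Finset.mem_product, mem_sgnF, mem_SnFinset] at he
      exact he.1.2.2.1
    unfold chR
    rw [Finset.sum_congr rfl h1, row_sum (m + 1) l hL μ hμ 0 d _ _ rfl, if_pos rfl, Finset.sum_singleton]
    have : Finset.univ.filter (cOK 0 d μ) = {id} := by
      ext p; simp [cOK]
    rw [this]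
    simp [HH]

theorem Sn_ex {n : ℕ} (l a : Fin n → ℕ) : (∃ σ : Equiv.Perm (Fin n), ∀ i, a i = l (σ i)) ↔ a ∈ Sn l := by
  constructor
  · rintro ⟨σ, h⟩
    refine ⟨σ.symm, ?_⟩
    funext i; simp [permAct, h]
  · rintro ⟨σ, rfl⟩
    exact ⟨σ.symm, fun i => rfl⟩

def toRows {n L : ℕ} {l : Fin n → ℕ} (Q : SMLQ n L l) (r : Fin L) : RowD n :=
  (Q.reg r, Q.cpair r, Q.sgn r, Q.spair r)

theorem toRows_inj {n L : ℕ} {l : Fin n → ℕ} : Function.Injective (toRows (n := n) (L := L) (l := l)) := by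
  intro Q Q' h
  have h0 := fun r => congrFun h r
  unfold toRows at h0
  simp only [Prod.mk.injEq] at h0
  have h1 : Q.reg = Q'.reg := funext fun r => (h0 r).1
  have h2 : Q.cpair = Q'.cpair := funext fun r => (h0 r).2.1
  have h3 : Q.sgn = Q'.sgn := funext fun r => (h0 r).2.2.1
  have h4 : Q.spair = Q'.spair := funext fun r => (h0 r).2.2.2
  cases Q; cases Q'
  simp only at h1 h2 h3 h4
  subst h1 h2 h3 h4
  rfl

def dumRow (n : ℕ) : RowD n := (fun _ => 0, id, fun _ => 0, id)

theorem toRows_mem {n L : ℕ} (l : Fin n → ℕ) (μ : Fin n → ℕ) (Q : SMLQ n L l) (hQ : Q.typeOf = μ) :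
    toRows Q ∈ chn (rowS l μ) L 0 (dumRow n) := by
  rw [chn_mem]
  intro r
  rw [zero_add]
  unfold rowS
  simp only [Finset.mem_filter, Finset.mem_product, Finset.mem_univ, true_and, and_true, mem_sgnF, mem_SnFinset]
  refine ⟨⟨?_, ?_⟩, ?_, ?_⟩
  · split_ifs with h
    · rw [Finset.mem_singleton, ← hQ]
      funext i
      unfold SMLQ.typeOf
      have hL : 0 < L := lt_of_le_of_lt (Nat.zero_le _) r.2
      rw [dif_pos hL]
      have : r = ⟨0, hL⟩ := Fin.ext h
      subst this; rfl
    · rw [mem_SnFinset, ← Sn_ex]; exact Q.reg_content r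
  · rw [← Sn_ex]; exact Q.sgn_content r
  · unfold cOK
    split_ifs with h
    · exact Q.cpair_bot r h
    · unfold prvRow
      rw [if_neg h]
      have h' : 0 < r.1 := Nat.pos_of_ne_zero h
      refine ⟨Q.cpair_triv r, Q.cpair_label r h', Q.cpair_inj r, fun j hj => ?_⟩
      have := Q.cpair_below r h' j hj
      refine ⟨fun h => this.1 (fun h0 => h ?_), this.2⟩
      show (Q.sgn (rowBelow r) j).natAbs = 0
      rw [h0]; rfl
  · exact ⟨Q.spair_triv r, Q.spair_label r, Q.spair_inj r, Q.spair_nowrap r, Q.spair_pos r, Q.spair_neg r⟩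

theorem mem_toRows {n L : ℕ} (l : Fin n → ℕ) (μ : Fin n → ℕ) (hμ : μ ∈ Sn l) (hL : ∀ i, l i ≤ L) (x : Fin L → RowD n)
    (hx : x ∈ chn (rowS l μ) L 0 (dumRow n)) : ∃ Q : SMLQ n L l, Q.typeOf = μ ∧ toRows Q = x := by
  rw [chn_mem] at hx
  have hx1 : ∀ r : Fin L, (x r).1 ∈ (if r.1 = 0 then {μ} else SnFinset (lamTrunc l (r.1 + 1))) ∧
      ab (x r).2.2.1 ∈ Sn (lamTrunc l (r.1 + 1)) ∧ cOK r.1 (prvRow (dumRow n) x r) (x r).1 (x r).2.1 ∧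
      SVal (x r).2.2.1 (x r).1 (x r).2.2.2 := by
    intro r
    have := hx r
    rw [zero_add] at this
    unfold rowS at this
    simp only [Finset.mem_filter, Finset.mem_product, Finset.mem_univ, true_and, and_true, mem_sgnF, mem_SnFinset] at this
    exact ⟨this.1.1, this.1.2, this.2⟩
  have hc0 : ∀ r : Fin L, r.1 = 0 → (x r).2.1 = id := by
    intro r h
    have := (hx1 r).2.2.1
    unfold cOK at this
    rwa [if_pos h] at this
  have hc1 : ∀ r : Fin L, 0 < r.1 → CVal (x r).1 (ab (x (rowBelow r)).2.2.1) (x r).2.1 := by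
    intro r h
    have := (hx1 r).2.2.1
    unfold cOK prvRow at this
    rwa [if_neg (by omega), if_neg (by omega)] at this
  refine ⟨⟨fun r => (x r).1, fun r => (x r).2.2.1, fun r => (x r).2.1, fun r => (x r).2.2.2, ?_, ?_, hc0, ?_,
    fun r h => (hc1 r h).label, ?_, ?_, fun r => (hx1 r).2.2.2.triv, fun r => (hx1 r).2.2.2.label,
    fun r => (hx1 r).2.2.2.inj, fun r => (hx1 r).2.2.2.nowrap, fun r => (hx1 r).2.2.2.pos,
    fun r => (hx1 r).2.2.2.neg⟩, ?_, ?_⟩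
  · intro r
    rw [Sn_ex]
    have := (hx1 r).1
    split_ifs at this with h
    · rw [Finset.mem_singleton] at this
      rw [h, zero_add, lamTrunc_one, this]; exact hμ
    · exact (mem_SnFinset _ _).1 this
  · intro r
    rw [Sn_ex]
    exact (hx1 r).2.1
  · intro r j h
    rcases Nat.eq_zero_or_pos r.1 with h0 | h0
    · show (x r).2.1 j = j
      rw [hc0 r h0]; rfl
    · exact (hc1 r h0).triv j h
  · intro r j j' h h' he
    rcases Nat.eq_zero_or_pos r.1 with h0 | h0
    · change (x r).2.1 j = (x r).2.1 j' at he
      rw [hc0 r h0] at he; exact he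
    · exact (hc1 r h0).inj j j' h h' he
  · intro r h j hj
    have := (hc1 r h).below j hj
    exact ⟨fun h0 => this.1 (Int.natAbs_ne_zero.2 h0), this.2⟩
  · funext i
    unfold SMLQ.typeOf
    split_ifs with h
    · have := (hx1 ⟨0, h⟩).1
      rw [if_pos rfl, Finset.mem_singleton] at this
      exact congrFun this i
    · obtain ⟨j, hj⟩ := Sn_val _ _ hμ i
      have := hL j
      omega
  · rfl

theorem wt_rows {n L : ℕ} (l : Fin n → ℕ) (Q : SMLQ n L l) :
    Q.wt = ∏ r, roww (0 + r.1) (prvRow (dumRow n) (toRows Q) r) (toRows Q r) := by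
  unfold SMLQ.wt SMLQ.pairWeight SMLQ.ballWeight roww
  rw [Finset.prod_mul_distrib, ← map_prod, Finset.prod_mul_distrib]
  congr 1
  · congr 2
    apply Finset.prod_congr rfl
    intro r _
    apply Finset.prod_congr rfl
    intro j _
    rw [zero_add]
    split_ifs with h
    · unfold prvRow
      rw [if_neg (by omega)]
      rfl
    · rfl
  · apply Finset.prod_congr rfl
    intro r _
    rw [zero_add]
    rfl

theorem Fstar_eq {n L : ℕ} (l : Fin n → ℕ) (hL : ∀ i, l i ≤ L) (μ : Fin n → ℕ) (hμ : μ ∈ Sn l) :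
    Fstar n L l μ = HH L l L 0 μ := by
  rw [← chR_top L l hL μ hμ (dumRow n), ← chn_sum, ← finsum_mem_coe_finset]
  have hr : (↑(chn (rowS l μ) L 0 (dumRow n)) : Set (Fin L → RowD n)) =
      Set.range (fun Q : {Q : SMLQ n L l // Q.typeOf = μ} => toRows Q.1) := by
    ext x
    rw [Finset.mem_coe, Set.mem_range]
    constructor
    · intro h
      obtain ⟨Q, h1, h2⟩ := mem_toRows l μ hμ hL x h
      exact ⟨⟨Q, h1⟩, h2⟩
    · rintro ⟨Q, rfl⟩
      exact toRows_mem l μ Q.1 Q.2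
  rw [hr, finsum_mem_range (fun a b h => Subtype.ext (toRows_inj h))]
  unfold Fstar
  apply finsum_congr
  intro Q
  exact wt_rows l Q.1

def invc {n : ℕ} (κ : Fin n → ℕ) : Finset (Fin n × Fin n) := Finset.univ.filter (fun p => p.1 < p.2 ∧ κ p.1 < κ p.2)

theorem sw_lt_iff {N : ℕ} (i : Fin N) (a b : Fin (N + 1)) : sw i a < sw i b ↔
    (a < b ∧ ¬ (a = i.castSucc ∧ b = i.succ)) ∨ (a = i.succ ∧ b = i.castSucc) := by
  unfold sw
  simp only [Equiv.swap_apply_def, Fin.ext_iff, Fin.val_castSucc, Fin.val_succ]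
  split_ifs <;> simp only [Fin.lt_def, Fin.val_castSucc, Fin.val_succ] <;> omega

theorem invc_sw {N : ℕ} (i : Fin N) (κ : Fin (N + 1) → ℕ) : (invc (κ ∘ sw i)).card =
    (Finset.univ.filter (fun p : Fin (N + 1) × Fin (N + 1) => sw i p.1 < sw i p.2 ∧ κ p.1 < κ p.2)).card := by
  apply Finset.card_bij' (fun p _ => (sw i p.1, sw i p.2)) (fun p _ => (sw i p.1, sw i p.2))
  · intro p hp
    simp only [invc, Finset.mem_filter, Finset.mem_univ, true_and, Function.comp] at hp ⊢
    simpa [sw] using hp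
  · intro p hp
    simp only [invc, Finset.mem_filter, Finset.mem_univ, true_and, Function.comp] at hp ⊢
    simpa [sw] using hp
  · intro p _; simp [sw]
  · intro p _; simp [sw]

theorem invc_lt {N : ℕ} (i : Fin N) (κ : Fin (N + 1) → ℕ) (h : κ i.succ < κ i.castSucc) :
    (invc (κ ∘ sw i)).card = (invc κ).card + 1 := by
  rw [invc_sw]
  have hn : (i.succ, i.castSucc) ∉ invc κ := by
    simp only [invc, Finset.mem_filter, Finset.mem_univ, true_and, not_and]
    intro h1
    exact absurd h1 (not_lt.2 (le_of_lt Fin.castSucc_lt_succ))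
  rw [← Finset.card_insert_of_notMem hn]
  congr 1
  ext ⟨a, b⟩
  simp only [invc, Finset.mem_filter, Finset.mem_univ, true_and, Finset.mem_insert, sw_lt_iff, Prod.mk.injEq]
  constructor
  · rintro ⟨h1 | h1, h2⟩
    · exact Or.inr ⟨h1.1, h2⟩
    · exact Or.inl h1
  · rintro (⟨rfl, rfl⟩ | ⟨h1, h2⟩)
    · exact ⟨Or.inr ⟨rfl, rfl⟩, h⟩
    · refine ⟨Or.inl ⟨h1, ?_⟩, h2⟩
      rintro ⟨rfl, rfl⟩
      omega

theorem invc_ge {N : ℕ} (i : Fin N) (κ : Fin (N + 1) → ℕ) (h : ¬ κ i.succ < κ i.castSucc) :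
    (invc (κ ∘ sw i)).card ≤ (invc κ).card := by
  rw [invc_sw]
  apply Finset.card_le_card
  rintro ⟨a, b⟩ hp
  simp only [invc, Finset.mem_filter, Finset.mem_univ, true_and, sw_lt_iff] at hp ⊢
  obtain ⟨h1 | ⟨rfl, rfl⟩, h2⟩ := hp
  · exact ⟨h1.1, h2⟩
  · exact absurd h2 h

theorem permAct_sw {N : ℕ} (i : {i : ℕ // i + 1 < N + 1}) (σ : Equiv.Perm (Fin (N + 1))) (l : Fin (N + 1) → ℕ) :
    permAct (adjSwap i * σ) l = permAct σ l ∘ sw ⟨i.1, by omega⟩ := by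
  funext j; rfl

theorem word_ex {N : ℕ} (l : Fin (N + 1) → ℕ) (hl : IsPartition l) (κ : Fin (N + 1) → ℕ) (hκ : κ ∈ Sn l) :
    ∃ w : List {i : ℕ // i + 1 < N + 1}, permAct (w.map adjSwap).prod l = κ ∧ w.length = (invc κ).card := by
  have := sort_ind id (fun κ => κ ∈ Sn l → ∃ w : List {i : ℕ // i + 1 < N + 1},
    permAct (w.map adjSwap).prod l = κ ∧ w.length = (invc κ).card) ?_ ?_ κ
  · exact this hκ
  · intro κ hk hκ
    have e : κ = l := sorted_unique id Function.injective_id κ l ((Sn_iff _ _).1 hκ) hk (fun i j h => hl i j h)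
    subst e
    refine ⟨[], rfl, ?_⟩
    symm
    rw [List.length_nil, Finset.card_eq_zero]
    unfold invc
    rw [Finset.filter_eq_empty_iff]
    rintro ⟨a, b⟩ _ ⟨h1, h2⟩
    exact absurd (hl a b (le_of_lt h1)) (not_le.2 h2)
  · intro κ i h ih hκ
    have hκ' : κ ∈ Sn l := by
      have := Sn_comp _ _ (sw i) hκ
      rwa [comp_sw_sw] at this
    obtain ⟨w, h1, h2⟩ := ih hκ'
    refine ⟨⟨i.1, by omega⟩ :: w, ?_, ?_⟩
    · rw [List.map_cons, List.prod_cons, permAct_sw, h1]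
    · rw [List.length_cons, h2, invc_lt i κ h]

theorem word_le {N : ℕ} (l : Fin (N + 1) → ℕ) (hl : IsPartition l) (w : List {i : ℕ // i + 1 < N + 1}) :
    (invc (permAct (w.map adjSwap).prod l)).card ≤ w.length := by
  induction w with
  | nil =>
    rw [List.length_nil, Nat.le_zero, Finset.card_eq_zero]
    unfold invc
    rw [Finset.filter_eq_empty_iff]
    rintro ⟨a, b⟩ _ ⟨h1, h2⟩
    exact absurd (hl a b (le_of_lt h1)) (not_le.2 h2)
  | cons i w ih =>
    rw [List.map_cons, List.prod_cons, permAct_sw, List.length_cons]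
    by_cases h : permAct (w.map adjSwap).prod l (Fin.succ ⟨i.1, by omega⟩) < permAct (w.map adjSwap).prod l (Fin.castSucc ⟨i.1, by omega⟩)
    · rw [invc_lt _ _ h]; omega
    · exact (invc_ge _ _ h).trans (by omega)

def dlt (N : ℕ) : Fin (N + 1) → ℕ := fun i => N - i.1

theorem dlt_part (N : ℕ) : IsPartition (dlt N) := by
  intro i j h
  have : i.1 ≤ j.1 := h
  unfold dlt; omega

theorem dlt_lt {N : ℕ} (a b : Fin (N + 1)) : dlt N a < dlt N b ↔ b < a := by
  unfold dlt; rw [Fin.lt_def]; omega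

theorem permLength_eq {N : ℕ} (σ : Equiv.Perm (Fin (N + 1))) : permLength σ = (invc (permAct σ (dlt N))).card := by
  unfold permLength
  rw [← Set.ncard_coe_finset]
  apply Set.ncard_congr (fun p _ => (σ p.2, σ p.1))
  · rintro ⟨a, b⟩ ⟨h1, h2⟩
    simp only [invc, Finset.coe_filter, Finset.mem_univ, true_and, Set.mem_setOf_eq, permAct, Function.comp,
      Equiv.symm_apply_apply, dlt_lt]
    exact ⟨h2, h1⟩
  · rintro ⟨a, b⟩ ⟨c, d⟩ _ _ h
    simp only [Prod.mk.injEq, EmbeddingLike.apply_eq_iff_eq] at h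
    rw [h.1, h.2]
  · rintro ⟨a, b⟩ h
    simp only [invc, Finset.coe_filter, Finset.mem_univ, true_and, Set.mem_setOf_eq, permAct, Function.comp,
      dlt_lt] at h
    exact ⟨(σ.symm b, σ.symm a), ⟨h.2, by simpa using h.1⟩, by simp⟩

theorem permAct_dlt_inj {N : ℕ} (σ τ : Equiv.Perm (Fin (N + 1))) (h : permAct σ (dlt N) = permAct τ (dlt N)) : σ = τ := by
  have : σ.symm = τ.symm := by
    ext i
    have := congrFun h i
    simp only [permAct, Function.comp, dlt] at this
    omega
  rw [← σ.symm_symm, this, τ.symm_symm]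

theorem reduced_ex {N : ℕ} (σ : Equiv.Perm (Fin (N + 1))) : ∃ w, IsReducedWordOf w σ := by
  obtain ⟨w, h1, h2⟩ := word_ex (dlt N) (dlt_part N) (permAct σ (dlt N)) ⟨σ, rfl⟩
  exact ⟨w, permAct_dlt_inj _ _ h1, by rw [h2, permLength_eq]⟩

theorem permLength_word {N : ℕ} (w : List {i : ℕ // i + 1 < N + 1}) : permLength (w.map adjSwap).prod ≤ w.length := by
  rw [permLength_eq]; exact word_le _ (dlt_part N) w

theorem Tword_G {N : ℕ} (l : Fin (N + 1) → ℕ) (hl : IsPartition l) (G : (Fin (N + 1) → ℕ) → MvPolynomial (Fin (N + 1)) K)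
    (hG : PFam N (Sn l) id (fun _ _ => 1) G) (w : List {i : ℕ // i + 1 < N + 1})
    (hw : (invc (permAct (w.map adjSwap).prod l)).card = w.length) :
    Tword w (G l) = G (permAct (w.map adjSwap).prod l) := by
  induction w with
  | nil => rfl
  | cons i w ih =>
    rw [List.map_cons, List.prod_cons, permAct_sw, List.length_cons] at hw
    have hle := word_le l hl w
    have h : permAct (w.map adjSwap).prod l (Fin.succ ⟨i.1, by omega⟩) < permAct (w.map adjSwap).prod l (Fin.castSucc ⟨i.1, by omega⟩) := by
      by_contra h
      have := invc_ge _ _ h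
      omega
    rw [invc_lt _ _ h] at hw
    have e : Tword (i :: w) (G l) = Th ⟨i.1, by omega⟩ (Tword w (G l)) := rfl
    rw [e, ih (by omega), List.map_cons, List.prod_cons, permAct_sw, hG.hstep _ ⟨_, rfl⟩ _ h, C_1, one_mul]

theorem fstar_G {N : ℕ} (l : Fin (N + 1) → ℕ) (hl : IsPartition l) (G : (Fin (N + 1) → ℕ) → MvPolynomial (Fin (N + 1)) K)
    (hG : PFam N (Sn l) id (fun _ _ => 1) G) (hE : IsEstar l (G l)) (μ : Fin (N + 1) → ℕ) (hμ : μ ∈ Sn l) :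
    fstar μ = G μ := by
  have hs : sortDesc μ = l := by
    have hex : ∃ l, IsPartition l ∧ μ ∈ Sn l := ⟨l, hl, hμ⟩
    unfold sortDesc
    rw [dif_pos hex]
    have h1 := hex.choose_spec
    apply sorted_unique id Function.injective_id _ _ _ (fun i j h => h1.1 i j h) (fun i j h => hl i j h)
    intro a
    exact ((Sn_iff _ _).1 h1.2 a).symm.trans ((Sn_iff _ _).1 hμ a)
  have hEs : Estar l = G l := by
    have hex : ∃ f, IsEstar l f := ⟨_, hE⟩
    unfold Estar
    rw [dif_pos hex]
    exact IsEstar_unique l _ _ hex.choose_spec hE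
  have hsm : permAct (sigmaMin l μ) l = μ ∧ ∀ τ, permAct τ l = μ → permLength (sigmaMin l μ) ≤ permLength τ := by
    have hex : ∃ σ, permAct σ l = μ ∧ ∀ τ, permAct τ l = μ → permLength σ ≤ permLength τ := by
      have hne : (Finset.univ.filter (fun σ => permAct σ l = μ)).Nonempty := by
        obtain ⟨σ, h⟩ := hμ
        exact ⟨σ, by simpa using h⟩
      obtain ⟨σ, h1, h2⟩ := Finset.exists_min_image _ permLength hne
      exact ⟨σ, by simpa using h1, fun τ h => h2 τ (by simpa using h)⟩
    unfold sigmaMin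
    rw [dif_pos hex]
    exact hex.choose_spec
  unfold fstar
  rw [hs, hEs]
  generalize sigmaMin l μ = σ at hsm
  obtain ⟨h1, h2⟩ := hsm
  have hex := reduced_ex σ
  unfold Tsigma
  rw [dif_pos hex]
  obtain ⟨w1, w2⟩ := hex.choose_spec
  generalize hex.choose = w at w1 w2
  subst w1
  rw [Tword_G l hl G hG w, h1]
  apply le_antisymm (word_le l hl w)
  rw [h1]
  obtain ⟨w', e1, e2⟩ := word_ex l hl μ hμ
  have := h2 _ e1
  have := permLength_word w'
  omega

theorem sum_Th {N : ℕ} (l : Fin (N + 1) → ℕ) (G : (Fin (N + 1) → ℕ) → MvPolynomial (Fin (N + 1)) K)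
    (hG : PFam N (Sn l) id (fun _ _ => 1) G) (i : Fin N) :
    Th i (∑ μ ∈ SnFinset l, G μ) = C tt * ∑ μ ∈ SnFinset l, G μ := by
  have hre : ∀ f : (Fin (N + 1) → ℕ) → MvPolynomial (Fin (N + 1)) K,
      ∑ μ ∈ SnFinset l, f (μ ∘ sw i) = ∑ μ ∈ SnFinset l, f μ := by
    intro f
    apply Finset.sum_nbij' (fun μ => μ ∘ sw i) (fun μ => μ ∘ sw i)
    · intro μ h; rw [mem_SnFinset] at h ⊢; exact Sn_comp _ _ _ h
    · intro μ h; rw [mem_SnFinset] at h ⊢; exact Sn_comp _ _ _ h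
    · intro μ _; exact comp_sw_sw i μ
    · intro μ _; exact comp_sw_sw i μ
    · intro μ _; rfl
  have hp : ∀ μ ∈ SnFinset l, Th i (G μ) + Th i (G (μ ∘ sw i)) = C tt * G μ + C tt * G (μ ∘ sw i) := by
    intro μ hμ
    rw [mem_SnFinset] at hμ
    rw [hG.act μ hμ i, hG.act _ (Sn_comp _ _ (sw i) hμ) i, comp_sw_sw]
    simp only [Function.comp, sw_left, sw_right]
    rcases lt_trichotomy (μ i.succ) (μ i.castSucc) with h1 | h1 | h1
    · simp only [if_pos h1, if_neg (not_lt.2 h1.le), C_1, C_0, C_sub]; ring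
    · have : μ ∘ sw i = μ := by
        funext k
        by_cases h2 : k = i.castSucc
        · subst h2; simp [sw_left, h1]
        · by_cases h3 : k = i.succ
          · subst h3; simp [sw_right, h1]
          · simp [sw_val_ne i k h2 h3]
      rw [this]
      simp [h1]
    · simp only [if_pos h1, if_neg (not_lt.2 h1.le), C_1, C_0, C_sub]; ring
  have h2 := Finset.sum_congr rfl hp
  rw [Finset.sum_add_distrib, Finset.sum_add_distrib, hre (fun μ => Th i (G μ)), hre (fun μ => C tt * G μ),
    ← two_mul, ← two_mul] at h2
  rw [Th_sum, Finset.mul_sum]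
  exact mul_left_cancel₀ (by norm_num) h2

theorem sum_symm {N : ℕ} (f : MvPolynomial (Fin (N + 1)) K) (h : ∀ i : Fin N, rename (sw i) f = f) : f.IsSymmetric := by
  intro σ
  obtain ⟨w, rfl, _⟩ := reduced_ex σ
  clear * - h
  induction w with
  | nil => simp
  | cons i w ih =>
    rw [List.map_cons, List.prod_cons, Equiv.Perm.coe_mul, ← rename_rename, ih]
    exact h ⟨i.1, by omega⟩

theorem symm_vanish {N : ℕ} (d : ℕ) (f : MvPolynomial (Fin (N + 1)) K) (hf : f.IsSymmetric) (hd : f.totalDegree ≤ d)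
    (hv : ∀ ν, IsPartition ν → csize ν ≤ d → eval (evalPt ν) f = 0) : f = 0 := by
  apply interp_unique _ d f hd
  refine sort_ind id _ ?_ ?_
  · intro κ hk
    exact hv κ (fun i j h => hk h)
  · intro κ i hlt ih hc
    rw [csize_sw] at hc
    have hlt : κ i.succ < κ i.castSucc := hlt
    have e : evalPt (κ ∘ sw i) = evalPt κ ∘ sw i :=
      evalPt_swap κ _ _ Fin.castSucc_lt_succ (sw_adj i) (by omega)
    rw [e, ← eval_rename, hf (sw i)]
    exact ih hc

theorem Pstar_G {N : ℕ} (l : Fin (N + 1) → ℕ) (hl : IsPartition l) (f : MvPolynomial (Fin (N + 1)) K)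
    (hf : IsPstar l f) : Pstar l = f := by
  have hex : ∃ f, IsPstar l f := ⟨f, hf⟩
  unfold Pstar
  rw [dif_pos hex]
  have hg := hex.choose_spec
  generalize hex.choose = g at hg
  obtain ⟨f1, f2, f3, f4⟩ := hf
  obtain ⟨g1, g2, g3, g4⟩ := hg
  have hsm : ∀ (a b : K), (C a * f - C b * g).IsSymmetric := by
    intro a b σ
    rw [map_sub, map_mul, map_mul, rename_C, rename_C, f1 σ, g1 σ]
  have hdg : ∀ (a b : K), (C a * f - C b * g).totalDegree ≤ csize l := by
    intro a b
    refine (totalDegree_sub _ _).trans (max_le ?_ ?_) <;> refine (totalDegree_mul _ _).trans ?_ <;> simpa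
  have h0 : C (eval (evalPt l) g) * f - C (eval (evalPt l) f) * g = 0 := by
    apply symm_vanish (csize l) _ (hsm _ _) (hdg _ _)
    intro ν hν hc
    by_cases h : ν = l
    · subst h; simp; ring
    · simp [f4 ν hν hc h, g4 ν hν hc h]
  have hfn : eval (evalPt l) f ≠ 0 := by
    intro h
    have : f = 0 := by
      apply symm_vanish (csize l) f f1 f2
      intro ν hν hc
      by_cases h' : ν = l
      · rw [h', h]
      · exact f4 ν hν hc h'
    rw [this] at f3; simp at f3
  have hc := congrArg (coeff (expOf l)) h0
  rw [coeff_sub, coeff_C_mul, coeff_C_mul, f3, g3, mul_one, mul_one, coeff_zero] at hc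
  rw [sub_eq_zero.1 hc, ← mul_sub] at h0
  rcases mul_eq_zero.1 h0 with h | h
  · exact absurd (C_eq_zero.1 h) hfn
  · exact (sub_eq_zero.1 h).symm

theorem G_vanish {N : ℕ} (l : Fin (N + 1) → ℕ) (hl : IsPartition l) (G : (Fin (N + 1) → ℕ) → MvPolynomial (Fin (N + 1)) K)
    (hG : PFam N (Sn l) id (fun _ _ => 1) G)
    (hV : ∀ ν, csize ν ≤ csize l → ν ≠ l → eval (evalPt ν) (G l) = 0) :
    ∀ μ, μ ∈ Sn l → ∀ ν, csize ν ≤ csize l → ν ∉ Sn l → eval (evalPt ν) (G μ) = 0 := by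
  refine sort_ind id _ ?_ ?_
  · intro κ hk hκ ν hν hn
    have e : κ = l := sorted_unique id Function.injective_id κ l ((Sn_iff _ _).1 hκ) hk (fun i j h => hl i j h)
    subst e
    exact hV ν hν (fun h => hn (h ▸ Sn_self _))
  · intro κ i hlt ih hκ ν hν hn
    have hκ' : κ ∈ Sn l := by
      have := Sn_comp _ _ (sw i) hκ
      rwa [comp_sw_sw] at this
    have e := hG.hstep κ hκ' i hlt
    rw [C_1, one_mul] at e
    have hs : ∀ ν : Fin (N + 1) → ℕ, sPt 1 ν = evalPt ν := fun ν => by funext j; simp [sPt]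
    have h1 := eval_Th_sPt 1 one_ne_zero i (G κ) ν
    rw [hs, hs] at h1
    have hn' : ν ∘ sw i ∉ Sn l := by
      intro h
      apply hn
      have := Sn_comp _ _ (sw i) h
      rwa [comp_sw_sw] at this
    rw [← e, h1, ih hκ' ν hν hn, ih hκ' (ν ∘ sw i) (by rw [csize_sw]; exact hν) hn']
    ring

theorem main_aux (N L : ℕ) (l : Fin (N + 1) → ℕ) (hl : IsPartition l) (hL : ∀ i, l i ≤ L)
    (μ : Fin (N + 1) → ℕ) (hμ : μ ∈ Sn l) :
    fstar μ = Fstar (N + 1) L l μ ∧ Pstar l = ∑ μ' ∈ SnFinset l, Fstar (N + 1) L l μ' := by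
  obtain ⟨h1, h2, h3, h4⟩ := GG_props L l hl hL
  have hF : ∀ μ ∈ Sn l, Fstar (N + 1) L l μ = HH L l L 0 μ := fun μ hμ => Fstar_eq l hL μ hμ
  generalize HH L l L 0 = G at h1 h2 h3 h4 hF
  constructor
  · rw [hF μ hμ]
    exact fstar_G l hl G h1 ⟨h2 l (Sn_self l), by rw [h4 l (Sn_self l), if_pos rfl], h3⟩ μ hμ
  · rw [Finset.sum_congr rfl (fun μ hμ => hF μ ((mem_SnFinset _ _).1 hμ))]
    apply Pstar_G l hl
    refine ⟨sum_symm _ (fun i => Th_eq_symm i _ (sum_Th l G h1 i)), ?_, ?_, ?_⟩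
    · exact totalDegree_finsetSum_le (fun κ hκ => h2 κ ((mem_SnFinset _ _).1 hκ))
    · rw [coeff_sum, Finset.sum_congr rfl (fun μ hμ => h4 μ ((mem_SnFinset _ _).1 hμ)), Finset.sum_ite_eq',
        if_pos ((mem_SnFinset _ _).2 (Sn_self l))]
    · intro ν hν hc hne
      rw [map_sum]
      apply Finset.sum_eq_zero
      intro κ hκ
      apply G_vanish l hl G h1 h3 κ ((mem_SnFinset _ _).1 hκ) ν hc
      intro h
      exact hne (sorted_unique id Function.injective_id ν l ((Sn_iff _ _).1 h) (fun i j h => hν i j h) (fun i j h => hl i j h))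

/-- Main theorem: `f*_μ = F*_μ` and `P*_λ = Z*_λ`. -/
theorem statement19 (n L : ℕ) (hn : 1 ≤ n) (l : Fin n → ℕ) (hl : IsPartition l)
    (hL : l ⟨0, hn⟩ = L) (μ : Fin n → ℕ) (hμ : μ ∈ Sn l) :
    fstar μ = Fstar n L l μ ∧
    Pstar l = ∑ μ' ∈ SnFinset l, Fstar n L l μ' := by
  obtain ⟨N, rfl⟩ : ∃ N, n = N + 1 := ⟨n - 1, by omega⟩
  refine main_aux N L l hl (fun i => ?_) μ hμ
  rw [← hL]
  exact hl _ _ (Fin.zero_le i)
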